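/- Let P_n be a graph sampled uniformly at random from 𝒫_n and let h(G) = min{α(G), ω(G)}, where α is the independence number and ω the clique number. Then h(P_n) is asymptotically normal: writing m_n = E[h(P_n)] and v_n = Var[h(P_n)], for every real t one has P(h(P_n) ≤ m_n + t·√v_n) → Φ(t) as n → ∞, where Φ is the standard normal cumulative distribution function; moreover m_n·(2 ln n)/n → 1 and v_n·(2 ln² n)/n → 1 as n → ∞. -/

import Mathlib

open scoped Classical
open Filter

noncomputable section

/-- A finite simple graph is perfect if every induced subgraph has chromatic number
equal to clique number. -/
def IsPerfect {V : Type*} (G : SimpleGraph V) : Prop :=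
  ∀ s : Set V, (G.induce s).chromaticNumber = ((G.induce s).cliqueNum : ℕ∞)

/-- `(G, C)` is a unipolar arrangement: `C` is a clique (the central clique) and every
connected component of the subgraph induced on the complement of `C` is a clique. -/
def IsUnipolarArrangement {V : Type*} (G : SimpleGraph V) (C : Set V) : Prop :=
  G.IsClique C ∧
    ∀ u v : (Cᶜ : Set V), (G.induce Cᶜ).Reachable u v → u ≠ v → (G.induce Cᶜ).Adj u v

def IsUnipolar {V : Type*} (G : SimpleGraph V) : Prop :=
  ∃ C : Set V, IsUnipolarArrangement G C

def IsCoUnipolar {V : Type*} (G : SimpleGraph V) : Prop := IsUnipolar Gᶜ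

def IsGenSplit {V : Type*} (G : SimpleGraph V) : Prop := IsUnipolar G ∨ IsCoUnipolar G

/-- the `m`-th Bell number: the number of partitions of an `m`-element set. -/
def bell (m : ℕ) : ℕ := Nat.card (Finpartition (Finset.univ : Finset (Fin m)))

/-- `ℓ_{n,k} = C(n,k) · 2^{k(n-k)} · B_{n-k}` -/
def ell (n k : ℕ) : ℕ := Nat.choose n k * 2 ^ (k * (n - k)) * bell (n - k)

/-- `𝓛_n = Σ_{k=0}^n ℓ_{n,k}` -/
def scrL (n : ℕ) : ℕ := ∑ k ∈ Finset.range (n + 1), ell n k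

/-- the number of perfect graphs on `{1,…,n}` -/
def perfectCount (n : ℕ) : ℕ := Nat.card {G : SimpleGraph (Fin n) // IsPerfect G}

/-- independence number -/
def indepNum {V : Type*} (G : SimpleGraph V) : ℕ := Gᶜ.cliqueNum

/-- `h(G) = min{α(G), ω(G)}` -/
def hNum {V : Type*} (G : SimpleGraph V) : ℕ := min (indepNum G) G.cliqueNum

/-- the mean `E[h(P_n)]` for a uniformly random perfect graph on `{1,…,n}` -/
def hMean (n : ℕ) : ℝ :=
  (∑ G : SimpleGraph (Fin n), if IsPerfect G then (hNum G : ℝ) else 0) / (perfectCount n : ℝ)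

/-- the variance `Var[h(P_n)]` for a uniformly random perfect graph on `{1,…,n}` -/
def hVar (n : ℕ) : ℝ :=
  (∑ G : SimpleGraph (Fin n), if IsPerfect G then ((hNum G : ℝ)) ^ 2 else 0) /
      (perfectCount n : ℝ) - (hMean n) ^ 2

/-- `P(h(P_n) ≤ m_n + t√v_n)` for a uniformly random perfect graph on `{1,…,n}` -/
def hCdf (n : ℕ) (t : ℝ) : ℝ :=
  (Nat.card {G : SimpleGraph (Fin n) //
      IsPerfect G ∧ (hNum G : ℝ) ≤ hMean n + t * Real.sqrt (hVar n)} : ℝ) /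
    (perfectCount n : ℝ)

/-- the standard normal cumulative distribution function -/
def stdNormalCdf (t : ℝ) : ℝ :=
  (∫ x in Set.Iic t, Real.exp (-x ^ 2 / 2)) / Real.sqrt (2 * Real.pi)

namespace PerfectGraphs

/-! ### Five-cycles, unipolar graphs and perfection -/

section unipolar

variable {V : Type*}

/-- `G` contains an induced cycle on five vertices. -/
def HasC5 (G : SimpleGraph V) : Prop :=
  ∃ a b c d e, G.Adj a b ∧ G.Adj b c ∧ G.Adj c d ∧ G.Adj d e ∧ G.Adj e a ∧
    ¬ G.Adj a c ∧ ¬ G.Adj a d ∧ ¬ G.Adj b d ∧ ¬ G.Adj b e ∧ ¬ G.Adj c e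

theorem HasC5.compl {G : SimpleGraph V} (h : HasC5 G) : HasC5 Gᶜ := by
  obtain ⟨a, b, c, d, e, h1, h2, h3, h4, h5, h6, h7, h8, h9, h10⟩ := h
  refine ⟨a, c, e, b, d, ?_⟩
  have n1 : a ≠ c := by rintro rfl; exact h7 h3
  have n2 : a ≠ d := by rintro rfl; exact h6 h3.symm
  have n3 : b ≠ d := by rintro rfl; exact h9 h4
  have n4 : b ≠ e := by rintro rfl; exact h8 h4.symm
  have n5 : c ≠ e := by rintro rfl; exact h6 h5.symm
  have h6' := mt SimpleGraph.Adj.symm h6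
  have h7' := mt SimpleGraph.Adj.symm h7
  have h8' := mt SimpleGraph.Adj.symm h8
  have h9' := mt SimpleGraph.Adj.symm h9
  have h10' := mt SimpleGraph.Adj.symm h10
  simp only [SimpleGraph.compl_adj, not_and, not_not]
  exact ⟨⟨n1, h6⟩, ⟨n5, h10⟩, ⟨n4.symm, h9'⟩, ⟨n3, h8⟩, ⟨n2.symm, h7'⟩, fun _ => h5.symm,
    fun _ => h1, fun _ => h2.symm, fun _ => h3, fun _ => h4.symm⟩

theorem hasC5_compl_iff {G : SimpleGraph V} : HasC5 Gᶜ ↔ HasC5 G :=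
  ⟨fun h => by simpa using h.compl, HasC5.compl⟩

theorem _root_.IsPerfect.not_hasC5 [Finite V] {G : SimpleGraph V} (hG : IsPerfect G) :
    ¬ HasC5 G := by
  rintro ⟨a, b, c, d, e, h1, h2, h3, h4, h5, h6, h7, h8, h9, h10⟩
  have h6' := mt SimpleGraph.Adj.symm h6
  have h7' := mt SimpleGraph.Adj.symm h7
  have h8' := mt SimpleGraph.Adj.symm h8
  have h9' := mt SimpleGraph.Adj.symm h9
  have h10' := mt SimpleGraph.Adj.symm h10
  set s : Set V := {a, b, c, d, e} with hs
  have hfree : (G.induce s).CliqueFree 3 := by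
    intro t ht
    rw [SimpleGraph.is3Clique_iff] at ht
    obtain ⟨⟨x, hx⟩, ⟨y, hy⟩, ⟨z, hz⟩, hxy, hxz, hyz, -⟩ := ht
    simp only [SimpleGraph.comap_adj, Function.Embedding.subtype_apply] at hxy hxz hyz
    simp only [hs, Set.mem_insert_iff, Set.mem_singleton_iff] at hx hy hz
    rcases hx with rfl | rfl | rfl | rfl | rfl <;> rcases hy with rfl | rfl | rfl | rfl | rfl <;>
      first
      | exact absurd hxy (G.irrefl)
      | contradiction
      | (rcases hz with rfl | rfl | rfl | rfl | rfl <;>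
          first
          | exact absurd hxz (G.irrefl)
          | exact absurd hyz (G.irrefl)
          | contradiction)
  have hw : (G.induce s).cliqueNum ≤ 2 := by
    by_contra hcon
    push Not at hcon
    obtain ⟨t, ht⟩ := (G.induce s).exists_isNClique_cliqueNum
    exact (hfree.mono hcon) t ht
  have hchi : (G.induce s).Colorable 2 := by
    rw [← SimpleGraph.chromaticNumber_le_iff_colorable, hG s]
    exact_mod_cast hw
  obtain ⟨f⟩ := hchi
  have ha : a ∈ s := by simp [hs]
  have hb : b ∈ s := by simp [hs]
  have hc : c ∈ s := by simp [hs]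
  have hd : d ∈ s := by simp [hs]
  have he : e ∈ s := by simp [hs]
  have k1 := f.valid (v := ⟨a, ha⟩) (w := ⟨b, hb⟩) h1
  have k2 := f.valid (v := ⟨b, hb⟩) (w := ⟨c, hc⟩) h2
  have k3 := f.valid (v := ⟨c, hc⟩) (w := ⟨d, hd⟩) h3
  have k4 := f.valid (v := ⟨d, hd⟩) (w := ⟨e, he⟩) h4
  have k5 := f.valid (v := ⟨e, he⟩) (w := ⟨a, ha⟩) h5
  omega

/-- the vertices outside `S` induce a disjoint union of cliques, and `S` is a clique -/
def Uni (G : SimpleGraph V) (S : Set V) : Prop :=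
  G.IsClique S ∧ ∀ u v w, u ∉ S → v ∉ S → w ∉ S → G.Adj u v → G.Adj v w → u ≠ w → G.Adj u w

theorem Uni.induce {G : SimpleGraph V} {S : Set V} (h : Uni G S) (s : Set V) :
    Uni (G.induce s) (Subtype.val ⁻¹' S) := by
  refine ⟨?_, ?_⟩
  · intro x hx y hy hxy
    exact h.1 hx hy (fun h => hxy (Subtype.ext h))
  · intro u v w hu hv hw huv hvw huw
    exact h.2 u v w hu hv hw huv hvw (fun h => huw (Subtype.ext h))

theorem isPerfect_of_colorable [Finite V] {G : SimpleGraph V}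
    (h : ∀ s : Set V, (G.induce s).Colorable (G.induce s).cliqueNum) : IsPerfect G := fun s =>
  le_antisymm (SimpleGraph.chromaticNumber_le_iff_colorable.2 (h s))
    (SimpleGraph.cliqueNum_le_chromaticNumber)

theorem Uni.exists_partial_coloring [Fintype V] {G : SimpleGraph V} {S : Finset V}
    (hS : G.IsClique S) (K : Finset V) (hK : G.IsClique K) (hKS : ∀ u ∈ K, u ∉ S) :
    ∃ f : V → S ⊕ Fin (G.cliqueNum - S.card),
      Set.InjOn f K ∧ ∀ u ∈ K, ∀ c : S, f u = Sum.inl c → ¬ G.Adj c u := by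
  have hSω : S.card ≤ G.cliqueNum := hS.card_le_cliqueNum
  let t : K → Finset (S ⊕ Fin (G.cliqueNum - S.card)) := fun u =>
    (Finset.univ.filter fun c : S => ¬ G.Adj c u).disjSum Finset.univ
  have hall : ∀ A : Finset K, A.card ≤ (A.biUnion t).card := by
    intro A
    rcases A.eq_empty_or_nonempty with rfl | ⟨a, ha⟩
    · simp
    let N : Finset S := Finset.univ.filter fun c : S => ∃ u ∈ A, ¬ G.Adj c u
    have hsub : N.disjSum (Finset.univ : Finset (Fin (G.cliqueNum - S.card))) ⊆ A.biUnion t := by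
      intro x hx
      rw [Finset.mem_biUnion]
      rw [Finset.mem_disjSum] at hx
      rcases hx with ⟨c, hc, rfl⟩ | ⟨d, -, rfl⟩
      · obtain ⟨u, hu, hcu⟩ := (Finset.mem_filter.1 hc).2
        exact ⟨u, hu, by simp [t, hcu]⟩
      · exact ⟨a, ha, by simp [t]⟩
    have h1 := Finset.card_le_card hsub
    rw [Finset.card_disjSum, Finset.card_univ, Fintype.card_fin] at h1
    let M : Finset V := (Finset.univ.filter fun c : S => ¬ ∃ u ∈ A, ¬ G.Adj c u).map
      (Function.Embedding.subtype _)
    have hM : M.card + N.card = S.card := by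
      rw [Finset.card_map, add_comm, Finset.card_filter_add_card_filter_not, Finset.card_univ,
        Fintype.card_coe]
    let A' : Finset V := A.map (Function.Embedding.subtype _)
    have hMA : G.IsClique (↑(M ∪ A') : Set V) := by
      have hadj : ∀ x ∈ M, ∀ y ∈ A', G.Adj x y := by
        intro x hx y hy
        simp only [M, A', Finset.mem_map, Finset.mem_filter, Finset.mem_univ, true_and,
          Function.Embedding.subtype_apply] at hx hy
        obtain ⟨c, hc, rfl⟩ := hx
        obtain ⟨u, hu, rfl⟩ := hy
        push Not at hc
        exact hc u hu
      have hMS : ∀ x ∈ M, x ∈ S := by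
        intro x hx
        obtain ⟨c, -, rfl⟩ := Finset.mem_map.1 hx
        exact c.2
      have hAK : ∀ x ∈ A', x ∈ K := by
        intro x hx
        obtain ⟨c, -, rfl⟩ := Finset.mem_map.1 hx
        exact c.2
      intro x hx y hy hxy
      rw [Finset.mem_coe, Finset.mem_union] at hx hy
      rcases hx with hx | hx <;> rcases hy with hy | hy
      · exact hS (hMS x hx) (hMS y hy) hxy
      · exact hadj x hx y hy
      · exact (hadj y hy x hx).symm
      · exact hK (hAK x hx) (hAK y hy) hxy
    have hdisj : Disjoint M A' := by
      rw [Finset.disjoint_left]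
      intro x hx hy
      obtain ⟨c, -, rfl⟩ := Finset.mem_map.1 hx
      obtain ⟨u, -, hu⟩ := Finset.mem_map.1 hy
      exact hKS u u.2 (by rw [show (u : V) = c from hu]; exact c.2)
    have h2 : (M ∪ A').card ≤ G.cliqueNum := hMA.card_le_cliqueNum
    rw [Finset.card_union_of_disjoint hdisj, Finset.card_map (s := A)] at h2
    omega
  obtain ⟨f, hf, hft⟩ := (Finset.all_card_le_biUnion_card_iff_exists_injective t).1 hall
  rcases K.eq_empty_or_nonempty with rfl | ⟨k, hk⟩
  · rcases isEmpty_or_nonempty (S ⊕ Fin (G.cliqueNum - S.card)) with he | ⟨⟨x⟩⟩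
    · rcases isEmpty_or_nonempty V with hV | ⟨⟨v⟩⟩
      · exact ⟨fun v => hV.elim v, by simp, by simp⟩
      · have : G.IsClique (({v} : Finset V) : Set V) := by simp
        have h1 := this.card_le_cliqueNum
        have h2 : Fintype.card (S ⊕ Fin (G.cliqueNum - S.card)) = 0 := Fintype.card_eq_zero
        rw [Fintype.card_sum, Fintype.card_coe, Fintype.card_fin] at h2
        rw [Finset.card_singleton] at h1
        omega
    · exact ⟨fun _ => x, by simp, by simp⟩
  · refine ⟨fun v => if h : v ∈ K then f ⟨v, h⟩ else f ⟨k, hk⟩, ?_, ?_⟩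
    · intro u hu v hv huv
      rw [Finset.mem_coe] at hu hv
      simp only [hu, hv, dif_pos] at huv
      exact congrArg Subtype.val (hf huv)
    · intro u hu c hc
      simp only [hu, dif_pos] at hc
      have := hft ⟨u, hu⟩
      rw [hc] at this
      simpa [t] using this

theorem Uni.colorable [Fintype V] {G : SimpleGraph V} {S : Set V} (h : Uni G S) :
    G.Colorable G.cliqueNum := by
  obtain ⟨S, rfl⟩ : ∃ T : Finset V, (T : Set V) = S := ⟨S.toFinset, by simp⟩
  have hSω : S.card ≤ G.cliqueNum := h.1.card_le_cliqueNum
  let K : V → Finset V := fun v => Finset.univ.filter fun u => u ∉ S ∧ (u = v ∨ G.Adj u v)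
  have hK : ∀ v, v ∉ S → G.IsClique (K v) ∧ ∀ u ∈ K v, u ∉ S := by
    intro v hv
    refine ⟨?_, fun u hu => (Finset.mem_filter.1 hu).2.1⟩
    intro x hx y hy hxy
    obtain ⟨-, hx, hxv⟩ := Finset.mem_filter.1 hx
    obtain ⟨-, hy, hyv⟩ := Finset.mem_filter.1 hy
    rcases hxv with rfl | hxv <;> rcases hyv with rfl | hyv
    · exact absurd rfl hxy
    · exact hyv.symm
    · exact hxv
    · exact h.2 x v y hx hv hy hxv hyv.symm hxy
  have hKeq : ∀ u v, u ∉ S → v ∉ S → G.Adj u v → K u = K v := by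
    have key : ∀ u v, u ∉ S → v ∉ S → G.Adj u v → K u ⊆ K v := by
      intro u v hu hv huv x hx
      obtain ⟨-, hx, hxv⟩ := Finset.mem_filter.1 hx
      refine Finset.mem_filter.2 ⟨Finset.mem_univ _, hx, ?_⟩
      rcases hxv with rfl | hxv
      · exact Or.inr huv
      · by_cases hxv' : x = v
        · exact Or.inl hxv'
        · exact Or.inr (h.2 x u v hx hu hv hxv huv hxv')
    exact fun u v hu hv huv => (key u v hu hv huv).antisymm (key v u hv hu huv.symm)
  have hF : ∀ K : Finset V, ∃ f : V → S ⊕ Fin (G.cliqueNum - S.card),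
      (G.IsClique K ∧ ∀ u ∈ K, u ∉ S) →
      Set.InjOn f K ∧ ∀ u ∈ K, ∀ c : S, f u = Sum.inl c → ¬ G.Adj c u := by
    intro K
    by_cases hK : G.IsClique K ∧ ∀ u ∈ K, u ∉ S
    · obtain ⟨f, hf⟩ := Uni.exists_partial_coloring h.1 K hK.1 hK.2
      exact ⟨f, fun _ => hf⟩
    · obtain ⟨f, -⟩ := Uni.exists_partial_coloring h.1 ∅ (by simp) (by simp)
      exact ⟨f, fun h => absurd h hK⟩
  choose F hF using hF
  have hmem : ∀ v, v ∉ S → v ∈ K v := fun v hv => by simp [K, hv]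
  let col : V → S ⊕ Fin (G.cliqueNum - S.card) := fun v =>
    if hv : v ∈ S then Sum.inl ⟨v, hv⟩ else F (K v) v
  have hvalid : ∀ {v w}, G.Adj v w → col v ≠ col w := by
    have mixed : ∀ v w, v ∈ S → w ∉ S → G.Adj v w → col v ≠ col w := by
      intro v w hv hw hvw heq
      simp only [col, hv, hw, dif_pos, dif_neg, not_false_iff] at heq
      exact (hF (K w) (hK w hw)).2 w (hmem w hw) _ heq.symm hvw
    intro v w hvw
    by_cases hv : v ∈ S <;> by_cases hw : w ∈ S
    · simp only [col, hv, hw, dif_pos]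
      intro heq
      simp only [Sum.inl.injEq, Subtype.mk.injEq] at heq
      exact hvw.ne heq
    · exact mixed v w hv hw hvw
    · exact (mixed w v hw hv hvw.symm).symm
    · simp only [col, hv, hw, dif_neg, not_false_iff]
      rw [hKeq v w hv hw hvw]
      intro heq
      refine hvw.ne ((hF (K w) (hK w hw)).1 ?_ (hmem w hw) heq)
      rw [← hKeq v w hv hw hvw]
      exact hmem v hv
  have hc := (SimpleGraph.Coloring.mk col hvalid).colorable
  have : Fintype.card (S ⊕ Fin (G.cliqueNum - S.card)) = G.cliqueNum := by simp; omega
  rwa [this] at hc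

theorem Uni.colorable_compl [Fintype V] {G : SimpleGraph V} {S : Set V} (h : Uni Gᶜ S) :
    G.Colorable G.cliqueNum := by
  have hadj : ∀ u v, u ∉ S → v ∉ S → u ≠ v → ∀ w, w ∉ S → ¬ G.Adj u w → ¬ G.Adj w v →
      ¬ G.Adj u v := by
    intro u v hu hv huv w hw h1 h2 h3
    have h4 : u ≠ w := by rintro rfl; exact h2 h3
    have h5 : w ≠ v := by rintro rfl; exact h1 h3
    exact (h.2 u w v hu hw hv ⟨h4, h1⟩ ⟨h5, h2⟩ huv).2 h3
  let s : Setoid {v // v ∉ S} :=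
    { r := fun u v => ¬ G.Adj u v
      iseqv := by
        refine ⟨fun u => G.irrefl, fun h => mt SimpleGraph.Adj.symm h, ?_⟩
        intro u w v h1 h2
        by_cases huv : u = v
        · subst huv; exact G.irrefl
        · exact hadj u v u.2 v.2 (fun h => huv (Subtype.ext h)) w w.2 h1 h2 }
  let cl : V → Option (Quotient s) := fun v => if hv : v ∈ S then none else some ⟦⟨v, hv⟩⟧
  have hrel : ∀ u v (hu : u ∉ S) (hv : v ∉ S), G.Adj u v →
      (⟦⟨u, hu⟩⟧ : Quotient s) ≠ ⟦⟨v, hv⟩⟧ := by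
    intro u v hu hv huv heq
    exact Quotient.exact heq huv
  by_cases hω : Fintype.card (Quotient s) + 1 ≤ G.cliqueNum
  · have hvalid : ∀ {v w}, G.Adj v w → cl v ≠ cl w := by
      intro v w hvw
      by_cases hv : v ∈ S <;> by_cases hw : w ∈ S
      · exact absurd hvw (h.1 hv hw hvw.ne).2
      · simp [cl, hv, hw]
      · simp [cl, hv, hw]
      · simp only [cl, hv, hw, dif_neg, not_false_iff]
        exact fun h => hrel v w hv hw hvw (Option.some.inj h)
    have hc := (SimpleGraph.Coloring.mk cl hvalid).colorable
    rw [Fintype.card_option] at hc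
    exact hc.mono hω
  · have hmiss : ∀ v ∈ S, ∃ p : Quotient s, ∀ u (hu : u ∉ S), (⟦⟨u, hu⟩⟧ : Quotient s) = p →
        ¬ G.Adj v u := by
      intro v hv
      by_contra hcon
      push Not at hcon
      choose f hfS hfp hfadj using hcon
      have hfinj : Function.Injective f := by
        intro p q hpq
        rw [← hfp p, ← hfp q]
        congr 1
        exact Subtype.ext hpq
      have hff : ∀ p q, p ≠ q → G.Adj (f p) (f q) := by
        intro p q hpq
        by_contra hn
        apply hpq
        rw [← hfp p, ← hfp q]
        exact Quotient.sound hn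
      have hcl : G.IsClique (↑(insert v (Finset.univ.image f)) : Set V) := by
        intro x hx y hy hxy
        simp only [Finset.coe_insert, Finset.coe_image, Finset.coe_univ, Set.image_univ,
          Set.mem_insert_iff, Set.mem_range] at hx hy
        rcases hx with rfl | ⟨p, rfl⟩ <;> rcases hy with rfl | ⟨q, rfl⟩
        · exact absurd rfl hxy
        · exact hfadj q
        · exact (hfadj p).symm
        · exact hff p q (fun h => hxy (by rw [h]))
      have := hcl.card_le_cliqueNum
      rw [Finset.card_insert_of_notMem, Finset.card_image_of_injective _ hfinj,
        Finset.card_univ] at this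
      · exact hω this
      · simp only [Finset.mem_image, Finset.mem_univ, true_and, not_exists]
        intro p hp
        exact hfS p (hp ▸ hv)
    choose m hm using hmiss
    have hr : Fintype.card (Quotient s) ≤ G.cliqueNum := by
      have hinj : Function.Injective fun p : Quotient s => (p.out : V) := by
        intro p q hpq
        rw [← p.out_eq, ← q.out_eq, Subtype.ext hpq]
      have hcl : G.IsClique (↑(Finset.univ.image fun p : Quotient s => (p.out : V)) : Set V) := by
        intro x hx y hy hxy
        simp only [Finset.coe_image, Finset.coe_univ, Set.image_univ, Set.mem_range] at hx hy
        obtain ⟨p, rfl⟩ := hx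
        obtain ⟨q, rfl⟩ := hy
        by_contra hn
        refine hxy ?_
        have : p = q := by
          rw [← p.out_eq, ← q.out_eq]
          exact Quotient.sound hn
        rw [this]
      have := hcl.card_le_cliqueNum
      rwa [Finset.card_image_of_injective _ hinj, Finset.card_univ] at this
    let col : V → Quotient s := fun v => if hv : v ∈ S then m v hv else ⟦⟨v, hv⟩⟧
    have hvalid : ∀ {v w}, G.Adj v w → col v ≠ col w := by
      have mixed : ∀ v w, v ∈ S → w ∉ S → G.Adj v w → col v ≠ col w := by
        intro v w hv hw hvw heq
        simp only [col, hv, hw, dif_pos, dif_neg, not_false_iff] at heq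
        exact hm v hv w hw heq.symm hvw
      intro v w hvw
      by_cases hv : v ∈ S <;> by_cases hw : w ∈ S
      · exact absurd hvw (h.1 hv hw hvw.ne).2
      · exact mixed v w hv hw hvw
      · exact (mixed w v hw hv hvw.symm).symm
      · simp only [col, hv, hw, dif_neg, not_false_iff]
        exact hrel v w hv hw hvw
    exact (SimpleGraph.Coloring.mk col hvalid).colorable.mono hr

theorem Uni.isPerfect [Finite V] {G : SimpleGraph V} {S : Set V} (h : Uni G S) : IsPerfect G := by
  have := Fintype.ofFinite V
  exact isPerfect_of_colorable fun s => (h.induce s).colorable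

theorem Uni.isPerfect_of_compl [Finite V] {G : SimpleGraph V} {S : Set V} (h : Uni Gᶜ S) :
    IsPerfect G := by
  have := Fintype.ofFinite V
  refine isPerfect_of_colorable fun s => Uni.colorable_compl (S := Subtype.val ⁻¹' S) ?_
  have h1 := h.induce s
  have h2 : (G.induce s)ᶜ = Gᶜ.induce s := by
    ext u v
    simp [SimpleGraph.compl_adj, Subtype.ext_iff]
  rwa [h2]

/-! ### Regular partitions of graphs without induced five-cycles -/

/-- `r x y` with prescribed truth value -/
def Sgn (r : V → V → Prop) (b : Bool) (x y : V) : Prop := r x y ↔ b = true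

/-- every pair of large subsets of `s`, `t` has density at least `η` for the relation `r` -/
def LargeDense (r : V → V → Prop) (ε η : ℝ) (s t : Finset V) : Prop :=
  ∀ s' ⊆ s, ∀ t' ⊆ t, ε * s.card ≤ s'.card → ε * t.card ≤ t'.card →
    η * (s'.card * t'.card) ≤ ((s' ×ˢ t').filter fun p => r p.1 p.2).card

theorem LargeDense.card_bad_lt {r : V → V → Prop} {ε η : ℝ} {s t : Finset V}
    (h : LargeDense r ε η s t) (hε : 0 < ε) (hs : s.Nonempty) {t' : Finset V}
    (ht' : t' ⊆ t) (htc : ε * t.card ≤ t'.card) :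
    ((s.filter fun x => ((t'.filter fun y => r x y).card : ℝ) < η * t'.card).card : ℝ)
      < ε * s.card := by
  by_contra hcon
  push Not at hcon
  set B := s.filter fun x => ((t'.filter fun y => r x y).card : ℝ) < η * t'.card with hB
  have h1 := h B (Finset.filter_subset _ _) t' ht' hcon htc
  have hBne : B.Nonempty := by
    have : (0:ℝ) < s.card := by exact_mod_cast hs.card_pos
    have : (0:ℝ) < B.card := lt_of_lt_of_le (by positivity) hcon
    exact Finset.card_pos.1 (by exact_mod_cast this)
  have h2 : (((B ×ˢ t').filter fun p => r p.1 p.2).card : ℝ)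
      = ∑ x ∈ B, ((t'.filter fun y => r x y).card : ℝ) := by
    rw [Finset.card_filter, Finset.sum_product]
    push_cast [Finset.card_filter]
    rfl
  have h3 : ∑ x ∈ B, ((t'.filter fun y => r x y).card : ℝ) < ∑ x ∈ B, η * t'.card :=
    Finset.sum_lt_sum_of_nonempty hBne fun x hx => (Finset.mem_filter.1 hx).2
  rw [Finset.sum_const, nsmul_eq_mul] at h3
  nlinarith

theorem LargeDense.pick {ι : Type*} [Fintype ι] [Nonempty ι] {R : ι → V → V → Prop} {ε η : ℝ}
    {s : Finset V} {t T : ι → Finset V} (h : ∀ i, LargeDense (R i) ε η s (t i)) (hε : 0 < ε)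
    (hs : s.Nonempty) (hT : ∀ i, T i ⊆ t i)
    (hTc : ∀ i, ε * (t i).card ≤ (T i).card) {s' : Finset V} (hs' : s' ⊆ s)
    (hc : Fintype.card ι * (ε * s.card) ≤ s'.card) :
    ∃ x ∈ s', ∀ i, η * (T i).card ≤ ((T i).filter fun y => R i x y).card := by
  let B : ι → Finset V := fun i =>
    s.filter fun x => (((T i).filter fun y => R i x y).card : ℝ) < η * (T i).card
  have hB : ((Finset.univ.biUnion B).card : ℝ) < s'.card := by
    have h1 : ((Finset.univ.biUnion B).card : ℝ) ≤ ∑ i, ((B i).card : ℝ) := by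
      exact_mod_cast Finset.card_biUnion_le
    have h2 : ∑ i, ((B i).card : ℝ) < ∑ _i : ι, ε * s.card :=
      Finset.sum_lt_sum_of_nonempty Finset.univ_nonempty fun i _ =>
        (h i).card_bad_lt hε hs (hT i) (hTc i)
    rw [Finset.sum_const, nsmul_eq_mul, Finset.card_univ] at h2
    linarith
  obtain ⟨x, hx, hxB⟩ := Finset.exists_mem_notMem_of_card_lt_card (by exact_mod_cast hB)
  refine ⟨x, hx, fun i => ?_⟩
  by_contra hcon
  push Not at hcon
  exact hxB (Finset.mem_biUnion.2 ⟨i, Finset.mem_univ _, Finset.mem_filter.2 ⟨hs' hx, hcon⟩⟩)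

/-- a five-cycle pattern in a relation -/
def PatC5 (r : V → V → Prop) : Prop :=
  ∃ a b c d e, r a b ∧ r b c ∧ r c d ∧ r d e ∧ r e a ∧
    ¬ r a c ∧ ¬ r a d ∧ ¬ r b d ∧ ¬ r b e ∧ ¬ r c e

theorem patC5_of_adj {r : V → V → Prop} (hr : ∀ x y, r x y → r y x) {ε η : ℝ} (hη : 0 < η)
    (hη1 : η ≤ 1) (hε : 0 < ε) (hεη : 32 * ε ≤ η ^ 4) {Y Z : Finset V}
    (hY : Y.Nonempty) (hZ : Z.Nonempty)
    (hYZ : ∀ b, LargeDense (Sgn r b) ε η Y Z) {x₁ x₂ : V} (hx : r x₁ x₂)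
    (hYx : ∀ b₁ b₂, η ^ 2 * Y.card ≤
      (Y.filter fun y => Sgn r b₁ x₁ y ∧ Sgn r b₂ x₂ y).card)
    (hZx : ∀ b₁ b₂, η ^ 2 * Z.card ≤
      (Z.filter fun y => Sgn r b₁ x₁ y ∧ Sgn r b₂ x₂ y).card) : PatC5 r := by
  have hYp : (0:ℝ) < Y.card := by exact_mod_cast hY.card_pos
  have hZp : (0:ℝ) < Z.card := by exact_mod_cast hZ.card_pos
  have e4 : η ^ 4 ≤ η ^ 3 := pow_le_pow_of_le_one hη.le hη1 (by norm_num)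
  have e3 : η ^ 3 ≤ η ^ 2 := pow_le_pow_of_le_one hη.le hη1 (by norm_num)
  have hYs : ∀ b₁ b₂ (k : ℕ), k ≤ 32 → (k : ℝ) * (ε * Y.card) ≤
      (Y.filter fun y => Sgn r b₁ x₁ y ∧ Sgn r b₂ x₂ y).card := by
    intro b₁ b₂ k hk
    refine le_trans ?_ (hYx b₁ b₂)
    have : (k:ℝ) ≤ 32 := by exact_mod_cast hk
    rw [← mul_assoc]
    gcongr
    nlinarith
  let W : Bool → Bool → Finset V := fun b₁ b₂ => Z.filter fun y => Sgn r b₁ x₁ y ∧ Sgn r b₂ x₂ y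
  have hεk : ∀ {T : Finset V} (k : ℕ), k ≤ 4 → η ^ k * Z.card ≤ T.card → ε * Z.card ≤ T.card := by
    intro T k hk hT
    refine le_trans ?_ hT
    have : η ^ 4 ≤ η ^ k := pow_le_pow_of_le_one hη.le hη1 hk
    gcongr
    linarith
  obtain ⟨y₁, hy₁, h1⟩ := LargeDense.pick (ι := Bool × Bool × Bool)
    (R := fun i => Sgn r i.2.2) (T := fun i => W i.1 i.2.1) (t := fun _ => Z)
    (fun i => hYZ i.2.2) hε hY (fun i => Finset.filter_subset _ _)
    (fun i => hεk 2 (by norm_num) (hZx _ _))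
    (Finset.filter_subset _ _) (hYs true false _ (by simp))
  let W1 : Bool → Bool → Bool → Finset V := fun b₁ b₂ c₁ =>
    (W b₁ b₂).filter fun z => Sgn r c₁ y₁ z
  have hW1 : ∀ b₁ b₂ c₁, η ^ 3 * Z.card ≤ (W1 b₁ b₂ c₁).card := by
    intro b₁ b₂ c₁
    refine le_trans ?_ (h1 (b₁, b₂, c₁))
    have := hZx b₁ b₂
    rw [pow_succ', mul_assoc]
    gcongr
  obtain ⟨y₂, hy₂, h2⟩ := LargeDense.pick (ι := Bool × Bool × Bool × Bool)
    (R := fun i => Sgn r i.2.2.2) (T := fun i => W1 i.1 i.2.1 i.2.2.1) (t := fun _ => Z)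
    (fun i => hYZ i.2.2.2) hε hY
    (fun i => (Finset.filter_subset _ _).trans (Finset.filter_subset _ _))
    (fun i => hεk 3 (by norm_num) (hW1 _ _ _))
    (Finset.filter_subset _ _) (hYs false true _ (by simp))
  let W2 : Bool → Bool → Bool → Bool → Finset V := fun b₁ b₂ c₁ c₂ =>
    (W1 b₁ b₂ c₁).filter fun z => Sgn r c₂ y₂ z
  have hW2 : ∀ b₁ b₂ c₁ c₂, η ^ 4 * Z.card ≤ (W2 b₁ b₂ c₁ c₂).card := by
    intro b₁ b₂ c₁ c₂
    refine le_trans ?_ (h2 (b₁, b₂, c₁, c₂))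
    have := hW1 b₁ b₂ c₁
    rw [pow_succ', mul_assoc]
    gcongr
  obtain ⟨y₀, hy₀, h3⟩ := LargeDense.pick (ι := Bool × Bool × Bool × Bool × Bool)
    (R := fun i => Sgn r i.2.2.2.2) (T := fun i => W2 i.1 i.2.1 i.2.2.1 i.2.2.2.1) (t := fun _ => Z)
    (fun i => hYZ i.2.2.2.2) hε hY
    (fun i => ((Finset.filter_subset _ _).trans (Finset.filter_subset _ _)).trans
      (Finset.filter_subset _ _))
    (fun i => hεk 4 (by norm_num) (hW2 _ _ _ _))
    (Finset.filter_subset _ _) (hYs false false _ (by simp))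
  have hex : ∀ b₁ b₂ c₁ c₂ c₀, ∃ z, Sgn r b₁ x₁ z ∧ Sgn r b₂ x₂ z ∧ Sgn r c₁ y₁ z ∧
      Sgn r c₂ y₂ z ∧ Sgn r c₀ y₀ z := by
    intro b₁ b₂ c₁ c₂ c₀
    have h4 := h3 (b₁, b₂, c₁, c₂, c₀)
    have h5 := hW2 b₁ b₂ c₁ c₂
    have h6 : (0:ℝ) < ((W2 b₁ b₂ c₁ c₂).filter fun z => Sgn r c₀ y₀ z).card := by
      refine lt_of_lt_of_le ?_ h4
      have : 0 < η ^ 4 * Z.card := by positivity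
      have : (0:ℝ) < (W2 b₁ b₂ c₁ c₂).card := by linarith
      positivity
    obtain ⟨z, hz⟩ := Finset.card_pos.1 (by exact_mod_cast h6)
    simp only [W2, W1, W, Finset.mem_filter] at hz
    exact ⟨z, hz.1.1.1.2.1, hz.1.1.1.2.2, hz.1.1.2, hz.1.2, hz.2⟩
  simp only [Finset.mem_filter, Sgn, iff_true, Bool.false_eq_true, iff_false] at hy₁ hy₂ hy₀
  have hn : ∀ {x y}, ¬ r x y → ¬ r y x := fun h h' => h (hr _ _ h')
  by_cases hyy : r y₁ y₂
  · obtain ⟨z₁, a1, a2, a3, a4, a5⟩ := hex true false false false true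
    obtain ⟨z₂, d1, d2, d3, d4, d5⟩ := hex false true false true true
    simp only [Sgn, iff_true, Bool.false_eq_true, iff_false] at a1 a2 a3 a4 a5 d1 d2 d3 d4 d5
    by_cases hzz : r z₁ z₂
    · exact ⟨x₁, y₁, y₂, z₂, z₁, hy₁.2.1, hyy, d4, hr _ _ hzz, hr _ _ a1, hy₂.2.1, d1, d3, a3, a4⟩
    · exact ⟨x₁, x₂, z₂, y₀, z₁, hx, d2, hr _ _ d5, a5, hr _ _ a1, d1, hy₀.2.1, hy₀.2.2, a2,
        hn hzz⟩
  · obtain ⟨z, a1, a2, a3, a4, -⟩ := hex false false true true true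
    simp only [Sgn, iff_true, Bool.false_eq_true, iff_false] at a1 a2 a3 a4
    exact ⟨x₁, y₁, z, y₂, x₂, hy₁.2.1, a3, hr _ _ a4, hr _ _ hy₂.2.2, hr _ _ hx, a1, hy₂.2.1, hyy,
      hn hy₁.2.2, hn a2⟩

theorem Sgn.not {r : V → V → Prop} {b : Bool} {x y : V} :
    Sgn (fun x y => ¬ r x y) b x y ↔ Sgn r (!b) x y := by
  cases b <;> simp [Sgn]

theorem hasC5_of_largeDense {G : SimpleGraph V} {ε η : ℝ} (hη : 0 < η) (hη1 : η ≤ 1) (hε : 0 < ε)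
    (hεη : 32 * ε ≤ η ^ 4) {X Y Z : Finset V} (hX : X.Nonempty) (hY : Y.Nonempty)
    (hZ : Z.Nonempty) (hXY : ∀ b, LargeDense (Sgn G.Adj b) ε η X Y)
    (hXZ : ∀ b, LargeDense (Sgn G.Adj b) ε η X Z) (hYZ : ∀ b, LargeDense (Sgn G.Adj b) ε η Y Z) :
    HasC5 G := by
  have e4 : η ^ 4 ≤ η := pow_le_of_le_one hη.le hη1 (by norm_num)
  have hXp : (0:ℝ) < X.card := by exact_mod_cast hX.card_pos
  let t : Bool → Finset V := fun c => if c then Y else Z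
  have htd : ∀ c b, LargeDense (Sgn G.Adj b) ε η X (t c) := by
    intro c b; cases c
    · exact hXZ b
    · exact hXY b
  have hcard : ∀ k : ℕ, k ≤ 32 → (k : ℝ) * (ε * X.card) ≤ X.card := by
    intro k hk
    have : (k:ℝ) ≤ 32 := by exact_mod_cast hk
    have : (k:ℝ) * ε ≤ 1 := by nlinarith
    nlinarith
  obtain ⟨x₁, -, h1⟩ := LargeDense.pick (ι := Bool × Bool) (R := fun i => Sgn G.Adj i.2)
    (T := fun i => t i.1) (t := fun i => t i.1) (fun i => htd _ _) hε hX
    (fun i => subset_rfl) (fun i => by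
      have : (0:ℝ) ≤ (t i.1).card := by positivity
      nlinarith)
    subset_rfl (hcard _ (by simp))
  obtain ⟨x₂, -, h2⟩ := LargeDense.pick (ι := Bool × Bool × Bool) (R := fun i => Sgn G.Adj i.2.2)
    (T := fun i => (t i.1).filter fun y => Sgn G.Adj i.2.1 x₁ y) (t := fun i => t i.1)
    (fun i => htd _ _) hε hX (fun i => Finset.filter_subset _ _)
    (fun i => by
      refine le_trans ?_ (h1 (i.1, i.2.1))
      gcongr
      linarith) subset_rfl (hcard _ (by simp))
  have hsz : ∀ c b₁ b₂, η ^ 2 * (t c).card ≤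
      ((t c).filter fun y => Sgn G.Adj b₁ x₁ y ∧ Sgn G.Adj b₂ x₂ y).card := by
    intro c b₁ b₂
    have h3 := h2 (c, b₁, b₂)
    rw [Finset.filter_filter] at h3
    refine le_trans ?_ h3
    have := h1 (c, b₁)
    rw [pow_two, mul_assoc]
    gcongr
  have hszY : ∀ b₁ b₂, η ^ 2 * Y.card ≤
      (Y.filter fun y => Sgn G.Adj b₁ x₁ y ∧ Sgn G.Adj b₂ x₂ y).card := hsz true
  have hszZ : ∀ b₁ b₂, η ^ 2 * Z.card ≤
      (Z.filter fun y => Sgn G.Adj b₁ x₁ y ∧ Sgn G.Adj b₂ x₂ y).card := hsz false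
  by_cases hx : G.Adj x₁ x₂
  · exact patC5_of_adj (fun _ _ h => h.symm) hη hη1 hε hεη hY hZ hYZ hx hszY hszZ
  · have := patC5_of_adj (r := fun x y => ¬ G.Adj x y) (fun _ _ h h' => h h'.symm) hη hη1 hε hεη
      hY hZ (by simpa only [LargeDense, Sgn.not] using fun b => hYZ (!b)) hx
      (by simpa only [Sgn.not] using fun b₁ b₂ => hszY (!b₁) (!b₂))
      (by simpa only [Sgn.not] using fun b₁ b₂ => hszZ (!b₁) (!b₂))
    obtain ⟨a, b, c, d, e, g1, g2, g3, g4, g5, g6, g7, g8, g9, g10⟩ := this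
    simp only [not_not] at g6 g7 g8 g9 g10
    exact ⟨a, c, e, b, d, g6, g10, g9.symm, g8, g7.symm, fun h => g5 h.symm, g1,
      fun h => g2 h.symm, g3, fun h => g4 h.symm⟩

end unipolar

theorem edgeDensity_mul {V : Type*} (G : SimpleGraph V) (s t : Finset V) :
    (G.edgeDensity s t : ℝ) * (s.card * t.card) = ((s ×ˢ t).filter fun p => G.Adj p.1 p.2).card := by
  have h1 : ((s ×ˢ t).filter fun p => G.Adj p.1 p.2) = G.interedges s t := by
    ext p; simp [SimpleGraph.interedges, Rel.interedges]
  rcases s.eq_empty_or_nonempty with rfl | hs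
  · simp
  rcases t.eq_empty_or_nonempty with rfl | ht
  · simp
  have h2 : (s.card : ℝ) ≠ 0 := by exact_mod_cast hs.card_pos.ne'
  have h3 : (t.card : ℝ) ≠ 0 := by exact_mod_cast ht.card_pos.ne'
  rw [h1, SimpleGraph.edgeDensity_def]
  push_cast
  field_simp

theorem edgeDensity_not_mul {V : Type*} (G : SimpleGraph V) (s t : Finset V) :
    (1 - (G.edgeDensity s t : ℝ)) * (s.card * t.card)
      = ((s ×ˢ t).filter fun p => ¬ G.Adj p.1 p.2).card := by
  have h1 := Finset.card_filter_add_card_filter_not (s := s ×ˢ t) (fun p => G.Adj p.1 p.2)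
  rw [Finset.card_product] at h1
  have h2 : ((((s ×ˢ t).filter fun p => G.Adj p.1 p.2).card : ℝ) +
      ((s ×ˢ t).filter fun p => ¬ G.Adj p.1 p.2).card = s.card * t.card) := by exact_mod_cast h1
  rw [sub_mul, edgeDensity_mul, ← h2]
  ring

theorem largeDense_of_isUniform {V : Type*} {G : SimpleGraph V} {ε η : ℝ} {s t : Finset V}
    (h : G.IsUniform ε s t) (hεη : ε ≤ η) (h1 : 2 * η ≤ G.edgeDensity s t)
    (h2 : (G.edgeDensity s t : ℝ) ≤ 1 - 2 * η) (b : Bool) :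
    LargeDense (Sgn G.Adj b) ε η s t := by
  intro s' hs' t' ht' hsc htc
  have h3 := abs_lt.1 (h hs' ht' (by linarith) (by linarith))
  have hp : (0:ℝ) ≤ s'.card * t'.card := by positivity
  cases b
  · have := edgeDensity_not_mul G s' t'
    simp only [Sgn, Bool.false_eq_true, iff_false]
    rw [← this]
    exact mul_le_mul_of_nonneg_right (by linarith) hp
  · have := edgeDensity_mul G s' t'
    simp only [Sgn, iff_true]
    rw [← this]
    exact mul_le_mul_of_nonneg_right (by linarith) hp

/-- ordered pairs on which `G` differs from the template, outside the pairs of `R` -/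
def mismatch {n M : ℕ} (G : SimpleGraph (Fin n)) (f : Fin n → Fin M) (R : SimpleGraph (Fin M))
    (τ : Fin M → Fin M → Bool) : Finset (Fin n × Fin n) :=
  Finset.univ.filter fun p => ¬ R.Adj (f p.1) (f p.2) ∧
    ¬ (G.Adj p.1 p.2 ↔ τ (f p.1) (f p.2) = true)

theorem mem_mismatch {n M : ℕ} {G : SimpleGraph (Fin n)} {f : Fin n → Fin M}
    {R : SimpleGraph (Fin M)} {τ : Fin M → Fin M → Bool} {p : Fin n × Fin n} :
    p ∈ mismatch G f R τ ↔ ¬ R.Adj (f p.1) (f p.2) ∧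
      ¬ (G.Adj p.1 p.2 ↔ τ (f p.1) (f p.2) = true) := by
  simp [mismatch]

theorem exists_template {γ : ℝ} (hγ : 0 < γ) (hγ1 : γ ≤ 1) : ∃ M₀ : ℕ, ∀ n : ℕ, M₀ ≤ n →
    ∀ G : SimpleGraph (Fin n), ¬ HasC5 G → ∃ M : ℕ, M ≤ M₀ ∧ 1 / γ ≤ M ∧
    ∃ (f : Fin n → Fin M) (R : SimpleGraph (Fin M)) (τ : Fin M → Fin M → Bool),
      (∀ i, ((Finset.univ.filter fun v => f v = i).card : ℝ) ≤ n / M + 1) ∧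
      (∀ i j k, R.Adj i j → R.Adj j k → ¬ R.Adj i k) ∧
      ((mismatch G f R τ).card : ℝ) ≤ γ * n ^ 2 := by
  obtain ⟨η, hηdef⟩ : ∃ η, η = γ / 8 := ⟨_, rfl⟩
  have hη : 0 < η := by rw [hηdef]; positivity
  have hη1 : η ≤ 1 := by rw [hηdef]; linarith
  obtain ⟨ε, hεdef⟩ : ∃ ε, ε = η ^ 4 / 32 := ⟨_, rfl⟩
  have hε : 0 < ε := by rw [hεdef]; positivity
  have hεη : ε ≤ η / 32 := by
    have : η ^ 4 ≤ η := pow_le_of_le_one hη.le hη1 (by norm_num)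
    rw [hεdef]; linarith
  obtain ⟨l, hl⟩ : ∃ l : ℕ, 8 / γ ≤ l := ⟨_, Nat.le_ceil _⟩
  refine ⟨max l (SzemerediRegularity.bound ε l), fun n hn G hG => ?_⟩
  have hln : l ≤ n := (le_max_left _ _).trans hn
  obtain ⟨P, hPe, hPl, hPM, hPu⟩ := szemeredi_regularity G hε (l := l) (by simpa using hln)
  have hl8 : (8:ℝ) ≤ l := le_trans (by rw [le_div_iff₀ hγ]; linarith) hl
  have hlpos : 0 < l := by
    have : (0:ℝ) < l := by linarith
    exact_mod_cast this
  have hMpos : 0 < P.parts.card := by omega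
  have hMn : P.parts.card ≤ n := by simpa using P.card_parts_le_card
  have hnpos : 0 < n := by omega
  set M := P.parts.card with hM
  have hMl : (l:ℝ) ≤ M := by exact_mod_cast hPl
  let e : P.parts ≃ Fin M := P.parts.equivFin
  have hmemp : ∀ v, P.part v ∈ P.parts := fun v => P.part_mem.2 (Finset.mem_univ v)
  let f : Fin n → Fin M := fun v => e ⟨P.part v, hmemp v⟩
  have hfv : ∀ v i, f v = i ↔ v ∈ (e.symm i).1 := by
    intro v i
    rw [show f v = e ⟨P.part v, hmemp v⟩ from rfl, ← Equiv.eq_symm_apply, Subtype.ext_iff]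
    constructor
    · rintro h; rw [← h]; exact P.mem_part (Finset.mem_univ v)
    · intro h; exact P.part_eq_of_mem (e.symm i).2 h
  have hcard : ∀ U ∈ P.parts, (U.card : ℝ) ≤ n / M + 1 := by
    intro U hU
    have h1 := hPe.card_part_le_average_add_one hU
    have h2 : ((Finset.univ : Finset (Fin n)).card / M + 1 : ℕ) ≤ (n:ℝ) / M + 1 := by
      push_cast
      have := @Nat.cast_div_le ℝ _ _ _ n M
      simp only [Finset.card_univ, Fintype.card_fin]
      linarith
    exact le_trans (by exact_mod_cast h1) h2
  let R : SimpleGraph (Fin M) :=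
    { Adj := fun i j => i ≠ j ∧ G.IsUniform ε (e.symm i).1 (e.symm j).1 ∧
        2 * η ≤ G.edgeDensity (e.symm i).1 (e.symm j).1 ∧
        (G.edgeDensity (e.symm i).1 (e.symm j).1 : ℝ) ≤ 1 - 2 * η
      symm := ⟨fun i j h => ⟨h.1.symm, h.2.1.symm, by rw [G.edgeDensity_comm]; exact h.2.2.1,
        by rw [G.edgeDensity_comm]; exact h.2.2.2⟩⟩
      loopless := ⟨fun i h => h.1 rfl⟩ }
  let τ : Fin M → Fin M → Bool := fun i j =>
    decide ((1:ℝ) - 2 * η < G.edgeDensity (e.symm i).1 (e.symm j).1)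
  refine ⟨M, hPM.trans (le_max_right _ _), ?_, f, R, τ, ?_, ?_, ?_⟩
  · refine le_trans ?_ (hl.trans hMl)
    gcongr; norm_num
  · intro i
    have : (Finset.univ.filter fun v => f v = i) = (e.symm i).1 := by
      ext v; simp [hfv]
    rw [this]
    exact hcard _ (e.symm i).2
  · intro i j k hij hjk hik
    have hne : ∀ i, (e.symm i).1.Nonempty := fun i => P.nonempty_of_mem_parts (e.symm i).2
    exact hG (hasC5_of_largeDense hη hη1 hε (by rw [hεdef]; linarith) (hne i) (hne j) (hne k)
      (largeDense_of_isUniform hij.2.1 (by linarith) hij.2.2.1 hij.2.2.2)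
      (largeDense_of_isUniform hik.2.1 (by linarith) hik.2.2.1 hik.2.2.2)
      (largeDense_of_isUniform hjk.2.1 (by linarith) hjk.2.2.1 hjk.2.2.2))
  · let m : Finset (Fin n) × Finset (Fin n) → Finset (Fin n × Fin n) := fun q =>
      (mismatch G f R τ).filter fun p => p.1 ∈ q.1 ∧ p.2 ∈ q.2
    have hcover : mismatch G f R τ ⊆ (P.parts ×ˢ P.parts).biUnion m := by
      intro p hp
      refine Finset.mem_biUnion.2 ⟨(P.part p.1, P.part p.2), Finset.mem_product.2
        ⟨hmemp _, hmemp _⟩, Finset.mem_filter.2 ⟨hp, ?_, ?_⟩⟩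
      · exact P.mem_part (Finset.mem_univ _)
      · exact P.mem_part (Finset.mem_univ _)
    have h1 : ((mismatch G f R τ).card : ℝ) ≤ ∑ q ∈ P.parts ×ˢ P.parts, ((m q).card : ℝ) := by
      exact_mod_cast (Finset.card_le_card hcover).trans Finset.card_biUnion_le
    have hsub : ∀ q, m q ⊆ q.1 ×ˢ q.2 := by
      intro q p hp
      exact Finset.mem_product.2 (Finset.mem_filter.1 hp).2
    have hsubc : ∀ q, ((m q).card : ℝ) ≤ q.1.card * q.2.card := by
      intro q
      exact_mod_cast (Finset.card_le_card (hsub q)).trans (Finset.card_product _ _).le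
    have hq : ∀ q ∈ P.parts ×ˢ P.parts, ((m q).card : ℝ) ≤
        (if q.1 = q.2 then (q.1.card : ℝ) * q.2.card else 0) +
        (if q ∈ P.nonUniforms G ε then (q.1.card : ℝ) * q.2.card else 0) +
        2 * η * (q.1.card * q.2.card) := by
      rintro ⟨U, W⟩ hq
      obtain ⟨hU, hW⟩ := Finset.mem_product.1 hq
      have hnn : (0:ℝ) ≤ (U.card : ℝ) * W.card := by positivity
      have hnn2 : (0:ℝ) ≤ 2 * η * ((U.card : ℝ) * W.card) := by positivity
      by_cases hUW : U = W
      · have := hsubc (U, W)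
        simp only [hUW, if_true] at this ⊢
        split_ifs <;> nlinarith
      by_cases hunif : (U, W) ∈ P.nonUniforms G ε
      · have := hsubc (U, W)
        simp only [hUW, hunif, if_true, if_false] at this ⊢
        linarith
      simp only [hUW, hunif, if_false, zero_add]
      have hunif' : G.IsUniform ε U W := by
        by_contra hcon
        exact hunif ((P.mk_mem_nonUniforms (G := G) (ε := ε)).2 ⟨hU, hW, hUW, hcon⟩)
      have hUi : ∀ v ∈ U, f v = e ⟨U, hU⟩ := fun v hv => by rw [hfv]; simpa using hv
      have hWi : ∀ v ∈ W, f v = e ⟨W, hW⟩ := fun v hv => by rw [hfv]; simpa using hv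
      have hne : e ⟨U, hU⟩ ≠ e ⟨W, hW⟩ := by
        intro h; exact hUW (congrArg Subtype.val (e.injective h))
      have hmm : ∀ p ∈ m (U, W), p.1 ∈ U ∧ p.2 ∈ W ∧
          ¬ (2 * η ≤ G.edgeDensity U W ∧ (G.edgeDensity U W : ℝ) ≤ 1 - 2 * η) ∧
          ¬ (G.Adj p.1 p.2 ↔ (1:ℝ) - 2 * η < G.edgeDensity U W) := by
        intro p hp
        have hp1 := (Finset.mem_filter.1 hp).2.1
        have hp2 := (Finset.mem_filter.1 hp).2.2
        obtain ⟨hp3, hp4⟩ := mem_mismatch.1 (Finset.mem_filter.1 hp).1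
        rw [hUi _ hp1, hWi _ hp2] at hp3 hp4
        simp only [R, τ, Equiv.symm_apply_apply, decide_eq_true_eq] at hp3 hp4
        exact ⟨hp1, hp2, fun h => hp3 ⟨hne, hunif', h⟩, hp4⟩
      by_cases hd : (1:ℝ) - 2 * η < G.edgeDensity U W
      · have : m (U, W) ⊆ (U ×ˢ W).filter fun p => ¬ G.Adj p.1 p.2 := by
          intro p hp
          have := hmm p hp
          exact Finset.mem_filter.2 ⟨Finset.mem_product.2 ⟨this.1, this.2.1⟩, fun h =>
            this.2.2.2 ⟨fun _ => hd, fun _ => h⟩⟩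
        have h2 : ((m (U, W)).card : ℝ) ≤ ((U ×ˢ W).filter fun p => ¬ G.Adj p.1 p.2).card :=
          Nat.cast_le.2 (Finset.card_le_card this)
        rw [← edgeDensity_not_mul] at h2
        refine h2.trans (mul_le_mul_of_nonneg_right (by linarith) hnn)
      · have : m (U, W) ⊆ (U ×ˢ W).filter fun p => G.Adj p.1 p.2 := by
          intro p hp
          have := hmm p hp
          refine Finset.mem_filter.2 ⟨Finset.mem_product.2 ⟨this.1, this.2.1⟩, ?_⟩
          by_contra h
          exact this.2.2.2 ⟨fun h' => absurd h' h, fun h' => absurd h' hd⟩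
        have h2 : ((m (U, W)).card : ℝ) ≤ ((U ×ˢ W).filter fun p => G.Adj p.1 p.2).card :=
          Nat.cast_le.2 (Finset.card_le_card this)
        rcases (m (U, W)).eq_empty_or_nonempty with he | ⟨p, hp⟩
        · rw [he]; simpa using hnn2
        have h3 := (hmm p hp).2.2.1
        have h4 : (G.edgeDensity U W : ℝ) ≤ 2 * η := by
          by_contra hcon
          exact h3 ⟨by linarith, by linarith⟩
        rw [← edgeDensity_mul] at h2
        exact h2.trans (mul_le_mul_of_nonneg_right h4 hnn)
    have hsum1 : ∑ U ∈ P.parts, (U.card : ℝ) = n := by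
      have := P.sum_card_parts
      rw [Finset.card_univ, Fintype.card_fin] at this
      exact_mod_cast this
    have hA : ∑ q ∈ P.parts ×ˢ P.parts, (if q.1 = q.2 then (q.1.card : ℝ) * q.2.card else 0)
        ≤ γ / 4 * n ^ 2 := by
      rw [Finset.sum_product]
      simp only [Finset.sum_ite_eq]
      have hMp : (0:ℝ) < M := by exact_mod_cast hMpos
      calc _ ≤ ∑ U ∈ P.parts, (U.card : ℝ) * (n / M + 1) := by
            refine Finset.sum_le_sum fun U hU => ?_
            rw [if_pos hU]
            have := hcard U hU
            gcongr
        _ = n * (n / M + 1) := by rw [← Finset.sum_mul, hsum1]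
        _ ≤ n * (n / M + n / M) := by
            gcongr
            rw [le_div_iff₀ hMp, one_mul]
            exact_mod_cast hMn
        _ = 2 * n ^ 2 / M := by ring
        _ ≤ 2 * n ^ 2 / (8 / γ) := by
            gcongr
            exact hl.trans hMl
        _ = γ / 4 * n ^ 2 := by field_simp; ring
    have hB : ∑ q ∈ P.parts ×ˢ P.parts,
        (if q ∈ P.nonUniforms G ε then (q.1.card : ℝ) * q.2.card else 0) ≤ γ / 4 * n ^ 2 := by
      rw [← Finset.sum_filter]
      have hsub : (P.parts ×ˢ P.parts).filter (fun q => q ∈ P.nonUniforms G ε)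
          ⊆ P.nonUniforms G ε := fun q hq => (Finset.mem_filter.1 hq).2
      have h5 := hPe.sum_nonUniforms_lt' (G := G) (𝕜 := ℝ)
        (by rw [← Finset.card_pos]; simpa using hnpos) hε hPu
      have h6 := Finset.sum_le_sum_of_subset_of_nonneg (f := fun q : Finset (Fin n) × Finset (Fin n)
        => (q.1.card : ℝ) * q.2.card) hsub (fun _ _ _ => by positivity)
      refine h6.trans (h5.le.trans ?_)
      simp only [Finset.card_univ, Fintype.card_fin]
      have : (M : ℝ) ≤ n := by exact_mod_cast hMn
      calc ε * ((n:ℝ) + M) ^ 2 ≤ (η / 32) * ((n:ℝ) + n) ^ 2 := by gcongr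
        _ ≤ γ / 4 * n ^ 2 := by rw [hηdef]; nlinarith [sq_nonneg (n:ℝ)]
    have hC : ∑ q ∈ P.parts ×ˢ P.parts, 2 * η * ((q.1.card : ℝ) * q.2.card) ≤ γ / 4 * n ^ 2 := by
      rw [← Finset.mul_sum, Finset.sum_product]
      simp only [← Finset.mul_sum, ← Finset.sum_mul, hsum1]
      rw [hηdef]
      nlinarith [sq_nonneg (n:ℝ)]
    have h7 := h1.trans (Finset.sum_le_sum hq)
    rw [Finset.sum_add_distrib, Finset.sum_add_distrib] at h7
    nlinarith [sq_nonneg (n:ℝ)]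

/-- number of subsets of size at most `k` of an `N`-set -/
def ball (N k : ℕ) : ℕ := (Finset.univ.filter fun s : Finset (Fin N) => s.card ≤ k).card

theorem card_finset_card_le (X : Type*) [Fintype X] (k : ℕ) :
    (Finset.univ.filter fun s : Finset X => s.card ≤ k).card = ball (Fintype.card X) k := by
  refine Finset.card_bij (fun s _ => s.map (Fintype.equivFin X).toEmbedding) ?_ ?_ ?_
  · intro s hs; simpa using hs
  · intro s _ t _ h; exact Finset.map_injective _ h
  · intro s hs
    refine ⟨s.map (Fintype.equivFin X).symm.toEmbedding, by simpa using hs, ?_⟩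
    ext; simp

theorem ball_le (N k : ℕ) {x : ℝ} (hx : 0 < x) (hx1 : x ≤ 1) :
    (ball N k : ℝ) ≤ Real.exp (x * N - k * Real.log x) := by
  have h1 : ∑ s : Finset (Fin N), x ^ s.card * 1 ^ (Fintype.card (Fin N) - s.card)
      = (x + 1) ^ Fintype.card (Fin N) := Fintype.sum_pow_mul_eq_add_pow (Fin N) x 1
  simp only [one_pow, mul_one, Fintype.card_fin] at h1
  have h2 : (ball N k : ℝ) * x ^ k ≤ (x + 1) ^ N := by
    rw [← h1, ball, ← nsmul_eq_mul, ← Finset.sum_const]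
    calc _ ≤ ∑ s ∈ Finset.univ.filter (fun s : Finset (Fin N) => s.card ≤ k), x ^ s.card :=
          Finset.sum_le_sum fun s hs =>
            pow_le_pow_of_le_one hx.le hx1 (Finset.mem_filter.1 hs).2
      _ ≤ _ := Finset.sum_le_sum_of_subset_of_nonneg (Finset.filter_subset _ _)
          fun _ _ _ => by positivity
  have h3 : (x + 1) ^ N ≤ Real.exp (x * N) := by
    rw [mul_comm, Real.exp_nat_mul]
    gcongr
    exact Real.add_one_le_exp x
  have h4 : Real.exp (k * Real.log x) = x ^ k := by
    rw [Real.exp_nat_mul, Real.exp_log hx]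
  rw [Real.exp_sub, h4, le_div_iff₀ (by positivity)]
  exact h2.trans h3

theorem exists_ball_le {η : ℝ} (hη : 0 < η) : ∃ γ : ℝ, 0 < γ ∧ ∀ N k : ℕ, (k : ℝ) ≤ γ * N →
    (ball N k : ℝ) ≤ Real.exp (η * N) := by
  set x := min (η / 2) (1 / 2) with hx
  have hx0 : 0 < x := by positivity
  have hx1 : x < 1 := lt_of_le_of_lt (min_le_right _ _) (by norm_num)
  have hl : Real.log x < 0 := Real.log_neg hx0 hx1
  refine ⟨η / 2 / (- Real.log x), by apply div_pos; positivity; linarith, fun N k hk => ?_⟩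
  refine (ball_le N k hx0 hx1.le).trans (Real.exp_le_exp.2 ?_)
  have h1 : x ≤ η / 2 := min_le_left _ _
  have h2 : (k:ℝ) * (- Real.log x) ≤ η / 2 * N := by
    calc (k:ℝ) * (- Real.log x) ≤ (η / 2 / (- Real.log x) * N) * (- Real.log x) := by
          gcongr; linarith
      _ = η / 2 * N := by
          have : Real.log x ≠ 0 := hl.ne
          field_simp
  have : (0:ℝ) ≤ N := by positivity
  nlinarith

/-- Functions avoiding a pattern on each of `|J|` disjoint blocks. -/
theorem card_avoid_le {E J K : Type*} [Fintype E] [Fintype J] [Fintype K] (e : J × K ↪ E)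
    (π : J → K → Bool) (A : Finset (E → Bool)) (hA : ∀ g ∈ A, ∀ j, ∃ p, g (e (j, p)) ≠ π j p) :
    (A.card : ℝ) ≤ 2 ^ Fintype.card E *
        Real.exp (-(Fintype.card J : ℝ) / 2 ^ Fintype.card K) := by
  let R := {x : E // x ∉ Set.range e}
  let T := (∀ j : J, {h : K → Bool // h ≠ π j}) × (R → Bool)
  have h1 : A.card ≤ Fintype.card T := by
    rw [← Fintype.card_coe]
    refine Fintype.card_le_of_injective (fun g => (⟨fun j => ⟨fun p => g.1 (e (j, p)), ?_⟩,
      fun x => g.1 x⟩ : T)) ?_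
    · intro h
      obtain ⟨p, hp⟩ := hA g.1 g.2 j
      exact hp (congrFun h p)
    · intro g g' h
      apply Subtype.ext
      funext x
      by_cases hx : x ∈ Set.range e
      · obtain ⟨⟨j, p⟩, rfl⟩ := hx
        have := congrFun (congrArg Prod.fst h) j
        exact congrFun (congrArg Subtype.val this) p
      · exact congrFun (congrArg Prod.snd h) ⟨x, hx⟩
  have h2 : Fintype.card T = (2 ^ Fintype.card K - 1) ^ Fintype.card J * 2 ^ Fintype.card R := by
    simp only [T, Fintype.card_prod, Fintype.card_pi, Fintype.card_bool, Finset.prod_const]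
    congr 1
    rw [Finset.prod_congr rfl (g := fun _ => 2 ^ Fintype.card K - 1), Finset.prod_const]
    · rfl
    · intro j _
      rw [Fintype.card_subtype_compl, Fintype.card_subtype_eq]
      simp
  have h3 : Fintype.card R + Fintype.card J * Fintype.card K = Fintype.card E := by
    have : Fintype.card R = Fintype.card E - Fintype.card (Set.range e) :=
      Fintype.card_subtype_compl _
    rw [Set.card_range_of_injective e.injective, Fintype.card_prod] at this
    have := Fintype.card_le_of_embedding e
    rw [Fintype.card_prod] at this
    omega
  refine (Nat.cast_le.2 (h1.trans h2.le)).trans ?_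
  rw [← h3, pow_add, mul_comm (Fintype.card J), pow_mul]
  push_cast [Nat.one_le_two_pow]
  set a : ℝ := 2 ^ Fintype.card K with ha
  have ha1 : 1 ≤ a := one_le_pow₀ (by norm_num)
  have h4 : (a - 1) ^ Fintype.card J ≤ a ^ Fintype.card J * Real.exp (-(Fintype.card J : ℝ) / a) := by
    have : Real.exp (-(Fintype.card J : ℝ) / a) = Real.exp (-1 / a) ^ Fintype.card J := by
      rw [← Real.exp_nat_mul]; congr 1; ring
    rw [this, ← mul_pow]
    have h5 := Real.add_one_le_exp (-1 / a)
    have h6 : a * (-1 / a + 1) = a - 1 := by field_simp; ring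
    gcongr
    rw [← h6]
    gcongr
  calc (a - 1) ^ Fintype.card J * 2 ^ Fintype.card R
      ≤ (a ^ Fintype.card J * Real.exp (-(Fintype.card J : ℝ) / a)) * 2 ^ Fintype.card R := by
        gcongr
    _ = _ := by ring

/-- Between many disjoint small tuples in `S` and many disjoint small tuples outside `S`,
every adjacency pattern occurs. -/
def RL {V : Type*} (b : ℕ) (G : SimpleGraph V) (S : Set V) : Prop :=
  ∀ r ≤ 3, ∀ s ≤ 3, ∀ (x : Fin b × Fin r ↪ V) (y : Fin b × Fin s ↪ V) (π : Fin r → Fin s → Bool),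
    (∀ p, x p ∈ S) → (∀ q, y q ∉ S) →
      ∃ i j, ∀ p q, G.Adj (x (i, p)) (y (j, q)) ↔ π p q = true

theorem two_pow_mul_le_exp {a b n : ℕ} (h : a + b = n) :
    (2:ℝ) ^ (a * b) ≤ Real.exp (Real.log 2 * (n ^ 2 / 4)) := by
  have h1 : (2:ℝ) ^ (a * b) = Real.exp (Real.log 2 * (a * b)) := by
    rw [← Nat.cast_mul, mul_comm (Real.log 2), Real.exp_nat_mul, Real.exp_log (by norm_num)]
  rw [h1]
  have : (0:ℝ) < Real.log 2 := Real.log_pos (by norm_num)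
  gcongr
  have : (n:ℝ) = a + b := by exact_mod_cast h.symm
  rw [this]
  nlinarith [sq_nonneg ((a:ℝ) - b)]

/-- index set for the possible failures of `RL` -/
abbrev RLIdx (n b : ℕ) : Type :=
  Σ rs : Fin 4 × Fin 4, (Fin b × Fin rs.1 → Fin n) × (Fin b × Fin rs.2 → Fin n) ×
    (Fin rs.1 → Fin rs.2 → Bool)

theorem card_RLIdx_le {n b : ℕ} (hn : 1 ≤ n) : Fintype.card (RLIdx n b) ≤ 8192 * n ^ (6 * b) := by
  rw [Fintype.card_sigma]
  have : ∀ rs : Fin 4 × Fin 4, Fintype.card ((Fin b × Fin rs.1 → Fin n) ×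
      (Fin b × Fin rs.2 → Fin n) × (Fin rs.1 → Fin rs.2 → Bool)) ≤ 512 * n ^ (6 * b) := by
    intro rs
    have hr : (rs.1 : ℕ) ≤ 3 := by omega
    have hs : (rs.2 : ℕ) ≤ 3 := by omega
    simp only [Fintype.card_prod, Fintype.card_fun, Fintype.card_fin, Fintype.card_bool]
    have h1 : n ^ (b * (rs.1 : ℕ)) ≤ n ^ (b * 3) := Nat.pow_le_pow_right hn (by gcongr)
    have h2 : n ^ (b * (rs.2 : ℕ)) ≤ n ^ (b * 3) := Nat.pow_le_pow_right hn (by gcongr)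
    have h3 : (2 ^ (rs.2 : ℕ)) ^ (rs.1 : ℕ) ≤ 512 := by
      rw [← pow_mul]
      calc 2 ^ ((rs.2 : ℕ) * rs.1) ≤ 2 ^ (3 * 3) := by gcongr; norm_num
        _ = 512 := by norm_num
    calc _ ≤ n ^ (b * 3) * (n ^ (b * 3) * 512) := by gcongr
      _ = 512 * n ^ (6 * b) := by rw [show 6 * b = b * 3 + b * 3 by ring, pow_add]; ring
  calc _ ≤ ∑ _rs : Fin 4 × Fin 4, 512 * n ^ (6 * b) := Finset.sum_le_sum fun rs _ => this rs
    _ = _ := by simp; ring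

/-- cross functions witnessing the failure of `RL` for given tuples and pattern -/
def avoidSet {n b r s : ℕ} (S : Finset (Fin n)) (x : Fin b × Fin r → Fin n)
    (y : Fin b × Fin s → Fin n) (π : Fin r → Fin s → Bool) :
    Finset ({v // v ∈ S} × {v // v ∉ S} → Bool) :=
  Finset.univ.filter fun g => Function.Injective x ∧ Function.Injective y ∧ (∀ p, x p ∈ S) ∧
    (∀ q, y q ∉ S) ∧ ∀ j k, ∃ p q, ∀ e, e.1.1 = x (j, p) → e.2.1 = y (k, q) → g e ≠ π p q

theorem mem_avoidSet {n b r s : ℕ} {S : Finset (Fin n)} {x : Fin b × Fin r → Fin n}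
    {y : Fin b × Fin s → Fin n} {π : Fin r → Fin s → Bool}
    {g : {v // v ∈ S} × {v // v ∉ S} → Bool} : g ∈ avoidSet S x y π ↔
      Function.Injective x ∧ Function.Injective y ∧ (∀ p, x p ∈ S) ∧ (∀ q, y q ∉ S) ∧
      ∀ j k, ∃ p q, ∀ e, e.1.1 = x (j, p) → e.2.1 = y (k, q) → g e ≠ π p q := by
  simp only [avoidSet, Finset.mem_filter, Finset.mem_univ, true_and]

theorem card_avoidSet_le {n b r s : ℕ} (hr : r ≤ 3) (hs : s ≤ 3) (S : Finset (Fin n))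
    (x : Fin b × Fin r → Fin n) (y : Fin b × Fin s → Fin n) (π : Fin r → Fin s → Bool) :
    ((avoidSet S x y π).card : ℝ) ≤ Real.exp (Real.log 2 * (n ^ 2 / 4)) *
      Real.exp (-(b : ℝ) ^ 2 / 512) := by
  by_cases hcase : Function.Injective x ∧ Function.Injective y ∧ (∀ p, x p ∈ S) ∧ (∀ q, y q ∉ S)
  · obtain ⟨hxi, hyi, hx, hy⟩ := hcase
    let e : (Fin b × Fin b) × (Fin r × Fin s) ↪ {v // v ∈ S} × {v // v ∉ S} :=
      ⟨fun w => (⟨x (w.1.1, w.2.1), hx _⟩, ⟨y (w.1.2, w.2.2), hy _⟩), by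
        rintro ⟨⟨i, j⟩, p, q⟩ ⟨⟨i', j'⟩, p', q'⟩ h
        have h1 := hxi (congrArg (fun z => (z.1 : Fin n)) h)
        have h2 := hyi (congrArg (fun z => (z.2 : Fin n)) h)
        simp only [Prod.mk.injEq] at h1 h2 ⊢
        tauto⟩
    have h1 := card_avoid_le e (fun _ p => π p.1 p.2) (avoidSet S x y π) (by
      intro g hg j
      obtain ⟨-, -, -, -, h⟩ := mem_avoidSet.1 hg
      obtain ⟨p, q, hpq⟩ := h j.1 j.2
      exact ⟨(p, q), hpq _ rfl rfl⟩)
    refine h1.trans ?_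
    have h3 : Fintype.card ({v // v ∈ S} × {v // v ∉ S}) = S.card * (n - S.card) := by
      rw [Fintype.card_prod, Fintype.card_subtype_compl, Fintype.card_coe, Fintype.card_fin]
    rw [h3]
    have hSn : S.card ≤ n := by simpa using S.card_le_univ
    refine mul_le_mul (two_pow_mul_le_exp (by omega)) (Real.exp_le_exp.2 ?_) (by positivity)
      (by positivity)
    simp only [Fintype.card_prod, Fintype.card_fin]
    rw [neg_div, neg_div, neg_le_neg_iff]
    push_cast
    rw [← pow_two]
    have : (2:ℝ) ^ (r * s) ≤ 512 := by
      calc (2:ℝ) ^ (r * s) ≤ 2 ^ (3 * 3) := by gcongr; norm_num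
        _ = 512 := by norm_num
    gcongr
  · have : avoidSet S x y π = ∅ := by
      refine Finset.eq_empty_of_forall_notMem fun g h => ?_
      obtain ⟨h1, h2, h3, h4, -⟩ := mem_avoidSet.1 h
      exact hcase ⟨h1, h2, h3, h4⟩
    rw [this]
    simp only [Finset.card_empty, Nat.cast_zero]
    positivity

theorem card_not_RL_le {n b : ℕ} (hn : 1 ≤ n) (S : Finset (Fin n))
    (𝒢 : Finset (SimpleGraph (Fin n))) {D : Type*} (φ : SimpleGraph (Fin n) → D)
    (Ds : Finset D) (hD : ∀ G ∈ 𝒢, φ G ∈ Ds) (hRL : ∀ G ∈ 𝒢, ¬ RL b G S)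
    (hφ : ∀ G ∈ 𝒢, ∀ G' ∈ 𝒢, φ G = φ G' → (∀ u ∈ S, ∀ v ∉ S, G.Adj u v ↔ G'.Adj u v) → G = G') :
    (𝒢.card : ℝ) ≤ Ds.card * (8192 * n ^ (6 * b) * Real.exp (Real.log 2 * (n ^ 2 / 4))
      * Real.exp (-(b : ℝ) ^ 2 / 512)) := by
  let ψ : SimpleGraph (Fin n) → {v // v ∈ S} × {v // v ∉ S} → Bool := fun G e =>
    decide (G.Adj e.1 e.2)
  let X : RLIdx n b → Finset ({v // v ∈ S} × {v // v ∉ S} → Bool) := fun i =>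
    avoidSet S i.2.1 i.2.2.1 i.2.2.2
  have hX : ∀ i, ((X i).card : ℝ) ≤ Real.exp (Real.log 2 * (n ^ 2 / 4)) *
      Real.exp (-(b : ℝ) ^ 2 / 512) := fun i =>
    card_avoidSet_le (by omega) (by omega) S _ _ _
  have hcov : (𝒢.image fun G => (φ G, ψ G)) ⊆ Ds ×ˢ Finset.univ.biUnion X := by
    intro z hz
    obtain ⟨G, hG, rfl⟩ := Finset.mem_image.1 hz
    refine Finset.mem_product.2 ⟨hD G hG, ?_⟩
    have h := hRL G hG
    unfold RL at h
    push Not at h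
    obtain ⟨r, hr, s, hs, x, y, π, hx, hy, h⟩ := h
    refine Finset.mem_biUnion.2 ⟨⟨(⟨r, by omega⟩, ⟨s, by omega⟩), x, y, π⟩, Finset.mem_univ _,
      mem_avoidSet.2 ⟨x.injective, y.injective, hx, hy, fun j k => ?_⟩⟩
    obtain ⟨p, q, hpq⟩ := h j k
    refine ⟨p, q, fun e he1 he2 heq => ?_⟩
    have : G.Adj (x (j, p)) (y (k, q)) ↔ π p q = true := by
      have h1 : decide (G.Adj e.1 e.2) = π p q := heq
      have h2 : e.1.1 = x (j, p) := he1
      have h3 : e.2.1 = y (k, q) := he2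
      rw [← h1, h2, h3]; simp
    tauto
  have hinj : Set.InjOn (fun G => (φ G, ψ G)) 𝒢 := by
    intro G hG G' hG' h
    simp only [Prod.mk.injEq] at h
    refine hφ G hG G' hG' h.1 fun u hu v hv => ?_
    have := congrFun h.2 (⟨u, hu⟩, ⟨v, hv⟩)
    simpa [ψ] using this
  have h1 := Finset.card_le_card hcov
  rw [Finset.card_image_of_injOn hinj, Finset.card_product] at h1
  have h2 : ((Finset.univ.biUnion X).card : ℝ) ≤ 8192 * n ^ (6 * b) *
      (Real.exp (Real.log 2 * (n ^ 2 / 4)) * Real.exp (-(b : ℝ) ^ 2 / 512)) := by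
    calc ((Finset.univ.biUnion X).card : ℝ) ≤ ∑ i, ((X i).card : ℝ) := by
          exact_mod_cast Finset.card_biUnion_le
      _ ≤ ∑ _i : RLIdx n b, (Real.exp (Real.log 2 * (n ^ 2 / 4)) *
            Real.exp (-(b : ℝ) ^ 2 / 512)) := Finset.sum_le_sum fun i _ => hX i
      _ = Fintype.card (RLIdx n b) * (Real.exp (Real.log 2 * (n ^ 2 / 4)) *
            Real.exp (-(b : ℝ) ^ 2 / 512)) := by
          rw [Finset.sum_const, nsmul_eq_mul, Finset.card_univ]
      _ ≤ _ := by
          have : (Fintype.card (RLIdx n b) : ℝ) ≤ 8192 * n ^ (6 * b) := by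
            exact_mod_cast card_RLIdx_le hn
          gcongr
  calc (𝒢.card : ℝ) ≤ Ds.card * ((Finset.univ.biUnion X).card : ℝ) := by exact_mod_cast h1
    _ ≤ _ := by
      rw [mul_assoc (8192 * (n:ℝ) ^ (6 * b))]
      gcongr

theorem sum_comp_le {n M : ℕ} {f : Fin n → Fin M} {q : ℝ}
    (hf : ∀ i, ((Finset.univ.filter fun v => f v = i).card : ℝ) ≤ q) {w : Fin M → ℝ}
    (hw : ∀ i, 0 ≤ w i) : ∑ v, w (f v) ≤ q * ∑ i, w i := by
  rw [← Finset.sum_fiberwise Finset.univ f, Finset.mul_sum]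
  refine Finset.sum_le_sum fun i _ => ?_
  rw [Finset.sum_congr rfl (g := fun _ => w i), Finset.sum_const, nsmul_eq_mul]
  · exact mul_le_mul_of_nonneg_right (hf i) (hw i)
  · intro v hv; rw [(Finset.mem_filter.1 hv).2]

theorem sum_comp_le₂ {n M : ℕ} {f : Fin n → Fin M} {q : ℝ} (hq : 0 ≤ q)
    (hf : ∀ i, ((Finset.univ.filter fun v => f v = i).card : ℝ) ≤ q) {w : Fin M → Fin M → ℝ}
    (hw : ∀ i j, 0 ≤ w i j) : ∑ u, ∑ v, w (f u) (f v) ≤ q ^ 2 * ∑ i, ∑ j, w i j := by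
  calc ∑ u, ∑ v, w (f u) (f v) ≤ ∑ u, q * ∑ j, w (f u) j :=
        Finset.sum_le_sum fun u _ => sum_comp_le hf (hw _)
    _ = q * ∑ u, ∑ j, w (f u) j := by rw [Finset.mul_sum]
    _ ≤ q * (q * ∑ i, ∑ j, w i j) := by
        gcongr
        exact sum_comp_le hf (w := fun i => ∑ j, w i j)
          fun i => Finset.sum_nonneg fun j _ => hw i j
    _ = _ := by ring

theorem card_template_sparse {n M k : ℕ} (f : Fin n → Fin M) (R : SimpleGraph (Fin M))
    (τ : Fin M → Fin M → Bool) (𝒢 : Finset (SimpleGraph (Fin n)))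
    (h : ∀ G ∈ 𝒢, (mismatch G f R τ).card ≤ k) :
    𝒢.card ≤ ball (n * n) k * 2 ^ (R.comap f).edgeFinset.card := by
  let H := R.comap f
  have h1 : 𝒢.card ≤ ((Finset.univ.filter fun s : Finset (Fin n × Fin n) => s.card ≤ k) ×ˢ
      (Finset.univ : Finset (H.edgeFinset → Bool))).card := by
    refine Finset.card_le_card_of_injOn
      (fun G => (mismatch G f R τ, fun e => decide (e.1 ∈ G.edgeSet))) ?_ ?_
    · intro G hG
      exact Finset.mem_coe.2 (Finset.mem_product.2
        ⟨Finset.mem_filter.2 ⟨Finset.mem_univ _, h G hG⟩, Finset.mem_univ _⟩)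
    · intro G hG G' hG' heq
      simp only [Prod.mk.injEq] at heq
      ext u v
      by_cases huv : R.Adj (f u) (f v)
      · have he : s(u, v) ∈ H.edgeFinset := by simpa [H] using huv
        have := congrFun heq.2 ⟨_, he⟩
        simpa using this
      · have h2 : (u, v) ∈ mismatch G f R τ ↔ (u, v) ∈ mismatch G' f R τ := by rw [heq.1]
        rw [mem_mismatch, mem_mismatch] at h2
        simp only [huv, not_false_iff, true_and] at h2
        tauto
  refine h1.trans ?_
  rw [Finset.card_product, card_finset_card_le, Finset.card_univ, Fintype.card_fun,
    Fintype.card_prod, Fintype.card_fin, Fintype.card_bool, Fintype.card_coe]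

theorem two_mul_edges_comap {n M : ℕ} (f : Fin n → Fin M) (R : SimpleGraph (Fin M)) :
    2 * ((R.comap f).edgeFinset.card : ℝ) = ∑ u, ∑ v, if R.Adj (f u) (f v) then (1:ℝ) else 0 := by
  have h1 := (R.comap f).sum_degrees_eq_twice_card_edges
  have h2 : ∀ u, ((R.comap f).degree u : ℝ) = ∑ v, if R.Adj (f u) (f v) then (1:ℝ) else 0 := by
    intro u
    rw [← SimpleGraph.card_neighborFinset_eq_degree, SimpleGraph.neighborFinset_eq_filter,
      Finset.card_filter]
    push_cast
    rfl
  rw [← Finset.sum_congr rfl fun u _ => h2 u]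
  exact_mod_cast h1.symm

theorem triangleFree_dichotomy {M : ℕ} (hM : 0 < M) (R : SimpleGraph (Fin M))
    (hR : ∀ i j k, R.Adj i j → R.Adj j k → ¬ R.Adj i k) {s : ℝ} (hs : 0 ≤ s) :
    (∑ i, ∑ j, if R.Adj i j then (1:ℝ) else 0) ≤ (1 / 2 - 2 * s ^ 2) * M ^ 2 ∨
    ∃ A : Finset (Fin M), (∀ i ∈ A, ∀ j ∈ A, ¬ R.Adj i j) ∧
      (∑ i ∈ Aᶜ, ∑ j ∈ Aᶜ, if R.Adj i j then (1:ℝ) else 0) ≤ 2 * s ^ 2 * M ^ 2 ∧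
      (A.card : ℝ) ≤ (1 / 2 + s) * M ∧ (M : ℝ) - A.card ≤ (1 / 2 + s) * M := by
  set r : Fin M → Fin M → ℝ := fun i j => if R.Adj i j then (1:ℝ) else 0 with hr
  by_cases hD : (∑ i, ∑ j, r i j) ≤ (1 / 2 - 2 * s ^ 2) * M ^ 2
  · exact Or.inl hD
  right
  push Not at hD
  have hne : (Finset.univ : Finset (Fin M)).Nonempty := ⟨⟨0, hM⟩, Finset.mem_univ _⟩
  obtain ⟨v, -, hv⟩ := Finset.exists_max_image Finset.univ (fun i => ∑ j, r i j) hne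
  set A := Finset.univ.filter fun j => R.Adj v j with hA
  have hAc : ∑ j, r v j = A.card := by
    rw [hA, Finset.card_filter]; push_cast; rfl
  have hAi : ∀ i ∈ A, ∀ j ∈ A, ¬ R.Adj i j := by
    intro i hi j hj hij
    exact hR v i j (Finset.mem_filter.1 hi).2 hij (Finset.mem_filter.1 hj).2
  have hsym : ∀ i j, r i j = r j i := fun i j => by simp only [hr, R.adj_comm]
  set X := ∑ i ∈ Aᶜ, ∑ j ∈ A, r i j with hX
  set Y := ∑ i ∈ Aᶜ, ∑ j ∈ Aᶜ, r i j with hY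
  have hsplit : ∀ i, ∑ j, r i j = ∑ j ∈ A, r i j + ∑ j ∈ Aᶜ, r i j := fun i =>
    (Finset.sum_add_sum_compl A _).symm
  have h0 : ∑ i ∈ A, ∑ j ∈ A, r i j = 0 :=
    Finset.sum_eq_zero fun i hi => Finset.sum_eq_zero fun j hj => if_neg (hAi i hi j hj)
  have h1 : ∑ i ∈ A, ∑ j ∈ Aᶜ, r i j = X := by
    rw [Finset.sum_comm, hX]
    exact Finset.sum_congr rfl fun i _ => Finset.sum_congr rfl fun j _ => hsym _ _
  have h2 : ∑ i, ∑ j, r i j = 2 * X + Y := by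
    rw [← Finset.sum_add_sum_compl A]
    simp only [hsplit, Finset.sum_add_distrib]
    rw [h0, h1, ← hX, ← hY]; ring
  have h3 : X + Y ≤ (M - A.card) * A.card := by
    have : X + Y = ∑ i ∈ Aᶜ, ∑ j, r i j := by
      simp only [hsplit, Finset.sum_add_distrib]; rw [← hX, ← hY]
    rw [this]
    calc ∑ i ∈ Aᶜ, ∑ j, r i j ≤ ∑ _i ∈ Aᶜ, (A.card : ℝ) :=
          Finset.sum_le_sum fun i _ => (hv i (Finset.mem_univ _)).trans hAc.le
      _ = (M - A.card) * A.card := by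
          rw [Finset.sum_const, nsmul_eq_mul, Finset.card_compl, Fintype.card_fin,
            Nat.cast_sub (by simpa using A.card_le_univ)]
  have hY0 : 0 ≤ Y := Finset.sum_nonneg fun i _ => Finset.sum_nonneg fun j _ => by
    simp only [hr]; split_ifs <;> norm_num
  have hMs : 0 ≤ s * M := by positivity
  have hsq : ((A.card : ℝ) - M / 2) ^ 2 ≤ (s * M) ^ 2 := by nlinarith
  have hab := abs_le.1 (abs_le_of_sq_le_sq hsq hMs)
  refine ⟨A, hAi, ?_, by linarith [hab.2], by linarith [hab.1]⟩
  nlinarith [sq_nonneg ((A.card : ℝ) - M / 2)]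

theorem card_template_dense {n M b k : ℕ} (hn : 1 ≤ n) (f : Fin n → Fin M) (R : SimpleGraph (Fin M))
    (τ : Fin M → Fin M → Bool) {q γ : ℝ} (hq : 0 ≤ q)
    (hf : ∀ i, ((Finset.univ.filter fun v => f v = i).card : ℝ) ≤ q) {A : Finset (Fin M)}
    (hA : ∀ i ∈ A, ∀ j ∈ A, ¬ R.Adj i j) {y : ℝ}
    (hy : (∑ i ∈ Aᶜ, ∑ j ∈ Aᶜ, if R.Adj i j then (1:ℝ) else 0) ≤ y)
    (hk : γ + q ^ 2 * y ≤ k)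
    (𝒢 : Finset (SimpleGraph (Fin n))) (h : ∀ G ∈ 𝒢, ((mismatch G f R τ).card : ℝ) ≤ γ)
    (hRL : ∀ G ∈ 𝒢, ¬ RL b G (Finset.univ.filter fun v => f v ∈ A : Finset (Fin n))) :
    (𝒢.card : ℝ) ≤ ball (n * n) k * (8192 * n ^ (6 * b) * Real.exp (Real.log 2 * (n ^ 2 / 4))
      * Real.exp (-(b : ℝ) ^ 2 / 512)) := by
  let I : Finset (Fin n × Fin n) := Finset.univ.filter fun p => f p.1 ∉ A ∧ f p.2 ∉ A ∧
    R.Adj (f p.1) (f p.2)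
  have hI : (I.card : ℝ) ≤ q ^ 2 * y := by
    have h1 : (I.card : ℝ) = ∑ u, ∑ v, if f u ∉ A ∧ f v ∉ A ∧ R.Adj (f u) (f v) then (1:ℝ)
        else 0 := by
      rw [Finset.card_filter, ← Finset.univ_product_univ, Finset.sum_product]
      push_cast
      rfl
    have h2 := sum_comp_le₂ hq hf (w := fun i j => if i ∉ A ∧ j ∉ A ∧ R.Adj i j then (1:ℝ) else 0)
      (fun i j => by split_ifs <;> norm_num)
    rw [h1]
    refine h2.trans (mul_le_mul_of_nonneg_left (le_trans (le_of_eq ?_) hy) (by positivity))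
    rw [← Finset.sum_subset (Finset.subset_univ Aᶜ)]
    · refine Finset.sum_congr rfl fun i hi => ?_
      rw [Finset.mem_compl] at hi
      rw [← Finset.sum_subset (Finset.subset_univ Aᶜ)]
      · refine Finset.sum_congr rfl fun j hj => ?_
        rw [Finset.mem_compl] at hj
        simp [hi, hj]
      · intro j _ hj
        rw [Finset.mem_compl, not_not] at hj
        simp [hj]
    · intro i _ hi
      rw [Finset.mem_compl, not_not] at hi
      simp [hi]
  let φ : SimpleGraph (Fin n) → Finset (Fin n × Fin n) := fun G => Finset.univ.filter fun p =>
    (f p.1 ∈ A ↔ f p.2 ∈ A) ∧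
      ¬ (G.Adj p.1 p.2 ↔ (¬ R.Adj (f p.1) (f p.2) ∧ τ (f p.1) (f p.2) = true))
  have hmem : ∀ G p, p ∈ φ G ↔ (f p.1 ∈ A ↔ f p.2 ∈ A) ∧
      ¬ (G.Adj p.1 p.2 ↔ (¬ R.Adj (f p.1) (f p.2) ∧ τ (f p.1) (f p.2) = true)) := fun G p => by
    simp [φ]
  have hφ : ∀ G ∈ 𝒢, φ G ⊆ mismatch G f R τ ∪ I := by
    intro G hG p hp
    rw [hmem] at hp
    rw [Finset.mem_union, mem_mismatch]
    by_cases hRp : R.Adj (f p.1) (f p.2)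
    · right
      refine Finset.mem_filter.2 ⟨Finset.mem_univ _, ?_, ?_, hRp⟩
      · intro h1; exact hA _ h1 _ (hp.1.1 h1) hRp
      · intro h1; exact hA _ (hp.1.2 h1) _ h1 hRp
    · left
      exact ⟨hRp, fun h' => hp.2 (by simpa [hRp] using h')⟩
  have hres := card_not_RL_le (b := b) hn (Finset.univ.filter fun v => f v ∈ A) 𝒢 φ
    (Finset.univ.filter fun s : Finset (Fin n × Fin n) => s.card ≤ k) ?_ hRL ?_
  · rw [card_finset_card_le, Fintype.card_prod, Fintype.card_fin] at hres
    exact hres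
  · intro G hG
    refine Finset.mem_filter.2 ⟨Finset.mem_univ _, ?_⟩
    have h1 : ((φ G).card : ℝ) ≤ (mismatch G f R τ).card + I.card := by
      exact_mod_cast (Finset.card_le_card (hφ G hG)).trans (Finset.card_union_le _ _)
    have h2 := h G hG
    have h3 : ((φ G).card : ℝ) ≤ k := by linarith
    exact_mod_cast h3
  · intro G hG G' hG' heq hcross
    have hin : ∀ u v, (f u ∈ A ↔ f v ∈ A) → (G.Adj u v ↔ G'.Adj u v) := by
      intro u v huv
      have h1 : (u, v) ∈ φ G ↔ (u, v) ∈ φ G' := by rw [heq]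
      rw [hmem, hmem] at h1
      simp only [huv, true_and] at h1
      tauto
    ext u v
    by_cases hu : f u ∈ A <;> by_cases hv : f v ∈ A
    · exact hin u v (by tauto)
    · exact hcross u (by simpa using hu) v (by simpa using hv)
    · rw [G.adj_comm, G'.adj_comm]
      exact hcross v (by simpa using hv) u (by simpa using hu)
    · exact hin u v (by tauto)

theorem card_le_of_cover {D α : Type*} [Fintype D] (P : D → α → Prop) (A : Finset α)
    (h : ∀ a ∈ A, ∃ d, P d a) {B : ℝ}
    (hB : ∀ d, ∀ A' ⊆ A, (∀ a ∈ A', P d a) → (A'.card : ℝ) ≤ B) :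
    (A.card : ℝ) ≤ Fintype.card D * B := by
  have h1 : A ⊆ Finset.univ.biUnion fun d => A.filter (P d) := by
    intro a ha
    obtain ⟨d, hd⟩ := h a ha
    exact Finset.mem_biUnion.2 ⟨d, Finset.mem_univ _, Finset.mem_filter.2 ⟨ha, hd⟩⟩
  calc (A.card : ℝ) ≤ ((∑ d, (A.filter (P d)).card : ℕ) : ℝ) := by
        exact_mod_cast (Finset.card_le_card h1).trans Finset.card_biUnion_le
    _ ≤ ∑ _d : D, B := by
        push_cast
        exact Finset.sum_le_sum fun d _ => hB d _ (Finset.filter_subset _ _)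
          fun a ha => (Finset.mem_filter.1 ha).2
    _ = _ := by rw [Finset.sum_const, nsmul_eq_mul, Finset.card_univ]

/-- An exponent of order `n log n` is eventually below any positive multiple of `n ^ 2`. -/
theorem eventually_nlog_le (C : ℝ) {c : ℝ} (hc : 0 < c) :
    ∀ᶠ n : ℕ in atTop, C * (n * Real.log n + n + 1) ≤ c * (n : ℝ) ^ 2 := by
  have h0 : (fun x : ℝ => C * (x * Real.log x + x + 1)) =o[atTop] fun x : ℝ => x ^ 2 := by
    refine Asymptotics.IsLittleO.const_mul_left ?_ _
    refine (Asymptotics.IsLittleO.add ?_ ?_).add ?_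
    · simp only [pow_two]
      exact (Asymptotics.isBigO_refl _ _).mul_isLittleO Real.isLittleO_log_id_atTop
    · simpa using Asymptotics.isLittleO_pow_pow_atTop_of_lt (𝕜 := ℝ) (show 1 < 2 by norm_num)
    · simp
  have h1 := (h0.comp_tendsto tendsto_natCast_atTop_atTop).bound hc
  filter_upwards [h1] with n hn
  simp only [Function.comp, Real.norm_eq_abs] at hn
  rw [abs_of_nonneg (sq_nonneg (n:ℝ))] at hn
  exact (le_abs_self _).trans hn

abbrev TemplateIdx (n M₀ : ℕ) :=
  Σ M : Fin (M₀ + 1), (Fin n → Fin M) × SimpleGraph (Fin M) × (Fin M → Fin M → Bool)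

theorem card_simpleGraph_le (M : ℕ) : Fintype.card (SimpleGraph (Fin M)) ≤ 2 ^ (M * M) := by
  have := Fintype.card_le_of_injective
    (fun (G : SimpleGraph (Fin M)) (p : Fin M × Fin M) => decide (G.Adj p.1 p.2)) ?_
  · simpa using this
  · intro G H h
    ext u v
    simpa using congrFun h (u, v)

theorem card_templateIdx_le (n M₀ : ℕ) : (Fintype.card (TemplateIdx n M₀) : ℝ) ≤
    Real.exp ((M₀ + 2 * M₀ ^ 2) * (n + 1)) := by
  have h1 : Fintype.card (TemplateIdx n M₀) ≤ (M₀ + 1) * (M₀ ^ n * 4 ^ (M₀ * M₀)) := by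
    rw [Fintype.card_sigma]
    refine (Finset.sum_le_card_nsmul _ _ (M₀ ^ n * 4 ^ (M₀ * M₀)) fun M _ => ?_).trans (by simp)
    have hM : (M : ℕ) ≤ M₀ := Nat.lt_succ_iff.1 M.2
    rw [Fintype.card_prod, Fintype.card_prod]
    refine Nat.mul_le_mul ?_ ?_
    · rw [Fintype.card_fun, Fintype.card_fin, Fintype.card_fin]
      exact Nat.pow_le_pow_left hM n
    · calc _ ≤ 2 ^ ((M : ℕ) * M) * 2 ^ ((M : ℕ) * M) := by
            refine Nat.mul_le_mul (card_simpleGraph_le _) (le_of_eq ?_)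
            simp [pow_mul]
        _ = 4 ^ ((M : ℕ) * M) := by rw [← mul_pow]; norm_num
        _ ≤ _ := Nat.pow_le_pow_right (by norm_num) (Nat.mul_le_mul hM hM)
  have hb : (M₀ : ℝ) ≤ Real.exp M₀ := by linarith [Real.add_one_le_exp (M₀ : ℝ)]
  have h4 : (4:ℝ) ≤ Real.exp 2 := by
    have := Real.add_one_le_exp (1:ℝ)
    calc (4:ℝ) ≤ Real.exp 1 * Real.exp 1 := by nlinarith
      _ = _ := by rw [← Real.exp_add]; norm_num
  calc (Fintype.card (TemplateIdx n M₀) : ℝ) ≤ (M₀ + 1) * (M₀ ^ n * 4 ^ (M₀ * M₀)) := by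
        exact_mod_cast h1
    _ ≤ Real.exp M₀ * (Real.exp M₀ ^ n * Real.exp 2 ^ (M₀ * M₀)) := by
        gcongr
        exact Real.add_one_le_exp _
    _ = Real.exp (M₀ + (n * M₀ + (M₀ * M₀ : ℕ) * 2)) := by
        rw [← Real.exp_nat_mul, ← Real.exp_nat_mul, ← Real.exp_add, ← Real.exp_add]
    _ ≤ _ := by
        apply Real.exp_le_exp.2
        push_cast
        have : (0:ℝ) ≤ M₀ ^ 2 * n := by positivity
        nlinarith

theorem dense_exponent_le {β L n b l C₁ c₁ : ℝ} (hβ : 0 < β) (hβ1 : β ≤ 1) (hn : 1 ≤ n)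
    (hl : 0 ≤ l) (hb1 : β * n ≤ b) (hb2 : b ≤ β * n + 1) (hC : 22 ≤ C₁) (hc : c₁ ≤ β ^ 2 / 1024) :
    β ^ 2 / 1024 * (n * n) + (13 + 6 * b * l + L * (n ^ 2 / 4) + -b ^ 2 / 512) ≤
      L * n ^ 2 / 4 - c₁ * n ^ 2 + C₁ * (n * l + n + 1) := by
  have hnl : 0 ≤ n * l := by positivity
  have h0 : 0 ≤ β * n := by positivity
  have h6 : (β * n) ^ 2 ≤ b ^ 2 := pow_le_pow_left₀ h0 hb1 2
  have h6' : (β * n) ^ 2 = β ^ 2 * n ^ 2 := by ring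
  have hb : b ≤ 2 * n := by
    have : β * n ≤ 1 * n := by gcongr
    linarith
  have h7 : b * l ≤ 2 * n * l := by gcongr
  have h8 : 22 * (n * l + n + 1) ≤ C₁ * (n * l + n + 1) := by gcongr
  have h9 : c₁ * n ^ 2 ≤ β ^ 2 / 1024 * n ^ 2 := by gcongr
  linarith

theorem sparse_exponent_le {L s n M M₀ l C₁ c₁ : ℝ} (hL1 : L ≤ 1) (hs : 0 < s)
    (hs1 : s ≤ 1 / 2) (hn : 1 ≤ n) (hM : 0 ≤ M) (hMM : M ≤ M₀) (hl : 0 ≤ l)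
    (hC : C₁ = 2 * M₀ + M₀ ^ 2 + 22) (hc : c₁ ≤ L * s ^ 2 / 2) :
    L * s ^ 2 / 2 * (n * n) + L * ((1 / 4 - s ^ 2) * (n + M) ^ 2) ≤
      L * n ^ 2 / 4 - c₁ * n ^ 2 + C₁ * (n * l + n + 1) := by
  have hM0 : 0 ≤ M₀ := hM.trans hMM
  have hs2 : s ^ 2 ≤ 1 / 4 := by nlinarith
  have hnl : 0 ≤ n * l := by positivity
  have h5 : L * ((1 / 4 - s ^ 2) * (2 * M * n + M ^ 2)) ≤ 1 * (1 * ((2 * M₀ + M₀ ^ 2) * n)) := by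
    have h1 : 2 * M * n + M ^ 2 ≤ (2 * M₀ + M₀ ^ 2) * n := by
      have : M * n ≤ M₀ * n := by gcongr
      have h2 : M ^ 2 ≤ M₀ ^ 2 * n := by
        calc M ^ 2 ≤ M₀ ^ 2 * 1 := by rw [mul_one]; gcongr
          _ ≤ _ := by gcongr
      linarith
    have h3 : 0 ≤ 1 / 4 - s ^ 2 := by linarith
    gcongr
    nlinarith
  have h6 : (2 * M₀ + M₀ ^ 2) * n ≤ C₁ * (n * l + n + 1) := by
    have h7 : 0 ≤ 2 * M₀ + M₀ ^ 2 := by positivity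
    calc (2 * M₀ + M₀ ^ 2) * n ≤ C₁ * n := by gcongr; linarith
      _ ≤ _ := by gcongr <;> linarith
  have h9 : c₁ * n ^ 2 ≤ L * s ^ 2 / 2 * n ^ 2 := by gcongr
  nlinarith

set_option maxHeartbeats 1000000 in
theorem card_nontypical_le {β : ℝ} (hβ : 0 < β) (hβ1 : β ≤ 1) : ∃ c : ℝ, 0 < c ∧
    ∀ᶠ n : ℕ in atTop, ∀ 𝒢 : Finset (SimpleGraph (Fin n)),
      (∀ G ∈ 𝒢, ¬ HasC5 G ∧ ∀ S : Finset (Fin n), (S.card : ℝ) ≤ n / 2 + β * n →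
        (n : ℝ) - S.card ≤ n / 2 + β * n → ¬ RL ⌈β * n⌉₊ G S) →
      (𝒢.card : ℝ) ≤ Real.exp (Real.log 2 * n ^ 2 / 4 - c * n ^ 2) := by
  have hL : 0 < Real.log 2 := Real.log_pos (by norm_num)
  have hL1 : Real.log 2 ≤ 1 := by linarith [Real.log_two_lt_d9]
  obtain ⟨γd, hγd, hballd⟩ := exists_ball_le (η := β ^ 2 / 1024) (by positivity)
  obtain ⟨s, hsdef⟩ : ∃ s, s = min (β / 2) (min 1 γd / 16) := ⟨_, rfl⟩
  have hs : 0 < s := by rw [hsdef]; positivity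
  have hsβ : s ≤ β / 2 := by rw [hsdef]; exact min_le_left _ _
  have hs16 : s ≤ min 1 γd / 16 := by rw [hsdef]; exact min_le_right _ _
  have hs1 : s ≤ 1 / 2 := by linarith
  have hs8 : 8 * s ^ 2 ≤ γd / 2 := by
    have := min_le_right 1 γd
    nlinarith
  obtain ⟨γs, hγs, hballs⟩ := exists_ball_le (η := Real.log 2 * s ^ 2 / 2) (by positivity)
  obtain ⟨γ, hγdef⟩ : ∃ γ, γ = min 1 (min γs (γd / 4)) := ⟨_, rfl⟩
  have hγ : 0 < γ := by rw [hγdef]; positivity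
  have hγ1 : γ ≤ 1 := by rw [hγdef]; exact min_le_left _ _
  have hγγs : γ ≤ γs := by rw [hγdef]; exact (min_le_right _ _).trans (min_le_left _ _)
  have hγγd : γ ≤ γd / 4 := by rw [hγdef]; exact (min_le_right _ _).trans (min_le_right _ _)
  obtain ⟨M₀, hM₀⟩ := exists_template hγ hγ1
  obtain ⟨c₁, hc₁def⟩ : ∃ c₁, c₁ = min (Real.log 2 * s ^ 2 / 2) (β ^ 2 / 1024) := ⟨_, rfl⟩
  have hc₁ : 0 < c₁ := by rw [hc₁def]; positivity
  have hc₁s : c₁ ≤ Real.log 2 * s ^ 2 / 2 := by rw [hc₁def]; exact min_le_left _ _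
  have hc₁d : c₁ ≤ β ^ 2 / 1024 := by rw [hc₁def]; exact min_le_right _ _
  obtain ⟨C₁, hC₁⟩ : ∃ C₁ : ℝ, C₁ = 2 * M₀ + M₀ ^ 2 + 22 := ⟨_, rfl⟩
  refine ⟨c₁ / 2, by positivity, ?_⟩
  have hγn : ∀ᶠ n : ℕ in atTop, 1 ≤ γd / 4 * (n : ℝ) ^ 2 := by
    filter_upwards [eventually_nlog_le 1 (c := γd / 4) (by positivity), eventually_ge_atTop 1]
      with n h1 h2
    have : 0 ≤ (n:ℝ) * Real.log n := by positivity
    nlinarith [(Nat.cast_nonneg n : (0:ℝ) ≤ n)]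
  have hMn : ∀ᶠ n : ℕ in atTop, (M₀ : ℝ) ≤ β / 2 * n :=
    (tendsto_natCast_atTop_atTop.const_mul_atTop (by positivity)).eventually_ge_atTop _
  filter_upwards [eventually_ge_atTop M₀, eventually_ge_atTop 3, hγn, hMn,
    eventually_nlog_le (C₁ + (M₀ + 2 * M₀ ^ 2)) (c := c₁ / 2) (by positivity)]
    with n hn0 hn3 hn1 hnM hnlog 𝒢 h𝒢
  have hn : (1:ℝ) ≤ n := by exact_mod_cast (by omega : 1 ≤ n)
  have hlog : 0 ≤ Real.log n := Real.log_nonneg hn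
  have hnl : 0 ≤ n * Real.log n := by positivity
  have key := card_le_of_cover (D := TemplateIdx n M₀)
    (fun d (G : SimpleGraph (Fin n)) => 1 / γ ≤ ((d.1 : ℕ) : ℝ) ∧
      (∀ i, ((Finset.univ.filter fun v => d.2.1 v = i).card : ℝ) ≤ n / (d.1 : ℕ) + 1) ∧
      (∀ i j k, d.2.2.1.Adj i j → d.2.2.1.Adj j k → ¬ d.2.2.1.Adj i k) ∧
      ((mismatch G d.2.1 d.2.2.1 d.2.2.2).card : ℝ) ≤ γ * n ^ 2) 𝒢
    (B := Real.exp (Real.log 2 * n ^ 2 / 4 - c₁ * n ^ 2 + C₁ * (n * Real.log n + n + 1))) ?_ ?_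
  · refine key.trans ((mul_le_mul_of_nonneg_right (card_templateIdx_le n M₀)
      (Real.exp_pos _).le).trans ?_)
    rw [← Real.exp_add]
    apply Real.exp_le_exp.2
    have : (M₀ + 2 * M₀ ^ 2 : ℝ) * (n + 1) ≤ (M₀ + 2 * M₀ ^ 2) * (n * Real.log n + n + 1) := by
      gcongr; linarith
    nlinarith
  · intro G hG
    obtain ⟨M, hM, h1, f, R, τ, h2, h3, h4⟩ := hM₀ n hn0 G (h𝒢 G hG).1
    exact ⟨⟨⟨M, Nat.lt_succ_of_le hM⟩, f, R, τ⟩, h1, h2, h3, h4⟩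
  · rintro ⟨⟨M, hM⟩, f, R, τ⟩ 𝒜 h𝒜 hP
    rcases 𝒜.eq_empty_or_nonempty with rfl | ⟨G₀, hG₀⟩
    · simp [Real.exp_nonneg]
    obtain ⟨hMγ, hf, hR, -⟩ := hP G₀ hG₀
    simp only at hMγ hf hR hP
    have hM1 : (1:ℝ) ≤ M := le_trans (by rw [le_div_iff₀ hγ]; linarith) hMγ
    have hMpos : 0 < M := by exact_mod_cast (by linarith : (0:ℝ) < M)
    have hMM₀ : (M : ℝ) ≤ M₀ := by exact_mod_cast Nat.lt_succ_iff.1 hM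
    have hM₀n : (M₀ : ℝ) ≤ n := by exact_mod_cast hn0
    obtain ⟨q, hq⟩ : ∃ q : ℝ, q = n / M + 1 := ⟨_, rfl⟩
    rw [← hq] at hf
    have hq0 : 0 ≤ q := by rw [hq]; positivity
    have hqM : q * M = n + M := by rw [hq]; field_simp
    have hmis : ∀ G ∈ 𝒜, ((mismatch G f R τ).card : ℝ) ≤ γ * n ^ 2 := fun G hG => (hP G hG).2.2.2
    rcases triangleFree_dichotomy hMpos R hR hs.le with hsp | ⟨A, hA, hy, hA1, hA2⟩
    · have h1 := card_template_sparse (k := ⌊γ * n ^ 2⌋₊) f R τ 𝒜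
        fun G hG => Nat.le_floor (hmis G hG)
      have h2 : ((R.comap f).edgeFinset.card : ℝ) ≤ (1 / 4 - s ^ 2) * (n + M) ^ 2 := by
        have h3 := two_mul_edges_comap f R
        have h4 := sum_comp_le₂ hq0 hf (w := fun i j => if R.Adj i j then (1:ℝ) else 0)
          (fun i j => by split_ifs <;> norm_num)
        have h5 := mul_le_mul_of_nonneg_left hsp (sq_nonneg q)
        have h6 : q ^ 2 * ((1 / 2 - 2 * s ^ 2) * M ^ 2) = (1 / 2 - 2 * s ^ 2) * (n + M) ^ 2 := by
          rw [← hqM]; ring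
        linarith
      have h3 : (ball (n * n) ⌊γ * n ^ 2⌋₊ : ℝ) ≤
          Real.exp (Real.log 2 * s ^ 2 / 2 * (n * n : ℕ)) := by
        refine hballs _ _ ?_
        calc ((⌊γ * n ^ 2⌋₊ : ℕ) : ℝ) ≤ γ * n ^ 2 := Nat.floor_le (by positivity)
          _ ≤ γs * n ^ 2 := by gcongr
          _ = _ := by push_cast; ring
      have h4 : (2:ℝ) ^ (R.comap f).edgeFinset.card =
          Real.exp (Real.log 2 * (R.comap f).edgeFinset.card) := by
        rw [mul_comm (Real.log 2), Real.exp_nat_mul, Real.exp_log (by norm_num)]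
      calc (𝒜.card : ℝ) ≤ ball (n * n) ⌊γ * n ^ 2⌋₊ * 2 ^ (R.comap f).edgeFinset.card := by
            exact_mod_cast h1
        _ ≤ Real.exp (Real.log 2 * s ^ 2 / 2 * (n * n : ℕ)) *
            Real.exp (Real.log 2 * ((1 / 4 - s ^ 2) * (n + M) ^ 2)) := by
            rw [h4]; gcongr
        _ ≤ _ := by
            rw [← Real.exp_add]
            apply Real.exp_le_exp.2
            push_cast
            exact sparse_exponent_le hL1 hs hs1 hn (by linarith) hMM₀ hlog hC₁ hc₁s
    · let b := ⌈β * n⌉₊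
      have hb1 : β * n ≤ b := Nat.le_ceil _
      have hb2 : (b : ℝ) ≤ β * n + 1 := (Nat.ceil_lt_add_one (by positivity)).le
      have h1 := card_template_dense (b := b) (k := ⌊γd * n ^ 2⌋₊) (γ := γ * n ^ 2) (by omega)
        f R τ hq0 hf hA hy ?_ 𝒜 hmis ?_
      · have h3 : (ball (n * n) ⌊γd * n ^ 2⌋₊ : ℝ) ≤
            Real.exp (β ^ 2 / 1024 * (n * n : ℕ)) := by
          refine hballd _ _ ?_
          calc ((⌊γd * n ^ 2⌋₊ : ℕ) : ℝ) ≤ γd * n ^ 2 := Nat.floor_le (by positivity)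
            _ = _ := by push_cast; ring
        have h4 : (n:ℝ) ^ (6 * b) = Real.exp (6 * b * Real.log n) := by
          have : (6 * b * Real.log n : ℝ) = ((6 * b : ℕ) : ℝ) * Real.log n := by push_cast; ring
          rw [this, Real.exp_nat_mul, Real.exp_log (by linarith)]
        have h5 : (8192 : ℝ) ≤ Real.exp 13 := by
          have h6 := Real.add_one_le_exp (1:ℝ)
          calc (8192:ℝ) = 2 ^ 13 := by norm_num
            _ ≤ Real.exp 1 ^ 13 := by gcongr; linarith
            _ = _ := by rw [← Real.exp_nat_mul]; norm_num
        calc (𝒜.card : ℝ) ≤ _ := h1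
          _ ≤ Real.exp (β ^ 2 / 1024 * (n * n : ℕ)) * (Real.exp 13 * Real.exp (6 * b * Real.log n) *
              Real.exp (Real.log 2 * (n ^ 2 / 4)) * Real.exp (-(b : ℝ) ^ 2 / 512)) := by
              rw [h4]; gcongr
          _ ≤ _ := by
              rw [← Real.exp_add, ← Real.exp_add, ← Real.exp_add, ← Real.exp_add]
              apply Real.exp_le_exp.2
              push_cast
              refine dense_exponent_le hβ hβ1 hn hlog hb1 hb2 ?_ hc₁d
              have : (0:ℝ) ≤ 2 * M₀ + M₀ ^ 2 := by positivity
              linarith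
      · have e : q ^ 2 * (2 * s ^ 2 * M ^ 2) = 2 * s ^ 2 * (n + M) ^ 2 := by rw [← hqM]; ring
        rw [e]
        have h2 : 2 * s ^ 2 * (n + M : ℝ) ^ 2 ≤ 2 * s ^ 2 * (2 * n) ^ 2 := by
          gcongr; linarith
        have h3 := Nat.lt_floor_add_one (γd * (n:ℝ) ^ 2)
        have h4 : γ * (n:ℝ) ^ 2 ≤ γd / 4 * n ^ 2 := by gcongr
        have h5 : 8 * s ^ 2 * (n:ℝ) ^ 2 ≤ γd / 2 * n ^ 2 := by gcongr
        linarith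
      · have hbal : (1 / 2 + s) * (n + M : ℝ) ≤ n / 2 + β * n := by
          have : (1 / 2 + s) * (M : ℝ) ≤ 1 * (β / 2 * n) := by gcongr <;> linarith
          nlinarith
        have hc1 : ((Finset.univ.filter fun v => f v ∈ A).card : ℝ) ≤ n / 2 + β * n := by
          have h2 := sum_comp_le hf (w := fun i => if i ∈ A then (1:ℝ) else 0)
            (fun i => by split_ifs <;> norm_num)
          rw [Finset.card_filter]
          push_cast
          refine h2.trans ?_
          simp only [Finset.sum_boole, Finset.filter_mem_eq_inter, Finset.univ_inter]
          nlinarith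
        have hc2 : (n : ℝ) - (Finset.univ.filter fun v => f v ∈ A).card ≤ n / 2 + β * n := by
          have h2 := sum_comp_le hf (w := fun i => if i ∈ A then (0:ℝ) else 1)
            (fun i => by split_ifs <;> norm_num)
          have h3 : ∑ v, (if f v ∈ A then (0:ℝ) else 1) =
              n - (Finset.univ.filter fun v => f v ∈ A).card := by
            rw [Finset.card_filter]
            push_cast
            have : (n:ℝ) = ∑ _v : Fin n, (1:ℝ) := by simp
            rw [this, ← Finset.sum_sub_distrib]
            exact Finset.sum_congr rfl fun v _ => by split_ifs <;> norm_num
          have h4 : ∑ i, (if i ∈ A then (0:ℝ) else 1) = M - A.card := by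
            have : (M:ℝ) = ∑ _v : Fin M, (1:ℝ) := by simp
            rw [this, eq_sub_iff_add_eq]
            have h5 : (A.card : ℝ) = ∑ i, if i ∈ A then (1:ℝ) else 0 := by simp
            rw [h5, ← Finset.sum_add_distrib]
            exact Finset.sum_congr rfl fun v _ => by split_ifs <;> norm_num
          rw [← h3]
          refine h2.trans ?_
          rw [h4]
          nlinarith
        intro G hG
        exact (h𝒢 G (h𝒜 hG)).2 _ hc1 hc2

theorem packing_or_cover {V : Type*} {r : ℕ} (Pr : (Fin r → V) → Prop) (T : Set V) (b : ℕ) :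
    (∃ f : Fin b × Fin r ↪ V, (∀ p, f p ∈ T) ∧ ∀ i, Pr fun p => f (i, p)) ∨
    ∃ Z : Finset V, Z.card ≤ r * b ∧ ∀ x : Fin r → V, Function.Injective x → (∀ p, x p ∈ T) →
      (∀ p, x p ∉ Z) → ¬ Pr x := by
  induction b with
  | zero => exact Or.inl ⟨⟨fun p => p.1.elim0, fun p => p.1.elim0⟩, fun p => p.1.elim0,
      fun i => i.elim0⟩
  | succ b ih =>
    rcases ih with ⟨f, hfT, hfP⟩ | ⟨Z, hZ, h⟩
    · by_cases hx : ∃ x : Fin r → V, Function.Injective x ∧ (∀ p, x p ∈ T) ∧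
          (∀ p, x p ∉ Finset.univ.map f) ∧ Pr x
      · obtain ⟨x, hxi, hxT, hxf, hxP⟩ := hx
        have hxf' : ∀ p q, f q ≠ x p := fun p q h => hxf p (by simp [← h])
        refine Or.inl ⟨⟨fun p => Fin.cases (x p.2) (fun i => f (i, p.2)) p.1, ?_⟩, ?_, ?_⟩
        · rintro ⟨i, p⟩ ⟨j, q⟩
          refine Fin.cases ?_ (fun i => ?_) i <;> refine Fin.cases ?_ (fun j => ?_) j
          · intro h; simpa using hxi h
          · intro h; exact absurd h.symm (hxf' _ _)
          · intro h; exact absurd h (hxf' _ _)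
          · intro h; simpa using f.injective h
        · rintro ⟨i, p⟩
          refine Fin.cases ?_ (fun i => ?_) i
          · exact hxT p
          · exact hfT _
        · intro i
          refine Fin.cases ?_ (fun i => ?_) i
          · exact hxP
          · exact hfP i
      · refine Or.inr ⟨Finset.univ.map f, ?_, fun x h1 h2 h3 h4 => hx ⟨x, h1, h2, h3, h4⟩⟩
        rw [Finset.card_map, Finset.card_univ, Fintype.card_prod, Fintype.card_fin,
          Fintype.card_fin, mul_comm]
        exact Nat.mul_le_mul_left _ (Nat.le_succ _)
    · exact Or.inr ⟨Z, hZ.trans (Nat.mul_le_mul_left _ (Nat.le_succ _)), h⟩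

theorem RL.trichotomy {V : Type*} {b : ℕ} {G : SimpleGraph V} {S : Set V} (h : RL b G S)
    {r s : ℕ} (hr : r ≤ 3) (hs : s ≤ 3) (Pr : (Fin r → V) → Prop) (Pr' : (Fin s → V) → Prop)
    (π : Fin r → Fin s → Bool) :
    (∃ Z : Finset V, Z.card ≤ r * b ∧ ∀ x : Fin r → V, Function.Injective x → (∀ p, x p ∈ S) →
      (∀ p, x p ∉ Z) → ¬ Pr x) ∨
    (∃ Z : Finset V, Z.card ≤ s * b ∧ ∀ x : Fin s → V, Function.Injective x → (∀ p, x p ∉ S) →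
      (∀ p, x p ∉ Z) → ¬ Pr' x) ∨
    ∃ (x : Fin r → V) (y : Fin s → V), (∀ p, x p ∈ S) ∧ (∀ q, y q ∉ S) ∧ Pr x ∧ Pr' y ∧
      ∀ p q, G.Adj (x p) (y q) ↔ π p q = true := by
  rcases packing_or_cover Pr S b with ⟨x, hx, hxP⟩ | h1
  · rcases packing_or_cover Pr' Sᶜ b with ⟨y, hy, hyP⟩ | h2
    · obtain ⟨i, j, hij⟩ := h r hr s hs x y π hx hy
      exact Or.inr (Or.inr ⟨_, _, fun p => hx (i, p), fun q => hy (j, q), hxP i, hyP j, hij⟩)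
    · exact Or.inr (Or.inl h2)
  · exact Or.inl h1

theorem RL.compl {V : Type*} {b : ℕ} {G : SimpleGraph V} {S : Set V} (h : RL b G S) :
    RL b Gᶜ S := by
  intro r hr s hs x y π hx hy
  obtain ⟨i, j, hij⟩ := h r hr s hs x y (fun p q => !π p q) hx hy
  refine ⟨i, j, fun p q => ?_⟩
  have hne : x (i, p) ≠ y (j, q) := fun h => hy (j, q) (h ▸ hx (i, p))
  rw [SimpleGraph.compl_adj, hij p q]
  simp [hne]

theorem RL.swap {V : Type*} {b : ℕ} {G : SimpleGraph V} {S : Set V} (h : RL b G S) :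
    RL b G Sᶜ := by
  intro r hr s hs x y π hx hy
  obtain ⟨i, j, hij⟩ := h s hs r hr y x (fun q p => π p q) (fun q => not_not.1 (hy q)) hx
  exact ⟨j, i, fun p q => by rw [G.adj_comm]; exact hij q p⟩

theorem exists_sub_tuples {V : Type*} {b₀ b r : ℕ} (x : Fin b × Fin r ↪ V) (Z : Finset V)
    (h : Z.card + b₀ ≤ b) : ∃ e : Fin b₀ ↪ Fin b, ∀ i p, x (e i, p) ∉ Z := by
  let B : Finset (Fin b) := Finset.univ.filter fun i => ∃ p, x (i, p) ∈ Z
  have hB : B.card ≤ Z.card := by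
    have : ∀ i : B, ∃ p, x (i.1, p) ∈ Z := fun i => (Finset.mem_filter.1 i.2).2
    choose p hp using this
    have := Fintype.card_le_of_injective (fun i : B => (⟨x (i.1, p i), hp i⟩ : Z)) ?_
    · simpa using this
    · intro i j hij
      have := x.injective (congrArg Subtype.val hij)
      exact Subtype.ext (congrArg Prod.fst this)
  have hc : b₀ ≤ Bᶜ.card := by
    rw [Finset.card_compl, Fintype.card_fin]; omega
  obtain ⟨C, hC, hCc⟩ := Finset.exists_subset_card_eq hc
  let e := C.orderEmbOfFin hCc
  refine ⟨e.toEmbedding, fun i p hi => ?_⟩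
  have h1 : e i ∈ Bᶜ := hC (C.orderEmbOfFin_mem hCc i)
  rw [Finset.mem_compl] at h1
  exact h1 (Finset.mem_filter.2 ⟨Finset.mem_univ _, p, hi⟩)

theorem RL.near {V : Type*} {b₀ b : ℕ} {G : SimpleGraph V} {S S' : Set V} (h : RL b₀ G S)
    (Z : Finset V) (hZ : ∀ v ∉ Z, v ∈ S ↔ v ∈ S') (hb : Z.card + b₀ ≤ b) : RL b G S' := by
  intro r hr s hs x y π hx hy
  obtain ⟨e, he⟩ := exists_sub_tuples x Z hb
  obtain ⟨e', he'⟩ := exists_sub_tuples y Z hb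
  obtain ⟨i, j, hij⟩ := h r hr s hs ((e.prodMap (.refl _)).trans x)
    ((e'.prodMap (.refl _)).trans y) π (fun p => (hZ _ (he _ _)).2 (hx _))
    (fun q hq => hy _ ((hZ _ (he' _ _)).1 hq))
  exact ⟨e i, e' j, hij⟩

def TransOn {V : Type*} (G : SimpleGraph V) (T : Set V) : Prop :=
  ∀ u ∈ T, ∀ v ∈ T, ∀ w ∈ T, G.Adj u v → G.Adj v w → u ≠ w → G.Adj u w

def CliqueOn {V : Type*} (G : SimpleGraph V) (T : Set V) : Prop :=
  ∀ u ∈ T, ∀ v ∈ T, u ≠ v → G.Adj u v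

section
variable {V : Type*} {G : SimpleGraph V} {S T T' : Set V}

theorem TransOn.mono (h : TransOn G T) (hT : T' ⊆ T) : TransOn G T' :=
  fun u hu v hv w hw => h u (hT hu) v (hT hv) w (hT hw)

theorem CliqueOn.mono (h : CliqueOn G T) (hT : T' ⊆ T) : CliqueOn G T' :=
  fun u hu v hv => h u (hT hu) v (hT hv)

theorem cliqueOn_or_of_transOn (h : TransOn G T) (h' : TransOn Gᶜ T) :
    CliqueOn G T ∨ CliqueOn Gᶜ T := by
  by_contra hcon
  push Not at hcon
  simp only [CliqueOn, SimpleGraph.compl_adj] at hcon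
  push Not at hcon
  obtain ⟨⟨a, ha, b, hb, hab, hnab⟩, c, hc, d, hd, hcd, hadj⟩ := hcon
  have hadj := hadj hcd
  have tri : ∀ x ∈ T, ∀ y ∈ T, ∀ z ∈ T, x ≠ z → y ≠ z → x ≠ y → G.Adj x y → G.Adj x z := by
    intro x hx y hy z hz hxz hyz hxy hadj
    by_contra hn
    by_cases hyz' : G.Adj y z
    · exact hn (h x hx y hy z hz hadj hyz' hxz)
    · have := h' x hx z hz y hy (by simpa [hxz] using hn)
        (by rw [SimpleGraph.compl_adj]; exact ⟨hyz.symm, fun h => hyz' h.symm⟩) hxy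
      exact ((SimpleGraph.compl_adj _ _ _).1 this).2 hadj
  have key : ∀ x ∈ T, x ≠ c → G.Adj c x := by
    intro x hx hxc
    by_cases hxd : x = d
    · exact hxd ▸ hadj
    · exact tri c hc d hd x hx hxc.symm (Ne.symm hxd) hcd hadj
  by_cases hac : a = c
  · exact hnab (hac ▸ key b hb (by rw [← hac]; exact hab.symm))
  · by_cases hbc : b = c
    · exact hnab (hbc ▸ (key a ha hac).symm)
    · exact hnab (h a ha c hc b hb (key a ha hac).symm (key b hb hbc) hab)

theorem RL.transOn_or_cliqueOn {b : ℕ} (hRL : RL b G S) (h5 : ¬ HasC5 G) :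
    (∃ Z : Finset V, Z.card ≤ 3 * b ∧ TransOn G (S \ Z)) ∨
    ∃ Z : Finset V, Z.card ≤ 3 * b ∧ CliqueOn Gᶜ (Sᶜ \ Z) := by
  rcases hRL.trichotomy (r := 3) (s := 2) le_rfl (by norm_num)
    (fun x => G.Adj (x 0) (x 1) ∧ G.Adj (x 1) (x 2) ∧ ¬ G.Adj (x 0) (x 2))
    (fun y => G.Adj (y 0) (y 1)) (fun p q => decide ((p = 2 ∧ q = 0) ∨ (p = 0 ∧ q = 1)))
    with ⟨Z, hZ, h⟩ | ⟨Z, hZ, h⟩ | ⟨x, y, hx, hy, ⟨h1, h2, h3⟩, h4, h⟩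
  · refine Or.inl ⟨Z, hZ, fun u hu v hv w hw huv hvw huw => ?_⟩
    by_contra hn
    refine h ![u, v, w] ?_ ?_ ?_ ⟨huv, hvw, hn⟩
    · intro i j hij
      have := huv.ne; have := hvw.ne
      fin_cases i <;> fin_cases j <;> simp_all
    · intro p; fin_cases p; exacts [hu.1, hv.1, hw.1]
    · intro p; fin_cases p; exacts [hu.2, hv.2, hw.2]
  · refine Or.inr ⟨Z, hZ.trans (by omega), fun u hu v hv huv => ?_⟩
    rw [SimpleGraph.compl_adj]
    refine ⟨huv, fun hadj => h ![u, v] ?_ ?_ ?_ hadj⟩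
    · intro i j hij
      fin_cases i <;> fin_cases j <;> simp_all
    · intro p; fin_cases p; exacts [hu.1, hv.1]
    · intro p; fin_cases p; exacts [hu.2, hv.2]
  · refine absurd ⟨x 0, x 1, x 2, y 0, y 1, h1, h2, (h 2 0).2 (by decide), h4,
      ((h 0 1).2 (by decide)).symm, h3, ?_, ?_, ?_, ?_⟩ h5
    · exact fun h' => absurd ((h 0 0).1 h') (by decide)
    · exact fun h' => absurd ((h 1 0).1 h') (by decide)
    · exact fun h' => absurd ((h 1 1).1 h') (by decide)
    · exact fun h' => absurd ((h 2 1).1 h') (by decide)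

/-- The sides of a random-like partition of a `C₅`-free graph are, up to few vertices, a clique
and a disjoint union of cliques, possibly after complementing and exchanging them. -/
theorem exists_core {b : ℕ} (hRL : RL b G S) (h5 : ¬ HasC5 G)
    (hS : ∀ Z : Finset V, Z.card ≤ 6 * b → ∃ u ∈ S \ Z, ∃ v ∈ S \ Z, u ≠ v)
    (hS' : ∀ Z : Finset V, Z.card ≤ 6 * b → ∃ u ∈ Sᶜ \ Z, ∃ v ∈ Sᶜ \ Z, u ≠ v) :
    ∃ H, (H = G ∨ H = Gᶜ) ∧ ∃ S', (S' = S ∨ S' = Sᶜ) ∧ ∃ Z : Finset V, Z.card ≤ 9 * b ∧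
      CliqueOn H (S' \ Z) ∧ TransOn H (S'ᶜ \ Z) := by
  have h5' : ¬ HasC5 Gᶜ := fun h => h5 (hasC5_compl_iff.1 h)
  have main : ∀ (H : SimpleGraph V) (S' : Set V), RL b H S' → ¬ HasC5 H →
      (∀ Z : Finset V, Z.card ≤ 6 * b → ∃ u ∈ S' \ Z, ∃ v ∈ S' \ Z, u ≠ v) →
      (∃ Z : Finset V, Z.card ≤ 3 * b ∧ CliqueOn H (S' \ Z)) →
      ∃ Z : Finset V, Z.card ≤ 9 * b ∧ CliqueOn H (S' \ Z) ∧ TransOn H (S'ᶜ \ Z) := by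
    rintro H S' hRL h5 hbig ⟨Z, hZ, hcl⟩
    rcases hRL.swap.transOn_or_cliqueOn h5 with ⟨Z', hZ', h⟩ | ⟨Z', hZ', h⟩
    · refine ⟨Z ∪ Z', (Finset.card_union_le _ _).trans (by omega), hcl.mono ?_, h.mono ?_⟩ <;>
        · intro v hv; simp_all
    · rw [compl_compl] at h
      obtain ⟨u, hu, v, hv, huv⟩ := hbig (Z ∪ Z') ((Finset.card_union_le _ _).trans (by omega))
      simp only [Finset.coe_union, Set.mem_sdiff, Set.mem_union, not_or] at hu hv
      exact absurd (hcl u ⟨hu.1, hu.2.1⟩ v ⟨hv.1, hv.2.1⟩ huv)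
        ((SimpleGraph.compl_adj _ _ _).1 (h u ⟨hu.1, hu.2.2⟩ v ⟨hv.1, hv.2.2⟩ huv)).2
  by_cases k1 : ∃ Z : Finset V, Z.card ≤ 3 * b ∧ CliqueOn G (S \ Z)
  · exact ⟨G, Or.inl rfl, S, Or.inl rfl, main G S hRL h5 hS k1⟩
  by_cases k2 : ∃ Z : Finset V, Z.card ≤ 3 * b ∧ CliqueOn Gᶜ (S \ Z)
  · exact ⟨Gᶜ, Or.inr rfl, S, Or.inl rfl, main _ _ hRL.compl h5' hS k2⟩
  by_cases k3 : ∃ Z : Finset V, Z.card ≤ 3 * b ∧ CliqueOn G (Sᶜ \ Z)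
  · exact ⟨G, Or.inl rfl, Sᶜ, Or.inr rfl, main _ _ hRL.swap h5 hS' k3⟩
  by_cases k4 : ∃ Z : Finset V, Z.card ≤ 3 * b ∧ CliqueOn Gᶜ (Sᶜ \ Z)
  · exact ⟨Gᶜ, Or.inr rfl, Sᶜ, Or.inr rfl, main _ _ hRL.swap.compl h5' hS' k4⟩
  obtain ⟨Z₁, hZ₁, t1⟩ := (hRL.transOn_or_cliqueOn h5).resolve_right k4
  obtain ⟨Z₂, hZ₂, t2⟩ := (hRL.compl.transOn_or_cliqueOn h5').resolve_right (by simpa using k3)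
  obtain ⟨Z₃, hZ₃, t3⟩ := (hRL.swap.transOn_or_cliqueOn h5).resolve_right (by simpa using k2)
  obtain ⟨Z₄, hZ₄, t4⟩ := (hRL.compl.swap.transOn_or_cliqueOn h5').resolve_right
    (by simpa using k1)
  have hc : (Z₁ ∪ Z₂).card ≤ 6 * b := (Finset.card_union_le _ _).trans (by omega)
  have s1 : S \ ↑(Z₁ ∪ Z₂) ⊆ S \ ↑Z₁ := fun v hv => by simp_all
  have s2 : S \ ↑(Z₁ ∪ Z₂) ⊆ S \ ↑Z₂ := fun v hv => by simp_all
  rcases cliqueOn_or_of_transOn (t1.mono s1) (t2.mono s2) with h | h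
  · refine ⟨G, Or.inl rfl, S, Or.inl rfl, Z₁ ∪ Z₂ ∪ Z₃,
      (Finset.card_union_le _ _).trans (by omega), h.mono ?_, t3.mono ?_⟩ <;>
      · intro v hv; simp_all
  · refine ⟨Gᶜ, Or.inr rfl, S, Or.inl rfl, Z₁ ∪ Z₂ ∪ Z₄,
      (Finset.card_union_le _ _).trans (by omega), h.mono ?_, t4.mono ?_⟩ <;>
      · intro v hv; simp_all

end

/-- A balanced random-like partition `S, Sᶜ` in which `S` is almost homogeneous and every
neighbourhood within its own side is almost trivial or almost another neighbourhood. -/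
structure GS {V : Type*} [Fintype V] (b : ℕ) (c : Bool) (G : SimpleGraph V) (S : Finset V) :
    Prop where
  core : ∃ Z : Finset V, Z.card ≤ b ∧ ∀ u ∈ S, ∀ v ∈ S, u ∉ Z → v ∉ Z → u ≠ v →
    (G.Adj u v ↔ c = true)
  rl : RL b G S
  card_le : 2 * S.card ≤ Fintype.card V + 2 * b
  card_compl_le : 2 * Sᶜ.card ≤ Fintype.card V + 2 * b
  approx : ∀ (x : V) (A : Finset V), A.card ≤ 3 → ∃ E : Finset V, E.card ≤ b ∧ x ∈ E ∧
    ((∃ c' : Bool, ∀ v ∉ E, (v ∈ S ↔ x ∈ S) → (G.Adj x v ↔ c' = true)) ∨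
      ∃ y ∉ A, y ∈ E ∧ ∀ v ∉ E, (v ∈ S ↔ x ∈ S) → (G.Adj x v ↔ G.Adj y v))

section
variable {V : Type*} [Fintype V] {G : SimpleGraph V} {S : Finset V}

theorem GS.compl {b : ℕ} {c : Bool} (h : GS b c G S) : GS b (!c) Gᶜ S where
  core := by
    obtain ⟨Z, hZ, hc⟩ := h.core
    refine ⟨Z, hZ, fun u hu v hv huZ hvZ huv => ?_⟩
    rw [SimpleGraph.compl_adj, hc u hu v hv huZ hvZ huv]
    simp [huv]
  rl := h.rl.compl
  card_le := h.card_le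
  card_compl_le := h.card_compl_le
  approx := by
    intro x A hA
    obtain ⟨E, hE, hx, ⟨c', hc'⟩ | ⟨y, hy, hyE, hy'⟩⟩ := h.approx x A hA
    · refine ⟨E, hE, hx, Or.inl ⟨!c', fun v hv hvx => ?_⟩⟩
      have : x ≠ v := fun h => hv (h ▸ hx)
      rw [SimpleGraph.compl_adj, hc' v hv hvx]
      simp [this]
    · refine ⟨E, hE, hx, Or.inr ⟨y, hy, hyE, fun v hv hvx => ?_⟩⟩
      have h1 : x ≠ v := fun h => hv (h ▸ hx)
      have h2 : y ≠ v := fun h => hv (h ▸ hyE)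
      rw [SimpleGraph.compl_adj, SimpleGraph.compl_adj, hy' v hv hvx]
      simp [h1, h2]

/-- A vertex splitting the clique core meets the other side in (nearly) one block. -/
theorem exists_block_of_split {b : ℕ} {Z : Finset V} (hRL : RL b G S) (h5 : ¬ HasC5 G)
    (hcl : CliqueOn G (S \ Z)) (z : V)
    (h1 : 2 * b + 2 ≤ ((S \ Z).filter fun v => G.Adj z v).card)
    (h0 : 2 * b + 2 ≤ ((S \ Z).filter fun v => ¬ G.Adj z v).card) :
    ∃ Z' : Finset V, Z'.card ≤ 4 * b ∧
      ∀ y, y ∉ S → y ∉ Z → y ∉ Z' → G.Adj z y → ∀ v, v ∉ S → v ∉ Z → v ∉ Z' → v ≠ y →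
        (G.Adj z v ↔ G.Adj y v) := by
  have pick : ∀ (X W : Finset V), 2 * b + 2 ≤ X.card → W.card ≤ 2 * b →
      ∃ u ∈ X, ∃ v ∈ X, u ∉ W ∧ v ∉ W ∧ u ≠ v := by
    intro X W hX hW
    have := Finset.le_card_sdiff W X
    obtain ⟨u, hu, v, hv, huv⟩ := Finset.one_lt_card.1 (by omega : 1 < (X \ W).card)
    rw [Finset.mem_sdiff] at hu hv
    exact ⟨u, hu.1, v, hv.1, hu.2, hv.2, huv⟩
  have inj : ∀ u v : V, u ≠ v → Function.Injective ![u, v] := by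
    intro u v huv i j hij
    fin_cases i <;> fin_cases j <;> simp_all
  obtain ⟨Z₁, hZ₁, hE⟩ : ∃ Z₁ : Finset V, Z₁.card ≤ 2 * b ∧ ∀ y, y ∉ S → y ∉ Z → y ∉ Z₁ →
      G.Adj z y → ∀ v, v ∉ S → v ∉ Z → v ∉ Z₁ → v ≠ y → ¬ G.Adj z v → ¬ G.Adj y v := by
    rcases hRL.trichotomy (r := 2) (s := 2) (by norm_num) (by norm_num)
      (fun x => x 0 ∉ Z ∧ x 1 ∉ Z ∧ G.Adj z (x 0) ∧ ¬ G.Adj z (x 1))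
      (fun y => y 0 ∉ Z ∧ y 1 ∉ Z ∧ G.Adj z (y 0) ∧ ¬ G.Adj z (y 1) ∧ G.Adj (y 0) (y 1))
      (fun p q => decide (p = 1 ∧ q = 1)) with ⟨W, hW, h⟩ | ⟨W, hW, h⟩ |
        ⟨x, y, hx, hy, ⟨x0, x1, hx0, hx1⟩, ⟨y0, y1, hy0, hy1, hy01⟩, h⟩
    · exfalso
      obtain ⟨u, hu, -, -, huW, -, -⟩ := pick _ W h1 hW
      obtain ⟨v, hv, -, -, hvW, -, -⟩ := pick _ W h0 hW
      rw [Finset.mem_filter, Finset.mem_sdiff] at hu hv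
      refine h ![u, v] (inj u v ?_) ?_ ?_ ⟨hu.1.2, hv.1.2, hu.2, hv.2⟩
      · rintro rfl; exact hv.2 hu.2
      · intro p; fin_cases p; exacts [hu.1.1, hv.1.1]
      · intro p; fin_cases p; exacts [huW, hvW]
    · refine ⟨W, hW, fun y hyS hyZ hyW hzy v hvS hvZ hvW hvy hzv hyv => ?_⟩
      refine h ![y, v] (inj y v hvy.symm) ?_ ?_ ⟨hyZ, hvZ, hzy, hzv, hyv⟩
      · intro p; fin_cases p; exacts [hyS, hvS]
      · intro p; fin_cases p; exacts [hyW, hvW]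
    · have hne : x 0 ≠ x 1 := fun h => hx1 (h ▸ hx0)
      refine absurd ⟨z, x 0, x 1, y 1, y 0, hx0, hcl _ ⟨hx 0, x0⟩ _ ⟨hx 1, x1⟩ hne,
        (h 1 1).2 (by decide), hy01.symm, hy0.symm, hx1, hy1, ?_, ?_, ?_⟩ h5
      · exact fun h' => absurd ((h 0 1).1 h') (by decide)
      · exact fun h' => absurd ((h 0 0).1 h') (by decide)
      · exact fun h' => absurd ((h 1 0).1 h') (by decide)
  obtain ⟨Z₂, hZ₂, hN⟩ : ∃ Z₂ : Finset V, Z₂.card ≤ 2 * b ∧ ∀ y, y ∉ S → y ∉ Z → y ∉ Z₂ →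
      G.Adj z y → ∀ v, v ∉ S → v ∉ Z → v ∉ Z₂ → v ≠ y → G.Adj z v → G.Adj y v := by
    rcases hRL.trichotomy (r := 2) (s := 2) (by norm_num) (by norm_num)
      (fun x => x 0 ∉ Z ∧ x 1 ∉ Z ∧ ¬ G.Adj z (x 0) ∧ ¬ G.Adj z (x 1) ∧ x 0 ≠ x 1)
      (fun y => y 0 ∉ Z ∧ y 1 ∉ Z ∧ G.Adj z (y 0) ∧ G.Adj z (y 1) ∧ ¬ G.Adj (y 0) (y 1))
      (fun p q => decide (p = q)) with ⟨W, hW, h⟩ | ⟨W, hW, h⟩ |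
        ⟨x, y, hx, hy, ⟨x0, x1, hx0, hx1, hne⟩, ⟨y0, y1, hy0, hy1, hy01⟩, h⟩
    · exfalso
      obtain ⟨u, hu, v, hv, huW, hvW, huv⟩ := pick _ W h0 hW
      rw [Finset.mem_filter, Finset.mem_sdiff] at hu hv
      refine h ![u, v] (inj u v huv) ?_ ?_ ⟨hu.1.2, hv.1.2, hu.2, hv.2, huv⟩
      · intro p; fin_cases p; exacts [hu.1.1, hv.1.1]
      · intro p; fin_cases p; exacts [huW, hvW]
    · refine ⟨W, hW, fun y hyS hyZ hyW hzy v hvS hvZ hvW hvy hzv => ?_⟩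
      by_contra hyv
      refine h ![y, v] (inj y v hvy.symm) ?_ ?_ ⟨hyZ, hvZ, hzy, hzv, hyv⟩
      · intro p; fin_cases p; exacts [hyS, hvS]
      · intro p; fin_cases p; exacts [hyW, hvW]
    · refine absurd ⟨z, y 0, x 0, x 1, y 1, hy0, ((h 0 0).2 (by decide)).symm,
        hcl _ ⟨hx 0, x0⟩ _ ⟨hx 1, x1⟩ hne, (h 1 1).2 (by decide), hy1.symm, hx0, hx1, ?_, hy01,
        ?_⟩ h5
      · exact fun h' => absurd ((h 1 0).1 h'.symm) (by decide)
      · exact fun h' => absurd ((h 0 1).1 h') (by decide)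
  refine ⟨Z₁ ∪ Z₂, (Finset.card_union_le _ _).trans (by omega), ?_⟩
  intro y hyS hyZ hyW hzy v hvS hvZ hvW hvy
  simp only [Finset.mem_union, not_or] at hyW hvW
  constructor
  · exact hN y hyS hyZ hyW.2 hzy v hvS hvZ hvW.2 hvy
  · intro hyv
    by_contra hzv
    exact hE y hyS hyZ hyW.1 hzy v hvS hvZ hvW.1 hvy hzv hyv

theorem exists_GS_of_core {b : ℕ} (hb : 1 ≤ b) {Z : Finset V} (hZ : Z.card ≤ 9 * b)
    (hRL : RL b G S) (h5 : ¬ HasC5 G) (hcl : CliqueOn G (S \ Z)) (htr : TransOn G (Sᶜ \ Z))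
    (hc : 2 * S.card ≤ Fintype.card V + 2 * b) (hc' : 2 * Sᶜ.card ≤ Fintype.card V + 2 * b) :
    ∃ S' : Finset V, GS (30 * b) true G S' := by
  let split : V → Prop := fun z => 2 * b + 2 ≤ ((S \ Z).filter fun v => G.Adj z v).card ∧
    2 * b + 2 ≤ ((S \ Z).filter fun v => ¬ G.Adj z v).card
  let S' : Finset V := Finset.univ.filter fun v => if v ∈ Z then ¬ split v else v ∈ S
  have hS' : ∀ v, v ∈ S' ↔ if v ∈ Z then ¬ split v else v ∈ S := fun v => by simp [S']
  have hnear : ∀ v ∉ Z, (v ∈ S ↔ v ∈ S') := fun v hv => by rw [hS', if_neg hv]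
  refine ⟨S', ⟨Z, by omega, ?_⟩, hRL.near Z hnear (by omega), ?_, ?_, ?_⟩
  · intro u hu v hv huZ hvZ huv
    exact ⟨fun _ => rfl, fun _ => hcl u ⟨(hnear u huZ).2 hu, huZ⟩ v ⟨(hnear v hvZ).2 hv, hvZ⟩ huv⟩
  · have : S' ⊆ S ∪ Z := fun v hv => by
      rw [Finset.mem_union]
      by_cases h : v ∈ Z
      · exact Or.inr h
      · exact Or.inl ((hnear v h).2 hv)
    have := (Finset.card_le_card this).trans (Finset.card_union_le _ _)
    omega
  · have : S'ᶜ ⊆ Sᶜ ∪ Z := fun v hv => by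
      rw [Finset.mem_union]
      by_cases h : v ∈ Z
      · exact Or.inr h
      · rw [Finset.mem_compl] at hv ⊢
        exact Or.inl fun h' => hv ((hnear v h).1 h')
    have := (Finset.card_le_card this).trans (Finset.card_union_le _ _)
    omega
  intro x A hA
  by_cases hxZ : x ∈ Z
  · by_cases hsp : split x
    · obtain ⟨Z', hZ', h⟩ := exists_block_of_split hRL h5 hcl x hsp.1 hsp.2
      have hxS' : x ∉ S' := by rw [hS', if_pos hxZ]; exact not_not.2 hsp
      by_cases hy : ∃ y, y ∉ S ∧ y ∉ Z ∧ y ∉ Z' ∧ y ∉ A ∧ G.Adj x y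
      · obtain ⟨y, hyS, hyZ, hyZ', hyA, hxy⟩ := hy
        refine ⟨insert y (Z ∪ Z'), ?_, by simp [hxZ], Or.inr ⟨y, hyA, by simp, ?_⟩⟩
        · have := Finset.card_insert_le y (Z ∪ Z')
          have := Finset.card_union_le Z Z'
          omega
        · intro v hv hvx
          simp only [Finset.mem_insert, Finset.mem_union, not_or] at hv
          refine h y hyS hyZ hyZ' hxy v ?_ hv.2.1 hv.2.2 hv.1
          rw [hnear v hv.2.1, hvx]; exact hxS'
      · refine ⟨Z ∪ Z' ∪ A, ?_, by simp [hxZ], Or.inl ⟨false, fun v hv hvx => ?_⟩⟩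
        · have := Finset.card_union_le (Z ∪ Z') A
          have := Finset.card_union_le Z Z'
          omega
        · simp only [Finset.mem_union, not_or] at hv
          refine ⟨fun hxv => absurd ⟨v, ?_, hv.1.1, hv.1.2, hv.2, hxv⟩ hy, fun h => by simp at h⟩
          rw [hnear v hv.1.1, hvx]; exact hxS'
    · have hxS' : x ∈ S' := by rw [hS', if_pos hxZ]; exact hsp
      simp only [split, not_and_or, not_le] at hsp
      rcases hsp with hsp | hsp
      · refine ⟨Z ∪ (S \ Z).filter (fun v => G.Adj x v), ?_, by simp [hxZ],
          Or.inl ⟨false, fun v hv hvx => ?_⟩⟩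
        · have := Finset.card_union_le Z ((S \ Z).filter (fun v => G.Adj x v))
          omega
        · rw [Finset.mem_union, not_or] at hv
          refine ⟨fun hxv => absurd (Finset.mem_filter.2 ⟨Finset.mem_sdiff.2 ⟨?_, hv.1⟩, hxv⟩) hv.2,
            fun h => by simp at h⟩
          rw [hnear v hv.1, hvx]; exact hxS'
      · refine ⟨Z ∪ (S \ Z).filter (fun v => ¬ G.Adj x v), ?_, by simp [hxZ],
          Or.inl ⟨true, fun v hv hvx => ?_⟩⟩
        · have := Finset.card_union_le Z ((S \ Z).filter (fun v => ¬ G.Adj x v))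
          omega
        · rw [Finset.mem_union, not_or] at hv
          refine ⟨fun _ => rfl, fun _ => ?_⟩
          by_contra hxv
          refine absurd (Finset.mem_filter.2 ⟨Finset.mem_sdiff.2 ⟨?_, hv.1⟩, hxv⟩) hv.2
          rw [hnear v hv.1, hvx]; exact hxS'
  · by_cases hxS : x ∈ S
    · refine ⟨insert x Z, ?_, by simp, Or.inl ⟨true, fun v hv hvx => ⟨fun _ => rfl, fun _ => ?_⟩⟩⟩
      · have := Finset.card_insert_le x Z
        omega
      · simp only [Finset.mem_insert, not_or] at hv
        refine hcl x ⟨hxS, hxZ⟩ v ⟨?_, hv.2⟩ (Ne.symm hv.1)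
        exact (hnear v hv.2).2 (hvx.2 ((hnear x hxZ).1 hxS))
    · have hside : ∀ v ∉ Z, (v ∈ S' ↔ x ∈ S') → v ∈ ((Sᶜ : Set V) \ Z) := fun v hv hvx =>
        ⟨fun h => hxS ((hnear x hxZ).2 (hvx.1 ((hnear v hv).1 h))), hv⟩
      have hxm : x ∈ ((Sᶜ : Set V) \ Z) := ⟨hxS, hxZ⟩
      by_cases hy : ∃ y, y ∉ S ∧ y ∉ Z ∧ y ∉ A ∧ G.Adj x y
      · obtain ⟨y, hyS, hyZ, hyA, hxy⟩ := hy
        have hym : y ∈ ((Sᶜ : Set V) \ Z) := ⟨hyS, hyZ⟩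
        refine ⟨insert x (insert y Z), ?_, by simp, Or.inr ⟨y, hyA, by simp, fun v hv hvx => ?_⟩⟩
        · have := Finset.card_insert_le x (insert y Z)
          have := Finset.card_insert_le y Z
          omega
        · simp only [Finset.mem_insert, not_or] at hv
          have hvm := hside v hv.2.2 hvx
          exact ⟨fun h => htr y hym x hxm v hvm hxy.symm h (Ne.symm hv.2.1),
            fun h => htr x hxm y hym v hvm hxy h (Ne.symm hv.1)⟩
      · refine ⟨insert x (Z ∪ A), ?_, by simp, Or.inl ⟨false, fun v hv hvx => ?_⟩⟩
        · have := Finset.card_insert_le x (Z ∪ A)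
          have := Finset.card_union_le Z A
          omega
        · simp only [Finset.mem_insert, Finset.mem_union, not_or] at hv
          have hvm := hside v hv.2.1 hvx
          exact ⟨fun h => absurd ⟨v, hvm.1, hv.2.1, hv.2.2, h⟩ hy, fun h => by simp at h⟩

/-- Structure theorem for typical `C₅`-free graphs. -/
theorem exists_GS {b : ℕ} (hb : 1 ≤ b) (hRL : RL b G S) (h5 : ¬ HasC5 G)
    (hc : 2 * S.card ≤ Fintype.card V + 2 * b) (hc' : 2 * Sᶜ.card ≤ Fintype.card V + 2 * b)
    (hbig : 18 * b ≤ Fintype.card V) :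
    ∃ H, (H = G ∨ H = Gᶜ) ∧ ∃ S' : Finset V, GS (30 * b) true H S' := by
  have hsum := Finset.card_add_card_compl S
  have hpick : ∀ T : Finset V, 6 * b + 1 < T.card → ∀ Z : Finset V, Z.card ≤ 6 * b →
      ∃ u ∈ (T : Set V) \ Z, ∃ v ∈ (T : Set V) \ Z, u ≠ v := by
    intro T hT Z hZ
    have := Finset.le_card_sdiff Z T
    obtain ⟨u, hu, v, hv, huv⟩ := Finset.one_lt_card.1 (by omega : 1 < (T \ Z).card)
    rw [Finset.mem_sdiff] at hu hv
    exact ⟨u, hu, v, hv, huv⟩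
  obtain ⟨H, hH, S', hS', Z, hZ, hcl, htr⟩ := exists_core hRL h5 (hpick S (by omega))
    (by rw [← Finset.coe_compl]; exact hpick Sᶜ (by omega))
  have h5H : ¬ HasC5 H := by
    rcases hH with rfl | rfl
    · exact h5
    · exact fun h => h5 (hasC5_compl_iff.1 h)
  have hRLH : RL b H S := by
    rcases hH with rfl | rfl
    · exact hRL
    · exact hRL.compl
  refine ⟨H, hH, ?_⟩
  rcases hS' with rfl | rfl
  · exact exists_GS_of_core hb hZ hRLH h5H hcl htr hc hc'
  · refine exists_GS_of_core (S := Sᶜ) hb hZ ?_ h5H ?_ ?_ hc' (by rwa [compl_compl])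
    · rw [Finset.coe_compl]; exact hRLH.swap
    · rw [Finset.coe_compl]; exact hcl
    · rw [Finset.coe_compl]; exact htr

end

/-- The number of graphs on `n` vertices without induced five-cycles. -/
def c5FreeCount (n : ℕ) : ℕ :=
  (Finset.univ.filter fun G : SimpleGraph (Fin n) => ¬ HasC5 G).card

theorem HasC5.of_comap {V W : Type*} {G : SimpleGraph V} (e : W → V) (h : HasC5 (G.comap e)) :
    HasC5 G := by
  obtain ⟨a, b, c, d, f, h⟩ := h
  exact ⟨e a, e b, e c, e d, e f, h⟩

theorem card_symmDiff_le {V : Type*} [Fintype V] {b k : ℕ} {S T : Finset V}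
    (h1 : 2 * S.card ≤ Fintype.card V + 2 * b) (h2 : 2 * Tᶜ.card ≤ Fintype.card V + 2 * b)
    (h : (T \ S).card ≤ k) : (symmDiff S T).card ≤ 2 * b + 2 * k := by
  have h3 := Finset.card_add_card_compl T
  have h4 := Finset.card_sdiff_add_card_inter S T
  have h5 := Finset.card_sdiff_add_card_inter T S
  rw [Finset.inter_comm] at h5
  have h6 : (symmDiff S T).card ≤ (S \ T).card + (T \ S).card := by
    rw [symmDiff_def]; exact Finset.card_union_le _ _
  omega

theorem GS.sides_close {V : Type*} [Fintype V] {b : ℕ} {c : Bool} {G₁ G₂ : SimpleGraph V}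
    {S₁ S₂ : Finset V} (h₁ : GS b c G₁ S₁) (h₂ : GS b c G₂ S₂) {A : Finset V} (hA : A.card ≤ 3)
    (hG : ∀ u ∉ A, ∀ v ∉ A, (G₁.Adj u v ↔ G₂.Adj u v)) :
    (symmDiff S₁ S₂).card ≤ 6 * b + 6 ∨ (symmDiff S₁ᶜ S₂).card ≤ 6 * b + 6 := by
  obtain ⟨Z, hZ, hc⟩ := h₂.core
  have hb : ∀ W : Finset V, W.card ≤ 1 * b → ((W ∪ Z) ∪ A).card ≤ 2 * b + 3 := fun W hW => by
    have := Finset.card_union_le (W ∪ Z) A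
    have := Finset.card_union_le W Z
    omega
  rcases h₁.rl.trichotomy (r := 1) (s := 1) (by norm_num) (by norm_num)
    (fun x => x 0 ∈ S₂ ∧ x 0 ∉ Z ∧ x 0 ∉ A) (fun x => x 0 ∈ S₂ ∧ x 0 ∉ Z ∧ x 0 ∉ A)
    (fun _ _ => !c) with ⟨W, hW, h⟩ | ⟨W, hW, h⟩ | ⟨x, y, hx, hy, ⟨x1, x2, x3⟩, ⟨y1, y2, y3⟩, h⟩
  · right
    have : (symmDiff S₁ᶜ S₂).card ≤ 2 * b + 2 * (2 * b + 3) := by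
      refine card_symmDiff_le h₁.card_compl_le h₂.card_compl_le
        ((Finset.card_le_card fun v hv => ?_).trans (hb W hW))
      simp only [Finset.mem_sdiff, Finset.mem_compl, not_not] at hv
      by_contra hcon
      simp only [Finset.mem_union, not_or] at hcon
      exact h (fun _ => v) (fun i j _ => Subsingleton.elim _ _) (fun _ => hv.2)
        (fun _ => hcon.1.1) ⟨hv.1, hcon.1.2, hcon.2⟩
    omega
  · left
    have : (symmDiff S₁ S₂).card ≤ 2 * b + 2 * (2 * b + 3) := by
      refine card_symmDiff_le h₁.card_le h₂.card_compl_le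
        ((Finset.card_le_card fun v hv => ?_).trans (hb W hW))
      simp only [Finset.mem_sdiff] at hv
      by_contra hcon
      simp only [Finset.mem_union, not_or] at hcon
      exact h (fun _ => v) (fun i j _ => Subsingleton.elim _ _) (fun _ => hv.2)
        (fun _ => hcon.1.1) ⟨hv.1, hcon.1.2, hcon.2⟩
    omega
  · exfalso
    have hne : x 0 ≠ y 0 := fun h' => hy 0 (h' ▸ hx 0)
    have h6 := h 0 0
    rw [hG _ x3 _ y3, hc _ x1 _ y1 x2 y2 hne] at h6
    cases c <;> simp at h6

/-- An induced path `p` inside one side (`t`) of `S` and a matching `m` inside the other side. -/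
structure PathMatching {n : ℕ} (q : ℕ) (G : SimpleGraph (Fin n)) (S : Finset (Fin n))
    (p : Fin 3 ↪ Fin n) (t : Bool) : Prop where
  path : G.Adj (p 0) (p 1) ∧ G.Adj (p 1) (p 2) ∧ ¬ G.Adj (p 0) (p 2)
  side : ∀ i, p i ∈ S ↔ t = true
  matching : ∃ m : Fin q × Fin 2 ↪ Fin n, (∀ x, ¬ (m x ∈ S ↔ t = true)) ∧
    ∀ i, G.Adj (m (i, 0)) (m (i, 1))

theorem card_pathMatching_fixed_nbr_le {n q : ℕ} {p : Fin 3 ↪ Fin n} {t : Bool}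
    {S : Finset (Fin n)} (𝒢 : Finset (SimpleGraph (Fin n)))
    (h𝒢 : ∀ G ∈ 𝒢, ¬ HasC5 G ∧ PathMatching q G S p t)
    (hout : ∀ G ∈ 𝒢, ∀ G' ∈ 𝒢, ∀ u ∉ Finset.univ.map p, ∀ v ∉ Finset.univ.map p,
      (G.Adj u v ↔ G'.Adj u v))
    (hin : ∀ G ∈ 𝒢, ∀ G' ∈ 𝒢, ∀ i, ∀ v ∉ Finset.univ.map p, (v ∈ S ↔ t = true) →
      (G.Adj (p i) v ↔ G'.Adj (p i) v)) :
    (𝒢.card : ℝ) ≤ 2 ^ (3 * (Finset.univ.filter fun v => ¬ (v ∈ S ↔ t = true)).card) *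
      Real.exp (-(q : ℝ) / 64) := by
  rcases 𝒢.eq_empty_or_nonempty with rfl | ⟨G₀, hG₀⟩
  · simp only [Finset.card_empty, Nat.cast_zero]; positivity
  obtain ⟨m, hm, hm₀⟩ := (h𝒢 G₀ hG₀).2.matching
  have hm' : ∀ x, m x ∉ Finset.univ.map p := by
    intro x hx
    obtain ⟨i, -, hi⟩ := Finset.mem_map.1 hx
    exact hm x (hi ▸ (h𝒢 G₀ hG₀).2.side i)
  have hmadj : ∀ G ∈ 𝒢, ∀ i, G.Adj (m (i, 0)) (m (i, 1)) := by
    intro G hG i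
    exact (hout G hG G₀ hG₀ _ (hm' _) _ (hm' _)).2 (hm₀ i)
  let E := Fin 3 × {v : Fin n // ¬ (v ∈ S ↔ t = true)}
  let e : Fin q × (Fin 3 × Fin 2) ↪ E :=
    ⟨fun x => (x.2.1, ⟨m (x.1, x.2.2), hm _⟩), by
      rintro ⟨j, i, s⟩ ⟨j', i', s'⟩ h
      obtain ⟨h1, h2⟩ := Prod.ext_iff.1 h
      have h3 := Prod.ext_iff.1 (m.injective (congrArg Subtype.val h2))
      exact Prod.ext h3.1 (Prod.ext h1 h3.2)⟩
  let g : SimpleGraph (Fin n) → E → Bool := fun G x => decide (G.Adj (p x.1) x.2.1)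
  have hinj : Set.InjOn g 𝒢 := by
    intro G hG G' hG' heq
    have hT : ∀ i, ∀ v ∉ Finset.univ.map p, (G.Adj (p i) v ↔ G'.Adj (p i) v) := by
      intro i v hv
      by_cases hvt : v ∈ S ↔ t = true
      · exact hin G hG G' hG' i v hv hvt
      · simpa [g] using congrFun heq (i, ⟨v, hvt⟩)
    have hA : ∀ i j, (G.Adj (p i) (p j) ↔ G'.Adj (p i) (p j)) := by
      obtain ⟨h1, h2, h3⟩ := (h𝒢 G hG).2.path
      obtain ⟨h1', h2', h3'⟩ := (h𝒢 G' hG').2.path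
      have h4 := mt SimpleGraph.Adj.symm h3
      have h4' := mt SimpleGraph.Adj.symm h3'
      intro i j
      fin_cases i <;> fin_cases j <;> simp [h1, h2, h3, h1', h2', h3', h4, h4', h1.symm, h2.symm,
        h1'.symm, h2'.symm]
    ext u v
    by_cases hu : u ∈ Finset.univ.map p <;> by_cases hv : v ∈ Finset.univ.map p
    · obtain ⟨i, -, rfl⟩ := Finset.mem_map.1 hu
      obtain ⟨j, -, rfl⟩ := Finset.mem_map.1 hv
      exact hA i j
    · obtain ⟨i, -, rfl⟩ := Finset.mem_map.1 hu
      exact hT i v hv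
    · obtain ⟨j, -, rfl⟩ := Finset.mem_map.1 hv
      rw [G.adj_comm, G'.adj_comm]
      exact hT j u hu
    · exact hout G hG G' hG' u hu v hv
  rw [← Finset.card_image_of_injOn hinj]
  have key := card_avoid_le e
    (fun _ k => decide ((k.1 = 2 ∧ k.2 = 0) ∨ (k.1 = 0 ∧ k.2 = 1))) (𝒢.image g) ?_
  · refine key.trans (le_of_eq ?_)
    congr 1
    · congr 1
      simp only [E, Fintype.card_prod, Fintype.card_fin]
      rw [Fintype.card_subtype]
    · norm_num
  · intro g' hg' j
    obtain ⟨G, hG, rfl⟩ := Finset.mem_image.1 hg'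
    by_contra hcon
    push Not at hcon
    have hp : ∀ i s, (G.Adj (p i) (m (j, s)) ↔ (i = 2 ∧ s = 0) ∨ (i = 0 ∧ s = 1)) := by
      intro i s
      have := hcon (i, s)
      simp only [g, e, Function.Embedding.coeFn_mk] at this
      rw [← decide_eq_decide]; exact this
    obtain ⟨h1, h2, h3⟩ := (h𝒢 G hG).2.path
    refine (h𝒢 G hG).1 ⟨p 0, p 1, p 2, m (j, 0), m (j, 1), h1, h2, (hp 2 0).2 (by simp),
      hmadj G hG j, ((hp 0 1).2 (by simp)).symm, h3, ?_, ?_, ?_, ?_⟩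
    · rw [hp]; decide
    · rw [hp]; decide
    · rw [hp]; decide
    · rw [hp]; decide

theorem card_subtype_card_le (n k : ℕ) :
    Fintype.card {D : Finset (Fin n) // D.card ≤ k} = ball n k := by
  rw [Fintype.card_subtype]; rfl

theorem card_pathMatching_fixed_side_le {n q b : ℕ} {c : Bool} {p : Fin 3 ↪ Fin n} {t : Bool}
    {S : Finset (Fin n)} (𝒢 : Finset (SimpleGraph (Fin n)))
    (h𝒢 : ∀ G ∈ 𝒢, ¬ HasC5 G ∧ GS b c G S ∧ PathMatching q G S p t)
    (hout : ∀ G ∈ 𝒢, ∀ G' ∈ 𝒢, ∀ u ∉ Finset.univ.map p, ∀ v ∉ Finset.univ.map p,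
      (G.Adj u v ↔ G'.Adj u v)) :
    (𝒢.card : ℝ) ≤ ((n + 2) * ball n b) ^ 3 * (Real.exp (Real.log 2 * (3 / 2 * (n + 2 * b))) *
      Real.exp (-(q : ℝ) / 64)) := by
  rcases 𝒢.eq_empty_or_nonempty with rfl | ⟨G₀, hG₀⟩
  · simp only [Finset.card_empty, Nat.cast_zero]; positivity
  let base : Bool ⊕ Fin n → Fin n → Prop := fun d v =>
    match d with
    | Sum.inl c' => c' = true
    | Sum.inr y => G₀.Adj y v
  let P : (Fin 3 → (Bool ⊕ Fin n) × {D : Finset (Fin n) // D.card ≤ b}) →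
      SimpleGraph (Fin n) → Prop := fun d G => ∀ i, ∀ v ∉ Finset.univ.map p, (v ∈ S ↔ t = true) →
      (v ∈ (d i).2.1 ↔ ¬ (G.Adj (p i) v ↔ base (d i).1 v))
  have hcard : (Fintype.card (Fin 3 → (Bool ⊕ Fin n) × {D : Finset (Fin n) // D.card ≤ b}) : ℝ) =
      ((n + 2) * ball n b) ^ 3 := by
    rw [Fintype.card_fun, Fintype.card_prod, card_subtype_card_le]
    simp [add_comm]
  rw [← hcard]
  refine card_le_of_cover P 𝒢 (fun G hG => ?_) (fun d 𝒢' h𝒢' hP => ?_)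
  · have key : ∀ i, ∃ d : (Bool ⊕ Fin n) × {D : Finset (Fin n) // D.card ≤ b},
        ∀ v ∉ Finset.univ.map p, (v ∈ S ↔ t = true) →
          (v ∈ d.2.1 ↔ ¬ (G.Adj (p i) v ↔ base d.1 v)) := by
      intro i
      have hex : ∃ d : Bool ⊕ Fin n, ∃ E : Finset (Fin n), E.card ≤ b ∧
          ∀ v ∉ Finset.univ.map p, v ∉ E → (v ∈ S ↔ t = true) → (G.Adj (p i) v ↔ base d v) := by
        have hs := (h𝒢 G hG).2.2.side i
        obtain ⟨E, hE, -, ⟨c', hc'⟩ | ⟨y, hy, -, hy'⟩⟩ :=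
          (h𝒢 G hG).2.1.approx (p i) (Finset.univ.map p) (by simp)
        · exact ⟨Sum.inl c', E, hE, fun v _ hvE hv => hc' v hvE (hv.trans hs.symm)⟩
        · exact ⟨Sum.inr y, E, hE, fun v hvp hvE hv =>
            (hy' v hvE (hv.trans hs.symm)).trans (hout G hG G₀ hG₀ y hy v hvp)⟩
      obtain ⟨d, E, hE, h⟩ := hex
      refine ⟨(d, ⟨E.filter fun v => ¬ (G.Adj (p i) v ↔ base d v),
        (Finset.card_filter_le _ _).trans hE⟩), fun v hv hvt => ?_⟩
      simp only [Finset.mem_filter]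
      exact ⟨fun h => h.2, fun h' => ⟨by_contra fun hvE => h' (h v hv hvE hvt), h'⟩⟩
    choose d hd using key
    exact ⟨d, hd⟩
  · refine (card_pathMatching_fixed_nbr_le 𝒢' (fun G hG => ⟨(h𝒢 G (h𝒢' hG)).1,
      (h𝒢 G (h𝒢' hG)).2.2⟩) (fun G hG G' hG' => hout G (h𝒢' hG) G' (h𝒢' hG')) ?_).trans ?_
    · intro G hG G' hG' i v hv hvt
      have h1 := hP G hG i v hv hvt
      have h2 := hP G' hG' i v hv hvt
      tauto
    · refine mul_le_mul_of_nonneg_right ?_ (Real.exp_pos _).le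
      have hle : 2 * (Finset.univ.filter fun v => ¬ (v ∈ S ↔ t = true)).card ≤ n + 2 * b := by
        cases t
        · have := (h𝒢 G₀ hG₀).2.1.card_le
          simpa using this
        · have := (h𝒢 G₀ hG₀).2.1.card_compl_le
          simp only [Fintype.card_fin] at this
          convert this using 3
          ext v; simp
      have hle' : (2 : ℝ) * (Finset.univ.filter fun v => ¬ (v ∈ S ↔ t = true)).card ≤ n + 2 * b := by
        exact_mod_cast hle
      have h2 : (2 : ℝ) = Real.exp (Real.log 2) := (Real.exp_log two_pos).symm
      conv_lhs => rw [h2]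
      rw [← Real.exp_nat_mul, Real.exp_le_exp, mul_comm]
      refine mul_le_mul_of_nonneg_left ?_ (Real.log_pos one_lt_two).le
      push_cast
      linarith

theorem card_pathMatching_fixed_rest_le {n q b : ℕ} {c : Bool} {p : Fin 3 ↪ Fin n} {t : Bool}
    (𝒢 : Finset (SimpleGraph (Fin n)))
    (h𝒢 : ∀ G ∈ 𝒢, ¬ HasC5 G ∧ ∃ S, GS b c G S ∧ PathMatching q G S p t)
    (hout : ∀ G ∈ 𝒢, ∀ G' ∈ 𝒢, ∀ u ∉ Finset.univ.map p, ∀ v ∉ Finset.univ.map p,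
      (G.Adj u v ↔ G'.Adj u v)) :
    (𝒢.card : ℝ) ≤ (2 * ball n (6 * b + 6)) * (((n + 2) * ball n b) ^ 3 *
      (Real.exp (Real.log 2 * (3 / 2 * (n + 2 * b))) * Real.exp (-(q : ℝ) / 64))) := by
  rcases 𝒢.eq_empty_or_nonempty with rfl | ⟨G₀, hG₀⟩
  · simp only [Finset.card_empty, Nat.cast_zero]; positivity
  obtain ⟨S₀, hS₀, -⟩ := (h𝒢 G₀ hG₀).2
  let f : Bool × {D : Finset (Fin n) // D.card ≤ 6 * b + 6} → Finset (Fin n) := fun d =>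
    Finset.univ.filter fun v => ¬ ((v ∈ S₀ ↔ d.1 = true) ↔ v ∈ d.2.1)
  have hcard : (Fintype.card (Bool × {D : Finset (Fin n) // D.card ≤ 6 * b + 6}) : ℝ) =
      2 * ball n (6 * b + 6) := by
    rw [Fintype.card_prod, card_subtype_card_le]; simp
  rw [← hcard]
  refine card_le_of_cover (fun d G => GS b c G (f d) ∧ PathMatching q G (f d) p t) 𝒢
    (fun G hG => ?_) (fun d 𝒢' h𝒢' hP => ?_)
  · obtain ⟨S, hS, hP⟩ := (h𝒢 G hG).2
    rcases hS₀.sides_close hS (A := Finset.univ.map p) (by simp) (hout G₀ hG₀ G hG) with h | h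
    · have hf : f (true, ⟨_, h⟩) = S := by
        ext v
        simp only [f, Finset.mem_filter, Finset.mem_univ, Finset.mem_symmDiff]
        tauto
      exact ⟨(true, ⟨_, h⟩), by rwa [hf], by rwa [hf]⟩
    · have hf : f (false, ⟨_, h⟩) = S := by
        ext v
        simp only [f, Finset.mem_filter, Finset.mem_univ, Finset.mem_symmDiff, Finset.mem_compl,
          Bool.false_eq_true, iff_false]
        tauto
      exact ⟨(false, ⟨_, h⟩), by rwa [hf], by rwa [hf]⟩
  · exact card_pathMatching_fixed_side_le 𝒢' (fun G hG => ⟨(h𝒢 G (h𝒢' hG)).1, hP G hG⟩)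
      (fun G hG G' hG' => hout G (h𝒢' hG) G' (h𝒢' hG'))

theorem card_pathMatching_le {n q b : ℕ} {c : Bool} (𝒢 : Finset (SimpleGraph (Fin n)))
    (h𝒢 : ∀ G ∈ 𝒢, ¬ HasC5 G ∧ ∃ S, GS b c G S ∧ ∃ p t, PathMatching q G S p t) :
    (𝒢.card : ℝ) ≤ (2 * n ^ 3) * (c5FreeCount (n - 3) * ((2 * ball n (6 * b + 6)) *
      (((n + 2) * ball n b) ^ 3 *
      (Real.exp (Real.log 2 * (3 / 2 * (n + 2 * b))) * Real.exp (-(q : ℝ) / 64))))) := by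
  have hcard : (Fintype.card ((Fin 3 ↪ Fin n) × Bool) : ℝ) ≤ 2 * n ^ 3 := by
    have : Fintype.card (Fin 3 ↪ Fin n) ≤ n ^ 3 := by
      simpa [-Fintype.card_embedding_eq] using
        Fintype.card_le_of_injective _ (DFunLike.coe_injective (F := Fin 3 ↪ Fin n))
    rw [Fintype.card_prod, Fintype.card_bool]
    push_cast
    rw [mul_comm]
    exact mul_le_mul_of_nonneg_left (by exact_mod_cast this) zero_le_two
  refine le_trans (card_le_of_cover (D := (Fin 3 ↪ Fin n) × Bool)
    (fun d G => ∃ S, GS b c G S ∧ PathMatching q G S d.1 d.2) 𝒢 ?_ ?_)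
    (mul_le_mul_of_nonneg_right hcard (by positivity))
  · intro G hG
    obtain ⟨S, hS, p, t, hP⟩ := (h𝒢 G hG).2
    exact ⟨(p, t), S, hS, hP⟩
  rintro ⟨p, t⟩ 𝒢' h𝒢' hP
  have hA : ((Finset.univ.map p)ᶜ).card = n - 3 := by
    rw [Finset.card_compl, Finset.card_map]; simp
  let e := ((Finset.univ.map p)ᶜ).orderEmbOfFin hA
  have hC : (Fintype.card {H : SimpleGraph (Fin (n - 3)) // ¬ HasC5 H} : ℝ) =
      c5FreeCount (n - 3) := by
    rw [Fintype.card_subtype]; rfl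
  rw [← hC]
  refine card_le_of_cover (fun H G => G.comap e = H.1) 𝒢' (fun G hG => ?_)
    (fun H 𝒢'' h𝒢'' hH => ?_)
  · exact ⟨⟨G.comap e, fun h => (h𝒢 G (h𝒢' hG)).1 (HasC5.of_comap _ h)⟩, rfl⟩
  · refine card_pathMatching_fixed_rest_le 𝒢'' (fun G hG => ⟨(h𝒢 G (h𝒢' (h𝒢'' hG))).1,
      hP G (h𝒢'' hG)⟩) ?_
    intro G hG G' hG' u hu v hv
    have hr : ∀ u ∉ Finset.univ.map p, ∃ x, e x = u := by
      intro u hu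
      have : u ∈ Set.range e := by
        rw [Finset.range_orderEmbOfFin]; simpa using hu
      exact this
    obtain ⟨x, rfl⟩ := hr u hu
    obtain ⟨y, rfl⟩ := hr v hv
    have := (hH G hG).trans (hH G' hG').symm
    exact iff_of_eq (congrFun (congrFun (congrArg SimpleGraph.Adj this) x) y)

theorem PathMatching.of_not_transOn {n q : ℕ} {G : SimpleGraph (Fin n)} {S : Finset (Fin n)}
    {t : Bool} (h : ¬ TransOn G {v | v ∈ S ↔ t = true})
    (m : Fin q × Fin 2 ↪ Fin n) (hm : ∀ x, ¬ (m x ∈ S ↔ t = true))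
    (hadj : ∀ i, G.Adj (m (i, 0)) (m (i, 1))) : ∃ p, PathMatching q G S p t := by
  simp only [TransOn] at h
  push Not at h
  obtain ⟨u, hu, v, hv, w, hw, huv, hvw, huw, hn⟩ := h
  refine ⟨⟨![u, v, w], ?_⟩, ⟨huv, hvw, hn⟩, ?_, m, hm, hadj⟩
  · intro i j hij
    have h1 := huv.ne
    have h2 := hvw.ne
    fin_cases i <;> fin_cases j <;> simp_all
  · intro i
    fin_cases i
    exacts [hu, hv, hw]

theorem matching_or_cliqueOn_compl {n : ℕ} (q : ℕ) (G : SimpleGraph (Fin n)) (T : Set (Fin n)) :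
    (∃ m : Fin q × Fin 2 ↪ Fin n, (∀ x, m x ∈ T) ∧ ∀ i, G.Adj (m (i, 0)) (m (i, 1))) ∨
    ∃ Z : Finset (Fin n), Z.card ≤ 2 * q ∧ CliqueOn Gᶜ (T \ Z) := by
  rcases packing_or_cover (r := 2) (fun x : Fin 2 → Fin n => G.Adj (x 0) (x 1)) T q with h | h
  · exact Or.inl h
  · obtain ⟨Z, hZ, h⟩ := h
    refine Or.inr ⟨Z, hZ, fun u hu v hv huv => ?_⟩
    rw [SimpleGraph.compl_adj]
    refine ⟨huv, fun hadj => h ![u, v] ?_ ?_ ?_ hadj⟩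
    · intro i j hij
      fin_cases i <;> fin_cases j <;> simp_all
    · intro i
      fin_cases i
      exacts [hu.1, hv.1]
    · intro i
      fin_cases i
      exacts [hu.2, hv.2]

theorem not_cliqueOn_both {n : ℕ} {G : SimpleGraph (Fin n)} {T Z Z' : Finset (Fin n)}
    (h : CliqueOn G ((T : Set (Fin n)) \ Z)) (h' : CliqueOn Gᶜ ((T : Set (Fin n)) \ Z'))
    (hc : Z.card + Z'.card + 2 ≤ T.card) : False := by
  have h1 := Finset.card_union_le Z Z'
  have h2 := Finset.le_card_sdiff (Z ∪ Z') T
  obtain ⟨u, hu, v, hv, huv⟩ := Finset.one_lt_card.1 (by omega : 1 < (T \ (Z ∪ Z')).card)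
  simp only [Finset.mem_sdiff, Finset.mem_union, not_or] at hu hv
  have h3 := h u ⟨hu.1, hu.2.1⟩ v ⟨hv.1, hv.2.1⟩ huv
  have h4 := h' u ⟨hu.1, hu.2.2⟩ v ⟨hv.1, hv.2.2⟩ huv
  exact ((SimpleGraph.compl_adj _ _ _).1 h4).2 h3

/-- Without a path on one side facing a matching on the other, in the graph or its complement,
both sides are degenerate. -/
theorem GS.uni_or_degenerate {n q b : ℕ} {G : SimpleGraph (Fin n)} {S : Finset (Fin n)}
    (hGS : GS b true G S) (h1 : ∀ p t, ¬ PathMatching q G S p t)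
    (h0 : ∀ p t, ¬ PathMatching q Gᶜ S p t) (hbig : 8 * q + 4 * b + 8 ≤ n) :
    (∃ C : Set (Fin n), Uni G C) ∨
    ∃ Z Z' : Finset (Fin n), Z.card ≤ b + 2 * q ∧ Z'.card ≤ b + 2 * q ∧
      TransOn G (Sᶜ : Finset (Fin n)) ∧ CliqueOn G ((S : Set (Fin n)) \ Z) ∧
      ((TransOn G S ∧ CliqueOn G (((Sᶜ : Finset (Fin n)) : Set (Fin n)) \ Z')) ∨
        (TransOn Gᶜ S ∧ CliqueOn Gᶜ (((Sᶜ : Finset (Fin n)) : Set (Fin n)) \ Z'))) := by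
  have hcs := Finset.card_add_card_compl S
  have hc1 := hGS.card_le
  have hc2 : 2 * Sᶜ.card ≤ Fintype.card (Fin n) + 2 * b := by convert hGS.card_compl_le
  simp only [Fintype.card_fin] at hcs hc1 hc2
  obtain ⟨Z, hZ, hcore⟩ := hGS.core
  have hcl : CliqueOn G ((S : Set (Fin n)) \ Z) := fun u hu v hv huv =>
    (hcore u hu.1 v hv.1 hu.2 hv.2 huv).2 rfl
  have hSf : {v | v ∈ S ↔ false = true} = ((Sᶜ : Finset (Fin n)) : Set (Fin n)) := by
    ext; simp
  have hSt : {v | v ∈ S ↔ true = true} = (S : Set (Fin n)) := by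
    ext; simp
  have hout : TransOn G (Sᶜ : Finset (Fin n)) := by
    by_contra hcon
    rcases matching_or_cliqueOn_compl q G S with ⟨m, hm, hadj⟩ | ⟨Z', hZ', hcl'⟩
    · obtain ⟨p, hp⟩ := PathMatching.of_not_transOn (t := false) (hSf ▸ hcon) m
        (by simpa using hm) hadj
      exact h1 p false hp
    · exact not_cliqueOn_both hcl hcl' (by omega)
  have hin : ∀ H : SimpleGraph (Fin n), (∀ p t, ¬ PathMatching q H S p t) →
      TransOn H S ∨ ∃ Z' : Finset (Fin n), Z'.card ≤ 2 * q ∧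
        CliqueOn Hᶜ (((Sᶜ : Finset (Fin n)) : Set (Fin n)) \ Z') := by
    intro H hH
    rcases matching_or_cliqueOn_compl q H ((Sᶜ : Finset (Fin n)) : Set (Fin n)) with
      ⟨m, hm, hadj⟩ | h
    · left
      by_contra hcon
      obtain ⟨p, hp⟩ := PathMatching.of_not_transOn (t := true) (hSt ▸ hcon) m
        (by simpa using hm) hadj
      exact hH p true hp
    · exact Or.inr h
  rcases hin G h1 with ht | ⟨Z', hZ', hc'⟩
  · rcases hin Gᶜ h0 with ht' | ⟨Z'', hZ'', hc''⟩
    · left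
      refine ⟨S, ?_, ?_⟩
      · rcases cliqueOn_or_of_transOn ht ht' with h | h
        · exact fun u hu v hv huv => h u hu v hv huv
        · have h' : CliqueOn Gᶜ ((S : Set (Fin n)) \ (∅ : Finset (Fin n))) := h.mono (by simp)
          exact (not_cliqueOn_both hcl h' (by simp; omega)).elim
      · intro u v w hu hv hw
        exact hout u (by simpa using hu) v (by simpa using hv) w (by simpa using hw)
    · rw [compl_compl] at hc''
      exact Or.inr ⟨Z, Z'', by omega, by omega, hout, hcl, Or.inl ⟨ht, hc''⟩⟩
  · rcases hin Gᶜ h0 with ht' | ⟨Z'', hZ'', hc''⟩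
    · exact Or.inr ⟨Z, Z', by omega, by omega, hout, hcl, Or.inr ⟨ht', hc'⟩⟩
    · rw [compl_compl] at hc''
      exact (not_cliqueOn_both hc'' hc' (by omega)).elim

/-- The labelling given by `d` (the identity or a constant) overridden by the list `l`. -/
def labelOf {V : Type*} {k : ℕ} (d : Option V) (l : Fin k → V × V) (u : V) : V :=
  if h : ∃ i, (l i).1 = u then (l h.choose).2 else d.getD u

theorem exists_labelOf_eq {V : Type*} [Fintype V] {k : ℕ} [Nonempty V] (φ : V → V) (d : Option V)
    (Z : Finset V) (hZ : Z.card ≤ k) :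
    ∃ l : Fin k → V × V, ∀ u, (u ∉ Z → φ u = d.getD u) → labelOf d l u = φ u := by
  obtain ⟨e, he⟩ : ∃ e : Fin k → V, ∀ z ∈ Z, ∃ i, e i = z := by
    let z0 : V := Classical.arbitrary V
    refine ⟨fun i => if h : i.1 < Z.card then (Z.equivFin.symm ⟨i, h⟩ : V) else z0,
      fun z hz => ⟨⟨Z.equivFin ⟨z, hz⟩, (Fin.is_lt _).trans_le hZ⟩, ?_⟩⟩
    simp
  refine ⟨fun i => (e i, φ (e i)), fun u hu => ?_⟩
  unfold labelOf
  split_ifs with h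
  · have := h.choose_spec
    simp only at this ⊢
    rw [this]
  · rw [hu fun hz => h (he u hz)]

theorem exists_labelOf_of_transOn {V : Type*} [Fintype V] [Nonempty V] {k : ℕ}
    {H : SimpleGraph V} {T : Set V}
    (ht : TransOn H T) {Z : Finset V} (hZ : Z.card ≤ k)
    (hc : CliqueOn H (T \ Z) ∨ CliqueOn Hᶜ (T \ Z)) :
    ∃ (d : Option V) (l : Fin k → V × V), ∀ u ∈ T, ∀ v ∈ T, u ≠ v →
      (H.Adj u v ↔ labelOf d l u = labelOf d l v) := by
  let r : V → V → Prop := fun u w => u = w ∨ u ∈ T ∧ w ∈ T ∧ H.Adj u w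
  have rsymm : ∀ {u v}, r u v → r v u := by
    rintro u v (rfl | ⟨h1, h2, h3⟩)
    exacts [Or.inl rfl, Or.inr ⟨h2, h1, h3.symm⟩]
  have rtrans : ∀ {u v w}, r u v → r v w → r u w := by
    rintro u v w (rfl | ⟨h1, h2, h3⟩) (rfl | ⟨h4, h5, h6⟩)
    · exact Or.inl rfl
    · exact Or.inr ⟨h4, h5, h6⟩
    · exact Or.inr ⟨h1, h2, h3⟩
    · by_cases huw : u = w
      · exact Or.inl huw
      · exact Or.inr ⟨h1, h5, ht u h1 v h2 w h5 h3 h6 huw⟩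
  have main : ∀ (W : Set V) (d : Option V),
      (∀ u ∈ T, u ∉ Z → ∀ w, w ∈ W → r u w → w = d.getD u) →
      (∀ u ∈ T, u ∉ Z → ∃ w ∈ W, r u w) →
      ∃ (d : Option V) (l : Fin k → V × V), ∀ u ∈ T, ∀ v ∈ T, u ≠ v →
      (H.Adj u v ↔ labelOf d l u = labelOf d l v) := by
    intro W d hd hW
    let P : V → V → Prop := fun u w => r u w ∧ ((∃ w' ∈ W, r u w') → w ∈ W)
    have hP : ∀ u, ∃ w, P u w := by
      intro u
      by_cases h : ∃ w' ∈ W, r u w'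
      · obtain ⟨w, hw, hr⟩ := h
        exact ⟨w, hr, fun _ => hw⟩
      · exact ⟨u, Or.inl rfl, fun h' => (h h').elim⟩
    let φ : V → V := fun u => Classical.epsilon (P u)
    have hφ : ∀ u, P u (φ u) := fun u => Classical.epsilon_spec (hP u)
    have hcongr : ∀ u v, r u v → φ u = φ v := by
      intro u v huv
      have h1 : ∀ w, r u w ↔ r v w := fun w =>
        ⟨fun h => rtrans (rsymm huv) h, fun h => rtrans huv h⟩
      have : P u = P v := by
        funext w
        simp only [P, h1]
      simp only [φ, this]
    obtain ⟨l, hl⟩ := exists_labelOf_eq φ d Z hZ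
    refine ⟨d, l, fun u hu v hv huv => ?_⟩
    have hlu : ∀ u ∈ T, labelOf d l u = φ u := fun u hu =>
      hl u fun huZ => hd u hu huZ _ ((hφ u).2 (hW u hu huZ)) (hφ u).1
    rw [hlu u hu, hlu v hv]
    constructor
    · exact fun h => hcongr u v (Or.inr ⟨hu, hv, h⟩)
    · intro h
      rcases rtrans (hφ u).1 (h ▸ rsymm (hφ v).1) with h' | h'
      · exact (huv h').elim
      · exact h'.2.2
  rcases hc with hc | hc
  · by_cases hne : ∃ r0, r0 ∈ T \ (Z : Set V)
    · obtain ⟨r0, h0⟩ := hne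
      refine main {r0} (some r0) (fun u _ _ w hw _ => hw) (fun u hu huZ => ⟨r0, rfl, ?_⟩)
      by_cases h : u = r0
      · exact Or.inl h
      · exact Or.inr ⟨hu, h0.1, hc u ⟨hu, huZ⟩ r0 h0 h⟩
    · refine main ∅ none (fun u _ _ w hw => hw.elim) (fun u hu huZ => (hne ⟨u, hu, huZ⟩).elim)
  · refine main (T \ Z) none (fun u hu huZ w hw hr => ?_)
      (fun u hu huZ => ⟨u, ⟨hu, huZ⟩, Or.inl rfl⟩)
    rcases hr with h | h
    · exact h.symm
    · by_contra hne
      exact ((SimpleGraph.compl_adj _ _ _).1 (hc u ⟨hu, huZ⟩ w hw (Ne.symm hne))).2 h.2.2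

theorem card_degenerate_le {n q b : ℕ} (hbig : 8 * q + 4 * b + 8 ≤ n)
    (𝒢 : Finset (SimpleGraph (Fin n)))
    (h𝒢 : ∀ G ∈ 𝒢, (¬ ∃ C : Set (Fin n), Uni G C) ∧ ∃ S, GS b true G S ∧
      (∀ p t, ¬ PathMatching q G S p t) ∧ ∀ p t, ¬ PathMatching q Gᶜ S p t) :
    (𝒢.card : ℝ) ≤ 2 ^ n * 2 * ((n + 1) * n ^ (2 * (b + 2 * q))) ^ 2 *
      Real.exp (Real.log 2 * (n ^ 2 / 4)) := by
  have : Nonempty (Fin n) := ⟨⟨0, by omega⟩⟩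
  let Lab := Option (Fin n) × (Fin (b + 2 * q) → Fin n × Fin n)
  have hcard : (Fintype.card (Finset (Fin n) × Bool × Lab × Lab) : ℝ) =
      2 ^ n * 2 * ((n + 1) * n ^ (2 * (b + 2 * q))) ^ 2 := by
    simp only [Fintype.card_prod, Fintype.card_fun, Fintype.card_finset, Fintype.card_fin,
      Fintype.card_bool, Fintype.card_option, Lab]
    push_cast
    rw [pow_mul]
    ring
  rw [← hcard]
  refine card_le_of_cover (fun d G =>
    (∀ u ∉ d.1, ∀ v ∉ d.1, u ≠ v → (G.Adj u v ↔
      labelOf d.2.2.1.1 d.2.2.1.2 u = labelOf d.2.2.1.1 d.2.2.1.2 v)) ∧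
    (∀ u ∈ d.1, ∀ v ∈ d.1, u ≠ v → (G.Adj u v ↔ (d.2.1 = true ↔
      labelOf d.2.2.2.1 d.2.2.2.2 u = labelOf d.2.2.2.1 d.2.2.2.2 v)))) 𝒢 ?_ ?_
  · intro G hG
    obtain ⟨hnu, S, hGS, h1, h0⟩ := h𝒢 G hG
    rcases hGS.uni_or_degenerate h1 h0 hbig with h | ⟨Z, Z', hZ, hZ', ht, hc, h⟩
    · exact (hnu h).elim
    obtain ⟨d, l, hdl⟩ := exists_labelOf_of_transOn ht hZ' (h.imp And.right And.right)
    have hdl' : ∀ u ∉ S, ∀ v ∉ S, u ≠ v → (G.Adj u v ↔ labelOf d l u = labelOf d l v) :=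
      fun u hu v hv => hdl u (by simpa using hu) v (by simpa using hv)
    rcases h with ⟨ht', -⟩ | ⟨ht', -⟩
    · obtain ⟨d', l', hdl''⟩ := exists_labelOf_of_transOn ht' hZ (Or.inl hc)
      exact ⟨(S, true, (d, l), (d', l')), hdl', fun u hu v hv huv => by
        simpa using hdl'' u hu v hv huv⟩
    · obtain ⟨d', l', hdl''⟩ := exists_labelOf_of_transOn ht' hZ
        (Or.inr (by rwa [compl_compl]))
      refine ⟨(S, false, (d, l), (d', l')), hdl', fun u hu v hv huv => ?_⟩
      have := hdl'' u hu v hv huv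
      rw [SimpleGraph.compl_adj] at this
      simp only [Bool.false_eq_true, false_iff]
      tauto
  · rintro ⟨S, c, L1, L2⟩ 𝒢' - hP
    have hcs := Finset.card_add_card_compl S
    rw [Fintype.card_fin] at hcs
    refine le_trans ?_ (two_pow_mul_le_exp hcs)
    have : 𝒢'.card ≤ Fintype.card (S × (Sᶜ : Finset (Fin n)) → Bool) := by
      rw [← Finset.card_univ]
      refine Finset.card_le_card_of_injOn (fun G x => decide (G.Adj x.1 x.2))
        (fun _ _ => Finset.mem_univ _) ?_
      intro G hG G' hG' heq
      have hx : ∀ u ∈ S, ∀ v ∉ S, (G.Adj u v ↔ G'.Adj u v) := by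
        intro u hu v hv
        simpa using congrFun heq (⟨u, hu⟩, ⟨v, by simpa using hv⟩)
      ext u v
      by_cases huv : u = v
      · subst huv; simp
      by_cases hu : u ∈ S <;> by_cases hv : v ∈ S
      · rw [(hP G hG).2 u hu v hv huv, (hP G' hG').2 u hu v hv huv]
      · exact hx u hu v hv
      · rw [G.adj_comm, G'.adj_comm]
        exact hx v hv u hu
      · rw [(hP G hG).1 u hu v hv huv, (hP G' hG').1 u hu v hv huv]
    simp only [Fintype.card_fun, Fintype.card_prod, Fintype.card_coe, Fintype.card_bool] at this
    exact_mod_cast this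

/-! ### Set partitions and arrangements -/

instance fintypeSetoid (X : Type*) [Fintype X] : Fintype (Setoid X) :=
  Fintype.ofInjective (fun s : Setoid X => fun x y => s x y) fun _ _ h => Setoid.eq_iff_rel_eq.2 h

/-- The number of equivalence relations on `m` points. -/
def setoidCount (m : ℕ) : ℕ := Fintype.card (Setoid (Fin m))

theorem card_setoid_le_of_injective {X Y : Type*} [Fintype X] [Fintype Y] (f : X → Y)
    (hf : Function.Injective f) : Fintype.card (Setoid X) ≤ Fintype.card (Setoid Y) :=
  Fintype.card_le_of_surjective _ (Setoid.comap_surjective f hf)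

theorem card_setoid (X : Type*) [Fintype X] :
    Fintype.card (Setoid X) = setoidCount (Fintype.card X) :=
  le_antisymm (card_setoid_le_of_injective _ (Fintype.equivFin X).injective)
    (card_setoid_le_of_injective _ (Fintype.equivFin X).symm.injective)

theorem setoidCount_mono : Monotone setoidCount := fun _ _ h =>
  card_setoid_le_of_injective (Fin.castLE h) (Fin.castLE_injective h)

theorem setoidCount_pos (m : ℕ) : 0 < setoidCount m := Fintype.card_pos_iff.2 ⟨⊥⟩

theorem pow_le_setoidCount (r k : ℕ) : r ^ k ≤ setoidCount (r + k) := by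
  have h : Fintype.card (Fin k → Fin r) ≤ Fintype.card (Setoid (Fin r ⊕ Fin k)) := by
    refine Fintype.card_le_of_injective (fun f => Setoid.ker (Sum.elim id f)) fun f g h => ?_
    funext i
    have : (Setoid.ker (Sum.elim id f)) (Sum.inr i) (Sum.inl (f i)) := by
      simp [Setoid.ker_def]
    have h' : Setoid.ker (Sum.elim id f) = Setoid.ker (Sum.elim id g) := h
    rw [h'] at this
    simpa [Setoid.ker_def, eq_comm] using this
  rw [card_setoid] at h
  simpa using h

/-- An arrangement: a central set, a partition of the complement, and the edges in between. -/
abbrev Arr (n : ℕ) : Type := Σ C : Finset (Fin n),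
  Setoid {v : Fin n // v ∉ C} × ({v : Fin n // v ∈ C} → {v : Fin n // v ∉ C} → Bool)

/-- The number of arrangements. -/
def arrCount (n : ℕ) : ℕ := ∑ k ∈ Finset.range (n + 1),
  n.choose k * (setoidCount (n - k) * 2 ^ (k * (n - k)))

theorem card_fiber_arr {n : ℕ} (C : Finset (Fin n)) :
    Fintype.card ({v : Fin n // v ∈ C} → {v : Fin n // v ∉ C} → Bool) =
      2 ^ (C.card * (n - C.card)) := by
  have h : Fintype.card {v : Fin n // v ∉ C} = n - C.card := by
    simp [Fintype.card_subtype_compl]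
  rw [Fintype.card_fun, Fintype.card_fun, Fintype.card_coe, h, Fintype.card_bool, ← pow_mul,
    mul_comm]

theorem card_side {n : ℕ} (C : Finset (Fin n)) : Fintype.card {v : Fin n // v ∉ C} = n - C.card := by
  simp [Fintype.card_subtype_compl]

theorem card_arr (n : ℕ) : Fintype.card (Arr n) = arrCount n := by
  rw [Fintype.card_sigma, arrCount]
  have h : ∀ C : Finset (Fin n), Fintype.card (Setoid {v : Fin n // v ∉ C} ×
      ({v : Fin n // v ∈ C} → {v : Fin n // v ∉ C} → Bool)) =
      (fun k => setoidCount (n - k) * 2 ^ (k * (n - k))) C.card := fun C => by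
    rw [Fintype.card_prod, card_setoid, card_side, card_fiber_arr]
  have h' := Finset.sum_powerset_apply_card (fun k => setoidCount (n - k) * 2 ^ (k * (n - k)))
    (x := (Finset.univ : Finset (Fin n)))
  rw [Finset.sum_congr rfl fun C _ => h C, ← Finset.powerset_univ, h']
  simp

/-- The graph of an arrangement. -/
def Arr.graph {n : ℕ} (a : Arr n) : SimpleGraph (Fin n) :=
  SimpleGraph.fromRel fun u v => (u ∈ a.1 ∧ v ∈ a.1) ∨
    (∃ (hu : u ∉ a.1) (hv : v ∉ a.1), a.2.1 ⟨u, hu⟩ ⟨v, hv⟩) ∨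
    ∃ (hu : u ∈ a.1) (hv : v ∉ a.1), a.2.2 ⟨u, hu⟩ ⟨v, hv⟩ = true

section
variable {n : ℕ} (a : Arr n) {u v : Fin n}

theorem Arr.graph_adj_center (hu : u ∈ a.1) (hv : v ∈ a.1) : a.graph.Adj u v ↔ u ≠ v := by
  simp [Arr.graph, SimpleGraph.fromRel_adj, hu, hv]

theorem Arr.graph_adj_side (hu : u ∉ a.1) (hv : v ∉ a.1) :
    a.graph.Adj u v ↔ u ≠ v ∧ a.2.1 ⟨u, hu⟩ ⟨v, hv⟩ := by
  simp [Arr.graph, SimpleGraph.fromRel_adj, hu, hv, a.2.1.comm' (x := ⟨v, hv⟩)]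

theorem Arr.graph_adj_cross (hu : u ∈ a.1) (hv : v ∉ a.1) :
    a.graph.Adj u v ↔ a.2.2 ⟨u, hu⟩ ⟨v, hv⟩ = true := by
  have : u ≠ v := fun h => hv (h ▸ hu)
  simp [Arr.graph, SimpleGraph.fromRel_adj, hu, hv, this]

theorem Arr.uni : Uni a.graph (a.1 : Set (Fin n)) := by
  refine ⟨fun u hu v hv huv => (a.graph_adj_center hu hv).2 huv, ?_⟩
  intro u v w hu hv hw huv hvw huw
  rw [a.graph_adj_side hu hv] at huv
  rw [a.graph_adj_side hv hw] at hvw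
  exact (a.graph_adj_side hu hw).2 ⟨huw, a.2.1.trans' huv.2 hvw.2⟩

end

theorem exists_arr_of_uni {n : ℕ} {G : SimpleGraph (Fin n)} {C : Set (Fin n)} (h : Uni G C) :
    ∃ a : Arr n, (a.1 : Set (Fin n)) = C ∧ a.graph = G := by
  obtain ⟨D, rfl⟩ : ∃ D : Finset (Fin n), (D : Set (Fin n)) = C := ⟨C.toFinset, by simp⟩
  let s : Setoid {v : Fin n // v ∉ D} :=
    { r := fun u v => u = v ∨ G.Adj u v
      iseqv := ⟨fun u => Or.inl rfl, fun h => h.imp Eq.symm SimpleGraph.Adj.symm, by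
        rintro u v w (rfl | h1) (rfl | h2)
        · exact Or.inl rfl
        · exact Or.inr h2
        · exact Or.inr h1
        · by_cases huw : u = w
          · exact Or.inl huw
          · exact Or.inr (h.2 u v w u.2 v.2 w.2 h1 h2 fun h => huw (Subtype.ext h))⟩ }
  let a : Arr n := ⟨D, s, fun u v => decide (G.Adj u v)⟩
  refine ⟨a, rfl, ?_⟩
  ext u v
  by_cases hu : u ∈ a.1 <;> by_cases hv : v ∈ a.1
  · rw [a.graph_adj_center hu hv]
    exact ⟨fun h' => h.1 hu hv h', fun h' => h'.ne⟩
  · rw [a.graph_adj_cross hu hv]; simp [a]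
  · rw [SimpleGraph.adj_comm, a.graph_adj_cross hv hu, SimpleGraph.adj_comm]; simp [a]
  · rw [a.graph_adj_side hu hv]
    constructor
    · rintro ⟨hne, h' | h'⟩
      · exact (hne (congrArg Subtype.val h')).elim
      · exact h'
    · exact fun h' => ⟨h'.ne, Or.inr h'⟩

theorem arrCount_pos (n : ℕ) : 0 < arrCount n := by
  rw [← card_arr]
  exact Fintype.card_pos_iff.2 ⟨⟨∅, ⊥, fun _ _ => true⟩⟩

theorem choose_mul_le_arrCount {n k : ℕ} (hk : k ≤ n) :
    n.choose k * (setoidCount (n - k) * 2 ^ (k * (n - k))) ≤ arrCount n :=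
  Finset.single_le_sum (f := fun k => n.choose k * (setoidCount (n - k) * 2 ^ (k * (n - k))))
    (fun _ _ => Nat.zero_le _) (Finset.mem_range.2 (Nat.lt_succ_of_le hk))

theorem exp_half_le_pow_add_pow {n k : ℕ} (hk : k ≤ n) :
    Real.exp (Real.log 2 * (n / 2)) ≤ 2 ^ k + 2 ^ (n - k) := by
  have key : ∀ m : ℕ, n ≤ 2 * m → Real.exp (Real.log 2 * (n / 2)) ≤ 2 ^ m := by
    intro m hm
    have h2 : (2 : ℝ) ^ m = Real.exp (Real.log 2 * m) := by
      rw [mul_comm, Real.exp_nat_mul, Real.exp_log two_pos]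
    rw [h2, Real.exp_le_exp]
    refine mul_le_mul_of_nonneg_left ?_ (Real.log_pos one_lt_two).le
    have : (n : ℝ) ≤ 2 * m := by exact_mod_cast hm
    linarith
  rcases le_total n (2 * k) with h | h
  · have := key k h
    have : (0 : ℝ) < 2 ^ (n - k) := by positivity
    linarith
  · have := key (n - k) (by omega)
    have : (0 : ℝ) < 2 ^ k := by positivity
    linarith

theorem arrCount_succ_ge (n : ℕ) :
    Real.exp (Real.log 2 * (n / 2)) * arrCount n ≤ arrCount (n + 1) := by
  have h1 : ∀ k ∈ Finset.range (n + 1), Real.exp (Real.log 2 * (n / 2)) *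
      (n.choose k * (setoidCount (n - k) * 2 ^ (k * (n - k))) : ℝ) ≤
      n.choose k * (setoidCount (n + 1 - k) * 2 ^ (k * (n + 1 - k))) +
      n.choose k * (setoidCount (n - k) * 2 ^ ((k + 1) * (n - k))) := by
    intro k hk
    have hk' : k ≤ n := Nat.lt_succ_iff.1 (Finset.mem_range.1 hk)
    have h2 : ((setoidCount (n - k) : ℕ) : ℝ) ≤ setoidCount (n + 1 - k) := by
      exact_mod_cast setoidCount_mono (by omega)
    have h3 : (2 : ℝ) ^ (k * (n + 1 - k)) = 2 ^ (k * (n - k)) * 2 ^ k := by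
      rw [← pow_add]; congr 1; rw [show n + 1 - k = n - k + 1 by omega]; ring
    have h4 : (2 : ℝ) ^ ((k + 1) * (n - k)) = 2 ^ (k * (n - k)) * 2 ^ (n - k) := by
      rw [← pow_add]; congr 1; ring
    rw [h3, h4]
    calc _ ≤ (2 ^ k + 2 ^ (n - k)) *
          (n.choose k * (setoidCount (n - k) * 2 ^ (k * (n - k))) : ℝ) :=
          mul_le_mul_of_nonneg_right (exp_half_le_pow_add_pow hk') (by positivity)
      _ = n.choose k * (setoidCount (n - k) * (2 ^ (k * (n - k)) * 2 ^ k)) +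
          n.choose k * (setoidCount (n - k) * (2 ^ (k * (n - k)) * 2 ^ (n - k))) := by ring
      _ ≤ _ := by gcongr
  have h5 := Finset.sum_le_sum h1
  rw [← Finset.mul_sum, Finset.sum_add_distrib] at h5
  simp only [arrCount]
  push_cast
  refine h5.trans (le_of_eq ?_)
  rw [Finset.sum_range_succ' _ (n + 1)]
  simp only [Nat.choose_succ_succ, Nat.cast_add, add_mul, Finset.sum_add_distrib,
    Nat.add_sub_add_right]
  rw [add_comm, add_assoc]
  congr 1
  have h6 := Finset.sum_range_succ' (fun k => (n.choose k : ℝ) * (setoidCount (n + 1 - k) *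
    2 ^ (k * (n + 1 - k)))) (n + 1)
  rw [Finset.sum_range_succ] at h6
  simp only [Nat.choose_succ_self, Nat.cast_zero, zero_mul, add_zero,
    Nat.add_sub_add_right] at h6
  rw [h6]
  simp [Nat.add_mul]

theorem four_mul_half_mul_sub_ge (n : ℕ) : n ^ 2 ≤ 4 * (n / 2 * (n - n / 2)) + 1 := by
  obtain ⟨m, rfl | rfl⟩ := n.even_or_odd'
  · rw [show 2 * m / 2 = m by omega, show 2 * m - m = m by omega]
    nlinarith
  · rw [show (2 * m + 1) / 2 = m by omega, show 2 * m + 1 - m = m + 1 by omega]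
    nlinarith

theorem quarter_mul_log_ge {x k : ℝ} (hx : 100 ≤ x) (hl : 100 ≤ Real.log x) (hk : x ≤ 4 * k + 3)
    (hkx : 5 * k ≥ x) :
    1 / 5 * (x * Real.log x) + 1 ≤ k * Real.log k := by
  have h1 : Real.log x - 4 ≤ Real.log k := by
    have h2 : Real.log x ≤ Real.log (5 * k) := Real.log_le_log (by linarith) hkx
    rw [Real.log_mul (by norm_num) (by linarith)] at h2
    have h3 : Real.log 5 ≤ 5 - 1 := Real.log_le_sub_one_of_pos (by norm_num)
    linarith
  have h4 : (x - 3) / 4 * (Real.log x - 4) ≤ k * Real.log k :=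
    mul_le_mul (by linarith) h1 (by linarith) (by linarith)
  nlinarith

theorem eventually_le_arrCount : ∀ᶠ n : ℕ in atTop,
    Real.exp (Real.log 2 * (n ^ 2 / 4) + 1 / 5 * (n * Real.log n)) ≤ arrCount n := by
  filter_upwards [eventually_ge_atTop 100,
    (Real.tendsto_log_atTop.comp tendsto_natCast_atTop_atTop).eventually_ge_atTop 100] with n hn hl
  have hn' : (100 : ℝ) ≤ n := by exact_mod_cast hn
  have h1 := choose_mul_le_arrCount (Nat.div_le_self n 2)
  have h2 : (n / 4) ^ (n / 4) * 2 ^ (n / 2 * (n - n / 2)) ≤ arrCount n := by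
    refine le_trans (Nat.mul_le_mul_right _ ?_)
      ((Nat.le_mul_of_pos_left _ (Nat.choose_pos (Nat.div_le_self n 2))).trans h1)
    exact (pow_le_setoidCount _ _).trans (setoidCount_mono (by omega))
  have h3 : ((n / 4 : ℕ) : ℝ) ^ (n / 4) * 2 ^ (n / 2 * (n - n / 2)) ≤ arrCount n := by
    exact_mod_cast h2
  refine le_trans ?_ h3
  have h4 : (0 : ℝ) < (n / 4 : ℕ) := by
    have : 0 < n / 4 := by omega
    exact_mod_cast this
  have h5 : ((n / 4 : ℕ) : ℝ) ^ (n / 4) = Real.exp ((n / 4 : ℕ) * Real.log (n / 4 : ℕ)) := by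
    rw [Real.exp_nat_mul, Real.exp_log h4]
  have h6 : (2 : ℝ) ^ (n / 2 * (n - n / 2)) =
      Real.exp ((n / 2 * (n - n / 2) : ℕ) * Real.log 2) := by
    rw [Real.exp_nat_mul, Real.exp_log two_pos]
  rw [h5, h6, ← Real.exp_add, Real.exp_le_exp]
  have h7 : (n : ℝ) ^ 2 ≤ 4 * (n / 2 * (n - n / 2) : ℕ) + 1 := by
    exact_mod_cast four_mul_half_mul_sub_ge n
  have h8 : (n : ℝ) ≤ 4 * (n / 4 : ℕ) + 3 := by
    have : n ≤ 4 * (n / 4) + 3 := by omega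
    exact_mod_cast this
  have h9 : 5 * ((n / 4 : ℕ) : ℝ) ≥ n := by
    have : n ≤ 5 * (n / 4) := by omega
    exact_mod_cast this
  have h10 := quarter_mul_log_ge hn' hl h8 h9
  have h11 := Real.log_two_lt_d9
  have h12 := Real.log_pos one_lt_two
  nlinarith

/-- The number of graphs without induced five-cycles which are neither unipolar nor
co-unipolar. -/
def badCount (n : ℕ) : ℕ := (Finset.univ.filter fun G : SimpleGraph (Fin n) => ¬ HasC5 G ∧
  (¬ ∃ C : Set (Fin n), Uni G C) ∧ ¬ ∃ C : Set (Fin n), Uni Gᶜ C).card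

theorem card_compl_mem {n : ℕ} (𝒜 : Finset (SimpleGraph (Fin n))) :
    (Finset.univ.filter fun G : SimpleGraph (Fin n) => Gᶜ ∈ 𝒜).card = 𝒜.card :=
  Finset.card_bij (fun G _ => Gᶜ) (fun G hG => (Finset.mem_filter.1 hG).2)
    (fun G _ G' _ h => compl_injective h)
    (fun G hG => ⟨Gᶜ, by simpa using hG, compl_compl G⟩)

theorem badCount_le {n q b : ℕ} {β N F D : ℝ} (hb : b = ⌈β * n⌉₊) (hb1 : 1 ≤ b)
    (hbn : 18 * b ≤ n)
    (hN : ∀ 𝒢 : Finset (SimpleGraph (Fin n)), (∀ G ∈ 𝒢, ¬ HasC5 G ∧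
      ∀ S : Finset (Fin n), (S.card : ℝ) ≤ n / 2 + β * n → (n : ℝ) - S.card ≤ n / 2 + β * n →
        ¬ RL b G S) → (𝒢.card : ℝ) ≤ N)
    (hF : ∀ c : Bool, ∀ 𝒢 : Finset (SimpleGraph (Fin n)), (∀ G ∈ 𝒢, ¬ HasC5 G ∧
      ∃ S, GS (30 * b) c G S ∧ ∃ p t, PathMatching q G S p t) → (𝒢.card : ℝ) ≤ F)
    (hD : ∀ 𝒢 : Finset (SimpleGraph (Fin n)), (∀ G ∈ 𝒢, (¬ ∃ C : Set (Fin n), Uni G C) ∧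
      ∃ S, GS (30 * b) true G S ∧ (∀ p t, ¬ PathMatching q G S p t) ∧
        ∀ p t, ¬ PathMatching q Gᶜ S p t) → (𝒢.card : ℝ) ≤ D) :
    (badCount n : ℝ) ≤ N + 2 * (2 * F + D) := by
  let 𝒩 := Finset.univ.filter fun G : SimpleGraph (Fin n) => ¬ HasC5 G ∧
      ∀ S : Finset (Fin n), (S.card : ℝ) ≤ n / 2 + β * n → (n : ℝ) - S.card ≤ n / 2 + β * n →
        ¬ RL b G S
  let ℱ : Bool → Finset (SimpleGraph (Fin n)) := fun c =>
    Finset.univ.filter fun G : SimpleGraph (Fin n) => ¬ HasC5 G ∧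
      ∃ S, GS (30 * b) c G S ∧ ∃ p t, PathMatching q G S p t
  let 𝒟 := Finset.univ.filter fun G : SimpleGraph (Fin n) => (¬ ∃ C : Set (Fin n), Uni G C) ∧
      ∃ S, GS (30 * b) true G S ∧ (∀ p t, ¬ PathMatching q G S p t) ∧
        ∀ p t, ¬ PathMatching q Gᶜ S p t
  let cc : Finset (SimpleGraph (Fin n)) → Finset (SimpleGraph (Fin n)) := fun 𝒜 =>
    Finset.univ.filter fun G : SimpleGraph (Fin n) => Gᶜ ∈ 𝒜
  have hsub : (Finset.univ.filter fun G : SimpleGraph (Fin n) => ¬ HasC5 G ∧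
      (¬ ∃ C : Set (Fin n), Uni G C) ∧ ¬ ∃ C : Set (Fin n), Uni Gᶜ C) ⊆
      𝒩 ∪ ((ℱ true ∪ cc (ℱ true)) ∪ (ℱ false ∪ cc (ℱ false)) ∪ (𝒟 ∪ cc 𝒟)) := by
    intro G hG
    simp only [Finset.mem_filter, Finset.mem_univ, true_and] at hG
    obtain ⟨h5, hu, hcu⟩ := hG
    by_cases hG : G ∈ 𝒩
    · exact Finset.mem_union_left _ hG
    refine Finset.mem_union_right _ ?_
    obtain ⟨S, hS1, hS2, hRL⟩ : ∃ S : Finset (Fin n), (S.card : ℝ) ≤ n / 2 + β * n ∧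
        (n : ℝ) - S.card ≤ n / 2 + β * n ∧ RL b G S := by
      by_contra hcon
      push Not at hcon
      exact hG (Finset.mem_filter.2 ⟨Finset.mem_univ _, h5, hcon⟩)
    have hce : β * n ≤ b := hb ▸ Nat.le_ceil _
    have hc1 : 2 * S.card ≤ Fintype.card (Fin n) + 2 * b := by
      rw [Fintype.card_fin]
      have : (2 : ℝ) * S.card ≤ n + 2 * b := by linarith
      exact_mod_cast this
    have hc2 : 2 * Sᶜ.card ≤ Fintype.card (Fin n) + 2 * b := by
      have h := Finset.card_add_card_compl S
      rw [Fintype.card_fin] at h ⊢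
      have h' : (S.card : ℝ) + Sᶜ.card = n := by exact_mod_cast h
      have : (2 : ℝ) * Sᶜ.card ≤ n + 2 * b := by linarith
      exact_mod_cast this
    obtain ⟨H, hH, S', hGS⟩ := exists_GS hb1 hRL h5 hc1 (by convert hc2) (by simpa using hbn)
    have hmem : H ∈ ℱ true ∨ Hᶜ ∈ ℱ false ∨ H ∈ 𝒟 := by
      have h5H : ¬ HasC5 H := by
        rcases hH with rfl | rfl
        exacts [h5, by rwa [hasC5_compl_iff]]
      have huH : ¬ ∃ C : Set (Fin n), Uni H C := by
        rcases hH with rfl | rfl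
        exacts [hu, hcu]
      by_cases h1 : ∃ p t, PathMatching q H S' p t
      · left
        exact Finset.mem_filter.2 ⟨Finset.mem_univ _, h5H, S', hGS, h1⟩
      by_cases h0 : ∃ p t, PathMatching q Hᶜ S' p t
      · right; left
        refine Finset.mem_filter.2 ⟨Finset.mem_univ _, ?_⟩
        exact ⟨by rwa [hasC5_compl_iff], S', hGS.compl, h0⟩
      · right; right
        push Not at h1 h0
        exact Finset.mem_filter.2 ⟨Finset.mem_univ _, huH, S', hGS, h1, h0⟩
    have hcc : ∀ (𝒜 : Finset (SimpleGraph (Fin n))), Gᶜ ∈ 𝒜 → G ∈ cc 𝒜 := fun 𝒜 h =>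
      Finset.mem_filter.2 ⟨Finset.mem_univ _, h⟩
    have hor : ∀ (𝒜 : Finset (SimpleGraph (Fin n))), G ∈ 𝒜 ∨ Gᶜ ∈ 𝒜 → G ∈ 𝒜 ∪ cc 𝒜 :=
      fun 𝒜 h => Finset.mem_union.2 (h.imp_right (hcc 𝒜))
    have hHG : ∀ (𝒜 : Finset (SimpleGraph (Fin n))), H ∈ 𝒜 ∨ Hᶜ ∈ 𝒜 → G ∈ 𝒜 ∪ cc 𝒜 := by
      intro 𝒜 h
      rcases hH with rfl | rfl
      · exact hor 𝒜 h
      · rw [compl_compl] at h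
        exact hor 𝒜 h.symm
    rcases hmem with h | h | h
    · exact Finset.mem_union_left _ (Finset.mem_union_left _ (hHG _ (Or.inl h)))
    · exact Finset.mem_union_left _ (Finset.mem_union_right _ (hHG _ (Or.inr h)))
    · exact Finset.mem_union_right _ (hHG _ (Or.inl h))
  have hcc : ∀ 𝒜, ((cc 𝒜).card : ℝ) = 𝒜.card := fun 𝒜 => by exact_mod_cast card_compl_mem 𝒜
  have h1 := hN 𝒩 (fun G hG => (Finset.mem_filter.1 hG).2)
  have h2 : ∀ c, ((ℱ c).card : ℝ) ≤ F := fun c =>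
    hF c (ℱ c) (fun G hG => (Finset.mem_filter.1 hG).2)
  have h3 := hD 𝒟 (fun G hG => (Finset.mem_filter.1 hG).2)
  have hun : ∀ 𝒜 ℬ : Finset (SimpleGraph (Fin n)),
      (((𝒜 ∪ ℬ : Finset (SimpleGraph (Fin n))).card : ℕ) : ℝ) ≤ 𝒜.card + ℬ.card := fun 𝒜 ℬ => by
    exact_mod_cast Finset.card_union_le 𝒜 ℬ
  have h4 := (Nat.cast_le (α := ℝ)).2 (Finset.card_le_card hsub)
  change (badCount n : ℝ) ≤ _ at h4
  have h5 := hun 𝒩 ((ℱ true ∪ cc (ℱ true)) ∪ (ℱ false ∪ cc (ℱ false)) ∪ (𝒟 ∪ cc 𝒟))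
  have h6 := hun ((ℱ true ∪ cc (ℱ true)) ∪ (ℱ false ∪ cc (ℱ false))) (𝒟 ∪ cc 𝒟)
  have h7 := hun (ℱ true ∪ cc (ℱ true)) (ℱ false ∪ cc (ℱ false))
  have h8 := hun (ℱ true) (cc (ℱ true))
  have h9 := hun (ℱ false) (cc (ℱ false))
  have h10 := hun 𝒟 (cc 𝒟)
  rw [hcc] at h8 h9 h10
  have := h2 true
  have := h2 false
  linarith

theorem eventually_pow_le_exp (C : ℝ) (k : ℕ) {c : ℝ} (hc : 0 < c) :
    ∀ᶠ n : ℕ in atTop, C * (n : ℝ) ^ k ≤ Real.exp (c * n) := by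
  have h := (isLittleO_pow_exp_pos_mul_atTop k hc).comp_tendsto tendsto_natCast_atTop_atTop
  filter_upwards [h.bound (show (0 : ℝ) < (|C| + 1)⁻¹ by positivity)] with n hn
  simp only [Function.comp, Real.norm_eq_abs, Real.abs_exp] at hn
  have h1 : |(n : ℝ) ^ k| = (n : ℝ) ^ k := abs_of_nonneg (by positivity)
  rw [h1, inv_mul_eq_div, le_div_iff₀ (by positivity)] at hn
  have h2 : C * (n : ℝ) ^ k ≤ (n : ℝ) ^ k * (|C| + 1) := by
    rw [mul_comm]
    exact mul_le_mul_of_nonneg_left (by linarith [le_abs_self C]) (by positivity)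
  linarith

theorem pathMatching_bound_le {n Q B₁ B₂ b q β : ℝ} (hQ : 0 ≤ Q)
    (hB₁0 : 0 ≤ B₁) (hB₂0 : 0 ≤ B₂) (hn : 0 ≤ n) (hb0 : 0 ≤ b)
    (h1 : 16 * n ^ 3 * (n + 2) ^ 3 ≤ Real.exp (1 / 1000000 * n))
    (hB₁ : B₁ ≤ Real.exp (1 / 1000000 * n)) (hB₂ : B₂ ≤ Real.exp (1 / 1000000 * n))
    (hb : b ≤ 31 * β * n) (hβ : β ≤ 1 / 10000000) (hq : n / 200 ≤ q) :
    4 * ((2 * n ^ 3) * (Q * ((2 * B₁) * (((n + 2) * B₂) ^ 3 *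
      (Real.exp (Real.log 2 * (3 / 2 * (n + 2 * b))) * Real.exp (-q / 64)))))) ≤
    Real.exp (-(1 / 50000) * n) * (Q * Real.exp (Real.log 2 * (3 / 2 * n))) := by
  have hl := Real.log_two_lt_d9
  have hl0 := Real.log_pos one_lt_two
  have hE : Real.exp (Real.log 2 * (3 / 2 * (n + 2 * b))) =
      Real.exp (Real.log 2 * (3 / 2 * n)) * Real.exp (Real.log 2 * (3 * b)) := by
    rw [← Real.exp_add]; congr 1; ring
  rw [hE]
  calc _ = (16 * n ^ 3 * (n + 2) ^ 3 * B₁ * B₂ ^ 3 * Real.exp (Real.log 2 * (3 * b)) *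
        Real.exp (-q / 64)) * (Q * Real.exp (Real.log 2 * (3 / 2 * n))) := by ring
    _ ≤ (Real.exp (1 / 1000000 * n) * Real.exp (1 / 1000000 * n) *
        Real.exp (1 / 1000000 * n) ^ 3 * Real.exp (Real.log 2 * (3 * b)) *
        Real.exp (-q / 64)) * (Q * Real.exp (Real.log 2 * (3 / 2 * n))) := by
        gcongr
    _ ≤ _ := by
        refine mul_le_mul_of_nonneg_right ?_ (by positivity)
        rw [← Real.exp_nat_mul, ← Real.exp_add, ← Real.exp_add, ← Real.exp_add, ← Real.exp_add,
          Real.exp_le_exp]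
        push_cast
        have h2 : Real.log 2 * (3 * b) ≤ 3 * b := by nlinarith
        have h3 : β * n ≤ 1 / 10000000 * n := mul_le_mul_of_nonneg_right hβ hn
        nlinarith

theorem degenerate_bound_le {n : ℕ} {k : ℕ} (hn : 1 ≤ n) (hk : (k : ℝ) ≤ n / 90)
    (hl : 20 ≤ Real.log n) (h1 : 8 * (n : ℝ) ^ 2 ≤ Real.exp (1 * n)) :
    (2 : ℝ) ^ n * 2 * ((n + 1) * n ^ (2 * k)) ^ 2 * Real.exp (Real.log 2 * (n ^ 2 / 4)) ≤
    Real.exp (-n) * Real.exp (Real.log 2 * (n ^ 2 / 4) + 1 / 5 * (n * Real.log n)) := by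
  have hn' : (1 : ℝ) ≤ n := by exact_mod_cast hn
  have h2 : (2 : ℝ) ^ n ≤ Real.exp n := by
    rw [← Real.exp_one_rpow, Real.rpow_natCast]
    exact pow_le_pow_left₀ (by norm_num) (by linarith [Real.add_one_le_exp 1]) n
  have h3 : ((n : ℝ) ^ (2 * k)) ^ 2 = Real.exp (4 * k * Real.log n) := by
    rw [← pow_mul, show 2 * k * 2 = 4 * k by ring]
    rw [show (4 * (k : ℝ)) * Real.log n = ((4 * k : ℕ) : ℝ) * Real.log n by push_cast; ring,
      Real.exp_nat_mul, Real.exp_log (by linarith)]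
  have h4 : 2 * ((n : ℝ) + 1) ^ 2 ≤ Real.exp n := by
    rw [one_mul] at h1
    nlinarith
  calc _ = (2 : ℝ) ^ n * (2 * ((n : ℝ) + 1) ^ 2) * ((n : ℝ) ^ (2 * k)) ^ 2 *
        Real.exp (Real.log 2 * (n ^ 2 / 4)) := by ring
    _ ≤ Real.exp n * Real.exp n * Real.exp (4 * k * Real.log n) *
        Real.exp (Real.log 2 * (n ^ 2 / 4)) := by
        rw [h3]; gcongr
    _ ≤ _ := by
        rw [← Real.exp_add, ← Real.exp_add, ← Real.exp_add, ← Real.exp_add, Real.exp_le_exp]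
        have h5 : (k : ℝ) * Real.log n ≤ n / 90 * Real.log n :=
          mul_le_mul_of_nonneg_right hk (by linarith)
        nlinarith

theorem nontypical_bound_le {n : ℕ} {c : ℝ} (h : 1 ≤ c * n) :
    Real.exp (Real.log 2 * n ^ 2 / 4 - c * n ^ 2) ≤
    Real.exp (-n) * Real.exp (Real.log 2 * (n ^ 2 / 4) + 1 / 5 * (n * Real.log n)) := by
  rw [← Real.exp_add, Real.exp_le_exp]
  have h1 : 0 ≤ (n : ℝ) * Real.log n := mul_nonneg n.cast_nonneg (Real.log_natCast_nonneg n)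
  have h2 : (n : ℝ) * 1 ≤ n * (c * n) := mul_le_mul_of_nonneg_left h n.cast_nonneg
  nlinarith

theorem eventually_badCount_le : ∃ δ : ℝ, 0 < δ ∧ ∀ᶠ n : ℕ in atTop,
    (badCount n : ℝ) ≤ Real.exp (-δ * n) *
      (arrCount n + c5FreeCount (n - 3) * Real.exp (Real.log 2 * (3 / 2 * n))) := by
  obtain ⟨γ, hγ, hball⟩ := exists_ball_le (show (0 : ℝ) < 1 / 1000000 by norm_num)
  set β := min (γ / 200) (1 / 10000000) with hβdef
  have hβ : 0 < β := lt_min (by positivity) (by norm_num)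
  have hβ1 : β ≤ 1 / 10000000 := min_le_right _ _
  have hβγ : β ≤ γ / 200 := min_le_left _ _
  obtain ⟨c, hc, hN⟩ := card_nontypical_le hβ (hβ1.trans (by norm_num))
  refine ⟨1 / 50000, by norm_num, ?_⟩
  have hlin : ∀ (C : ℝ) {a : ℝ}, 0 < a → ∀ᶠ n : ℕ in atTop, C ≤ a * n := fun C a ha =>
    (tendsto_natCast_atTop_atTop.const_mul_atTop ha).eventually_ge_atTop C
  filter_upwards [hN, eventually_le_arrCount, hlin 30 hβ, hlin 1 hc,
    eventually_pow_le_exp (16 * 27) 6 (show (0 : ℝ) < 1 / 1000000 by norm_num),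
    eventually_pow_le_exp 8 2 one_pos, eventually_ge_atTop 10000,
    (Real.tendsto_log_atTop.comp tendsto_natCast_atTop_atTop).eventually_ge_atTop 20]
    with n hN hL h30 hc1 hexp hexp2 hn hl
  have hn' : (10000 : ℝ) ≤ n := by exact_mod_cast hn
  set b := ⌈β * n⌉₊ with hb
  set q := ⌈(n : ℝ) / 200⌉₊ with hq
  have hb1 : 1 ≤ b := Nat.ceil_pos.2 (by linarith)
  have hbu : (b : ℝ) ≤ β * n + 1 := (Nat.ceil_lt_add_one (by positivity)).le
  have hqu : (q : ℝ) ≤ n / 200 + 1 := (Nat.ceil_lt_add_one (by positivity)).le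
  have hql : (n : ℝ) / 200 ≤ q := Nat.le_ceil _
  have hβn : β * n ≤ 1 / 10000000 * n := mul_le_mul_of_nonneg_right hβ1 (by linarith)
  have hβγn : β * n ≤ γ / 200 * n := mul_le_mul_of_nonneg_right hβγ (by linarith)
  have hBu : ((30 * b : ℕ) : ℝ) ≤ 31 * β * n := by push_cast; linarith
  have hbn : 18 * b ≤ n := by
    have : (18 : ℝ) * b ≤ n := by linarith
    exact_mod_cast this
  have hbig : 8 * q + 4 * (30 * b) + 8 ≤ n := by
    have : (8 : ℝ) * q + 4 * (30 * b) + 8 ≤ n := by linarith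
    exact_mod_cast this
  have key := badCount_le (q := q) hb hb1 hbn hN
    (fun cc 𝒢 h𝒢 => card_pathMatching_le (q := q) (b := 30 * b) (c := cc) 𝒢 h𝒢)
    (fun 𝒢 h𝒢 => card_degenerate_le hbig 𝒢 h𝒢)
  have hF := pathMatching_bound_le (n := n) (Q := c5FreeCount (n - 3))
    (B₁ := ball n (6 * (30 * b) + 6)) (B₂ := ball n (30 * b)) (b := (30 * b : ℕ)) (q := q) (β := β)
    (by positivity) (by positivity) (by positivity) (by positivity) (by positivity) (by
      have h3 : (n : ℝ) + 2 ≤ 3 * n := by linarith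
      calc 16 * (n : ℝ) ^ 3 * (n + 2) ^ 3 ≤ 16 * (n : ℝ) ^ 3 * (3 * n) ^ 3 := by gcongr
        _ = 16 * 27 * (n : ℝ) ^ 6 := by ring
        _ ≤ _ := hexp)
    (hball _ _ (by push_cast at hBu ⊢; linarith)) (hball _ _ (by push_cast at hBu ⊢; linarith))
    hBu hβ1 hql
  have hD := degenerate_bound_le (n := n) (k := 30 * b + 2 * q) (by omega)
    (by push_cast at hBu ⊢; linarith) hl hexp2
  have hNt := nontypical_bound_le (n := n) (c := c) hc1
  have hexpL := mul_le_mul_of_nonneg_left hL (Real.exp_pos (-(n : ℝ))).le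
  have h3 : 3 * Real.exp (-(n : ℝ)) ≤ Real.exp (-(1 / 50000) * n) := by
    have h4 : (3 : ℝ) ≤ Real.exp (n / 2) := by linarith [Real.add_one_le_exp ((n : ℝ) / 2)]
    calc 3 * Real.exp (-(n : ℝ)) ≤ Real.exp (n / 2) * Real.exp (-(n : ℝ)) := by gcongr
      _ ≤ _ := by rw [← Real.exp_add, Real.exp_le_exp]; linarith
  have h5 := mul_le_mul_of_nonneg_right h3 (Nat.cast_nonneg (α := ℝ) (arrCount n))
  rw [mul_add]
  linarith

theorem card_uni_le (n : ℕ) :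
    (Finset.univ.filter fun G : SimpleGraph (Fin n) => ∃ C : Set (Fin n), Uni G C).card ≤
      arrCount n := by
  rw [← card_arr]
  refine (Finset.card_le_card (t := Finset.univ.image (Arr.graph (n := n))) ?_).trans
    Finset.card_image_le
  intro G hG
  obtain ⟨C, hC⟩ := (Finset.mem_filter.1 hG).2
  obtain ⟨a, -, ha⟩ := exists_arr_of_uni hC
  exact Finset.mem_image.2 ⟨a, Finset.mem_univ _, ha⟩

theorem c5FreeCount_le (n : ℕ) : c5FreeCount n ≤ 2 * arrCount n + badCount n := by
  let U := Finset.univ.filter fun G : SimpleGraph (Fin n) => ∃ C : Set (Fin n), Uni G C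
  let U' := Finset.univ.filter fun G : SimpleGraph (Fin n) => Gᶜ ∈ U
  let B := Finset.univ.filter fun G : SimpleGraph (Fin n) => ¬ HasC5 G ∧
    (¬ ∃ C : Set (Fin n), Uni G C) ∧ ¬ ∃ C : Set (Fin n), Uni Gᶜ C
  have hsub : (Finset.univ.filter fun G : SimpleGraph (Fin n) => ¬ HasC5 G) ⊆ (U ∪ U') ∪ B := by
    intro G hG
    by_cases h1 : G ∈ U
    · exact Finset.mem_union_left _ (Finset.mem_union_left _ h1)
    by_cases h2 : Gᶜ ∈ U
    · exact Finset.mem_union_left _ (Finset.mem_union_right _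
        (Finset.mem_filter.2 ⟨Finset.mem_univ _, h2⟩))
    · exact Finset.mem_union_right _ (Finset.mem_filter.2 ⟨Finset.mem_univ _,
        (Finset.mem_filter.1 hG).2,
        fun h => h1 (Finset.mem_filter.2 ⟨Finset.mem_univ _, h⟩),
        fun h => h2 (Finset.mem_filter.2 ⟨Finset.mem_univ _, h⟩)⟩)
  have h1 := Finset.card_le_card hsub
  have h2 := Finset.card_union_le (U ∪ U') B
  have h3 := Finset.card_union_le U U'
  have h4 : U.card ≤ arrCount n := card_uni_le n
  have h5 : U'.card = U.card := card_compl_mem U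
  have h6 : B.card = badCount n := rfl
  have h7 : c5FreeCount n ≤ (U ∪ U' ∪ B).card := h1
  omega

theorem arrCount_add_three_ge (n : ℕ) :
    Real.exp (Real.log 2 * (3 / 2 * (n + 3 : ℕ))) * arrCount n ≤ 8 * arrCount (n + 3) := by
  have h1 := arrCount_succ_ge n
  have h2 := arrCount_succ_ge (n + 1)
  have h3 := arrCount_succ_ge (n + 2)
  have e2 := (Real.exp_pos (Real.log 2 * ((n + 1 : ℕ) / 2))).le
  have e3 := (Real.exp_pos (Real.log 2 * ((n + 2 : ℕ) / 2))).le
  have h4 := (mul_le_mul_of_nonneg_left ((mul_le_mul_of_nonneg_left h1 e2).trans h2) e3).trans h3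
  have h8 : Real.exp (Real.log 2 * 3) = 8 := by
    rw [show Real.log 2 * 3 = ((3 : ℕ) : ℝ) * Real.log 2 by push_cast; ring, Real.exp_nat_mul,
      Real.exp_log two_pos]; norm_num
  have h9 : Real.exp (Real.log 2 * (3 / 2 * (n + 3 : ℕ))) =
      8 * (Real.exp (Real.log 2 * ((n + 2 : ℕ) / 2)) * (Real.exp (Real.log 2 * ((n + 1 : ℕ) / 2)) *
        Real.exp (Real.log 2 * (n / 2)))) := by
    rw [← h8, ← Real.exp_add, ← Real.exp_add, ← Real.exp_add]
    congr 1; push_cast; ring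
  rw [h9]
  calc _ = 8 * (Real.exp (Real.log 2 * ((n + 2 : ℕ) / 2)) *
        (Real.exp (Real.log 2 * ((n + 1 : ℕ) / 2)) *
        (Real.exp (Real.log 2 * (n / 2)) * arrCount n))) := by ring
    _ ≤ _ := mul_le_mul_of_nonneg_left h4 (by norm_num)

theorem exists_badCount_le : ∃ δ : ℝ, 0 < δ ∧ ∃ K : ℝ, 0 < K ∧ ∀ᶠ n : ℕ in atTop,
    (badCount n : ℝ) ≤ K * Real.exp (-δ * n) * arrCount n := by
  obtain ⟨δ, hδ, hbad⟩ := eventually_badCount_le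
  have hsmall : ∀ᶠ n : ℕ in atTop, Real.exp (-δ * n) ≤ 1 / 16 := by
    have : Tendsto (fun n : ℕ => Real.exp (-δ * n)) atTop (nhds 0) :=
      Real.tendsto_exp_atBot.comp
        ((tendsto_natCast_atTop_atTop (R := ℝ)).const_mul_atTop_of_neg (by linarith))
    exact this.eventually_le_const (by norm_num)
  have hbad' : ∀ᶠ n : ℕ in atTop, (badCount n : ℝ) ≤ Real.exp (-δ * n) *
      (1 + 8 * (c5FreeCount (n - 3) / arrCount (n - 3))) * arrCount n := by
    filter_upwards [hbad, eventually_ge_atTop 3] with n hn h3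
    refine hn.trans ?_
    rw [mul_assoc]
    refine mul_le_mul_of_nonneg_left ?_ (Real.exp_pos _).le
    have h := arrCount_add_three_ge (n - 3)
    rw [show n - 3 + 3 = n by omega] at h
    have hp : (0 : ℝ) < arrCount (n - 3) := by exact_mod_cast arrCount_pos _
    have hQ : (0 : ℝ) ≤ c5FreeCount (n - 3) / arrCount (n - 3) := by positivity
    have h' := mul_le_mul_of_nonneg_left h hQ
    have e : (c5FreeCount (n - 3) / arrCount (n - 3) : ℝ) *
      (Real.exp (Real.log 2 * (3 / 2 * n)) * arrCount (n - 3)) =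
      c5FreeCount (n - 3) * Real.exp (Real.log 2 * (3 / 2 * n)) := by field_simp
    rw [e] at h'
    linarith
  obtain ⟨N, hN⟩ := eventually_atTop.1 (hbad'.and hsmall)
  set R : ℕ → ℝ := fun n => c5FreeCount n / arrCount n with hR
  have hR0 : ∀ n, 0 ≤ R n := fun n => by positivity
  obtain ⟨K, hK6, hK⟩ : ∃ K : ℝ, 6 ≤ K ∧ ∀ n < N + 3, R n ≤ K := by
    refine ⟨6 + ∑ n ∈ Finset.range (N + 3), R n, ?_, fun n hn => ?_⟩
    · linarith [Finset.sum_nonneg fun n (_ : n ∈ Finset.range (N + 3)) => hR0 n]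
    · linarith [Finset.single_le_sum (fun n _ => hR0 n) (Finset.mem_range.2 hn)]
  have hall : ∀ n, R n ≤ K := by
    intro n
    induction n using Nat.strong_induction_on with
    | _ n ih =>
      by_cases hn : n < N + 3
      · exact hK n hn
      obtain ⟨h1, h2⟩ := hN n (by omega)
      have h3 : R (n - 3) ≤ K := ih _ (by omega)
      have hp : (0 : ℝ) < arrCount n := by exact_mod_cast arrCount_pos _
      have h4 : (c5FreeCount n : ℝ) ≤ 2 * arrCount n + badCount n := by
        exact_mod_cast c5FreeCount_le n
      change (badCount n : ℝ) ≤ Real.exp (-δ * n) * (1 + 8 * R (n - 3)) * arrCount n at h1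
      have h5 : Real.exp (-δ * n) * (1 + 8 * R (n - 3)) * arrCount n ≤
          1 / 16 * (1 + 8 * K) * arrCount n := by gcongr
      simp only [hR]
      rw [div_le_iff₀ hp]
      nlinarith
  refine ⟨δ, hδ, 1 + 8 * K, by linarith, ?_⟩
  filter_upwards [hbad'] with n hn
  refine hn.trans ?_
  rw [mul_comm (1 + 8 * K)]
  have := hall (n - 3)
  gcongr

/-! ### A Gaussian approximation for the number of blocks of a random set partition -/

theorem sub_le_of_steps {f : ℕ → ℝ} {B : ℝ} {i j : ℕ} (hij : i ≤ j)
    (h : ∀ k, i ≤ k → k < j → f (k + 1) - f k ≤ B) : f j - f i ≤ B * ((j : ℝ) - i) := by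
  induction j, hij using Nat.le_induction with
  | base => simp
  | succ j hij ih =>
    have h1 := ih fun k hk hk' => h k hk (by omega)
    have h2 := h j hij (by omega)
    push_cast
    linarith

/-- The index nearest below the point at `x` standard deviations from the centre. -/
def stepIdx (c σ x : ℝ) : ℕ := ⌊c + σ * x⌋₊

/-- Log-weights `lam p` whose increments are decreasing and asymptotically linear near `c p` on
the scale `σ p`. -/
structure IsLaplace {ι : Type*} (l : Filter ι) (lam : ι → ℕ → ℝ) (c σ : ι → ℝ) : Prop where
  scale : Tendsto σ l atTop
  centre : Tendsto (fun p => c p / σ p) l atTop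
  anti : ∀ᶠ p in l, Antitone fun i => lam p (i + 1) - lam p i
  unif : ∀ R ε : ℝ, 0 < ε → ∀ᶠ p in l, ∀ i : ℕ, |(i : ℝ) - c p| ≤ R * σ p →
    |lam p (i + 1) - lam p i + ((i : ℝ) - c p) / σ p ^ 2| ≤ ε / σ p

theorem abs_quadratic_le {lam : ℕ → ℝ} {c σ R ε : ℝ} (hσ : 0 < σ)
    (h : ∀ i : ℕ, |(i : ℝ) - c| ≤ R * σ → |lam (i + 1) - lam i + ((i : ℝ) - c) / σ ^ 2| ≤ ε / σ)
    {i j : ℕ} (hi : |(i : ℝ) - c| ≤ R * σ) (hj : |(j : ℝ) - c| ≤ R * σ) :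
    |(lam j + (((j : ℝ) - c) ^ 2 - (j - c)) / (2 * σ ^ 2)) -
      (lam i + (((i : ℝ) - c) ^ 2 - (i - c)) / (2 * σ ^ 2))| ≤ ε / σ * |(j : ℝ) - i| := by
  have key : ∀ {i j : ℕ}, |(i : ℝ) - c| ≤ R * σ → |(j : ℝ) - c| ≤ R * σ → i ≤ j →
      |(lam j + (((j : ℝ) - c) ^ 2 - (j - c)) / (2 * σ ^ 2)) -
      (lam i + (((i : ℝ) - c) ^ 2 - (i - c)) / (2 * σ ^ 2))| ≤ ε / σ * |(j : ℝ) - i| := by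
    intro i j hi hj hij
    set f : ℕ → ℝ := fun j => lam j + (((j : ℝ) - c) ^ 2 - (j - c)) / (2 * σ ^ 2) with hf
    have hstep : ∀ k, i ≤ k → k < j → |f (k + 1) - f k| ≤ ε / σ := by
      intro k hk hk'
      have h1 : (i : ℝ) ≤ k := by exact_mod_cast hk
      have h2 : (k : ℝ) ≤ j := by exact_mod_cast hk'.le
      have h3 := h k (abs_le.2 ⟨by linarith [(abs_le.1 hi).1], by linarith [(abs_le.1 hj).2]⟩)
      have : f (k + 1) - f k = lam (k + 1) - lam k + ((k : ℝ) - c) / σ ^ 2 := by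
        simp only [hf]; push_cast; field_simp; ring
      rwa [this]
    have hij' : (i : ℝ) ≤ j := by exact_mod_cast hij
    rw [abs_of_nonneg (sub_nonneg.2 hij'), abs_le]
    have h4 := sub_le_of_steps hij fun k hk hk' => (abs_le.1 (hstep k hk hk')).2
    have h5 := sub_le_of_steps (f := fun k => - f k) hij fun k hk hk' =>
      show -f (k + 1) - -f k ≤ ε / σ by linarith [(abs_le.1 (hstep k hk hk')).1]
    exact ⟨by linarith, by linarith⟩
  rcases le_total i j with hij | hij
  · exact key hi hj hij
  · rw [abs_sub_comm, abs_sub_comm (j : ℝ)]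
    exact key hj hi hij

theorem exp_bound_of_antitone {lam : ℕ → ℝ} {c σ : ℝ} (hσ : 2 ≤ σ) (hc : 0 ≤ c)
    (hanti : Antitone fun i => lam (i + 1) - lam i)
    (h : ∀ i : ℕ, |(i : ℝ) - c| ≤ 3 * σ →
      |lam (i + 1) - lam i + ((i : ℝ) - c) / σ ^ 2| ≤ (1 / 4) / σ) (j : ℕ) :
    lam j - lam ⌊c⌋₊ ≤ 12 - |(j : ℝ) - c| / (2 * σ) := by
  have hσ0 : 0 < σ := by linarith
  have hfl := Nat.floor_le hc
  have hfl' := Nat.lt_floor_add_one c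
  have habs : ∀ i : ℕ, |(i : ℝ) - c| ≤ 3 * σ → |lam (i + 1) - lam i| ≤ 4 / σ := by
    intro i hi
    have h1 := h i hi
    have h2 : |((i : ℝ) - c) / σ ^ 2| ≤ 3 / σ := by
      rw [abs_div, abs_of_pos (by positivity : 0 < σ ^ 2), div_le_div_iff₀ (by positivity) hσ0]
      nlinarith
    have h3 : (1 / 4) / σ + 3 / σ ≤ 4 / σ := by rw [← add_div]; gcongr; norm_num
    rw [abs_le] at h1 h2 ⊢
    exact ⟨by linarith, by linarith⟩
  have hhalf : 1 / (2 * σ) = (1 / 2) / σ := by field_simp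
  have hdiv : ∀ x : ℝ, x / (2 * σ) = (1 / 2) / σ * x := fun x => by field_simp
  have hq : ((1 : ℝ) / 2) / σ * 1 ≤ 1 := by
    rw [mul_one, div_le_one hσ0]; linarith
  rcases le_total ⌊c⌋₊ j with hj | hj
  · set i₁ := ⌈c + σ⌉₊ with hi₁
    have hi₁l := Nat.le_ceil (c + σ)
    have hi₁u := (Nat.ceil_lt_add_one (show 0 ≤ c + σ by linarith)).le
    have hlate : ∀ i, i₁ ≤ i → lam (i + 1) - lam i ≤ - ((1 / 2) / σ) := by
      intro i hi
      have h1 := hanti hi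
      have h2 := h i₁ (abs_le.2 ⟨by linarith, by linarith⟩)
      have h3 : 1 / σ ≤ ((i₁ : ℝ) - c) / σ ^ 2 := by
        rw [div_le_div_iff₀ hσ0 (by positivity)]; nlinarith
      have h4 : (1 / 4) / σ - 1 / σ ≤ - ((1 / 2) / σ) := by
        rw [← sub_div, ← neg_div]; gcongr; norm_num
      simp only at h1
      linarith [(abs_le.1 h2).2]
    set f : ℕ → ℝ := fun j => lam j + (1 / 2) / σ * j with hf
    have hfj : f j - f ⌊c⌋₊ ≤ 10 := by
      have hle : ⌊c⌋₊ ≤ i₁ := by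
        have : (⌊c⌋₊ : ℝ) ≤ i₁ := by linarith
        exact_mod_cast this
      have early : ∀ j', ⌊c⌋₊ ≤ j' → j' ≤ i₁ → f j' - f ⌊c⌋₊ ≤ 10 := by
        intro j' h0 h1
        have h1' : (j' : ℝ) ≤ i₁ := by exact_mod_cast h1
        have h2 := sub_le_of_steps (f := f) (B := 5 / σ) h0 (by
          intro k hk hk'
          have hk1 : (⌊c⌋₊ : ℝ) ≤ k := by exact_mod_cast hk
          have hk2 : (k : ℝ) + 1 ≤ i₁ := by exact_mod_cast (by omega : k + 1 ≤ i₁)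
          have h3 := (abs_le.1 (habs k (abs_le.2 ⟨by linarith, by linarith⟩))).2
          have h4 : 4 / σ + (1 / 2) / σ ≤ 5 / σ := by rw [← add_div]; gcongr; norm_num
          simp only [hf]; push_cast; linarith)
        have h5 : 5 / σ * ((j' : ℝ) - ⌊c⌋₊) ≤ 5 / σ * (2 * σ) := by
          gcongr; linarith
        have h6 : 5 / σ * (2 * σ) = 10 := by field_simp; norm_num
        linarith
      rcases le_total j i₁ with h1 | h1
      · exact early j hj h1
      · have h2 := sub_le_of_steps (f := f) (B := 0) h1 (by
          intro k hk _
          have := hlate k hk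
          simp only [hf]; push_cast; linarith)
        have := early i₁ hle le_rfl
        linarith
    have hj' : (⌊c⌋₊ : ℝ) ≤ j := by exact_mod_cast hj
    have h7 : |(j : ℝ) - c| ≤ j - ⌊c⌋₊ + 1 := abs_le.2 ⟨by linarith, by linarith⟩
    rw [hdiv]
    have h8 : (1 / 2) / σ * |(j : ℝ) - c| ≤ (1 / 2) / σ * (j - ⌊c⌋₊ + 1) := by gcongr
    simp only [hf] at hfj
    linarith
  · set f : ℕ → ℝ := fun j => -(lam j - (1 / 2) / σ * j) with hf
    have hfj : f ⌊c⌋₊ - f j ≤ 10 := by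
      have hstep : ∀ k, k < ⌊c⌋₊ → (c - 2 * σ ≤ k → f (k + 1) - f k ≤ 5 / σ) ∧
          ((k : ℝ) < c - 2 * σ → f (k + 1) - f k ≤ 0) := by
        intro k hk
        have hk2 : (k : ℝ) + 1 ≤ ⌊c⌋₊ := by exact_mod_cast (by omega : k + 1 ≤ ⌊c⌋₊)
        refine ⟨fun hk1 => ?_, fun hk1 => ?_⟩
        · have h3 := (abs_le.1 (habs k (abs_le.2 ⟨by linarith, by linarith⟩))).1
          have h4 : 4 / σ + (1 / 2) / σ ≤ 5 / σ := by rw [← add_div]; gcongr; norm_num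
          simp only [hf]; push_cast; linarith
        · have hcs : 0 ≤ c - σ := by linarith [Nat.cast_nonneg (α := ℝ) k]
          have hi₂ := Nat.floor_le hcs
          have hi₂' := Nat.lt_floor_add_one (c - σ)
          have hk3 : k ≤ ⌊c - σ⌋₊ := Nat.le_floor (by linarith)
          have h1 := hanti hk3
          have h2 := h ⌊c - σ⌋₊ (abs_le.2 ⟨by linarith, by linarith⟩)
          have h3 : ((⌊c - σ⌋₊ : ℝ) - c) / σ ^ 2 ≤ - (1 / σ) := by
            rw [← neg_div, div_le_div_iff₀ (by positivity) hσ0]; nlinarith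
          have h4 : (1 / 4) / σ - 1 / σ ≤ - ((1 / 2) / σ) := by
            rw [← sub_div, ← neg_div]; gcongr; norm_num
          simp only at h1
          simp only [hf]; push_cast
          linarith [(abs_le.1 h2).1]
      set i₂ := ⌈c - 2 * σ⌉₊ with hi₂
      have late : ∀ j', i₂ ≤ j' → j' ≤ ⌊c⌋₊ → f ⌊c⌋₊ - f j' ≤ 10 := by
        intro j' h0 h1
        have h0' : c - 2 * σ ≤ j' := (Nat.le_ceil _).trans (by exact_mod_cast h0)
        have h2 := sub_le_of_steps (f := f) (B := 5 / σ) h1 (by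
          intro k hk hk'
          have hk1 : (j' : ℝ) ≤ k := by exact_mod_cast hk
          have := (hstep k hk').1 (by linarith)
          linarith)
        refine h2.trans ?_
        have h5 : 5 / σ * ((⌊c⌋₊ : ℝ) - j') ≤ 5 / σ * (2 * σ) := by
          gcongr; linarith
        have h6 : 5 / σ * (2 * σ) = 10 := by field_simp; norm_num
        linarith
      rcases le_total i₂ j with h1 | h1
      · exact late j h1 hj
      · have hi₂c : i₂ ≤ ⌊c⌋₊ ∨ ⌊c⌋₊ ≤ i₂ := le_total _ _
        have early : ∀ j', j ≤ j' → j' ≤ i₂ → j' ≤ ⌊c⌋₊ → f j' - f j ≤ 0 := by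
          intro j' h0 h2 h3
          have h4 := sub_le_of_steps (f := f) (B := 0) h0 (by
            intro k hk hk'
            exact (hstep k (by omega)).2 (Nat.lt_ceil.1 (by omega)))
          linarith
        rcases hi₂c with h2 | h2
        · have := late i₂ le_rfl h2
          have := early i₂ h1 le_rfl h2
          linarith
        · linarith [early ⌊c⌋₊ hj h2 le_rfl]
    have hj' : (j : ℝ) ≤ ⌊c⌋₊ := by exact_mod_cast hj
    have h7 : |(j : ℝ) - c| ≤ ⌊c⌋₊ - j + 1 := abs_le.2 ⟨by linarith, by linarith⟩
    rw [hdiv]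
    have h8 : (1 / 2) / σ * |(j : ℝ) - c| ≤ (1 / 2) / σ * (⌊c⌋₊ - j + 1) := by gcongr
    simp only [hf] at hfj
    linarith

section gaussian_limit

open MeasureTheory

theorem exp_neg_mul_pow_le (y : ℝ) :
    Real.exp (-|y| / 2) * (1 + y ^ 8) ≤ (1 + 40320 * 4 ^ 8) * Real.exp (-|y| / 4) := by
  have h1 : (|y| / 4) ^ 8 / (Nat.factorial 8 : ℝ) ≤ Real.exp (|y| / 4) :=
    Real.pow_div_factorial_le_exp _ (by positivity) 8
  have h2 : y ^ 8 ≤ 40320 * 4 ^ 8 * Real.exp (|y| / 4) := by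
    have : (|y| / 4) ^ 8 = y ^ 8 / 4 ^ 8 := by
      rw [div_pow, show |y| ^ 8 = (|y| ^ 2) ^ 4 by ring, sq_abs]; ring
    rw [this, show (Nat.factorial 8 : ℝ) = 40320 by norm_num [Nat.factorial]] at h1
    rw [div_div, div_le_iff₀ (by norm_num)] at h1
    linarith
  have h3 : 1 ≤ Real.exp (|y| / 4) := Real.one_le_exp (by positivity)
  calc _ ≤ Real.exp (-|y| / 2) * ((1 + 40320 * 4 ^ 8) * Real.exp (|y| / 4)) := by
        gcongr; linarith
    _ = (1 + 40320 * 4 ^ 8) * (Real.exp (-|y| / 2) * Real.exp (|y| / 4)) := by ring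
    _ = _ := by rw [← Real.exp_add]; congr 2; ring

theorem integrable_exp_neg_abs_div_four : Integrable fun x : ℝ => Real.exp (-|x| / 4) := by
  refine (integrable_inv_one_add_sq.const_mul 33).mono' (by fun_prop) (ae_of_all _ fun x => ?_)
  rw [Real.norm_of_nonneg (Real.exp_pos _).le]
  have h1 := Real.quadratic_le_exp_of_nonneg (x := |x| / 4) (by positivity)
  have h2 : Real.exp (-|x| / 4) = (Real.exp (|x| / 4))⁻¹ := by rw [← Real.exp_neg]; congr 1; ring
  have h3 : 1 + x ^ 2 ≤ 33 * Real.exp (|x| / 4) := by nlinarith [sq_abs x, abs_nonneg x]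
  rw [h2, ← div_eq_mul_inv, inv_eq_one_div, div_le_div_iff₀ (Real.exp_pos _) (by positivity)]
  linarith

theorem stepIdx_sub_div {c σ x : ℝ} (hσ : 0 < σ) (h : -c / σ ≤ x) :
    ((stepIdx c σ x : ℝ) - c) / σ ≤ x ∧ x ≤ ((stepIdx c σ x : ℝ) - c) / σ + 1 / σ := by
  have h0 : 0 ≤ c + σ * x := by rw [div_le_iff₀ hσ] at h; linarith
  have h1 := Nat.floor_le h0
  have h2 := Nat.lt_floor_add_one (c + σ * x)
  rw [← add_div, div_le_iff₀ hσ, le_div_iff₀ hσ, stepIdx]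
  exact ⟨by linarith, by linarith⟩

theorem hasSum_of_integrable_step {c σ : ℝ} (hσ : 0 < σ) {H : ℕ → ℝ}
    (hint : IntegrableOn (fun x => H (stepIdx c σ x)) (Set.Ici (-c / σ))) :
    HasSum (fun j => H j / σ) (∫ x in Set.Ici (-c / σ), H (stepIdx c σ x)) := by
  set s : ℕ → Set ℝ := fun j => Set.Ico ((j - c) / σ) ((j + 1 - c) / σ) with hs
  have hmem : ∀ (j : ℕ) (x : ℝ), x ∈ s j ↔ -c / σ ≤ x ∧ stepIdx c σ x = j := by
    intro j x
    simp only [hs, Set.mem_Ico]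
    rw [div_le_iff₀ hσ, lt_div_iff₀ hσ, div_le_iff₀ hσ, stepIdx]
    constructor
    · rintro ⟨h1, h2⟩
      have h0 : 0 ≤ c + σ * x := by linarith [Nat.cast_nonneg (α := ℝ) j]
      exact ⟨by linarith, (Nat.floor_eq_iff h0).2 ⟨by linarith, by linarith⟩⟩
    · rintro ⟨h1, h2⟩
      have := (Nat.floor_eq_iff (by linarith)).1 h2
      exact ⟨by linarith, by linarith⟩
  have hU : (⋃ j, s j) = Set.Ici (-c / σ) := by
    ext x
    simp [hmem]
  have hd : Pairwise (Function.onFun Disjoint s) := by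
    intro i j hij
    rw [Function.onFun, Set.disjoint_left]
    intro x hi hj
    exact hij (((hmem i x).1 hi).2.symm.trans ((hmem j x).1 hj).2)
  have h := hasSum_integral_iUnion (f := fun x => H (stepIdx c σ x))
    (fun j => (measurableSet_Ico : MeasurableSet (s j))) hd (by rwa [hU])
  rw [hU] at h
  have e : ∀ j : ℕ, (∫ x in s j, H (stepIdx c σ x)) = H j / σ := by
    intro j
    rw [setIntegral_congr_fun (g := fun _ => H j) measurableSet_Ico fun x hx => by
      simp only [((hmem j x).1 hx).2]]
    have hle : (j - c) / σ ≤ (j + 1 - c) / σ := by gcongr; linarith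
    rw [setIntegral_const, Measure.real, Real.volume_Ico, ENNReal.toReal_ofReal (by linarith),
      smul_eq_mul]
    field_simp
    ring
  exact (funext e) ▸ h

variable {ι : Type*} {l : Filter ι} {lam : ι → ℕ → ℝ} {c σ : ι → ℝ}

theorem IsLaplace.tendsto_weight (h : IsLaplace l lam c σ) {j : ι → ℕ} {x : ℝ}
    (hj : Tendsto (fun p => ((j p : ℝ) - c p) / σ p) l (nhds x)) :
    Tendsto (fun p => lam p (j p) - lam p ⌊c p⌋₊) l (nhds (-x ^ 2 / 2)) := by
  have hinv : Tendsto (fun p => 1 / σ p) l (nhds 0) :=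
    tendsto_const_nhds.div_atTop h.scale
  have hpos : ∀ᶠ p in l, 1 ≤ σ p ∧ 0 ≤ c p := by
    filter_upwards [h.scale.eventually_ge_atTop 1, h.centre.eventually_ge_atTop 0] with p h1 h2
    refine ⟨h1, ?_⟩
    by_contra hc
    push Not at hc
    exact absurd h2 (not_le.2 (div_neg_of_neg_of_pos hc (by linarith)))
  have hfl : Tendsto (fun p => ((⌊c p⌋₊ : ℝ) - c p) / σ p) l (nhds 0) := by
    refine squeeze_zero_norm' ?_ hinv
    filter_upwards [hpos] with p ⟨h1, h2⟩
    have h3 := Nat.floor_le h2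
    have h4 := Nat.lt_floor_add_one (c p)
    rw [Real.norm_eq_abs, abs_div, abs_of_pos (by linarith : 0 < σ p)]
    gcongr
    exact abs_le.2 ⟨by linarith, by linarith⟩
  have hmain : Tendsto (fun p => (lam p (j p) + (((j p : ℝ) - c p) ^ 2 - (j p - c p)) /
      (2 * σ p ^ 2)) - (lam p ⌊c p⌋₊ + (((⌊c p⌋₊ : ℝ) - c p) ^ 2 - (⌊c p⌋₊ - c p)) /
      (2 * σ p ^ 2))) l (nhds 0) := by
    rw [Metric.tendsto_nhds]
    intro ε hε
    set R := |x| + 2 with hR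
    have hR2 : 2 ≤ R := by simp [hR]
    have hδ : 0 < ε / (4 * R) := by positivity
    filter_upwards [hpos, h.unif R _ hδ, (Metric.tendsto_nhds.1 hj) 1 one_pos,
      h.scale.eventually_ge_atTop 1] with p ⟨h1, h2⟩ hu hj1 _
    have hσ0 : 0 < σ p := by linarith
    rw [Real.dist_eq] at hj1
    have hjR : |(j p : ℝ) - c p| ≤ R * σ p := by
      have h5 : |((j p : ℝ) - c p) / σ p| ≤ R := by
        have := abs_sub_abs_le_abs_sub (((j p : ℝ) - c p) / σ p) x
        linarith
      rwa [abs_div, abs_of_pos hσ0, div_le_iff₀ hσ0] at h5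
    have h3 := Nat.floor_le h2
    have h4 := Nat.lt_floor_add_one (c p)
    have hcR : |(⌊c p⌋₊ : ℝ) - c p| ≤ R * σ p :=
      (abs_le.2 ⟨by linarith, by linarith⟩ : |(⌊c p⌋₊ : ℝ) - c p| ≤ 1).trans (by nlinarith)
    have key := abs_quadratic_le hσ0 hu hcR hjR
    rw [Real.dist_eq, sub_zero]
    refine key.trans_lt ?_
    have h6 : |(j p : ℝ) - ⌊c p⌋₊| ≤ 2 * R * σ p := by
      have := abs_sub_le (j p : ℝ) (c p) ⌊c p⌋₊
      rw [abs_sub_comm (c p)] at this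
      linarith
    calc ε / (4 * R) / σ p * |(j p : ℝ) - ⌊c p⌋₊| ≤ ε / (4 * R) / σ p * (2 * R * σ p) := by gcongr
      _ = ε / 2 := by field_simp; norm_num
      _ < ε := by linarith
  have hq : ∀ {k : ι → ℕ} {y : ℝ}, Tendsto (fun p => ((k p : ℝ) - c p) / σ p) l (nhds y) →
      Tendsto (fun p => (((k p : ℝ) - c p) ^ 2 - (k p - c p)) / (2 * σ p ^ 2)) l
        (nhds (y ^ 2 / 2)) := by
    intro k y hk
    have h1 := ((hk.pow 2).div_const 2).sub ((hk.mul hinv).div_const 2)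
    rw [mul_zero, zero_div, sub_zero] at h1
    refine h1.congr' ?_
    filter_upwards [hpos] with p ⟨h2, _⟩
    have : σ p ≠ 0 := by linarith
    field_simp
  have := (hmain.sub (hq hj)).add (hq hfl)
  refine (this.congr fun p => ?_).trans (by simp [neg_div])
  ring

/-- The weighted sum of `F p` over the integers, normalised to approximate a Gaussian integral. -/
def laplaceSum (lam : ι → ℕ → ℝ) (c σ : ι → ℝ) (F : ι → ℝ → ℝ) (p : ι) : ℝ :=
  ∑' j : ℕ, Real.exp (lam p j - lam p ⌊c p⌋₊) * F p ((j - c p) / σ p) / σ p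

theorem IsLaplace.tendsto_laplaceSum [l.IsCountablyGenerated] (h : IsLaplace l lam c σ)
    {F : ι → ℝ → ℝ} {F₀ : ℝ → ℝ} {K : ℝ} (hK : ∀ p y, |F p y| ≤ K * (1 + y ^ 8))
    (hF : ∀ᵐ x, ∀ y : ι → ℝ, Tendsto y l (nhds x) →
      Tendsto (fun p => F p (y p)) l (nhds (F₀ x))) :
    (∀ᶠ p in l, Summable fun j : ℕ =>
      Real.exp (lam p j - lam p ⌊c p⌋₊) * F p ((j - c p) / σ p) / σ p) ∧
    Tendsto (laplaceSum lam c σ F) l (nhds (∫ x, F₀ x * Real.exp (-x ^ 2 / 2))) := by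
  have hinv : Tendsto (fun p => 1 / σ p) l (nhds 0) :=
    tendsto_const_nhds.div_atTop h.scale
  set H : ι → ℕ → ℝ := fun p j => Real.exp (lam p j - lam p ⌊c p⌋₊) * F p ((j - c p) / σ p)
    with hH
  set D : ι → ℝ → ℝ := fun p => (Set.Ici (-c p / σ p)).indicator
    fun x => H p (stepIdx (c p) (σ p) x) with hD
  have hmeas : ∀ p, Measurable fun x => H p (stepIdx (c p) (σ p) x) := fun p => by
    refine (measurable_of_countable (H p)).comp ?_
    unfold stepIdx
    fun_prop
  set B : ℝ → ℝ := fun x => (Real.exp 13 * |K| * (1 + 40320 * 4 ^ 8)) * Real.exp (-|x| / 4)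
    with hB
  have hBint : Integrable B := integrable_exp_neg_abs_div_four.const_mul _
  have hev : ∀ᶠ p in l, 2 ≤ σ p ∧ ∀ x, ‖D p x‖ ≤ B x := by
    filter_upwards [h.scale.eventually_ge_atTop 2, h.centre.eventually_ge_atTop 0, h.anti,
      h.unif 3 (1 / 4) (by norm_num)] with p h1 h2 h3 h4
    refine ⟨h1, fun x => ?_⟩
    have hσ0 : 0 < σ p := by linarith
    have hc : 0 ≤ c p := by
      by_contra hc
      push Not at hc
      exact absurd h2 (not_le.2 (div_neg_of_neg_of_pos hc hσ0))
    by_cases hx : x ∈ Set.Ici (-c p / σ p)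
    swap
    · simp only [hD, Set.indicator_of_notMem hx, norm_zero, hB]; positivity
    simp only [hD, Set.indicator_of_mem hx]
    obtain ⟨h5, h6⟩ := stepIdx_sub_div hσ0 hx
    set j := stepIdx (c p) (σ p) x
    set y := ((j : ℝ) - c p) / σ p with hy
    have h7 := exp_bound_of_antitone h1 hc h3 h4 j
    have h8 : |(j : ℝ) - c p| / (2 * σ p) = |y| / 2 := by
      rw [hy, abs_div, abs_of_pos hσ0]; field_simp
    rw [h8] at h7
    have h9 : 1 / σ p ≤ 1 := by rw [div_le_one hσ0]; linarith
    have h10 : |x| ≤ |y| + 1 := by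
      have := abs_sub_abs_le_abs_sub x y
      have : |x - y| ≤ 1 := abs_le.2 ⟨by linarith, by linarith⟩
      linarith
    have hexp := exp_neg_mul_pow_le y
    have hy8 : 0 ≤ 1 + y ^ 8 := by positivity
    rw [Real.norm_eq_abs, abs_mul, abs_of_pos (Real.exp_pos _)]
    calc Real.exp (lam p j - lam p ⌊c p⌋₊) * |F p y|
        ≤ Real.exp (12 - |y| / 2) * (|K| * (1 + y ^ 8)) := by
          gcongr
          exact (hK p y).trans (by gcongr; exact le_abs_self K)
      _ = Real.exp 12 * |K| * (Real.exp (-|y| / 2) * (1 + y ^ 8)) := by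
          rw [show 12 - |y| / 2 = 12 + -|y| / 2 by ring, Real.exp_add]; ring
      _ ≤ Real.exp 12 * |K| * ((1 + 40320 * 4 ^ 8) * Real.exp (-|y| / 4)) := by gcongr
      _ ≤ Real.exp 12 * |K| * ((1 + 40320 * 4 ^ 8) * Real.exp (1 + -|x| / 4)) := by
          gcongr; linarith
      _ = B x := by
          rw [Real.exp_add, hB, show (13 : ℝ) = 12 + 1 by norm_num, Real.exp_add]; ring
  have hlim : ∀ᵐ x, Tendsto (fun p => D p x) l (nhds (F₀ x * Real.exp (-x ^ 2 / 2))) := by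
    filter_upwards [hF] with x hx
    have hin : ∀ᶠ p in l, x ∈ Set.Ici (-c p / σ p) ∧ 0 < σ p := by
      filter_upwards [h.centre.eventually_ge_atTop (-x), h.scale.eventually_gt_atTop 0]
        with p h1 h2
      refine ⟨?_, h2⟩
      rw [Set.mem_Ici, neg_div]
      linarith
    have hy : Tendsto (fun p => ((stepIdx (c p) (σ p) x : ℝ) - c p) / σ p) l (nhds x) := by
      refine tendsto_of_tendsto_of_tendsto_of_le_of_le' (g := fun p => x - 1 / σ p)
        (by simpa using (tendsto_const_nhds (x := x)).sub hinv) tendsto_const_nhds ?_ ?_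
      · filter_upwards [hin] with p ⟨h1, h2⟩
        linarith [(stepIdx_sub_div h2 h1).2]
      · filter_upwards [hin] with p ⟨h1, h2⟩
        exact (stepIdx_sub_div h2 h1).1
    have h1 := ((Real.continuous_exp.tendsto _).comp (h.tendsto_weight hy)).mul (hx _ hy)
    rw [mul_comm]
    refine h1.congr' ?_
    filter_upwards [hin] with p ⟨h2, _⟩
    simp only [hD, Set.indicator_of_mem h2, hH, Function.comp]
  have hsum : ∀ᶠ p in l, HasSum (fun j => H p j / σ p) (∫ x, D p x) := by
    filter_upwards [hev] with p ⟨h1, h2⟩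
    have h3 : Integrable (D p) := hBint.mono'
      ((hmeas p).indicator measurableSet_Ici).aestronglyMeasurable (ae_of_all _ h2)
    have := hasSum_of_integrable_step (c := c p) (σ := σ p) (H := H p) (by linarith)
      ((integrable_indicator_iff measurableSet_Ici).1 h3)
    rwa [← integral_indicator measurableSet_Ici] at this
  refine ⟨hsum.mono fun p hp => hp.summable, ?_⟩
  have := tendsto_integral_filter_of_dominated_convergence (μ := volume) (F := D) B
    (Eventually.of_forall fun p => ((hmeas p).indicator measurableSet_Ici).aestronglyMeasurable)
    (hev.mono fun p hp => ae_of_all _ hp.2) hBint hlim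
  exact this.congr' (hsum.mono fun p hp => hp.tsum_eq.symm)

end gaussian_limit

/-- The number of classes of an equivalence relation. -/
def blocks {X : Type*} [Fintype X] (s : Setoid X) : ℕ := Fintype.card (Quotient s)

/-- Maps with a given kernel are embeddings of the quotient. -/
def kerEquiv {X Y : Type*} (s : Setoid X) : {f : X → Y // Setoid.ker f = s} ≃ (Quotient s ↪ Y) where
  toFun f := ⟨Quotient.lift f.1 fun a b h => by
      have : Setoid.ker f.1 a b := by rw [f.2]; exact h
      exact this, by
    rintro ⟨a⟩ ⟨b⟩ h
    refine Quotient.sound ?_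
    have : Setoid.ker f.1 a b := h
    rwa [f.2] at this⟩
  invFun e := ⟨fun x => e (Quotient.mk s x), by
    ext a b
    rw [Setoid.ker_def, e.injective.eq_iff]
    exact Quotient.eq⟩
  left_inv f := rfl
  right_inv e := by
    ext x
    induction x using Quotient.inductionOn
    rfl

theorem pow_eq_sum_descFactorial (X : Type*) [Fintype X] (j : ℕ) :
    j ^ Fintype.card X = ∑ s : Setoid X, j.descFactorial (blocks s) := by
  have h1 : Fintype.card (X → Fin j) = j ^ Fintype.card X := by simp
  rw [← h1, ← Fintype.card_congr (Equiv.sigmaFiberEquiv fun f : X → Fin j => Setoid.ker f),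
    Fintype.card_sigma]
  refine Finset.sum_congr rfl fun s _ => ?_
  rw [Fintype.card_congr (kerEquiv s), Fintype.card_embedding_eq, Fintype.card_fin, blocks]

theorem pow_div_factorial_eq_sum (X : Type*) [Fintype X] (j : ℕ) :
    (j : ℝ) ^ Fintype.card X / j.factorial =
      ∑ s : Setoid X, if blocks s ≤ j then (1 : ℝ) / (j - blocks s).factorial else 0 := by
  have h := congrArg (Nat.cast (R := ℝ)) (pow_eq_sum_descFactorial X j)
  push_cast at h
  rw [h, Finset.sum_div]
  refine Finset.sum_congr rfl fun s _ => ?_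
  split_ifs with hs
  · have h1 := Nat.factorial_mul_descFactorial hs
    have h2 : (j.factorial : ℝ) ≠ 0 := by positivity
    have h3 : ((j - blocks s).factorial : ℝ) ≠ 0 := by positivity
    rw [div_eq_div_iff h2 h3, one_mul, ← h1]
    push_cast; ring
  · rw [Nat.descFactorial_eq_zero_iff_lt.2 (by omega)]
    simp

theorem hasSum_blocks {X : Type*} [Fintype X] {g : ℕ → ℝ}
    (h : Summable fun j : ℕ => (j : ℝ) ^ Fintype.card X / j.factorial * g j) :
    (∀ s : Setoid X, Summable fun i : ℕ => g (blocks s + i) / i.factorial) ∧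
    ∑' j : ℕ, (j : ℝ) ^ Fintype.card X / j.factorial * g j =
      ∑ s : Setoid X, ∑' i : ℕ, g (blocks s + i) / i.factorial := by
  set f : Setoid X → ℕ → ℝ := fun s j =>
    (if blocks s ≤ j then (1 : ℝ) / (j - blocks s).factorial else 0) * g j with hf
  have hf0 : ∀ (s : Setoid X) (j : ℕ),
      (0 : ℝ) ≤ if blocks s ≤ j then (1 : ℝ) / (j - blocks s).factorial else 0 := fun s j => by
    split_ifs <;> positivity
  have hfs : ∀ s, Summable (f s) := fun s => by
    refine Summable.of_norm_bounded h.norm fun j => ?_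
    rw [hf, norm_mul, norm_mul, Real.norm_of_nonneg (hf0 s j),
      Real.norm_of_nonneg (by positivity : (0 : ℝ) ≤ (j : ℝ) ^ Fintype.card X / j.factorial),
      pow_div_factorial_eq_sum]
    gcongr
    exact Finset.single_le_sum (fun s _ => hf0 s j) (Finset.mem_univ s)
  have hshift : ∀ s, (fun i => f s (i + blocks s)) = fun i => g (blocks s + i) / i.factorial := by
    intro s
    ext i
    simp only [hf, Nat.le_add_left, if_true, Nat.add_sub_cancel]
    rw [add_comm i]; ring
  refine ⟨fun s => ?_, ?_⟩
  · rw [← hshift]; exact (summable_nat_add_iff _).2 (hfs s)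
  · have h1 : ∀ j : ℕ, (j : ℝ) ^ Fintype.card X / j.factorial * g j = ∑ s : Setoid X, f s j :=
      fun j => by rw [pow_div_factorial_eq_sum, Finset.sum_mul]
    simp_rw [h1]
    rw [Summable.tsum_finsetSum fun s _ => hfs s]
    refine Finset.sum_congr rfl fun s _ => ?_
    rw [← hshift, ← (hfs s).sum_add_tsum_nat_add (blocks s), Finset.sum_eq_zero, zero_add]
    intro j hj
    have := Finset.mem_range.1 hj
    simp only [hf, if_neg (not_le.2 this), zero_mul]

theorem hasSum_inv_factorial : HasSum (fun i : ℕ => (1 : ℝ) / i.factorial) (Real.exp 1) := by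
  have := NormedSpace.expSeries_div_hasSum_exp (1 : ℝ)
  simpa [Real.exp_eq_exp_ℝ] using this

theorem hasSum_mul_div_factorial {v : ℕ → ℝ} {S : ℝ}
    (h : HasSum (fun i : ℕ => v (i + 1) / i.factorial) S) :
    HasSum (fun i : ℕ => i * v i / i.factorial) S := by
  rw [← hasSum_nat_add_iff' 1]
  simp only [Finset.range_one, Finset.sum_singleton, Nat.cast_zero, zero_mul, zero_div, sub_zero]
  refine Eq.mp (congrArg (fun g => HasSum g S) (funext fun i => ?_)) h
  rw [Nat.factorial_succ]
  push_cast
  field_simp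

theorem hasSum_nat_div_factorial : HasSum (fun i : ℕ => (i : ℝ) / i.factorial) (Real.exp 1) := by
  simpa using hasSum_mul_div_factorial (v := fun _ => 1) hasSum_inv_factorial

theorem hasSum_sub_one_div_factorial :
    HasSum (fun i : ℕ => ((i : ℝ) - 1) / i.factorial) 0 := by
  simpa [sub_div] using hasSum_nat_div_factorial.sub hasSum_inv_factorial

theorem hasSum_sub_one_sq_div_factorial :
    HasSum (fun i : ℕ => ((i : ℝ) - 1) ^ 2 / i.factorial) (Real.exp 1) := by
  have h1 : HasSum (fun i : ℕ => (i : ℝ) * i / i.factorial) (Real.exp 1 + Real.exp 1) := by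
    refine hasSum_mul_div_factorial (v := fun i => (i : ℝ)) ?_
    simpa [add_div] using hasSum_nat_div_factorial.add hasSum_inv_factorial
  have h2 := (h1.sub (hasSum_nat_div_factorial.mul_left 2)).add hasSum_inv_factorial
  rw [show Real.exp 1 + Real.exp 1 - 2 * Real.exp 1 + Real.exp 1 = Real.exp 1 by ring] at h2
  exact Eq.mp (congrArg (fun g => HasSum g _) (funext fun i => by ring)) h2

theorem abs_log_one_add_sub_le {v : ℝ} (hv : |v| ≤ 1 / 2) : |Real.log (1 + v) - v| ≤ 2 * v ^ 2 := by
  obtain ⟨h1, h2⟩ := abs_le.1 hv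
  have h3 := Real.log_le_sub_one_of_pos (show 0 < 1 + v by linarith)
  have h4 := Real.log_le_sub_one_of_pos (inv_pos.2 (show 0 < 1 + v by linarith))
  rw [Real.log_inv] at h4
  have h5 : (1 + v)⁻¹ ≤ 1 - v + 2 * v ^ 2 := by
    rw [inv_le_iff_one_le_mul₀ (by linarith)]
    nlinarith [mul_nonneg (sq_nonneg v) (show 0 ≤ 1 + 2 * v by linarith)]
  exact abs_le.2 ⟨by linarith, by nlinarith⟩

theorem abs_logRatio_le {a l σ R M y : ℝ} (hl : 1 ≤ l) (hla : l + 1 ≤ a) (hlog : Real.log a = l)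
    (hσ : 1 ≤ σ) (hσ2 : σ ^ 2 * (l + 1) = a) (hR : 0 ≤ R) (hM : |M - a * l| ≤ l ^ 2 + 1)
    (hy : |y - 1 - a| ≤ R * σ) (hR2 : R * σ + 1 ≤ a / 2) (ha : 4 ≤ a) :
    |M * (Real.log (y + 1) - Real.log y) - Real.log y + (y - 1 - a) / σ ^ 2| ≤
      (19 + 4 * (R + 1) ^ 2) * (l + 1) ^ 2 / a := by
  have ha0 : 0 < a := by linarith
  have hl2 : l + 1 ≤ (l + 1) ^ 2 := by nlinarith
  have hll : l ^ 2 + 1 ≤ (l + 1) ^ 2 := by nlinarith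
  have hal : (l + 1) * (l + 1) ≤ a * (l + 1) := by gcongr
  obtain ⟨hy1, hy2⟩ := abs_le.1 hy
  have hya : a / 2 ≤ y := by linarith
  have hy0 : 0 < y := by linarith
  set v := (y - a) / a with hv
  have hyv : y = a * (1 + v) := by rw [hv]; field_simp; ring
  have hvabs : |v| ≤ (R + 1) * σ / a := by
    rw [hv, abs_div, abs_of_pos ha0]
    gcongr
    exact abs_le.2 ⟨by linarith, by linarith⟩
  have hvhalf : |v| ≤ 1 / 2 := by
    rw [hv, abs_div, abs_of_pos ha0, div_le_iff₀ ha0]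
    exact abs_le.2 ⟨by linarith, by linarith⟩
  have hv2 : v ^ 2 ≤ (R + 1) ^ 2 / (a * (l + 1)) := by
    rw [← sq_abs]
    calc |v| ^ 2 ≤ ((R + 1) * σ / a) ^ 2 := by gcongr
      _ = (R + 1) ^ 2 / (a * (l + 1)) := by
        rw [div_pow, mul_pow, div_eq_div_iff (by positivity) (by positivity),
          show (R + 1) ^ 2 * σ ^ 2 * (a * (l + 1)) = (R + 1) ^ 2 * (σ ^ 2 * (l + 1)) * a by ring, hσ2]
        ring
  obtain ⟨hv3, hv4⟩ := abs_le.1 hvhalf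
  have h1v : 0 < 1 + v := by linarith
  have hE1 : |Real.log (y + 1) - Real.log y - 1 / y| ≤ 8 / a ^ 2 := by
    have h := abs_log_one_add_sub_le (v := 1 / y) (by
      rw [abs_of_pos (by positivity), div_le_div_iff₀ hy0 two_pos]; linarith)
    have e : Real.log (y + 1) - Real.log y = Real.log (1 + 1 / y) := by
      rw [← Real.log_div (by linarith) hy0.ne']; congr 1; field_simp
    rw [e]
    refine h.trans ?_
    rw [div_pow, one_pow, mul_one_div, div_le_div_iff₀ (by positivity) (by positivity)]
    nlinarith
  have hE2 := abs_log_one_add_sub_le hvhalf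
  have hE3 : |1 / (1 + v) - 1 + v| ≤ 2 * v ^ 2 := by
    have e : 1 / (1 + v) - 1 + v = v ^ 2 / (1 + v) := by field_simp; ring
    rw [e, abs_of_nonneg (by positivity), div_le_iff₀ h1v]
    nlinarith [sq_nonneg v]
  have hlogy : Real.log y = l + Real.log (1 + v) := by
    rw [hyv, Real.log_mul ha0.ne' h1v.ne', hlog]
  set e := M - a * l with he
  set E1 := Real.log (y + 1) - Real.log y - 1 / y with hE1d
  set E2 := Real.log (1 + v) - v with hE2d
  set E3 := 1 / (1 + v) - 1 + v with hE3d
  have hdiv : (y - 1 - a) / σ ^ 2 = v * (l + 1) - (l + 1) / a := by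
    have : σ ^ 2 = a / (l + 1) := by rw [eq_div_iff (by linarith)]; exact hσ2
    rw [this, hv]
    field_simp
    ring
  have hMy : M * (1 / y) = l * (1 / (1 + v)) + e / y := by
    rw [he, hyv]
    field_simp
    ring
  have key : M * (Real.log (y + 1) - Real.log y) - Real.log y + (y - 1 - a) / σ ^ 2 =
      M * E1 + l * E3 + e / y - E2 - (l + 1) / a := by
    rw [hdiv]
    have h1 : Real.log (y + 1) - Real.log y = E1 + 1 / y := by rw [hE1d]; ring
    have h2 : Real.log y = l + v + E2 := by rw [hlogy, hE2d]; ring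
    rw [h1, mul_add, hMy, h2, hE3d]
    ring
  have hMb : |M| ≤ 2 * a * (l + 1) := by
    have h1 : |M| ≤ a * l + (l ^ 2 + 1) := by
      have : M = a * l + e := by rw [he]; ring
      rw [this]
      refine (abs_add_le _ _).trans ?_
      rw [abs_of_nonneg (by positivity : 0 ≤ a * l)]
      linarith
    linarith
  have b1 : |M * E1| ≤ 16 * (l + 1) ^ 2 / a := by
    rw [abs_mul]
    calc |M| * |E1| ≤ 2 * a * (l + 1) * (8 / a ^ 2) := by gcongr
      _ = 16 * (l + 1) / a := by field_simp; norm_num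
      _ ≤ _ := by gcongr
  have hvl : v ^ 2 * (l + 1) ≤ (R + 1) ^ 2 / a := by
    calc v ^ 2 * (l + 1) ≤ (R + 1) ^ 2 / (a * (l + 1)) * (l + 1) := by gcongr
      _ = _ := by field_simp
  have b23 : |l * E3| + |E2| ≤ 2 * ((R + 1) ^ 2 / a) := by
    rw [abs_mul, abs_of_nonneg (by linarith : 0 ≤ l)]
    have : l * |E3| ≤ l * (2 * v ^ 2) := by gcongr
    linarith
  have b23' : 2 * ((R + 1) ^ 2 / a) ≤ 2 * (R + 1) ^ 2 * (l + 1) ^ 2 / a := by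
    rw [← mul_div_assoc]
    exact div_le_div_of_nonneg_right
      (le_mul_of_one_le_right (by positivity) (one_le_pow₀ (by linarith))) ha0.le
  have b4 : |e / y| ≤ 2 * (l + 1) ^ 2 / a := by
    rw [abs_div, abs_of_pos hy0, div_le_div_iff₀ hy0 ha0]
    have h1 : |e| ≤ (l + 1) ^ 2 := hM.trans hll
    calc |e| * a ≤ (l + 1) ^ 2 * (2 * y) := by gcongr; linarith
      _ = _ := by ring
  have b5 : |(l + 1) / a| ≤ (l + 1) ^ 2 / a := by
    rw [abs_of_nonneg (by positivity)]
    gcongr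
  rw [key]
  have t1 := abs_sub (M * E1 + l * E3 + e / y - E2) ((l + 1) / a)
  have t2 := abs_sub (M * E1 + l * E3 + e / y) E2
  have t3 := abs_add_le (M * E1 + l * E3) (e / y)
  have t4 := abs_add_le (M * E1) (l * E3)
  have hsq : 0 ≤ (R + 1) ^ 2 * (l + 1) ^ 2 / a := by positivity
  have : (19 + 4 * (R + 1) ^ 2) * (l + 1) ^ 2 / a = 16 * (l + 1) ^ 2 / a + 2 * (l + 1) ^ 2 / a +
      (l + 1) ^ 2 / a + 2 * (R + 1) ^ 2 * (l + 1) ^ 2 / a + 2 * ((R + 1) ^ 2 * (l + 1) ^ 2 / a) := by ring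
  linarith

/-- The logarithm of `(i + 1) ^ (m - 1) / i!`. -/
def blockLogWeight (m i : ℕ) : ℝ :=
  ((m : ℝ) - 1) * Real.log (i + 1) - Real.log i.factorial

theorem exp_blockLogWeight {m : ℕ} (hm : 1 ≤ m) (i : ℕ) :
    Real.exp (blockLogWeight m i) = ((i + 1 : ℕ) : ℝ) ^ m / (i + 1).factorial := by
  have h1 : (0 : ℝ) < (i : ℝ) + 1 := by positivity
  have h2 : (0 : ℝ) < i.factorial := by positivity
  have h3 : ((m : ℝ) - 1) = ((m - 1 : ℕ) : ℝ) := by push_cast [Nat.cast_sub hm]; ring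
  rw [blockLogWeight, Real.exp_sub, Real.exp_log h2, h3, Real.exp_nat_mul, Real.exp_log h1,
    Nat.factorial_succ]
  obtain ⟨k, rfl⟩ : ∃ k, m = k + 1 := ⟨m - 1, by omega⟩
  push_cast
  rw [pow_succ]
  field_simp

theorem blockLogWeight_succ_sub (m i : ℕ) : blockLogWeight m (i + 1) - blockLogWeight m i =
    ((m : ℝ) - 1) * (Real.log ((i + 1 : ℝ) + 1) - Real.log (i + 1)) - Real.log (i + 1) := by
  have h1 : (0 : ℝ) < (i : ℝ) + 1 := by positivity
  have h2 : (0 : ℝ) < i.factorial := by positivity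
  rw [blockLogWeight, blockLogWeight, Nat.factorial_succ]
  push_cast
  rw [Real.log_mul h1.ne' h2.ne']
  ring

theorem antitone_blockLogWeight {m : ℕ} (hm : 1 ≤ m) :
    Antitone fun i => blockLogWeight m (i + 1) - blockLogWeight m i := by
  refine antitone_nat_of_succ_le fun i => ?_
  rw [blockLogWeight_succ_sub, blockLogWeight_succ_sub]
  have hm' : (0 : ℝ) ≤ (m : ℝ) - 1 := by
    have : (1 : ℝ) ≤ m := by exact_mod_cast hm
    linarith
  have h0 : (0 : ℝ) ≤ i := Nat.cast_nonneg i
  push_cast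
  have h1 : Real.log ((i : ℝ) + 1) ≤ Real.log (i + 1 + 1) :=
    Real.log_le_log (by linarith) (by linarith)
  have h2 : Real.log ((i : ℝ) + 1 + 1 + 1) + Real.log (i + 1) ≤ 2 * Real.log (i + 1 + 1) := by
    rw [← Real.log_mul (by positivity) (by positivity), ← Nat.cast_two, ← Real.log_pow]
    refine Real.log_le_log (by positivity) ?_
    nlinarith
  have h3 := mul_le_mul_of_nonneg_left
    (show Real.log ((i : ℝ) + 1 + 1 + 1) - Real.log (i + 1 + 1) ≤
      Real.log ((i : ℝ) + 1 + 1) - Real.log (i + 1) by linarith) hm'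
  linarith

theorem eventually_log_pow_le {c : ℝ} (hc : 0 < c) :
    ∀ᶠ x : ℝ in atTop, (Real.log x + 1) ^ 4 ≤ c * x := by
  have h := (Real.isLittleO_pow_log_id_atTop (n := 4)).def (show 0 < c / 16 by positivity)
  filter_upwards [h, Real.tendsto_log_atTop.eventually_ge_atTop 1, eventually_ge_atTop 1]
    with x hx h1 h2
  rw [id, Real.norm_of_nonneg (by positivity), Real.norm_of_nonneg (by linarith)] at hx
  calc (Real.log x + 1) ^ 4 ≤ (2 * Real.log x) ^ 4 := by gcongr; linarith
    _ = 16 * Real.log x ^ 4 := by ring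
    _ ≤ _ := by linarith

/-- The standard deviation scale of the number of classes. -/
def blockScale (a : ℝ) : ℝ := Real.sqrt (a / (Real.log a + 1))

theorem tendsto_blockScale : Tendsto blockScale atTop atTop := by
  refine tendsto_atTop.2 fun b => ?_
  have hb : 0 < 1 / (b ^ 2 + 1) := by positivity
  filter_upwards [eventually_log_pow_le hb, Real.tendsto_log_atTop.eventually_ge_atTop 1,
    eventually_ge_atTop 1] with x hx h1 h2
  refine Real.le_sqrt_of_sq_le ?_
  have h3 : Real.log x + 1 ≤ (Real.log x + 1) ^ 4 := le_self_pow₀ (by linarith) (by norm_num)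
  rw [le_div_iff₀ (by linarith)]
  have h4 := h3.trans hx
  rw [div_mul_eq_mul_div, one_mul, le_div_iff₀ (by positivity)] at h4
  nlinarith

theorem isLaplace_blockLogWeight {ι : Type*} {l : Filter ι} {a : ι → ℝ} {m : ι → ℕ}
    (ha : Tendsto a l atTop)
    (hm : ∀ᶠ p in l, |(m p : ℝ) - a p * Real.log (a p)| ≤ Real.log (a p) ^ 2) :
    IsLaplace l (fun p => blockLogWeight (m p)) a fun p => blockScale (a p) := by
  have hlog := Real.tendsto_log_atTop
  have hbasic : ∀ᶠ p in l, 1 ≤ Real.log (a p) ∧ Real.log (a p) + 1 ≤ a p ∧ 4 ≤ a p ∧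
      1 ≤ blockScale (a p) ∧ blockScale (a p) ^ 2 * (Real.log (a p) + 1) = a p := by
    have : ∀ᶠ x : ℝ in atTop, 1 ≤ Real.log x ∧ Real.log x + 1 ≤ x ∧ 4 ≤ x ∧
        1 ≤ blockScale x ∧ blockScale x ^ 2 * (Real.log x + 1) = x := by
      filter_upwards [hlog.eventually_ge_atTop 1, eventually_ge_atTop 4,
        tendsto_blockScale.eventually_ge_atTop 1] with x h1 h2 h3
      refine ⟨h1, by linarith [Real.log_le_sub_one_of_pos (show 0 < x by linarith)], h2, h3, ?_⟩
      rw [blockScale, Real.sq_sqrt (by positivity)]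
      field_simp
    exact ha.eventually this
  refine ⟨tendsto_blockScale.comp ha, ?_, ?_, ?_⟩
  · refine tendsto_atTop_mono' l ?_ ((tendsto_blockScale.comp ha))
    filter_upwards [hbasic] with p ⟨h1, h2, h3, h4, h5⟩
    simp only [Function.comp]
    rw [le_div_iff₀ (by linarith)]
    nlinarith [sq_nonneg (blockScale (a p))]
  · filter_upwards [hbasic, hm] with p ⟨h1, h2, h3, _⟩ h4
    refine antitone_blockLogWeight ?_
    have h5 := (abs_le.1 h4).1
    have h6 : (1 : ℝ) ≤ m p := by nlinarith
    exact_mod_cast h6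
  · intro R ε hε
    set R' := |R| with hR'
    have hR0 : 0 ≤ R' := abs_nonneg R
    set C := 19 + 4 * (R' + 1) ^ 2 with hC
    have hC0 : 0 < C := by positivity
    filter_upwards [hbasic, hm, ha.eventually (eventually_log_pow_le (c := (ε / C) ^ 2)
      (by positivity)), ha.eventually (eventually_ge_atTop (16 * (R' + 1) ^ 2))]
      with p ⟨h1, h2, h3, h4, h5⟩ h6 h7 h8 i hi
    set x := a p
    set L := Real.log x
    set s := blockScale x with hs
    have hx0 : 0 < x := by linarith
    have hs0 : 0 < s := by linarith
    have hsx : s ^ 2 ≤ x := by nlinarith [sq_nonneg s]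
    have hM : |((m p : ℝ) - 1) - x * L| ≤ L ^ 2 + 1 := by
      rw [abs_le] at h6 ⊢
      exact ⟨by linarith, by linarith⟩
    have hy : |((i : ℝ) + 1) - 1 - x| ≤ R' * s := by
      rw [add_sub_cancel_right]
      exact hi.trans (by gcongr; exact le_abs_self R)
    have hR2 : R' * s + 1 ≤ x / 2 := by
      have h9 : ((R' + 1) * s) ^ 2 ≤ (x / 4) ^ 2 := by
        calc ((R' + 1) * s) ^ 2 = (R' + 1) ^ 2 * s ^ 2 := by ring
          _ ≤ (R' + 1) ^ 2 * x := by gcongr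
          _ ≤ (x / 4) ^ 2 := by nlinarith
      have h10 := abs_le_of_sq_le_sq' h9 (by linarith)
      nlinarith [h10.2]
    have key := abs_logRatio_le h1 h2 rfl h4 h5 hR0 hM hy hR2 h3
    rw [blockLogWeight_succ_sub]
    rw [add_sub_cancel_right] at key
    refine key.trans ?_
    rw [div_le_div_iff₀ hx0 hs0]
    have h11 : (C * (L + 1) ^ 2 * s) ^ 2 ≤ (ε * x) ^ 2 := by
      calc (C * (L + 1) ^ 2 * s) ^ 2 = C ^ 2 * (L + 1) ^ 4 * s ^ 2 := by ring
        _ ≤ C ^ 2 * ((ε / C) ^ 2 * x) * x := by gcongr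
        _ = (ε * x) ^ 2 := by field_simp
    exact (abs_le_of_sq_le_sq' h11 (by positivity)).2

/-- The normalising constant in the Gaussian approximation of the number of blocks. -/
def blockNorm (m : ℕ) (a : ℝ) : ℝ := Real.exp (blockLogWeight m ⌊a⌋₊) * blockScale a

/-- The sum over all equivalence relations of the Poisson smoothing of `f`. -/
def poissonSum (X : Type*) [Fintype X] (f : ℝ → ℝ) : ℝ :=
  ∑ s : Setoid X, ∑' i : ℕ, f (blocks s + i - 1) / i.factorial

theorem poissonSum_eq {m : ℕ} (hm : 1 ≤ m) {a : ℝ} (hσ : 0 < blockScale a) {f : ℝ → ℝ}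
    (h : Summable fun j : ℕ => Real.exp (blockLogWeight m j - blockLogWeight m ⌊a⌋₊) *
      f ((j - a) / blockScale a) / blockScale a) :
    (∀ s : Setoid (Fin m), Summable fun i : ℕ =>
      f ((blocks s + i - 1 - a) / blockScale a) / i.factorial) ∧
    ∑' j : ℕ, Real.exp (blockLogWeight m j - blockLogWeight m ⌊a⌋₊) *
      f ((j - a) / blockScale a) / blockScale a =
    poissonSum (Fin m) (fun x => f ((x - a) / blockScale a)) / blockNorm m a := by
  set σ := blockScale a
  set g : ℕ → ℝ := fun j => f (((j : ℝ) - 1 - a) / σ) with hg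
  have hκ : 0 < blockNorm m a := mul_pos (Real.exp_pos _) hσ
  have e : (fun j : ℕ => Real.exp (blockLogWeight m j - blockLogWeight m ⌊a⌋₊) *
      f ((j - a) / σ) / σ) =
      fun j : ℕ => (((j + 1 : ℕ) : ℝ) ^ m / (j + 1).factorial * g (j + 1)) * (blockNorm m a)⁻¹ := by
    funext j
    rw [Real.exp_sub, exp_blockLogWeight hm, hg,
      show blockNorm m a = Real.exp (blockLogWeight m ⌊a⌋₊) * σ from rfl]
    have : ((j + 1 : ℕ) : ℝ) - 1 - a = j - a := by push_cast; ring
    simp only [this]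
    have := Real.exp_ne_zero (blockLogWeight m ⌊a⌋₊)
    have := hσ.ne'
    field_simp
  have h1 : Summable fun j : ℕ => ((j + 1 : ℕ) : ℝ) ^ m / (j + 1).factorial * g (j + 1) := by
    rw [e] at h
    exact (summable_mul_right_iff (inv_ne_zero hκ.ne')).1 h
  have h2 : Summable fun j : ℕ => (j : ℝ) ^ m / j.factorial * g j :=
    (summable_nat_add_iff (f := fun j : ℕ => (j : ℝ) ^ m / j.factorial * g j) 1).1 h1
  have h3 : Summable fun j : ℕ => (j : ℝ) ^ Fintype.card (Fin m) / j.factorial * g j := by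
    simpa using h2
  have h4 := hasSum_blocks h3
  have h5 : ∀ (T i : ℕ), g (T + i) = f (((T : ℝ) + i - 1 - a) / σ) := by
    intro T i; simp only [hg]; push_cast; rfl
  simp only [h5, Fintype.card_fin] at h4
  refine ⟨h4.1, ?_⟩
  rw [e, tsum_mul_right, poissonSum, ← h4.2, h2.tsum_eq_zero_add]
  simp [show m ≠ 0 by omega, div_eq_mul_inv]

section
variable {ι : Type*} {l : Filter ι} [l.IsCountablyGenerated] {a : ι → ℝ} {m : ι → ℕ}

theorem tendsto_poissonSum (ha : Tendsto a l atTop)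
    (hm : ∀ᶠ p in l, |(m p : ℝ) - a p * Real.log (a p)| ≤ Real.log (a p) ^ 2)
    {F : ι → ℝ → ℝ} {F₀ : ℝ → ℝ} {K : ℝ} (hK : ∀ p y, |F p y| ≤ K * (1 + y ^ 8))
    (hF : ∀ᵐ x, ∀ y : ι → ℝ, Tendsto y l (nhds x) →
      Tendsto (fun p => F p (y p)) l (nhds (F₀ x))) :
    (∀ᶠ p in l, ∀ s : Setoid (Fin (m p)), Summable fun i : ℕ =>
      F p ((blocks s + i - 1 - a p) / blockScale (a p)) / i.factorial) ∧
    Tendsto (fun p => poissonSum (Fin (m p)) (fun x => F p ((x - a p) / blockScale (a p))) /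
      blockNorm (m p) (a p)) l (nhds (∫ x, F₀ x * Real.exp (-x ^ 2 / 2))) := by
  have h := (isLaplace_blockLogWeight ha hm).tendsto_laplaceSum hK hF
  have hpos : ∀ᶠ p in l, 1 ≤ m p ∧ 0 < blockScale (a p) := by
    have hlog : Tendsto (fun p => Real.log (a p)) l atTop := Real.tendsto_log_atTop.comp ha
    filter_upwards [hm, hlog.eventually_ge_atTop 1,
      (tendsto_blockScale.comp ha).eventually_gt_atTop 0, ha.eventually_gt_atTop 0] with p h1 h2 h3 h4
    refine ⟨?_, h3⟩
    have h5 := (abs_le.1 h1).1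
    have h6 : Real.log (a p) ≤ a p - 1 := Real.log_le_sub_one_of_pos h4
    have h7 : (0 : ℝ) < m p := by nlinarith
    exact_mod_cast h7
  constructor
  · filter_upwards [h.1, hpos] with p h1 h2
    exact (poissonSum_eq h2.1 h2.2 h1).1
  · refine h.2.congr' ?_
    filter_upwards [h.1, hpos] with p h1 h2
    exact (poissonSum_eq h2.1 h2.2 h1).2

end

/-- The sum of a function of the number of blocks over all equivalence relations. -/
def blockSum (m : ℕ) (f : ℕ → ℝ) : ℝ := ∑ s : Setoid (Fin m), f (blocks s)

theorem sum_blocks_eq_blockSum (X : Type*) [Fintype X] (f : ℕ → ℝ) :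
    ∑ s : Setoid X, f (blocks s) = blockSum (Fintype.card X) f := by
  set e := Fintype.equivFin X
  refine (Fintype.sum_bijective (fun s : Setoid (Fin (Fintype.card X)) => s.comap e)
    ⟨fun s t h => ?_, Setoid.comap_surjective e e.injective⟩ _ _ fun s => ?_).symm
  · ext a b
    have := congrArg (fun r : Setoid X => r (e.symm a) (e.symm b)) h
    simpa [Setoid.comap_rel] using this
  · refine congrArg f (Fintype.card_congr ?_).symm
    exact Quotient.congr e fun a b => Iff.rfl

theorem blockSum_const (m : ℕ) (c : ℝ) : blockSum m (fun _ => c) = setoidCount m * c := by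
  simp [blockSum, setoidCount]

section gaussian
open MeasureTheory ProbabilityTheory

theorem integral_exp_neg_sq_div_two :
    ∫ x : ℝ, Real.exp (-x ^ 2 / 2) = √(2 * Real.pi) := by
  have := integral_gaussian (1 / 2)
  rw [show Real.pi / (1 / 2) = 2 * Real.pi by ring] at this
  rw [← this]
  congr 1; funext x; congr 1; ring

theorem integral_mul_exp_neg_sq_div_two (f : ℝ → ℝ) :
    ∫ x : ℝ, f x * Real.exp (-x ^ 2 / 2) = √(2 * Real.pi) * ∫ x, f x ∂gaussianReal 0 1 := by
  rw [integral_gaussianReal_eq_integral_smul one_ne_zero, ← integral_const_mul]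
  congr 1; funext x
  rw [gaussianPDFReal]
  have : √(2 * Real.pi) ≠ 0 := by positivity
  simp
  field_simp

theorem integral_id_mul_exp_neg_sq_div_two :
    ∫ x : ℝ, x * Real.exp (-x ^ 2 / 2) = 0 := by
  rw [integral_mul_exp_neg_sq_div_two, integral_id_gaussianReal, mul_zero]

theorem integral_sq_mul_exp_neg_sq_div_two :
    ∫ x : ℝ, x ^ 2 * Real.exp (-x ^ 2 / 2) = √(2 * Real.pi) := by
  have h := variance_fun_id_gaussianReal (μ := 0) (v := 1)
  rw [variance_eq_integral (by fun_prop), integral_id_gaussianReal] at h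
  simp only [sub_zero] at h
  rw [integral_mul_exp_neg_sq_div_two, h]
  simp

theorem integral_Iic_mul_exp_neg_sq_div_two (t : ℝ) :
    ∫ x : ℝ, (if x ≤ t then 1 else 0) * Real.exp (-x ^ 2 / 2) =
      √(2 * Real.pi) * stdNormalCdf t := by
  rw [stdNormalCdf, mul_div_cancel₀ _ (by positivity), ← integral_indicator measurableSet_Iic]
  congr 1; funext x
  simp [Set.indicator_apply]

end gaussian

theorem sum_div_factorial_pow_one (z σ : ℝ) :
    HasSum (fun i : ℕ => (z + (i - 1) / σ) / i.factorial) (Real.exp 1 * z) := by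
  have := (hasSum_inv_factorial.mul_left z).add (hasSum_sub_one_div_factorial.mul_left (1 / σ))
  rw [show z * Real.exp 1 + 1 / σ * 0 = Real.exp 1 * z by ring] at this
  refine Eq.mp (congrArg (fun g => HasSum g _) (funext fun i => ?_)) this
  ring

theorem sum_div_factorial_pow_two (z σ : ℝ) :
    HasSum (fun i : ℕ => (z + (i - 1) / σ) ^ 2 / i.factorial)
      (Real.exp 1 * z ^ 2 + Real.exp 1 * (1 / σ) ^ 2) := by
  have := ((hasSum_inv_factorial.mul_left (z ^ 2)).add
    (hasSum_sub_one_div_factorial.mul_left (2 * z * (1 / σ)))).add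
    (hasSum_sub_one_sq_div_factorial.mul_left ((1 / σ) ^ 2))
  rw [show z ^ 2 * Real.exp 1 + 2 * z * (1 / σ) * 0 + (1 / σ) ^ 2 * Real.exp 1 =
    Real.exp 1 * z ^ 2 + Real.exp 1 * (1 / σ) ^ 2 by ring] at this
  refine Eq.mp (congrArg (fun g => HasSum g _) (funext fun i => ?_)) this
  ring

theorem poissonSum_const (m : ℕ) :
    poissonSum (Fin m) (fun _ => 1) = Real.exp 1 * setoidCount m := by
  simp only [poissonSum, hasSum_inv_factorial.tsum_eq]
  simp [setoidCount, mul_comm]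

theorem poissonSum_id (m : ℕ) (a σ : ℝ) :
    poissonSum (Fin m) (fun x => (x - a) / σ) =
      Real.exp 1 * blockSum m fun T => (T - a) / σ := by
  rw [poissonSum, blockSum, Finset.mul_sum]
  refine Finset.sum_congr rfl fun s _ => ?_
  rw [← (sum_div_factorial_pow_one (((blocks s : ℝ) - a) / σ) σ).tsum_eq]
  congr 1; funext i; ring

theorem poissonSum_sq (m : ℕ) (a σ : ℝ) :
    poissonSum (Fin m) (fun x => ((x - a) / σ) ^ 2) =
      Real.exp 1 * blockSum m (fun T => ((T - a) / σ) ^ 2) +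
        Real.exp 1 * setoidCount m * (1 / σ) ^ 2 := by
  rw [mul_assoc, ← blockSum_const, ← mul_add, poissonSum, blockSum, blockSum,
    ← Finset.sum_add_distrib, Finset.mul_sum]
  refine Finset.sum_congr rfl fun s _ => ?_
  rw [mul_add, ← (sum_div_factorial_pow_two (((blocks s : ℝ) - a) / σ) σ).tsum_eq]
  congr 1; funext i; ring

theorem blockSum_le_poissonSum (m : ℕ) (f : ℝ → ℝ) (h0 : ∀ x, 0 ≤ f x)
    (hs : ∀ s : Setoid (Fin m), Summable fun i : ℕ => f (blocks s + i - 1) / i.factorial) :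
    blockSum m (fun T => f T) ≤ poissonSum (Fin m) f := by
  refine Finset.sum_le_sum fun s _ => ?_
  have := (hs s).hasSum
  refine le_trans (le_of_eq ?_) (le_hasSum this 1 fun j _ => div_nonneg (h0 _) (by positivity))
  simp

theorem poissonSum_indicator_le (m : ℕ) (x : ℝ) :
    poissonSum (Fin m) (fun y => if y ≤ x - 1 then 1 else 0) ≤
      Real.exp 1 * blockSum m fun T => if (T : ℝ) ≤ x then 1 else 0 := by
  rw [poissonSum, blockSum, Finset.mul_sum]
  refine Finset.sum_le_sum fun s _ => ?_
  have h1 := hasSum_inv_factorial.mul_right (if (blocks s : ℝ) ≤ x then (1 : ℝ) else 0)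
  have hle : ∀ i : ℕ, (if (blocks s : ℝ) + i - 1 ≤ x - 1 then (1 : ℝ) else 0) / i.factorial ≤
      1 / i.factorial * (if (blocks s : ℝ) ≤ x then (1 : ℝ) else 0) := by
    intro i
    have := Nat.cast_nonneg (α := ℝ) i
    split_ifs
    · simp
    · linarith
    · simp
    · simp
  refine hasSum_le hle (Summable.hasSum ?_) h1
  refine Summable.of_nonneg_of_le (fun i => ?_) hle h1.summable
  split_ifs <;> positivity

theorem le_poissonSum_indicator (m : ℕ) (x : ℝ) {r : ℝ} (hr : 0 < r) :
    Real.exp 1 * (1 - 1 / r) * blockSum m (fun T => if (T : ℝ) ≤ x then 1 else 0) ≤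
      poissonSum (Fin m) fun y => if y ≤ x + r then 1 else 0 := by
  rw [poissonSum, blockSum, Finset.mul_sum]
  refine Finset.sum_le_sum fun s _ => ?_
  have h1 := (hasSum_inv_factorial.sub (hasSum_nat_div_factorial.mul_right (1 / r))).mul_right
    (if (blocks s : ℝ) ≤ x then (1 : ℝ) else 0)
  rw [show Real.exp 1 - Real.exp 1 * (1 / r) = Real.exp 1 * (1 - 1 / r) by ring] at h1
  refine hasSum_le (fun i => ?_) h1 (Summable.hasSum ?_)
  · have hf : (0 : ℝ) < i.factorial := by positivity
    have e : (1 : ℝ) / i.factorial - i / i.factorial * (1 / r) = (1 - i / r) / i.factorial := by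
      field_simp
    rw [e]
    by_cases h : (blocks s : ℝ) ≤ x
    · rw [if_pos h, mul_one]
      gcongr
      split_ifs with h2
      · have : (0 : ℝ) ≤ i / r := by positivity
        linarith
      · have : 1 ≤ (i : ℝ) / r := by rw [le_div_iff₀ hr]; linarith
        linarith
    · rw [if_neg h, mul_zero]
      split_ifs <;> positivity
  · refine Summable.of_nonneg_of_le (fun i => ?_) (fun i => ?_) hasSum_inv_factorial.summable
    · split_ifs <;> positivity
    · gcongr
      split_ifs <;> norm_num

/-- The average of a function of the number of blocks of an equivalence relation. -/
def blockAvg (m : ℕ) (f : ℕ → ℝ) : ℝ := blockSum m f / setoidCount m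

theorem tendsto_ite_le {ι : Type*} {l : Filter ι} {t : ι → ℝ} {t₀ x : ℝ}
    (ht : Tendsto t l (nhds t₀)) (hx : x ≠ t₀) {y : ι → ℝ} (hy : Tendsto y l (nhds x)) :
    Tendsto (fun p => if y p ≤ t p then (1 : ℝ) else 0) l (nhds (if x ≤ t₀ then 1 else 0)) := by
  rcases hx.lt_or_gt with h | h
  · rw [if_pos h.le]
    refine tendsto_const_nhds.congr' ?_
    filter_upwards [hy.eventually_lt ht h] with p hp
    rw [if_pos hp.le]
  · rw [if_neg h.not_ge]
    refine tendsto_const_nhds.congr' ?_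
    filter_upwards [ht.eventually_lt hy h] with p hp
    rw [if_neg hp.not_ge]

section
variable {ι : Type*} {l : Filter ι} [l.IsCountablyGenerated] {a : ι → ℝ} {m : ι → ℕ}

theorem tendsto_blockNorm (ha : Tendsto a l atTop)
    (hm : ∀ᶠ p in l, |(m p : ℝ) - a p * Real.log (a p)| ≤ Real.log (a p) ^ 2) :
    Tendsto (fun p => Real.exp 1 * setoidCount (m p) / blockNorm (m p) (a p)) l
      (nhds √(2 * Real.pi)) := by
  have h := (tendsto_poissonSum ha hm (F := fun _ _ => 1) (F₀ := fun _ => 1) (K := 1)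
    (fun p y => by rw [abs_one, one_mul]; linarith [show 0 ≤ y ^ 8 by positivity])
    (.of_forall fun x y _ => tendsto_const_nhds)).2
  simp only [poissonSum_const, one_mul] at h
  rwa [integral_exp_neg_sq_div_two] at h

theorem tendsto_div_setoidCount (ha : Tendsto a l atTop)
    (hm : ∀ᶠ p in l, |(m p : ℝ) - a p * Real.log (a p)| ≤ Real.log (a p) ^ 2)
    {u : ι → ℝ} {L : ℝ}
    (hu : Tendsto (fun p => u p / blockNorm (m p) (a p)) l (nhds (√(2 * Real.pi) * L))) :
    Tendsto (fun p => u p / (Real.exp 1 * setoidCount (m p))) l (nhds L) := by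
  have hpi : √(2 * Real.pi) ≠ 0 := by positivity
  have h := hu.div (tendsto_blockNorm ha hm) hpi
  rw [mul_div_cancel_left₀ _ hpi] at h
  refine h.congr' ?_
  filter_upwards [(tendsto_blockScale.comp ha).eventually_gt_atTop 0] with p hp
  have hκ : blockNorm (m p) (a p) ≠ 0 := (mul_pos (Real.exp_pos _) hp).ne'
  simp only [Pi.div_apply]
  exact div_div_div_cancel_right₀ hκ _ _

theorem tendsto_blockAvg_id (ha : Tendsto a l atTop)
    (hm : ∀ᶠ p in l, |(m p : ℝ) - a p * Real.log (a p)| ≤ Real.log (a p) ^ 2) :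
    Tendsto (fun p => blockAvg (m p) fun T => (T - a p) / blockScale (a p)) l (nhds 0) := by
  have h := (tendsto_poissonSum ha hm (F := fun _ y => y) (F₀ := fun y => y) (K := 1)
    (fun p y => ?_) (.of_forall fun x y hy => hy)).2
  · rw [integral_id_mul_exp_neg_sq_div_two, ← mul_zero √(2 * Real.pi)] at h
    refine (tendsto_div_setoidCount ha hm h).congr fun p => ?_
    rw [poissonSum_id, blockAvg, mul_div_mul_left _ _ (Real.exp_ne_zero 1)]
  · have h1 : |y| ≤ (1 + y ^ 2) / 2 := by nlinarith [sq_nonneg (|y| - 1), sq_abs y]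
    nlinarith [sq_nonneg (y ^ 2 - 1), sq_nonneg (y ^ 4 - 1), sq_nonneg y]

theorem tendsto_blockAvg_sq (ha : Tendsto a l atTop)
    (hm : ∀ᶠ p in l, |(m p : ℝ) - a p * Real.log (a p)| ≤ Real.log (a p) ^ 2) :
    Tendsto (fun p => blockAvg (m p) fun T => ((T - a p) / blockScale (a p)) ^ 2) l (nhds 1) := by
  have h := (tendsto_poissonSum ha hm (F := fun _ y => y ^ 2) (F₀ := fun y => y ^ 2) (K := 1)
    (fun p y => ?_) (.of_forall fun x y hy => hy.pow 2)).2
  · rw [integral_sq_mul_exp_neg_sq_div_two, ← mul_one √(2 * Real.pi)] at h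
    have h2 : Tendsto (fun p => (1 / blockScale (a p)) ^ 2) l (nhds 0) := by
      have := (tendsto_const_nhds (x := (1 : ℝ))).div_atTop (tendsto_blockScale.comp ha)
      simpa using this.pow 2
    have h3 := (tendsto_div_setoidCount ha hm h).sub h2
    rw [sub_zero] at h3
    refine h3.congr fun p => ?_
    have hN : (setoidCount (m p) : ℝ) ≠ 0 := by exact_mod_cast (setoidCount_pos _).ne'
    have := Real.exp_ne_zero 1
    rw [poissonSum_sq, blockAvg, add_div, mul_div_mul_left _ _ this,
      mul_div_assoc (_ * _), mul_comm (Real.exp 1 * _) (_ / _), div_mul_cancel₀ _ (by positivity)]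
    ring
  · rw [abs_of_nonneg (by positivity)]
    nlinarith [sq_nonneg (y ^ 2 - 1), sq_nonneg (y ^ 4 - 1), sq_nonneg y]

theorem eventually_blockAvg_pow_eight_le (ha : Tendsto a l atTop)
    (hm : ∀ᶠ p in l, |(m p : ℝ) - a p * Real.log (a p)| ≤ Real.log (a p) ^ 2) :
    ∃ K : ℝ, ∀ᶠ p in l,
      blockAvg (m p) (fun T => ((T - a p) / blockScale (a p)) ^ 8) ≤ K := by
  have h := tendsto_poissonSum ha hm (F := fun _ y => y ^ 8) (F₀ := fun y => y ^ 8) (K := 1)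
    (fun p y => ?_) (.of_forall fun x y hy => hy.pow 8)
  · have hpi : √(2 * Real.pi) ≠ 0 := by positivity
    set I := ∫ x : ℝ, x ^ 8 * Real.exp (-x ^ 2 / 2)
    have h2 := h.2
    rw [show I = √(2 * Real.pi) * (I / √(2 * Real.pi)) by field_simp] at h2
    have h3 := tendsto_div_setoidCount ha hm h2
    refine ⟨(I / √(2 * Real.pi) + 1) * Real.exp 1, ?_⟩
    filter_upwards [h.1, h3.eventually_le_const (lt_add_one _)] with p h4 h5
    have h6 := blockSum_le_poissonSum (m p) (fun x => ((x - a p) / blockScale (a p)) ^ 8)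
      (fun x => by positivity) h4
    have hN : (0 : ℝ) < setoidCount (m p) := by exact_mod_cast setoidCount_pos _
    rw [div_le_iff₀ (by positivity)] at h5
    rw [blockAvg, div_le_iff₀ hN]
    linarith
  · rw [abs_of_nonneg (by positivity)]
    linarith

theorem tendsto_blockAvg_indicator (ha : Tendsto a l atTop)
    (hm : ∀ᶠ p in l, |(m p : ℝ) - a p * Real.log (a p)| ≤ Real.log (a p) ^ 2)
    {x : ι → ℝ} {t : ℝ} (hx : Tendsto (fun p => (x p - a p) / blockScale (a p)) l (nhds t)) :
    Tendsto (fun p => blockAvg (m p) fun T => if (T : ℝ) ≤ x p then 1 else 0) l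
      (nhds (stdNormalCdf t)) := by
  have hσ := tendsto_blockScale.comp ha
  have hpos := hσ.eventually_gt_atTop 0
  have key : ∀ {x : ι → ℝ}, Tendsto (fun p => (x p - a p) / blockScale (a p)) l (nhds t) →
      Tendsto (fun p => poissonSum (Fin (m p)) (fun y => if y ≤ x p then 1 else 0) /
        (Real.exp 1 * setoidCount (m p))) l (nhds (stdNormalCdf t)) := by
    intro x hx
    have h := (tendsto_poissonSum ha hm
      (F := fun p y => if y ≤ (x p - a p) / blockScale (a p) then 1 else 0)
      (F₀ := fun y => if y ≤ t then 1 else 0) (K := 1) (fun p y => ?_) ?_).2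
    · rw [integral_Iic_mul_exp_neg_sq_div_two] at h
      refine (tendsto_div_setoidCount ha hm h).congr' ?_
      filter_upwards [hpos] with p hp
      congr 2
      funext y
      have : 0 < blockScale (a p) := hp
      simp only [div_le_div_iff_of_pos_right this, sub_le_sub_iff_right]
    · have : 0 ≤ y ^ 8 := by positivity
      split_ifs <;> simp <;> linarith
    · have : ∀ᵐ x : ℝ, x ≠ t := by
        rw [MeasureTheory.ae_iff]; simp
      filter_upwards [this] with x hx' y hy
      exact tendsto_ite_le hx hx' hy
  have h1 : Tendsto (fun p => (x p - 1 - a p) / blockScale (a p)) l (nhds t) := by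
    have := hx.sub ((tendsto_const_nhds (x := (1 : ℝ))).div_atTop hσ)
    rw [sub_zero] at this
    refine this.congr fun p => ?_
    simp only [Function.comp]; ring
  have hr : Tendsto (fun p => √(blockScale (a p))) l atTop := Real.tendsto_sqrt_atTop.comp hσ
  have h2 : Tendsto (fun p => (x p + √(blockScale (a p)) - a p) / blockScale (a p)) l
      (nhds t) := by
    have := hx.add ((tendsto_const_nhds (x := (1 : ℝ))).div_atTop hr)
    rw [add_zero] at this
    refine this.congr' ?_
    filter_upwards [hpos] with p hp
    have hp' : 0 < blockScale (a p) := hp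
    have : 1 / √(blockScale (a p)) = √(blockScale (a p)) / blockScale (a p) := by
      rw [eq_div_iff hp'.ne', one_div, inv_mul_eq_div, Real.div_sqrt]
    rw [this]; ring
  have h3 : Tendsto (fun p => 1 - 1 / √(blockScale (a p))) l (nhds 1) := by
    simpa using tendsto_const_nhds.sub ((tendsto_const_nhds (x := (1 : ℝ))).div_atTop hr)
  have h4 := (key h2).div h3 one_ne_zero
  rw [div_one] at h4
  have hN : ∀ p, (0 : ℝ) < Real.exp 1 * setoidCount (m p) := fun p =>
    mul_pos (Real.exp_pos 1) (by exact_mod_cast setoidCount_pos _)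
  refine tendsto_of_tendsto_of_tendsto_of_le_of_le' (key h1) h4 (.of_forall fun p => ?_) ?_
  · have := poissonSum_indicator_le (m p) (x p)
    rw [blockAvg, div_le_iff₀ (hN p), div_mul_eq_mul_div, mul_left_comm, mul_div_assoc,
      mul_div_cancel_right₀ _ (by exact_mod_cast (setoidCount_pos _).ne')]
    exact this
  · filter_upwards [hr.eventually_gt_atTop 1] with p hp
    have h5 := le_poissonSum_indicator (m p) (x p) (r := √(blockScale (a p))) (by linarith)
    have h6 : 0 < 1 - 1 / √(blockScale (a p)) := by
      rw [sub_pos, div_lt_one (by linarith)]; exact hp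
    simp only [Pi.div_apply]
    rw [le_div_iff₀ h6, le_div_iff₀ (hN p), blockAvg]
    have hN' : (setoidCount (m p) : ℝ) ≠ 0 := by exact_mod_cast (setoidCount_pos _).ne'
    refine le_trans (le_of_eq ?_) h5
    field_simp

end

theorem exists_mul_log_eq (n : ℕ) : ∃ a : ℝ, 1 ≤ a ∧ a * Real.log a = n / 2 := by
  have hcont : ContinuousOn (fun x : ℝ => x * Real.log x) (Set.Icc 1 (n + 3)) :=
    Real.continuous_mul_log.continuousOn
  have hn := Nat.cast_nonneg (α := ℝ) n
  have hmem : (n : ℝ) / 2 ∈ Set.Icc ((1 : ℝ) * Real.log 1) ((n + 3) * Real.log (n + 3)) := by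
    refine ⟨by simp; positivity, ?_⟩
    have h1 : 1 ≤ Real.log (n + 3) := by
      rw [Real.le_log_iff_exp_le (by positivity)]
      linarith [Real.exp_one_lt_three]
    nlinarith
  obtain ⟨a, ha, h⟩ := intermediate_value_Icc (by linarith) hcont hmem
  exact ⟨a, ha.1, h⟩

/-- The solution `a` of `a log a = n / 2`. -/
def blockCentre (n : ℕ) : ℝ := (exists_mul_log_eq n).choose

theorem one_le_blockCentre (n : ℕ) : 1 ≤ blockCentre n := (exists_mul_log_eq n).choose_spec.1

theorem blockCentre_mul_log (n : ℕ) : blockCentre n * Real.log (blockCentre n) = n / 2 :=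
  (exists_mul_log_eq n).choose_spec.2

theorem half_le_blockCentre_sq (n : ℕ) : (n : ℝ) / 2 ≤ blockCentre n ^ 2 := by
  have h := one_le_blockCentre n
  have h1 := Real.log_le_sub_one_of_pos (show 0 < blockCentre n by linarith)
  nlinarith [blockCentre_mul_log n]

theorem tendsto_blockCentre : Tendsto blockCentre atTop atTop := by
  have h1 : Tendsto (fun n : ℕ => √((n : ℝ) / 2)) atTop atTop :=
    Real.tendsto_sqrt_atTop.comp (tendsto_natCast_atTop_atTop.atTop_div_const (by norm_num))
  refine tendsto_atTop_mono (fun n => ?_) h1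
  exact Real.sqrt_le_left (by linarith [one_le_blockCentre n]) |>.2 (half_le_blockCentre_sq n)

theorem log_le_two_mul_log_blockCentre {n : ℕ} (hn : 1 ≤ n) :
    Real.log n ≤ 2 * Real.log (blockCentre n) + Real.log 2 := by
  have hn' : (0 : ℝ) < n := by exact_mod_cast hn
  have h := one_le_blockCentre n
  have h1 : (n : ℝ) ≤ blockCentre n ^ 2 * 2 := by linarith [half_le_blockCentre_sq n]
  have h2 := Real.log_le_log hn' h1
  rw [Real.log_mul (by positivity) (by norm_num), Real.log_pow] at h2
  exact_mod_cast h2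

theorem tendsto_log_div_log_blockCentre :
    Tendsto (fun n : ℕ => Real.log n / Real.log (blockCentre n)) atTop (nhds 1) := by
  have hlog := Real.tendsto_log_atTop.comp tendsto_blockCentre
  have h1 : Tendsto (fun x : ℝ => Real.log x / x) atTop (nhds 0) := by
    simpa using Real.isLittleO_log_id_atTop.tendsto_div_nhds_zero
  have h2 : Tendsto (fun n : ℕ => 1 + Real.log 2 / Real.log (blockCentre n) +
      Real.log (Real.log (blockCentre n)) / Real.log (blockCentre n)) atTop (nhds 1) := by
    have := (tendsto_const_nhds (x := (1 : ℝ))).add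
      ((tendsto_const_nhds (x := Real.log 2)).div_atTop hlog) |>.add (h1.comp hlog)
    simpa using this
  refine h2.congr' ?_
  filter_upwards [hlog.eventually_gt_atTop 0, eventually_ge_atTop 1] with n h3 hn
  simp only [Function.comp] at h3
  have h4 := one_le_blockCentre n
  have h5 : (n : ℝ) = 2 * (blockCentre n * Real.log (blockCentre n)) := by
    rw [blockCentre_mul_log]; ring
  have h6 : Real.log n = Real.log 2 + (Real.log (blockCentre n) +
      Real.log (Real.log (blockCentre n))) := by
    conv_lhs => rw [h5]
    rw [Real.log_mul (by norm_num) (by positivity), Real.log_mul (by positivity) h3.ne']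
  rw [h6]
  field_simp
  ring

theorem tendsto_blockCentre_mul :
    Tendsto (fun n : ℕ => blockCentre n * (2 * Real.log n) / n) atTop (nhds 1) := by
  refine tendsto_log_div_log_blockCentre.congr' ?_
  filter_upwards [(Real.tendsto_log_atTop.comp tendsto_blockCentre).eventually_gt_atTop 0,
    eventually_ge_atTop 1] with n h3 hn
  simp only [Function.comp] at h3
  have hn' : (0 : ℝ) < n := by exact_mod_cast hn
  rw [div_eq_div_iff h3.ne' hn'.ne']
  linear_combination (-2 * Real.log n) * blockCentre_mul_log n

theorem tendsto_blockScale_sq_mul :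
    Tendsto (fun n : ℕ => blockScale (blockCentre n) ^ 2 * (2 * Real.log n ^ 2) / n) atTop
      (nhds 1) := by
  have hlog := Real.tendsto_log_atTop.comp tendsto_blockCentre
  have h1 : Tendsto (fun n => 1 - 1 / (Real.log (blockCentre n) + 1)) atTop (nhds 1) := by
    have := (tendsto_const_nhds (x := (1 : ℝ))).sub ((tendsto_const_nhds (x := (1 : ℝ))).div_atTop
      (tendsto_atTop_add_const_right _ 1 hlog))
    simpa using this
  have h2 := (tendsto_log_div_log_blockCentre.pow 2).mul h1
  rw [one_pow, one_mul] at h2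
  refine h2.congr' ?_
  filter_upwards [hlog.eventually_gt_atTop 0, eventually_ge_atTop 1] with n h3 hn
  simp only [Function.comp] at h3
  have hn' : (0 : ℝ) < n := by exact_mod_cast hn
  have h4 := one_le_blockCentre n
  have h5 : (n : ℝ) = 2 * (blockCentre n * Real.log (blockCentre n)) := by
    rw [blockCentre_mul_log]; ring
  rw [blockScale, Real.sq_sqrt (by positivity)]
  generalize Real.log n = y
  have h6 : Real.log (blockCentre n) + 1 ≠ 0 := by positivity
  rw [h5]
  have h7 : blockCentre n ≠ 0 := by positivity
  field_simp
  ring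

/-- The sizes of central sets that matter. -/
def Window (n k : ℕ) : Prop := 2 ^ Nat.dist k (n / 2) < 2 * n ^ 2

/-- The filter of pairs `(n, k)` with `k` in the window of `n`, as `n` grows. -/
def windowFilter : Filter (ℕ × ℕ) := atTop.comap Prod.fst ⊓ 𝓟 {p | Window p.1 p.2}

instance : windowFilter.IsCountablyGenerated := by unfold windowFilter; infer_instance

theorem eventually_windowFilter {P : ℕ → ℕ → Prop} :
    (∀ᶠ p in windowFilter, P p.1 p.2) ↔ ∀ᶠ n in atTop, ∀ k, Window n k → P n k := by
  rw [windowFilter, eventually_inf_principal, eventually_comap]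
  refine eventually_congr (.of_forall fun n => ⟨fun h k hk => h (n, k) rfl hk, ?_⟩)
  rintro h ⟨_, k⟩ rfl hk
  exact h k hk

theorem tendsto_fst_windowFilter : Tendsto Prod.fst windowFilter atTop :=
  tendsto_comap.mono_left inf_le_left

theorem Window.dist_mul_log_two_le {n k : ℕ} (h : Window n k) (hn : 1 ≤ n) :
    (Nat.dist k (n / 2) : ℝ) * Real.log 2 ≤ Real.log 2 + 2 * Real.log n := by
  have hn' : (0 : ℝ) < n := by exact_mod_cast hn
  have h1 : (2 : ℝ) ^ Nat.dist k (n / 2) ≤ 2 * n ^ 2 := by exact_mod_cast h.le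
  have h2 := Real.log_le_log (by positivity) h1
  rw [Real.log_mul (by norm_num) (by positivity), Real.log_pow, Real.log_pow] at h2
  exact_mod_cast h2

theorem Window.le_sq_log {n k : ℕ} (h : Window n k) (hn : 1 ≤ n)
    (hlog : 13 ≤ Real.log (blockCentre n)) :
    (Nat.dist k (n / 2) : ℝ) + 1 ≤ Real.log (blockCentre n) ^ 2 := by
  have h1 := h.dist_mul_log_two_le hn
  have h2 := log_le_two_mul_log_blockCentre hn
  have h3 := Real.log_two_gt_d9
  have h4 : (Nat.dist k (n / 2) : ℝ) * Real.log 2 ≤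
      (3 + 8 * Real.log (blockCentre n)) * Real.log 2 := by nlinarith
  have h5 := le_of_mul_le_mul_right h4 (by linarith)
  nlinarith

theorem abs_sub_half_le (n k : ℕ) (hk : k ≤ n) :
    |((n - k : ℕ) : ℝ) - n / 2| ≤ Nat.dist k (n / 2) + 1 := by
  have h1 : ((n - k : ℕ) : ℝ) = n - k := by push_cast [hk]; ring
  have h2 : 2 * k ≤ n + 2 * Nat.dist k (n / 2) ∧ n ≤ 2 * k + 1 + 2 * Nat.dist k (n / 2) := by
    unfold Nat.dist; omega
  have h3 : (2 * k : ℝ) ≤ n + 2 * Nat.dist k (n / 2) := by exact_mod_cast h2.1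
  have h4 : (n : ℝ) ≤ 2 * k + 1 + 2 * Nat.dist k (n / 2) := by exact_mod_cast h2.2
  rw [h1, abs_le]
  constructor <;> linarith

theorem eventually_window_lt : ∀ᶠ n in atTop, ∀ k, Window n k → 40 * Nat.dist k (n / 2) < n := by
  have h2 : 0 < Real.log 2 := Real.log_pos one_lt_two
  filter_upwards [eventually_pow_le_exp 2 2 (c := Real.log 2 / 40) (by positivity)] with n h k hk
  by_contra hlt
  have h3 : (n : ℝ) ≤ 40 * Nat.dist k (n / 2) := by exact_mod_cast not_lt.1 hlt
  have h4 : Real.exp (Real.log 2 / 40 * n) ≤ 2 ^ Nat.dist k (n / 2) := by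
    rw [← Real.exp_log (show (0 : ℝ) < 2 ^ Nat.dist k (n / 2) by positivity), Real.log_pow]
    refine Real.exp_le_exp.2 ?_
    nlinarith
  have h5 : ((2 ^ Nat.dist k (n / 2) : ℕ) : ℝ) < ((2 * n ^ 2 : ℕ) : ℝ) := by exact_mod_cast hk
  push_cast at h5
  linarith

theorem tendsto_centre_windowFilter :
    Tendsto (fun p : ℕ × ℕ => blockCentre p.1) windowFilter atTop :=
  tendsto_blockCentre.comp tendsto_fst_windowFilter

theorem eventually_abs_sub_le_windowFilter : ∀ᶠ p : ℕ × ℕ in windowFilter,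
    |((p.1 - p.2 : ℕ) : ℝ) - blockCentre p.1 * Real.log (blockCentre p.1)| ≤
      Real.log (blockCentre p.1) ^ 2 := by
  refine (eventually_windowFilter (P := fun n k => |((n - k : ℕ) : ℝ) -
    blockCentre n * Real.log (blockCentre n)| ≤ Real.log (blockCentre n) ^ 2)).2 ?_
  filter_upwards [(Real.tendsto_log_atTop.comp tendsto_blockCentre).eventually_ge_atTop 13,
    eventually_ge_atTop 1, eventually_window_lt] with n h1 h2 h3 k hk
  have hkn : k ≤ n := by
    have := h3 k hk
    unfold Nat.dist at this
    omega
  rw [blockCentre_mul_log]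
  exact (abs_sub_half_le n k hkn).trans (hk.le_sq_log h2 h1)

/-! ### Almost every arrangement is determined by its graph -/

theorem setoidCount_mul_le (x y : ℕ) :
    setoidCount x * setoidCount y ≤ setoidCount (x + y) := by
  have h : Fintype.card (Setoid (Fin x) × Setoid (Fin y)) ≤
      Fintype.card (Setoid (Fin x ⊕ Fin y)) := by
    refine Fintype.card_le_of_injective (fun p => Setoid.ker
      (Sum.map (Quotient.mk p.1) (Quotient.mk p.2))) fun p q h => ?_
    have h1 : ∀ (p : Setoid (Fin x) × Setoid (Fin y)) i j, (Setoid.ker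
        (Sum.map (Quotient.mk p.1) (Quotient.mk p.2))) (Sum.inl i) (Sum.inl j) ↔ p.1 i j := by
      intro p i j
      simp only [Setoid.ker_def, Sum.map_inl, Sum.inl.injEq]
      exact Quotient.eq
    have h2 : ∀ (p : Setoid (Fin x) × Setoid (Fin y)) i j, (Setoid.ker
        (Sum.map (Quotient.mk p.1) (Quotient.mk p.2))) (Sum.inr i) (Sum.inr j) ↔ p.2 i j := by
      intro p i j
      simp only [Setoid.ker_def, Sum.map_inr, Sum.inr.injEq]
      exact Quotient.eq
    refine Prod.ext (Setoid.ext fun i j => ?_) (Setoid.ext fun i j => ?_)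
    · rw [← h1 p, ← h1 q]; exact iff_of_eq (congrArg (fun r : Setoid _ => r _ _) h)
    · rw [← h2 p, ← h2 q]; exact iff_of_eq (congrArg (fun r : Setoid _ => r _ _) h)
  rw [Fintype.card_prod, card_setoid (Fin x ⊕ Fin y)] at h
  simpa [setoidCount] using h

section
variable {X : Type*} [Fintype X]

/-- The class of an element. -/
def cls (s : Setoid X) (u : X) : Finset X := Finset.univ.filter fun w => s u w

theorem card_class_le (B : Finset X) :
    ((Finset.univ : Finset (Setoid X)).filter fun s => ∃ u, cls s u = B).card ≤
      setoidCount (Fintype.card X - B.card) := by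
  have h0 : Fintype.card {v : X // v ∉ B} = Fintype.card X - B.card := by
    rw [Fintype.card_subtype_compl, Fintype.card_coe]
  rw [← h0, ← card_setoid, ← Finset.card_univ]
  refine Finset.card_le_card_of_injOn (fun s => s.comap Subtype.val)
    (fun _ _ => Finset.mem_coe.2 (Finset.mem_univ _)) ?_
  intro s hs t ht h
  obtain ⟨u, hu⟩ := (Finset.mem_filter.1 (Finset.mem_coe.1 hs)).2
  obtain ⟨v, hv⟩ := (Finset.mem_filter.1 (Finset.mem_coe.1 ht)).2
  have key : ∀ (r : Setoid X) (u : X), cls r u = B → ∀ i ∈ B, ∀ j, r i j ↔ j ∈ B := by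
    intro r u hr i hi j
    rw [← hr] at hi ⊢
    simp only [cls, Finset.mem_filter, Finset.mem_univ, true_and] at hi ⊢
    exact ⟨fun hij => r.trans hi hij, fun hj => r.trans (r.symm hi) hj⟩
  refine Setoid.ext fun i j => ?_
  by_cases hi : i ∈ B
  · rw [key s u hu i hi, key t v hv i hi]
  · by_cases hj : j ∈ B
    · rw [s.comm' (x := i) (y := j), t.comm' (x := i) (y := j), key s u hu j hj, key t v hv j hj]
    · exact iff_of_eq (congrArg (fun r : Setoid {v : X // v ∉ B} => r ⟨i, hi⟩ ⟨j, hj⟩) h)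

theorem card_large_class_le (q : ℕ) :
    ((Finset.univ : Finset (Setoid X)).filter fun s => ∃ u, q < (cls s u).card).card ≤
      2 ^ Fintype.card X * setoidCount (Fintype.card X - q) := by
  have hsub : ((Finset.univ : Finset (Setoid X)).filter fun s => ∃ u, q < (cls s u).card) ⊆
      ((Finset.univ : Finset (Finset X)).filter fun B => q < B.card).biUnion fun B =>
        (Finset.univ : Finset (Setoid X)).filter fun s => ∃ u, cls s u = B := by
    intro s hs
    obtain ⟨u, hu⟩ := (Finset.mem_filter.1 hs).2
    exact Finset.mem_biUnion.2 ⟨cls s u, Finset.mem_filter.2 ⟨Finset.mem_univ _, hu⟩,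
      Finset.mem_filter.2 ⟨Finset.mem_univ _, u, rfl⟩⟩
  refine (Finset.card_le_card hsub).trans ((Finset.card_biUnion_le_card_mul _ _
    (setoidCount (Fintype.card X - q)) fun B hB => ?_).trans ?_)
  · have := (Finset.mem_filter.1 hB).2
    exact (card_class_le B).trans
      (setoidCount_mono (by omega))
  · gcongr
    refine (Finset.card_le_univ _).trans ?_
    simp

/-- The support of `r` is covered by two classes. -/
def TwoBlocks (s : Setoid X) (r : X → Bool) : Prop := ∃ u v, ∀ w, r w = true → s u w ∨ s v w

theorem card_support_subset_le (B : Finset X) :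
    ((Finset.univ : Finset (X → Bool)).filter fun r => ∀ w, r w = true → w ∈ B).card ≤
      2 ^ B.card := by
  rw [← Finset.card_powerset]
  refine Finset.card_le_card_of_injOn (fun r => Finset.univ.filter fun w => r w = true) ?_ ?_
  · intro r hr
    refine Finset.mem_coe.2 (Finset.mem_powerset.2 fun w hw => ?_)
    exact (Finset.mem_filter.1 (Finset.mem_coe.1 hr)).2 w (Finset.mem_filter.1 hw).2
  · intro r _ r' _ h
    funext w
    have := congrArg (fun S : Finset X => w ∈ S) h
    simp only [Finset.mem_filter, Finset.mem_univ, true_and, eq_iff_iff] at this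
    exact Bool.eq_iff_iff.2 this

theorem card_twoBlocks_le (s : Setoid X) {q : ℕ} (h : ∀ u, (cls s u).card ≤ q) :
    ((Finset.univ : Finset (X → Bool)).filter fun r => TwoBlocks s r).card ≤
      Fintype.card X ^ 2 * 2 ^ (2 * q) := by
  have hsub : ((Finset.univ : Finset (X → Bool)).filter fun r => TwoBlocks s r) ⊆
      (Finset.univ : Finset (X × X)).biUnion fun p => Finset.univ.filter
        fun r => ∀ w, r w = true → w ∈ cls s p.1 ∪ cls s p.2 := by
    intro r hr
    obtain ⟨u, v, huv⟩ := (Finset.mem_filter.1 hr).2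
    refine Finset.mem_biUnion.2 ⟨(u, v), Finset.mem_univ _,
      Finset.mem_filter.2 ⟨Finset.mem_univ _, fun w hw => ?_⟩⟩
    simpa [cls] using huv w hw
  refine (Finset.card_le_card hsub).trans ((Finset.card_biUnion_le_card_mul _ _
    (2 ^ (2 * q)) fun p _ => (card_support_subset_le _).trans ?_).trans ?_)
  · refine Nat.pow_le_pow_right two_pos ((Finset.card_union_le _ _).trans ?_)
    linarith [h p.1, h p.2]
  · simp [sq]

theorem card_row_mem_mul {A Y : Type*} [Fintype A] [Fintype Y] (x : A) (S : Finset Y) :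
    ((Finset.univ : Finset (A → Y)).filter fun f => f x ∈ S).card * Fintype.card Y =
      S.card * Fintype.card (A → Y) := by
  rw [← Finset.card_univ (α := Y), ← Finset.card_product, ← Finset.card_univ (α := A → Y),
    ← Finset.card_product]
  refine Finset.card_nbij' (fun p => (p.1 x, Function.update p.1 x p.2))
    (fun p => (Function.update p.2 x p.1, p.2 x)) ?_ ?_ ?_ ?_
  · rintro ⟨f, y⟩ h
    simp only [Finset.coe_product, Set.mem_prod, Finset.mem_coe, Finset.mem_filter,
      Finset.mem_univ, true_and, and_true] at h ⊢
    exact h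
  · rintro ⟨y, f⟩ h
    simp only [Finset.coe_product, Set.mem_prod, Finset.mem_coe, Finset.mem_filter,
      Finset.mem_univ, true_and, and_true, Function.update_self] at h ⊢
    exact h
  · rintro ⟨f, y⟩ _
    simp
  · rintro ⟨y, f⟩ _
    simp

theorem card_exists_row_le {A : Type*} [Fintype A] (s : Setoid X) {q : ℕ}
    (h : ∀ u, (cls s u).card ≤ q) :
    ((Finset.univ : Finset (A → X → Bool)).filter fun f => ∃ x, TwoBlocks s (f x)).card *
      2 ^ Fintype.card X ≤
      Fintype.card A * (Fintype.card X ^ 2 * 2 ^ (2 * q)) * Fintype.card (A → X → Bool) := by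
  have hsub : ((Finset.univ : Finset (A → X → Bool)).filter fun f => ∃ x, TwoBlocks s (f x)) ⊆
      (Finset.univ : Finset A).biUnion fun x => Finset.univ.filter
        fun f => f x ∈ (Finset.univ : Finset (X → Bool)).filter fun r => TwoBlocks s r := by
    intro f hf
    obtain ⟨x, hx⟩ := (Finset.mem_filter.1 hf).2
    exact Finset.mem_biUnion.2 ⟨x, Finset.mem_univ _, Finset.mem_filter.2
      ⟨Finset.mem_univ _, Finset.mem_filter.2 ⟨Finset.mem_univ _, hx⟩⟩⟩
  have hc : Fintype.card (X → Bool) = 2 ^ Fintype.card X := by simp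
  refine (Nat.mul_le_mul_right _ ((Finset.card_le_card hsub).trans Finset.card_biUnion_le)).trans ?_
  rw [← hc, Finset.sum_mul, mul_assoc, ← smul_eq_mul, ← Finset.card_univ (α := A)]
  refine Finset.sum_le_card_nsmul _ _ _ fun x _ => ?_
  have h1 := card_row_mem_mul x ((Finset.univ : Finset (X → Bool)).filter fun r => TwoBlocks s r)
  refine le_trans (le_of_eq ?_) (h1.le.trans (Nat.mul_le_mul_right _ (card_twoBlocks_le s h)))
  congr!

theorem card_pair_twoBlocks_le {A : Type*} [Fintype A] (q : ℕ) :
    ((Finset.univ : Finset (Setoid X × (A → X → Bool))).filter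
      fun p => ∃ x, TwoBlocks p.1 (p.2 x)).card * 2 ^ Fintype.card X ≤
      (4 ^ Fintype.card X * setoidCount (Fintype.card X - q) +
        setoidCount (Fintype.card X) * (Fintype.card A * (Fintype.card X ^ 2 * 2 ^ (2 * q)))) *
        2 ^ (Fintype.card A * Fintype.card X) := by
  have h0 : Fintype.card (A → X → Bool) = 2 ^ (Fintype.card A * Fintype.card X) := by
    rw [Fintype.card_fun, Fintype.card_fun, Fintype.card_bool, ← pow_mul, mul_comm]
  rw [← h0]
  have h1 : ((Finset.univ : Finset (Setoid X × (A → X → Bool))).filter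
      fun p => ∃ x, TwoBlocks p.1 (p.2 x)).card = ∑ s : Setoid X,
      ((Finset.univ : Finset (A → X → Bool)).filter fun f => ∃ x, TwoBlocks s (f x)).card := by
    simp only [Finset.card_filter]
    exact Fintype.sum_prod_type _
  rw [h1, Finset.sum_mul]
  have h2 : ∀ s : Setoid X, ((Finset.univ : Finset (A → X → Bool)).filter
      fun f => ∃ x, TwoBlocks s (f x)).card * 2 ^ Fintype.card X ≤
      (if ∃ u, q < (cls s u).card then Fintype.card (A → X → Bool) * 2 ^ Fintype.card X else 0) +
      Fintype.card A * (Fintype.card X ^ 2 * 2 ^ (2 * q)) * Fintype.card (A → X → Bool) := by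
    intro s
    split_ifs with h
    · exact le_add_right (Nat.mul_le_mul_right _ (Finset.card_le_univ _))
    · rw [zero_add]
      push Not at h
      exact card_exists_row_le s h
  refine (Finset.sum_le_sum fun s _ => h2 s).trans ?_
  rw [Finset.sum_add_distrib, ← Finset.sum_filter, Finset.sum_const, Finset.sum_const,
    Finset.card_univ, card_setoid, smul_eq_mul, smul_eq_mul, add_mul]
  refine Nat.add_le_add ?_ (le_of_eq (by ring))
  refine (Nat.mul_le_mul_right _ (card_large_class_le q)).trans (le_of_eq ?_)
  rw [show (4 : ℕ) = 2 * 2 from rfl, mul_pow]; ring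

end

theorem eventually_pow_le_two_pow (k d : ℕ) (hd : 0 < d) :
    ∀ᶠ n : ℕ in atTop, n ^ k ≤ 2 ^ (n / d) := by
  have h2 : 0 < Real.log 2 := Real.log_pos one_lt_two
  have hd' : (0 : ℝ) < d := by exact_mod_cast hd
  filter_upwards [eventually_pow_le_exp 2 k (c := Real.log 2 / d) (by positivity)] with n h
  have h3 : (n : ℝ) ≤ d * ((n / d : ℕ) + 1) := by
    have := (Nat.lt_mul_div_succ n hd).le
    exact_mod_cast this
  have h4 : Real.exp (Real.log 2 / d * n) ≤ 2 ^ (n / d + 1) := by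
    rw [← Real.exp_log (show (0 : ℝ) < 2 ^ (n / d + 1) by positivity), Real.log_pow]
    refine Real.exp_le_exp.2 ?_
    rw [div_mul_eq_mul_div, div_le_iff₀ hd']
    push_cast
    nlinarith
  have h5 : 2 * (n : ℝ) ^ k ≤ 2 * 2 ^ (n / d) := by rw [pow_succ] at h4; linarith
  have h6 : (n : ℝ) ^ k ≤ 2 ^ (n / d) := by linarith
  exact_mod_cast h6

theorem eventually_window_bounds : ∀ᶠ n in atTop, ∀ k, Window n k →
    k ≤ n ∧ n ≤ 3 * (n - k) ∧ n ≤ 3 * k ∧ 40 * Nat.dist k (n / 2) < n := by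
  filter_upwards [eventually_window_lt, eventually_ge_atTop 100] with n h hn k hk
  have := h k hk
  unfold Nat.dist at this ⊢
  omega

theorem eventually_twoBlocks_bound : ∀ᶠ n in atTop, ∀ k, Window n k →
    n ^ 4 * (4 ^ (n - k) * setoidCount (n - k - (n - k) / 4) + setoidCount (n - k) *
      (k * ((n - k) ^ 2 * 2 ^ (2 * ((n - k) / 4))))) ≤ 2 * 2 ^ (n - k) * setoidCount (n - k) := by
  filter_upwards [eventually_window_bounds, eventually_pow_le_two_pow 7 100 (by norm_num),
    eventually_pow_le_two_pow 4 100 (by norm_num), eventually_ge_atTop 5000] with n hw h7 h4 hn k hk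
  obtain ⟨hkn, h3, -, -⟩ := hw k hk
  obtain ⟨m, hm⟩ : ∃ m, m = n - k := ⟨_, rfl⟩
  rw [← hm] at h3 ⊢
  have hmn : m ≤ n := by omega
  have e1 : n ^ 4 * (4 ^ m * setoidCount (m - m / 4)) ≤ 2 ^ m * setoidCount m := by
    have e2 : n ^ 4 * 2 ^ m ≤ setoidCount (m / 4) := by
      have e3 := pow_le_setoidCount 64 (m / 4 - 64)
      rw [show 64 + (m / 4 - 64) = m / 4 by omega, show 64 = 2 ^ 6 by norm_num, ← pow_mul] at e3
      refine le_trans ?_ e3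
      calc n ^ 4 * 2 ^ m ≤ 2 ^ (n / 100) * 2 ^ m := by gcongr
        _ = 2 ^ (n / 100 + m) := (pow_add _ _ _).symm
        _ ≤ _ := Nat.pow_le_pow_right two_pos (by omega)
    have e4 := setoidCount_mul_le (m - m / 4) (m / 4)
    rw [show m - m / 4 + m / 4 = m by omega] at e4
    calc n ^ 4 * (4 ^ m * setoidCount (m - m / 4))
        = 2 ^ m * (setoidCount (m - m / 4) * (n ^ 4 * 2 ^ m)) := by
          rw [show (4 : ℕ) ^ m = 2 ^ m * 2 ^ m by rw [← mul_pow]; norm_num]; ring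
      _ ≤ 2 ^ m * (setoidCount (m - m / 4) * setoidCount (m / 4)) := by gcongr
      _ ≤ _ := by gcongr
  have e5 : n ^ 4 * (setoidCount m * (k * (m ^ 2 * 2 ^ (2 * (m / 4))))) ≤
      2 ^ m * setoidCount m := by
    calc n ^ 4 * (setoidCount m * (k * (m ^ 2 * 2 ^ (2 * (m / 4)))))
        ≤ n ^ 4 * (setoidCount m * (n * (n ^ 2 * 2 ^ (2 * (m / 4))))) := by gcongr
      _ = n ^ 7 * 2 ^ (2 * (m / 4)) * setoidCount m := by ring
      _ ≤ 2 ^ (n / 100) * 2 ^ (2 * (m / 4)) * setoidCount m := by gcongr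
      _ = 2 ^ (n / 100 + 2 * (m / 4)) * setoidCount m := by rw [pow_add]
      _ ≤ _ := Nat.mul_le_mul_right _ (Nat.pow_le_pow_right two_pos (by omega))
  calc _ = n ^ 4 * (4 ^ m * setoidCount (m - m / 4)) +
        n ^ 4 * (setoidCount m * (k * (m ^ 2 * 2 ^ (2 * (m / 4))))) := by ring
    _ ≤ _ := by linarith

theorem eventually_many_blocks_bound : ∃ K : ℝ, 0 ≤ K ∧ ∀ᶠ n : ℕ in atTop, ∀ k, Window n k →
    (n : ℝ) ^ 4 * blockSum (n - k) (fun T => if 5 * T ≤ 2 * n then 0 else 1) ≤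
      K * setoidCount (n - k) := by
  obtain ⟨K, hK⟩ := eventually_blockAvg_pow_eight_le tendsto_centre_windowFilter
    eventually_abs_sub_le_windowFilter
  have hK' := (eventually_windowFilter (P := fun n k => blockAvg (n - k)
    (fun T => ((T - blockCentre n) / blockScale (blockCentre n)) ^ 8) ≤ K)).1 hK
  refine ⟨|K| * 5 ^ 8, by positivity, ?_⟩
  filter_upwards [hK', eventually_ge_atTop 1, (Real.tendsto_log_atTop.comp
    tendsto_blockCentre).eventually_ge_atTop 3] with n h1 hn h3 k hk
  have h4 := h1 k hk
  simp only [Function.comp] at h3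
  have hn' : (0 : ℝ) < n := by exact_mod_cast hn
  have hN : (0 : ℝ) < setoidCount (n - k) := by exact_mod_cast setoidCount_pos _
  set a := blockCentre n with ha
  have ha1 : 1 ≤ a := one_le_blockCentre n
  have ha2 : a * Real.log a = n / 2 := blockCentre_mul_log n
  have ha3 : a ≤ n / 5 := by nlinarith
  have hs0 : 0 < blockScale a := by
    refine Real.sqrt_pos.2 ?_; positivity
  have hs : blockScale a ^ 8 ≤ n ^ 4 := by
    have : blockScale a ^ 2 ≤ n := by
      rw [blockScale, Real.sq_sqrt (by positivity)]
      refine (div_le_self (by linarith) (by linarith)).trans (by linarith)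
    calc blockScale a ^ 8 = (blockScale a ^ 2) ^ 4 := by ring
      _ ≤ _ := by gcongr
  have hpt : ∀ T : ℕ, (n : ℝ) ^ 4 * (if 5 * T ≤ 2 * n then 0 else 1) ≤
      5 ^ 8 * ((T - a) / blockScale a) ^ 8 := by
    intro T
    split_ifs with hT
    · rw [mul_zero]; positivity
    · have hT' : (2 * n : ℝ) < 5 * T := by exact_mod_cast not_le.1 hT
      rw [mul_one, div_pow, ← mul_div_assoc, le_div_iff₀ (by positivity)]
      have h5 : (n : ℝ) / 5 ≤ T - a := by linarith
      calc (n : ℝ) ^ 4 * blockScale a ^ 8 ≤ n ^ 4 * n ^ 4 := by gcongr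
        _ = 5 ^ 8 * ((n : ℝ) / 5) ^ 8 := by ring
        _ ≤ _ := by gcongr
  rw [blockAvg, div_le_iff₀ hN] at h4
  calc (n : ℝ) ^ 4 * blockSum (n - k) (fun T => if 5 * T ≤ 2 * n then 0 else 1)
      = ∑ s : Setoid (Fin (n - k)), (n : ℝ) ^ 4 * (if 5 * blocks s ≤ 2 * n then 0 else 1) := by
        rw [blockSum, Finset.mul_sum]
    _ ≤ ∑ s : Setoid (Fin (n - k)), 5 ^ 8 * (((blocks s : ℝ) - a) / blockScale a) ^ 8 :=
        Finset.sum_le_sum fun s _ => hpt _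
    _ = 5 ^ 8 * blockSum (n - k) (fun T => ((T - a) / blockScale a) ^ 8) := by
        rw [blockSum, Finset.mul_sum]
    _ ≤ 5 ^ 8 * (K * setoidCount (n - k)) := by gcongr
    _ ≤ 5 ^ 8 * (|K| * setoidCount (n - k)) := by gcongr; exact le_abs_self K
    _ = _ := by ring

theorem setoidCount_succ_le (m : ℕ) : setoidCount (m + 1) ≤ (m + 1) * setoidCount m := by
  have h : Fintype.card (Setoid (Option (Fin m))) ≤
      Fintype.card (Option (Fin m) × Setoid (Fin m)) := by
    refine Fintype.card_le_of_injective (fun s =>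
      (if h : ∃ x, s none (some x) then some h.choose else none, s.comap some)) fun s t h => ?_
    have h2 : ∀ x y, s (some x) (some y) ↔ t (some x) (some y) := fun x y =>
      iff_of_eq (congrArg (fun r : Setoid (Fin m) => r x y) (Prod.ext_iff.1 h).2)
    have h3 : ∀ y, s none (some y) ↔ t none (some y) := by
      have h1 := (Prod.ext_iff.1 h).1
      dsimp only at h1
      split_ifs at h1 with hs ht ht
      · have e := Option.some_injective _ h1
        have hs' := hs.choose_spec
        have ht' := ht.choose_spec
        rw [← e] at ht'
        intro y
        have h4 : ∀ (r : Setoid (Option (Fin m))) x, r none (some x) →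
            (r none (some y) ↔ r (some x) (some y)) := fun r x hr =>
          ⟨fun h => r.trans (r.symm hr) h, fun h => r.trans hr h⟩
        rw [h4 s _ hs', h4 t _ ht', h2]
      · push Not at hs ht
        exact fun y => iff_of_false (hs y) (ht y)
    refine Setoid.ext fun i j => ?_
    rcases i with _ | i <;> rcases j with _ | j
    · exact iff_of_true (s.refl _) (t.refl _)
    · exact h3 j
    · rw [s.comm' (x := some i) (y := none), t.comm' (x := some i) (y := none)]
      exact h3 i
    · exact h2 i j
  rw [card_setoid, Fintype.card_prod, Fintype.card_option, Fintype.card_fin] at h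
  exact h

theorem setoidCount_add_le {n m : ℕ} (d : ℕ) (h : m + d ≤ n) :
    setoidCount (m + d) ≤ n ^ d * setoidCount m := by
  induction d with
  | zero => simp
  | succ d ih =>
    calc setoidCount (m + d + 1) ≤ (m + d + 1) * setoidCount (m + d) := setoidCount_succ_le _
      _ ≤ n * (n ^ d * setoidCount m) := Nat.mul_le_mul (by omega) (ih (by omega))
      _ = _ := by ring

theorem eventually_not_window_bound : ∀ᶠ n : ℕ in atTop, ∀ k ≤ n, ¬ Window n k →
    n ^ 6 * (n.choose k * (setoidCount (n - k) * 2 ^ (k * (n - k)))) ≤ arrCount n := by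
  filter_upwards [eventually_ge_atTop 100] with n hn k hk hw
  refine le_trans ?_ (choose_mul_le_arrCount (show n / 2 ≤ n by omega))
  set d := Nat.dist k (n / 2) with hd
  have hw' : 2 * n ^ 2 ≤ 2 ^ d := not_lt.1 hw
  have hd6 : 6 ≤ d := by
    by_contra h
    have : 2 ^ d ≤ 2 ^ 5 := Nat.pow_le_pow_right two_pos (by omega)
    nlinarith
  have e1 : setoidCount (n - k) ≤ n ^ d * setoidCount (n - n / 2) := by
    rcases le_total k (n / 2) with h | h
    · have h1 : n - k = n - n / 2 + d := by rw [hd, Nat.dist_eq_sub_of_le h]; omega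
      rw [h1]
      exact setoidCount_add_le d (by omega)
    · exact (setoidCount_mono (by omega)).trans
        (Nat.le_mul_of_pos_left _ (pow_pos (by omega) _))
  have e2 : k * (n - k) + d ^ 2 ≤ n / 2 * (n - n / 2) + d := by
    obtain ⟨q, hq⟩ : ∃ q, q = n / 2 := ⟨_, rfl⟩
    obtain ⟨r, hr⟩ : ∃ r, r = n - n / 2 := ⟨_, rfl⟩
    rw [← hr, ← hq]
    have hqr : q ≤ r ∧ r ≤ q + 1 := by omega
    rcases le_total k (n / 2) with h | h
    · have h1 : q = k + d := by rw [hd, Nat.dist_eq_sub_of_le h]; omega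
      have h2 : n - k = r + d := by omega
      rw [h2, h1]; nlinarith
    · have h1 : k = q + d := by rw [hd, Nat.dist_eq_sub_of_le_right h]; omega
      have h2 : r = n - k + d := by omega
      generalize n - k = x at h2
      rw [h2] at hqr ⊢
      rw [h1]; nlinarith
  have e3 : n ^ 6 * n ^ d * 2 ^ d ≤ 2 ^ d ^ 2 := by
    calc n ^ 6 * n ^ d * 2 ^ d ≤ n ^ d * n ^ d * 2 ^ d := by gcongr; omega
      _ = (2 * n ^ 2) ^ d := by rw [mul_pow, ← pow_mul, mul_comm 2 d, pow_mul]; ring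
      _ ≤ (2 ^ d) ^ d := by gcongr
      _ = _ := by rw [← pow_mul, sq]
  have e4 : 2 ^ (k * (n - k)) * 2 ^ d ^ 2 ≤ 2 ^ (n / 2 * (n - n / 2)) * 2 ^ d := by
    rw [← pow_add, ← pow_add]
    exact Nat.pow_le_pow_right two_pos e2
  refine Nat.le_of_mul_le_mul_right ?_ (show 0 < 2 ^ d ^ 2 by positivity)
  calc n ^ 6 * (n.choose k * (setoidCount (n - k) * 2 ^ (k * (n - k)))) * 2 ^ d ^ 2
      = n ^ 6 * (n.choose k * (setoidCount (n - k) * (2 ^ (k * (n - k)) * 2 ^ d ^ 2))) := by ring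
    _ ≤ n ^ 6 * (n.choose (n / 2) * (n ^ d * setoidCount (n - n / 2) *
        (2 ^ (n / 2 * (n - n / 2)) * 2 ^ d))) := by
      gcongr
      exact Nat.choose_le_middle k n
    _ = n.choose (n / 2) * (setoidCount (n - n / 2) * 2 ^ (n / 2 * (n - n / 2))) *
        (n ^ 6 * n ^ d * 2 ^ d) := by ring
    _ ≤ _ := by gcongr

/-- Arrangements that can be recovered from their graph. -/
def Arr.Good {n : ℕ} (a : Arr n) : Prop :=
  Window n a.1.card ∧ 5 * blocks a.2.1 ≤ 2 * n ∧ ∀ x, ¬ TwoBlocks a.2.1 (a.2.2 x)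

/-- The number of arrangements with a given central set of size `k`. -/
def arrFiber (n k : ℕ) : ℕ := setoidCount (n - k) * 2 ^ (k * (n - k))

theorem sum_card_finset (n : ℕ) (f : ℕ → ℝ) :
    ∑ C : Finset (Fin n), f C.card = ∑ k ∈ Finset.range (n + 1), n.choose k * f k := by
  have h := Finset.sum_powerset_apply_card f (x := (Finset.univ : Finset (Fin n)))
  rw [← Finset.powerset_univ, h]
  simp

theorem sum_arrFiber (n : ℕ) : ∑ C : Finset (Fin n), (arrFiber n C.card : ℝ) = arrCount n := by
  rw [sum_card_finset n fun k => (arrFiber n k : ℝ), arrCount]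
  push_cast [arrFiber]
  rfl

theorem card_arr_filter (n : ℕ) (P : Arr n → Prop) [DecidablePred P] :
    ((Finset.univ : Finset (Arr n)).filter P).card = ∑ C : Finset (Fin n),
      (Finset.univ.filter fun p => P ⟨C, p⟩).card := by
  simp only [Finset.card_filter]
  exact Fintype.sum_sigma _

theorem card_not_good_fiber_le {n : ℕ} (C : Finset (Fin n)) (hW : Window n C.card) :
    ((Finset.univ.filter fun p => ¬ Arr.Good (⟨C, p⟩ : Arr n)).card : ℝ) ≤
      blockSum (n - C.card) (fun T => if 5 * T ≤ 2 * n then 0 else 1) *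
        2 ^ (C.card * (n - C.card)) +
      ((Finset.univ : Finset (Setoid {v : Fin n // v ∉ C} ×
        ({v : Fin n // v ∈ C} → {v : Fin n // v ∉ C} → Bool))).filter
        fun p => ∃ x, TwoBlocks p.1 (p.2 x)).card := by
  have hsub : (Finset.univ.filter fun p => ¬ Arr.Good (⟨C, p⟩ : Arr n)) ⊆
      ((Finset.univ.filter fun s : Setoid {v : Fin n // v ∉ C} => ¬ 5 * blocks s ≤ 2 * n) ×ˢ
        (Finset.univ : Finset ({v : Fin n // v ∈ C} → {v : Fin n // v ∉ C} → Bool))) ∪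
      (Finset.univ.filter fun p => ∃ x, TwoBlocks p.1 (p.2 x)) := by
    intro p hp
    have hp' := (Finset.mem_filter.1 hp).2
    by_cases h1 : 5 * blocks p.1 ≤ 2 * n
    · refine Finset.mem_union_right _ (Finset.mem_filter.2 ⟨Finset.mem_univ _, ?_⟩)
      by_contra h2
      push Not at h2
      exact hp' ⟨hW, h1, h2⟩
    · exact Finset.mem_union_left _ (Finset.mem_product.2
        ⟨Finset.mem_filter.2 ⟨Finset.mem_univ _, h1⟩, Finset.mem_univ _⟩)
  have h1 := (Finset.card_le_card hsub).trans (Finset.card_union_le _ _)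
  rw [Finset.card_product, Finset.card_univ, card_fiber_arr] at h1
  have h2 : ((Finset.univ.filter fun s : Setoid {v : Fin n // v ∉ C} =>
      ¬ 5 * blocks s ≤ 2 * n).card : ℝ) =
      blockSum (n - C.card) (fun T => if 5 * T ≤ 2 * n then 0 else 1) := by
    rw [← card_side C, ← sum_blocks_eq_blockSum, Finset.card_filter]
    push_cast
    exact Finset.sum_congr rfl fun s _ => ite_not _ _ _
  rw [← h2]
  exact_mod_cast h1

theorem exists_card_not_good_le : ∃ K : ℝ, 0 ≤ K ∧ ∀ᶠ n : ℕ in atTop,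
    (n : ℝ) ^ 4 * ((Finset.univ : Finset (Arr n)).filter fun a => ¬ a.Good).card ≤
      K * arrCount n := by
  obtain ⟨K, hK0, hK⟩ := eventually_many_blocks_bound
  refine ⟨K + 3, by linarith, ?_⟩
  filter_upwards [hK, eventually_twoBlocks_bound, eventually_not_window_bound,
    eventually_window_bounds, eventually_ge_atTop 2] with n h1 h2 h3 h4 hn
  have key : ∀ C : Finset (Fin n),
      (n : ℝ) ^ 4 * (Finset.univ.filter fun p => ¬ Arr.Good (⟨C, p⟩ : Arr n)).card ≤
      (K + 2) * arrFiber n C.card +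
        (if Window n C.card then 0 else (n : ℝ) ^ 4 * arrFiber n C.card) := by
    intro C
    have hcard : Fintype.card (Setoid {v : Fin n // v ∉ C} ×
      ({v : Fin n // v ∈ C} → {v : Fin n // v ∉ C} → Bool)) = arrFiber n C.card := by
      rw [Fintype.card_prod, card_setoid, card_side, card_fiber_arr, arrFiber]
    split_ifs with hW
    · rw [add_zero]
      have e1 := card_not_good_fiber_le C hW
      have e2 := h1 _ hW
      have e3 := h2 _ hW
      have e4 := card_pair_twoBlocks_le (X := {v : Fin n // v ∉ C}) (A := {v : Fin n // v ∈ C})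
        ((n - C.card) / 4)
      rw [card_side, Fintype.card_coe] at e4
      set k := C.card
      set m := n - k
      set B := ((Finset.univ : Finset (Setoid {v : Fin n // v ∉ C} ×
        ({v : Fin n // v ∈ C} → {v : Fin n // v ∉ C} → Bool))).filter
        fun p => ∃ x, TwoBlocks p.1 (p.2 x)).card with hB
      have e5 : n ^ 4 * B ≤ 2 * arrFiber n k := by
        refine Nat.le_of_mul_le_mul_right ?_ (show 0 < 2 ^ m by positivity)
        calc n ^ 4 * B * 2 ^ m = n ^ 4 * (B * 2 ^ m) := by ring
          _ ≤ n ^ 4 * ((4 ^ m * setoidCount (m - m / 4) +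
              setoidCount m * (k * (m ^ 2 * 2 ^ (2 * (m / 4))))) * 2 ^ (k * m)) := by
            refine Nat.mul_le_mul_left _ (le_trans (le_of_eq ?_) e4)
            rw [hB]
            congr!
          _ = n ^ 4 * (4 ^ m * setoidCount (m - m / 4) +
              setoidCount m * (k * (m ^ 2 * 2 ^ (2 * (m / 4))))) * 2 ^ (k * m) := by ring
          _ ≤ 2 * 2 ^ m * setoidCount m * 2 ^ (k * m) := by gcongr
          _ = 2 * arrFiber n k * 2 ^ m := by rw [arrFiber]; ring
      have e5' : (n : ℝ) ^ 4 * B ≤ 2 * arrFiber n k := by exact_mod_cast e5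
      have e6 : (arrFiber n k : ℝ) = setoidCount m * 2 ^ (k * m) := by
        rw [arrFiber]; push_cast; rfl
      calc _ ≤ (n : ℝ) ^ 4 * (blockSum m (fun T => if 5 * T ≤ 2 * n then 0 else 1) *
            2 ^ (k * m) + B) := by gcongr
        _ = (n : ℝ) ^ 4 * blockSum m (fun T => if 5 * T ≤ 2 * n then 0 else 1) *
            2 ^ (k * m) + (n : ℝ) ^ 4 * B := by ring
        _ ≤ K * setoidCount m * 2 ^ (k * m) + 2 * arrFiber n k := by gcongr
        _ = _ := by rw [e6]; ring
    · have e1 : ((Finset.univ.filter fun p => ¬ Arr.Good (⟨C, p⟩ : Arr n)).card : ℝ) ≤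
          arrFiber n C.card := by
        rw [← hcard]; exact_mod_cast Finset.card_le_univ _
      have e2 : (0 : ℝ) ≤ (K + 2) * arrFiber n C.card := by positivity
      have : (n : ℝ) ^ 4 * (Finset.univ.filter fun p => ¬ Arr.Good (⟨C, p⟩ : Arr n)).card ≤
        (n : ℝ) ^ 4 * arrFiber n C.card := by gcongr
      linarith
  have hn' : (2 : ℝ) ≤ n := by exact_mod_cast hn
  have h5 : ∑ C : Finset (Fin n),
      (if Window n C.card then 0 else (n : ℝ) ^ 4 * arrFiber n C.card) ≤ arrCount n := by
    rw [sum_card_finset n fun k => if Window n k then 0 else (n : ℝ) ^ 4 * arrFiber n k]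
    have : ∀ k ∈ Finset.range (n + 1),
        (n.choose k : ℝ) * (if Window n k then 0 else (n : ℝ) ^ 4 * arrFiber n k) ≤
          arrCount n / n ^ 2 := by
      intro k hk
      split_ifs with hW
      · rw [mul_zero]; positivity
      · rw [le_div_iff₀ (by positivity)]
        have := h3 k (by simpa [Nat.lt_succ_iff] using hk) hW
        have h6 : (n : ℝ) ^ 6 * (n.choose k * arrFiber n k) ≤ arrCount n := by exact_mod_cast this
        linarith
    refine (Finset.sum_le_card_nsmul _ _ _ this).trans ?_
    rw [Finset.card_range, nsmul_eq_mul, mul_div_assoc', div_le_iff₀ (by positivity)]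
    push_cast
    have h7 : (0 : ℝ) ≤ arrCount n := by positivity
    rw [mul_comm]
    gcongr
    nlinarith
  rw [card_arr_filter]
  push_cast
  rw [Finset.mul_sum]
  refine (Finset.sum_le_sum fun C _ => key C).trans ?_
  rw [Finset.sum_add_distrib, ← Finset.mul_sum, sum_arrFiber]
  linarith

theorem exists_setoid_rel {X : Type*} [Nonempty X] (s : Setoid X) (P : X → Prop)
    (h : ∀ u v, P u → P v → s u v) : ∃ u, ∀ v, P v → s u v := by
  by_cases hP : ∃ u, P u
  · obtain ⟨u, hu⟩ := hP
    exact ⟨u, fun v hv => h u v hu hv⟩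
  · push Not at hP
    exact ⟨Classical.arbitrary X, fun v hv => (hP v hv).elim⟩

section
variable {n : ℕ} {a b : Arr n}

theorem Arr.center_subset (h : a.graph = b.graph) (hs : ∃ v, v ∉ a.1)
    (ha : ∀ x, ¬ TwoBlocks a.2.1 (a.2.2 x)) : a.1 ⊆ b.1 := by
  intro x hx
  by_contra hxb
  have : Nonempty {v // v ∉ a.1} := ⟨⟨hs.choose, hs.choose_spec⟩⟩
  have hside : ∀ u v : {v // v ∉ a.1}, (u ≠ v → a.graph.Adj u v) → a.2.1 u v := by
    intro u v huv
    by_cases e : u = v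
    · exact e ▸ a.2.1.refl' u
    · exact ((a.graph_adj_side u.2 v.2).1 (huv e)).2
  obtain ⟨u, hu⟩ := exists_setoid_rel a.2.1 (fun w => (w : Fin n) ∈ b.1) fun u v hu hv =>
    hside u v fun huv => h ▸ (b.graph_adj_center hu hv).2 fun e => huv (Subtype.ext e)
  obtain ⟨v, hv⟩ := exists_setoid_rel a.2.1
    (fun w => (w : Fin n) ∉ b.1 ∧ b.graph.Adj x w) fun u v hu hv =>
    hside u v fun huv => h ▸ b.uni.2 u x v hu.1 hxb hv.1 hu.2.symm hv.2
      fun e => huv (Subtype.ext e)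
  refine ha ⟨x, hx⟩ ⟨u, v, fun w hw => ?_⟩
  have hxw : b.graph.Adj x w := h ▸ (a.graph_adj_cross hx w.2).2 hw
  by_cases hwb : (w : Fin n) ∈ b.1
  · exact Or.inl (hu w hwb)
  · exact Or.inr (hv w ⟨hwb, hxw⟩)

theorem Arr.eq_of_graph_eq (h : a.graph = b.graph) (hc : a.1 = b.1) : a = b := by
  obtain ⟨C, s, r⟩ := a
  obtain ⟨D, s', r'⟩ := b
  obtain rfl : C = D := hc
  have hs : s = s' := by
    refine Setoid.ext fun u v => ?_
    by_cases e : u = v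
    · subst e; exact ⟨fun _ => s'.refl' u, fun _ => s.refl' u⟩
    · have e' : (u : Fin n) ≠ v := fun e' => e (Subtype.ext e')
      have h1 := (Arr.graph_adj_side ⟨C, s, r⟩ u.2 v.2)
      rw [h, Arr.graph_adj_side ⟨C, s', r'⟩ u.2 v.2] at h1
      simpa [e'] using h1.symm
  have hr : r = r' := by
    funext u v
    have h1 := (Arr.graph_adj_cross ⟨C, s, r⟩ u.2 v.2)
    rw [h, Arr.graph_adj_cross ⟨C, s', r'⟩ u.2 v.2] at h1
    exact (Bool.eq_iff_iff.2 h1).symm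
  rw [hs, hr]

theorem Arr.card_le_blocks (t : Finset (Fin n))
    (ht : ∀ u ∈ t, ∀ v ∈ t, u ≠ v → ¬ a.graph.Adj u v) : t.card ≤ blocks a.2.1 + 1 := by
  have h1 : (t.filter (· ∈ a.1)).card ≤ 1 := by
    refine Finset.card_le_one.2 fun u hu v hv => ?_
    rw [Finset.mem_filter] at hu hv
    by_contra huv
    exact ht u hu.1 v hv.1 huv ((a.graph_adj_center hu.2 hv.2).2 huv)
  have h2 : (t.filter (¬ · ∈ a.1)).card ≤ blocks a.2.1 := by
    rw [blocks, ← Fintype.card_coe]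
    refine Fintype.card_le_of_injective (fun u : {u // u ∈ t.filter (¬ · ∈ a.1)} =>
      Quotient.mk a.2.1 ⟨u, (Finset.mem_filter.1 u.2).2⟩) fun u v huv => ?_
    have hu := Finset.mem_filter.1 u.2
    have hv := Finset.mem_filter.1 v.2
    by_contra hne
    have hne' : (u : Fin n) ≠ v := fun e => hne (Subtype.ext e)
    exact ht u hu.1 v hv.1 hne' ((a.graph_adj_side hu.2 hv.2).2 ⟨hne', Quotient.exact huv⟩)
  have := Finset.card_filter_add_card_filter_not (s := t) (· ∈ a.1)
  omega

theorem Arr.indepNum_le (a : Arr n) : indepNum a.graph ≤ blocks a.2.1 + 1 := by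
  obtain ⟨t, ht⟩ := a.graphᶜ.exists_isNClique_cliqueNum
  rw [indepNum, ← ht.card_eq]
  refine Arr.card_le_blocks t fun u hu v hv huv => ?_
  have := ht.isClique hu hv huv
  rw [SimpleGraph.compl_adj] at this
  exact this.2

theorem Arr.blocks_le_indepNum (a : Arr n) : blocks a.2.1 ≤ indepNum a.graph := by
  let t : Finset (Fin n) := Finset.univ.image fun q : Quotient a.2.1 => (q.out : Fin n)
  have hc : t.card = blocks a.2.1 := by
    rw [blocks, ← Finset.card_univ]
    exact Finset.card_image_of_injective _
      (Subtype.val_injective.comp Quotient.out_injective)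
  rw [← hc]
  refine SimpleGraph.IsClique.card_le_cliqueNum (tc := ?_)
  intro u hu v hv huv
  obtain ⟨p, -, rfl⟩ := Finset.mem_image.1 hu
  obtain ⟨q, -, rfl⟩ := Finset.mem_image.1 hv
  rw [SimpleGraph.compl_adj, a.graph_adj_side p.out.2 q.out.2]
  refine ⟨huv, fun h => huv ?_⟩
  have : p = q := by rw [← p.out_eq, ← q.out_eq]; exact Quotient.sound h.2
  rw [this]

theorem Arr.card_center_le (a : Arr n) : a.1.card ≤ a.graph.cliqueNum :=
  SimpleGraph.IsClique.card_le_cliqueNum (tc := a.uni.1)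

theorem hNum_compl {V : Type*} (G : SimpleGraph V) : hNum Gᶜ = hNum G := by
  simp [hNum, indepNum, min_comm]

end

/-- The graph of an arrangement, complemented if the flag is set. -/
def flagGraph {n : ℕ} (p : Arr n × Bool) : SimpleGraph (Fin n) :=
  if p.2 then p.1.graphᶜ else p.1.graph

theorem flagGraph_isPerfect {n : ℕ} (p : Arr n × Bool) : IsPerfect (flagGraph p) := by
  obtain ⟨a, b⟩ := p
  cases b
  · exact a.uni.isPerfect
  · refine Uni.isPerfect_of_compl (S := (a.1 : Set (Fin n))) ?_
    simpa [flagGraph] using a.uni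

theorem hNum_flagGraph {n : ℕ} (p : Arr n × Bool) : hNum (flagGraph p) = hNum p.1.graph := by
  obtain ⟨a, b⟩ := p
  cases b
  · rfl
  · exact hNum_compl _

theorem eventually_good : ∀ᶠ n : ℕ in atTop,
    (∀ a : Arr n, a.Good → blocks a.2.1 ≤ hNum a.graph ∧ hNum a.graph ≤ blocks a.2.1 + 1) ∧
    ∀ p q : Arr n × Bool, p.1.Good → q.1.Good → flagGraph p = flagGraph q → p = q := by
  filter_upwards [eventually_window_bounds, eventually_ge_atTop 100] with n hn h100
  have hT : ∀ a b : Arr n, a.Good → b.Good → blocks a.2.1 + 1 < b.1.card := by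
    intro a b ha hb
    have h1 := (hn _ hb.1).2.2.2
    have h2 := ha.2.1
    unfold Nat.dist at h1
    omega
  have hinj : ∀ a b : Arr n, a.Good → b.Good → a.graph = b.graph → a = b := by
    have hside : ∀ a : Arr n, a.Good → ∃ v, v ∉ a.1 := by
      intro a ha
      by_contra! hcon
      have h1 : a.1 = Finset.univ := Finset.eq_univ_iff_forall.2 hcon
      have h2 := (hn _ ha.1).2.1
      rw [h1, Finset.card_univ, Fintype.card_fin] at h2
      omega
    intro a b ha hb h
    exact Arr.eq_of_graph_eq h (Finset.Subset.antisymm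
      (Arr.center_subset h (hside a ha) ha.2.2) (Arr.center_subset h.symm (hside b hb) hb.2.2))
  have hne : ∀ a b : Arr n, a.Good → b.Good → a.graph ≠ b.graphᶜ := by
    intro a b ha hb h
    refine (hT a b ha hb).not_ge (Arr.card_le_blocks b.1 fun u hu v hv huv hadj => ?_)
    rw [h, SimpleGraph.compl_adj] at hadj
    exact hadj.2 (b.uni.1 hu hv huv)
  refine ⟨fun a ha => ?_, ?_⟩
  · have h1 := a.indepNum_le
    have h2 := a.blocks_le_indepNum
    have h3 := a.card_center_le
    have h4 := hT a a ha ha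
    unfold hNum
    omega
  · rintro ⟨a, i⟩ ⟨b, j⟩ ha hb h
    cases i <;> cases j <;> simp only [flagGraph, if_true, Bool.false_eq_true, if_false] at h
    · rw [hinj a b ha hb h]
    · exact (hne a b ha hb h).elim
    · exact (hne b a hb ha h.symm).elim
    · rw [hinj a b ha hb (compl_injective h)]

/-! ### Transfer to perfect graphs -/

/-- The number of arrangements that need not be determined by their graph. -/
def notGoodCount (n : ℕ) : ℕ := ((Finset.univ : Finset (Arr n)).filter fun a => ¬ a.Good).card

/-- The sum of `f (hNum G)` over the perfect graphs `G` on `n` vertices. -/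
def perfSum (n : ℕ) (f : ℕ → ℝ) : ℝ :=
  ∑ G : SimpleGraph (Fin n), if IsPerfect G then f (hNum G) else 0

theorem hNum_le {n : ℕ} (G : SimpleGraph (Fin n)) : hNum G ≤ n := by
  refine (min_le_right _ _).trans ?_
  obtain ⟨t, ht⟩ := G.exists_isNClique_cliqueNum
  rw [← ht.card_eq]
  exact (Finset.card_le_univ _).trans_eq (Fintype.card_fin n)

theorem abs_perfSum_sub_le {n : ℕ} {f : ℕ → ℝ} {M : ℝ} (hM : ∀ i ≤ n, |f i| ≤ M)
    (hinj : ∀ p q : Arr n × Bool, p.1.Good → q.1.Good → flagGraph p = flagGraph q → p = q) :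
    |perfSum n f - 2 * ∑ a : Arr n, if a.Good then f (hNum a.graph) else 0| ≤
      M * (badCount n + 2 * notGoodCount n) := by
  set gd : Finset (Arr n × Bool) := (Finset.univ.filter fun a : Arr n => a.Good) ×ˢ Finset.univ
    with hgd
  set ng : Finset (Arr n × Bool) := (Finset.univ.filter fun a : Arr n => ¬ a.Good) ×ˢ Finset.univ
    with hng
  set im := gd.image flagGraph with him
  set pf := Finset.univ.filter fun G : SimpleGraph (Fin n) => IsPerfect G with hpf
  have hgd' : ∀ p ∈ gd, p.1.Good := fun p hp =>
    (Finset.mem_filter.1 (Finset.mem_product.1 hp).1).2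
  have hsub : im ⊆ pf := by
    intro G hG
    obtain ⟨p, -, rfl⟩ := Finset.mem_image.1 hG
    exact Finset.mem_filter.2 ⟨Finset.mem_univ _, flagGraph_isPerfect p⟩
  have hsum : ∑ G ∈ im, f (hNum G) = 2 * ∑ a : Arr n, if a.Good then f (hNum a.graph) else 0 := by
    rw [him, Finset.sum_image fun p hp q hq => hinj p q (hgd' p hp) (hgd' q hq), hgd,
      Finset.sum_product, ← Finset.sum_filter, Finset.mul_sum]
    refine Finset.sum_congr rfl fun a _ => ?_
    rw [Finset.sum_congr rfl fun b _ => congrArg f (hNum_flagGraph (a, b))]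
    simp
  have hcard : (pf \ im).card ≤ badCount n + 2 * notGoodCount n := by
    have h1 : pf \ im ⊆ (Finset.univ.filter fun G : SimpleGraph (Fin n) => ¬ HasC5 G ∧
        (¬ ∃ C, Uni G C) ∧ ¬ ∃ C, Uni Gᶜ C) ∪ ng.image flagGraph := by
      intro G hG
      obtain ⟨hG1, hG2⟩ := Finset.mem_sdiff.1 hG
      have hG3 := (Finset.mem_filter.1 hG1).2.not_hasC5
      have key : ∀ p : Arr n × Bool, flagGraph p = G → G ∈ ng.image flagGraph := by
        rintro p rfl
        refine Finset.mem_image_of_mem _ (Finset.mem_product.2 ⟨Finset.mem_filter.2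
          ⟨Finset.mem_univ _, fun hp => hG2 (Finset.mem_image_of_mem _ ?_)⟩, Finset.mem_univ _⟩)
        exact Finset.mem_product.2
          ⟨Finset.mem_filter.2 ⟨Finset.mem_univ _, hp⟩, Finset.mem_univ _⟩
      rw [Finset.mem_union]
      by_cases h1 : ∃ C, Uni G C
      · obtain ⟨C, hC⟩ := h1
        obtain ⟨a, -, ha⟩ := exists_arr_of_uni hC
        exact Or.inr (key (a, false) ha)
      by_cases h2 : ∃ C, Uni Gᶜ C
      · obtain ⟨C, hC⟩ := h2
        obtain ⟨a, -, ha⟩ := exists_arr_of_uni hC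
        exact Or.inr (key (a, true) (compl_eq_comm.1 ha.symm))
      · exact Or.inl (Finset.mem_filter.2 ⟨Finset.mem_univ _, hG3, h1, h2⟩)
    refine (Finset.card_le_card h1).trans ((Finset.card_union_le _ _).trans ?_)
    have h2 : (ng.image flagGraph).card ≤ 2 * notGoodCount n := by
      refine Finset.card_image_le.trans_eq ?_
      rw [hng, Finset.card_product, Finset.card_univ, Fintype.card_bool, mul_comm]
      rfl
    exact add_le_add le_rfl h2
  have hM0 : 0 ≤ M := (abs_nonneg _).trans (hM 0 (Nat.zero_le _))
  have e : perfSum n f = ∑ G ∈ pf \ im, f (hNum G) + ∑ G ∈ im, f (hNum G) := by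
    rw [Finset.sum_sdiff hsub, perfSum, hpf, Finset.sum_filter]
  rw [e, hsum, add_sub_cancel_right]
  refine (Finset.abs_sum_le_sum_abs _ _).trans ((Finset.sum_le_card_nsmul _ _ M
    fun G _ => hM _ (hNum_le G)).trans ?_)
  rw [nsmul_eq_mul, mul_comm]
  refine mul_le_mul_of_nonneg_left ?_ hM0
  exact_mod_cast hcard

theorem sum_window_eq (n : ℕ) (F : ℕ → ℝ) :
    ∑ a : Arr n, (if Window n a.1.card then F (blocks a.2.1) else 0) =
      ∑ C : Finset (Fin n), if Window n C.card then
        arrFiber n C.card * blockAvg (n - C.card) F else 0 := by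
  rw [Fintype.sum_sigma]
  refine Finset.sum_congr rfl fun C _ => ?_
  dsimp only
  split_ifs with h
  · rw [Fintype.sum_prod_type]
    change ∑ s : Setoid {v : Fin n // v ∉ C}, ∑ _r : {v : Fin n // v ∈ C} →
      {v : Fin n // v ∉ C} → Bool, F (blocks s) = _
    simp only [Finset.sum_const]
    rw [← Finset.smul_sum, sum_blocks_eq_blockSum, card_side, Finset.card_univ, card_fiber_arr,
      nsmul_eq_mul, arrFiber, blockAvg]
    have : (setoidCount (n - C.card) : ℝ) ≠ 0 := by exact_mod_cast (setoidCount_pos _).ne'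
    push_cast
    field_simp
  · simp

theorem tendsto_notGoodCount :
    Tendsto (fun n : ℕ => (n : ℝ) ^ 2 * notGoodCount n / arrCount n) atTop (nhds 0) := by
  obtain ⟨K, hK, h⟩ := exists_card_not_good_le
  refine squeeze_zero' (Eventually.of_forall fun n => by positivity) (g := fun n : ℕ => K / (n:ℝ)) ?_
    (tendsto_const_nhds.div_atTop tendsto_natCast_atTop_atTop)
  filter_upwards [h, eventually_ge_atTop 1] with n hn h1
  have hp : (0 : ℝ) < arrCount n := by exact_mod_cast arrCount_pos n
  have h1' : (1 : ℝ) ≤ n := by exact_mod_cast h1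
  rw [div_le_div_iff₀ hp (by linarith)]
  refine le_trans ?_ hn
  change _ ≤ (n : ℝ) ^ 4 * notGoodCount n
  have h2 : (0 : ℝ) ≤ (n : ℝ) ^ 3 * notGoodCount n := by positivity
  nlinarith

theorem tendsto_badCount :
    Tendsto (fun n : ℕ => (n : ℝ) ^ 2 * badCount n / arrCount n) atTop (nhds 0) := by
  obtain ⟨δ, hδ, K, hK, h⟩ := exists_badCount_le
  refine squeeze_zero' (Eventually.of_forall fun n => by positivity) (g := fun n : ℕ => K / (n:ℝ)) ?_
    (tendsto_const_nhds.div_atTop tendsto_natCast_atTop_atTop)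
  filter_upwards [h, eventually_pow_le_exp 1 3 hδ, eventually_ge_atTop 1] with n hn h3 h1
  have hp : (0 : ℝ) < arrCount n := by exact_mod_cast arrCount_pos n
  have h1' : (1 : ℝ) ≤ n := by exact_mod_cast h1
  rw [div_le_div_iff₀ hp (by linarith)]
  calc (n : ℝ) ^ 2 * badCount n * n = (1 * (n : ℝ) ^ 3) * badCount n := by ring
    _ ≤ Real.exp (δ * n) * (K * Real.exp (-δ * n) * arrCount n) := by gcongr
    _ = K * arrCount n * (Real.exp (δ * n) * Real.exp (-δ * n)) := by ring
    _ = K * arrCount n := by rw [← Real.exp_add]; simp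

/-- The proportion of arrangements with central set in the window tends to one, and averages over
them are governed by averages over set partitions. -/
theorem tendsto_sum_window {F : ℕ → ℕ → ℝ} {L : ℝ}
    (hF : Tendsto (fun p : ℕ × ℕ => blockAvg (p.1 - p.2) (F p.1)) windowFilter (nhds L)) :
    Tendsto (fun n : ℕ => (∑ a : Arr n, if Window n a.1.card then F n (blocks a.2.1) else 0) /
      arrCount n) atTop (nhds L) := by
  have h1 : Tendsto (fun n : ℕ => (∑ C : Finset (Fin n), if Window n C.card then
      (arrFiber n C.card : ℝ) else 0) / arrCount n) atTop (nhds 1) := by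
    have h0 : Tendsto (fun n : ℕ => 1 - (n : ℝ) ^ 2 * notGoodCount n / arrCount n) atTop
        (nhds 1) := by simpa using tendsto_const_nhds.sub tendsto_notGoodCount
    refine tendsto_of_tendsto_of_tendsto_of_le_of_le' h0 tendsto_const_nhds ?_
      (Eventually.of_forall fun n => ?_)
    · filter_upwards [eventually_ge_atTop 1] with n hn
      have hp : (0 : ℝ) < arrCount n := by exact_mod_cast arrCount_pos n
      have h1' : (1 : ℝ) ≤ n := by exact_mod_cast hn
      have e1 := sum_window_eq n fun _ => 1
      have e2 : ∀ m, blockAvg m (fun _ => 1) = 1 := fun m => by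
        rw [blockAvg, blockSum_const, mul_one, div_self]
        exact_mod_cast (setoidCount_pos _).ne'
      simp only [e2, mul_one] at e1
      rw [← e1, le_div_iff₀ hp, sub_mul, div_mul_cancel₀ _ hp.ne', one_mul]
      have e3 : (arrCount n : ℝ) ≤
          ∑ a : Arr n, (if Window n a.1.card then (1 : ℝ) else 0) + notGoodCount n := by
        rw [notGoodCount, Finset.card_filter, ← card_arr, ← Finset.card_univ, Finset.card_eq_sum_ones]
        push_cast
        rw [← Finset.sum_add_distrib]
        refine Finset.sum_le_sum fun a _ => ?_
        by_cases h : Window n a.1.card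
        · rw [if_pos h]; split_ifs <;> norm_num
        · rw [if_neg h, if_pos fun hg : a.Good => h hg.1]; norm_num
      have e4 : (notGoodCount n : ℝ) ≤ (n : ℝ) ^ 2 * notGoodCount n :=
        le_mul_of_one_le_left (by positivity) (one_le_pow₀ h1')
      linarith
    · refine div_le_one_of_le₀ ?_ (by positivity)
      rw [← sum_arrFiber]
      exact Finset.sum_le_sum fun C _ => by split_ifs <;> simp
  have h2 : Tendsto (fun n : ℕ => (∑ a : Arr n, if Window n a.1.card then
      F n (blocks a.2.1) else 0) / arrCount n - L * ((∑ C : Finset (Fin n),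
      if Window n C.card then (arrFiber n C.card : ℝ) else 0) / arrCount n)) atTop (nhds 0) := by
    rw [Metric.tendsto_nhds]
    intro ε hε
    have hε' := Metric.tendsto_nhds.1 hF (ε / 2) (half_pos hε)
    filter_upwards [(eventually_windowFilter
      (P := fun n k => dist (blockAvg (n - k) (F n)) L < ε / 2)).1 hε'] with n hn
    have hp : (0 : ℝ) < arrCount n := by exact_mod_cast arrCount_pos n
    rw [Real.dist_eq, sub_zero, mul_div_assoc', ← sub_div, abs_div, abs_of_pos hp, div_lt_iff₀ hp,
      sum_window_eq, Finset.mul_sum, ← Finset.sum_sub_distrib]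
    refine lt_of_le_of_lt (b := ε / 2 * arrCount n) ?_ (by nlinarith)
    rw [← sum_arrFiber, Finset.mul_sum]
    refine (Finset.abs_sum_le_sum_abs _ _).trans (Finset.sum_le_sum fun C _ => ?_)
    split_ifs with h
    · have h3 := hn _ h
      rw [Real.dist_eq] at h3
      rw [mul_comm L, ← mul_sub, abs_mul, Nat.abs_cast, mul_comm]
      exact mul_le_mul_of_nonneg_right h3.le (by positivity)
    · simp only [mul_zero, sub_self, abs_zero]
      positivity
  simpa using h2.add (h1.const_mul L)

theorem tendsto_perfSum {f F₁ F₂ : ℕ → ℕ → ℝ} {L : ℝ}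
    (h₁ : Tendsto (fun p : ℕ × ℕ => blockAvg (p.1 - p.2) (F₁ p.1)) windowFilter (nhds L))
    (h₂ : Tendsto (fun p : ℕ × ℕ => blockAvg (p.1 - p.2) (F₂ p.1)) windowFilter (nhds L))
    (hf : ∀ᶠ n : ℕ in atTop, ∀ i ≤ n, |f n i| ≤ (n : ℝ) ^ 2)
    (hF : ∀ᶠ n : ℕ in atTop, ∀ i ≤ n, F₁ n i ≤ 3 * (n : ℝ) ^ 2 ∧ -(3 * (n : ℝ) ^ 2) ≤ F₂ n i)
    (hle : ∀ᶠ n : ℕ in atTop, ∀ T, (F₁ n T ≤ f n T ∧ F₁ n T ≤ f n (T + 1)) ∧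
      f n T ≤ F₂ n T ∧ f n (T + 1) ≤ F₂ n T) :
    Tendsto (fun n => perfSum n (f n) / (2 * arrCount n)) atTop (nhds L) := by
  have herr : Tendsto (fun n : ℕ => (n : ℝ) ^ 2 * badCount n / arrCount n +
      4 * ((n : ℝ) ^ 2 * notGoodCount n / arrCount n)) atTop (nhds 0) := by
    simpa using tendsto_badCount.add (tendsto_notGoodCount.const_mul 4)
  have hlo := (tendsto_sum_window h₁).sub herr
  have hhi := (tendsto_sum_window h₂).add herr
  rw [sub_zero] at hlo
  rw [add_zero] at hhi
  have key : ∀ᶠ n : ℕ in atTop, ∀ a : Arr n,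
      (if Window n a.1.card then F₁ n (blocks a.2.1) else 0) -
          3 * (n : ℝ) ^ 2 * (if ¬ a.Good then 1 else 0) ≤
        (if a.Good then f n (hNum a.graph) else 0) ∧
      (if a.Good then f n (hNum a.graph) else 0) ≤
        (if Window n a.1.card then F₂ n (blocks a.2.1) else 0) +
          3 * (n : ℝ) ^ 2 * (if ¬ a.Good then 1 else 0) := by
    filter_upwards [hF, hle, eventually_good] with n h1 h2 h3 a
    have hsq : (0 : ℝ) ≤ 3 * (n : ℝ) ^ 2 := by positivity
    by_cases hg : a.Good
    · have h4 := h3.1 a hg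
      have h5 := h2 (blocks a.2.1)
      rw [if_pos hg, if_pos hg.1, if_pos hg.1, if_neg (not_not.2 hg), mul_zero, sub_zero, add_zero]
      obtain h6 | h6 : hNum a.graph = blocks a.2.1 ∨ hNum a.graph = blocks a.2.1 + 1 := by omega
      · rw [h6]; exact ⟨h5.1.1, h5.2.1⟩
      · rw [h6]; exact ⟨h5.1.2, h5.2.2⟩
    · have hb : blocks a.2.1 ≤ n := by
        refine (Fintype.card_le_of_surjective _ (Quotient.mk_surjective (s := a.2.1))).trans ?_
        rw [card_side]; exact Nat.sub_le _ _
      have h4 := h1 _ hb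
      rw [if_neg hg, if_pos hg, mul_one]
      split_ifs <;> constructor <;> linarith [h4.1, h4.2]
  refine tendsto_of_tendsto_of_tendsto_of_le_of_le' hlo hhi ?_ ?_
  · filter_upwards [key, hf, eventually_good] with n h1 h2 h3
    have hp : (0 : ℝ) < arrCount n := by exact_mod_cast arrCount_pos n
    have h4 := (abs_le.1 (abs_perfSum_sub_le h2 h3.2)).1
    have h5 := Finset.sum_le_sum fun (a : Arr n) (_ : a ∈ Finset.univ) => (h1 a).1
    rw [Finset.sum_sub_distrib, ← Finset.mul_sum, Finset.sum_boole] at h5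
    change _ - _ * (notGoodCount n : ℝ) ≤ _ at h5
    have h6 : (0 : ℝ) ≤ (n : ℝ) ^ 2 * badCount n := by positivity
    rw [le_div_iff₀ (by linarith), mul_div_assoc', ← add_div, ← sub_div, div_mul_eq_mul_div,
      div_le_iff₀ hp]
    nlinarith only [h4, h5, h6, hp]
  · filter_upwards [key, hf, eventually_good] with n h1 h2 h3
    have hp : (0 : ℝ) < arrCount n := by exact_mod_cast arrCount_pos n
    have h4 := (abs_le.1 (abs_perfSum_sub_le h2 h3.2)).2
    have h5 := Finset.sum_le_sum fun (a : Arr n) (_ : a ∈ Finset.univ) => (h1 a).2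
    rw [Finset.sum_add_distrib, ← Finset.mul_sum, Finset.sum_boole] at h5
    change _ ≤ _ + _ * (notGoodCount n : ℝ) at h5
    have h6 : (0 : ℝ) ≤ (n : ℝ) ^ 2 * badCount n := by positivity
    rw [div_le_iff₀ (by linarith), mul_div_assoc', ← add_div, ← add_div, div_mul_eq_mul_div,
      le_div_iff₀ hp]
    nlinarith only [h4, h5, h6, hp]

theorem perfSum_const_one (n : ℕ) : perfSum n (fun _ => 1) = perfectCount n := by
  rw [perfSum, Finset.sum_boole, perfectCount, Nat.card_eq_fintype_card, Fintype.card_subtype]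

theorem blockAvg_affine (m : ℕ) (f : ℕ → ℝ) (α β : ℝ) :
    blockAvg m (fun T => α * f T + β) = α * blockAvg m f + β := by
  have h : (setoidCount m : ℝ) ≠ 0 := by exact_mod_cast (setoidCount_pos m).ne'
  have e : blockSum m (fun T => α * f T + β) = α * blockSum m f + setoidCount m * β := by
    rw [← blockSum_const, blockSum, blockSum, blockSum, Finset.sum_add_distrib, Finset.mul_sum]
  rw [blockAvg, blockAvg, e]
  field_simp

/-- The average of `f (hNum G)` over the perfect graphs `G` on `n` vertices. -/
def perfAvg (n : ℕ) (f : ℕ → ℝ) : ℝ := perfSum n f / perfectCount n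

theorem tendsto_perfectCount :
    Tendsto (fun n => (perfectCount n : ℝ) / (2 * arrCount n)) atTop (nhds 1) := by
  have e : ∀ m, blockAvg m (fun _ => 1) = 1 := fun m => by
    rw [blockAvg, blockSum_const, mul_one, div_self]
    exact_mod_cast (setoidCount_pos _).ne'
  have h : Tendsto (fun p : ℕ × ℕ => blockAvg (p.1 - p.2) ((fun _ _ => 1 : ℕ → ℕ → ℝ) p.1))
      windowFilter (nhds 1) := by
    exact Tendsto.congr (fun p => (e (p.1 - p.2)).symm) tendsto_const_nhds
  have hsq : ∀ᶠ n : ℕ in atTop, (1 : ℝ) ≤ (n : ℝ) ^ 2 := by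
    filter_upwards [eventually_ge_atTop 1] with n hn
    have : (1 : ℝ) ≤ n := by exact_mod_cast hn
    exact one_le_pow₀ this
  have h2 := tendsto_perfSum (f := fun _ _ => 1) (F₁ := fun _ _ => 1) (F₂ := fun _ _ => 1) h h
    (hsq.mono fun n hn i _ => by rwa [abs_one])
    (hsq.mono fun n hn i _ => ⟨by linarith, by linarith⟩)
    (.of_forall fun n T => ⟨⟨le_rfl, le_rfl⟩, le_rfl, le_rfl⟩)
  exact h2.congr fun n => by rw [perfSum_const_one]

theorem tendsto_perfAvg {f F₁ F₂ : ℕ → ℕ → ℝ} {L : ℝ}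
    (h₁ : Tendsto (fun p : ℕ × ℕ => blockAvg (p.1 - p.2) (F₁ p.1)) windowFilter (nhds L))
    (h₂ : Tendsto (fun p : ℕ × ℕ => blockAvg (p.1 - p.2) (F₂ p.1)) windowFilter (nhds L))
    (hf : ∀ᶠ n : ℕ in atTop, ∀ i ≤ n, |f n i| ≤ (n : ℝ) ^ 2)
    (hF : ∀ᶠ n : ℕ in atTop, ∀ i ≤ n, F₁ n i ≤ 3 * (n : ℝ) ^ 2 ∧ -(3 * (n : ℝ) ^ 2) ≤ F₂ n i)
    (hle : ∀ᶠ n : ℕ in atTop, ∀ T, (F₁ n T ≤ f n T ∧ F₁ n T ≤ f n (T + 1)) ∧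
      f n T ≤ F₂ n T ∧ f n (T + 1) ≤ F₂ n T) :
    Tendsto (fun n => perfAvg n (f n)) atTop (nhds L) := by
  have h := (tendsto_perfSum h₁ h₂ hf hF hle).div tendsto_perfectCount one_ne_zero
  rw [div_one] at h
  refine h.congr fun n => ?_
  have hp : (arrCount n : ℝ) ≠ 0 := by exact_mod_cast (arrCount_pos n).ne'
  simp only [Pi.div_apply]
  rw [div_div_div_cancel_right₀ (by simpa using hp), perfAvg]

theorem perfectCount_pos (n : ℕ) : 0 < perfectCount n := by
  have : Nonempty {G : SimpleGraph (Fin n) // IsPerfect G} :=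
    ⟨⟨_, flagGraph_isPerfect (⟨∅, ⊥, fun _ _ => true⟩, false)⟩⟩
  exact Nat.card_pos

theorem perfAvg_quadratic (n : ℕ) (f g : ℕ → ℝ) (α β γ : ℝ) :
    perfAvg n (fun i => α * f i + β * g i + γ) = α * perfAvg n f + β * perfAvg n g + γ := by
  have h : (perfectCount n : ℝ) ≠ 0 := by exact_mod_cast (perfectCount_pos n).ne'
  have e : perfSum n (fun i => α * f i + β * g i + γ) =
      α * perfSum n f + β * perfSum n g + γ * perfSum n (fun _ => 1) := by
    simp only [perfSum, Finset.mul_sum, ← Finset.sum_add_distrib]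
    refine Finset.sum_congr rfl fun G _ => ?_
    split_ifs <;> ring
  rw [perfAvg, perfAvg, perfAvg, e, perfSum_const_one]
  field_simp

theorem hMean_eq (n : ℕ) : hMean n = perfAvg n fun i => (i : ℝ) := rfl

theorem hVar_eq (n : ℕ) : hVar n = perfAvg n (fun i => (i : ℝ) ^ 2) - hMean n ^ 2 := rfl

theorem hCdf_eq (n : ℕ) (t : ℝ) : hCdf n t =
    perfAvg n fun i => if (i : ℝ) ≤ hMean n + t * √(hVar n) then 1 else 0 := by
  rw [hCdf, perfAvg, perfSum, Nat.card_eq_fintype_card, Fintype.card_subtype,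
    Finset.card_filter]
  push_cast
  congr 1
  refine Finset.sum_congr rfl fun G _ => ?_
  split_ifs <;> simp_all

theorem tendsto_scale_centre : Tendsto (fun n => blockScale (blockCentre n)) atTop atTop :=
  tendsto_blockScale.comp tendsto_blockCentre

theorem eventually_abs_standardized_le : ∀ᶠ n : ℕ in atTop, 1 ≤ blockScale (blockCentre n) ∧
    2 ≤ (n : ℝ) ∧ ∀ i ≤ n, |((i : ℝ) - blockCentre n) / blockScale (blockCentre n)| ≤ n := by
  have hlog : ∀ᶠ n : ℕ in atTop, 1 ≤ Real.log n :=
    (Real.tendsto_log_atTop.comp tendsto_natCast_atTop_atTop).eventually_ge_atTop 1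
  filter_upwards [tendsto_scale_centre.eventually_ge_atTop 1, hlog, eventually_ge_atTop 2,
    tendsto_blockCentre_mul.eventually_le_const (show (1 : ℝ) < 2 by norm_num)]
    with n h1 h2 h3 h4
  have h3' : (2 : ℝ) ≤ n := by exact_mod_cast h3
  refine ⟨h1, h3', fun i hi => ?_⟩
  have hi' : (i : ℝ) ≤ n := by exact_mod_cast hi
  have h0 : (0 : ℝ) ≤ i := Nat.cast_nonneg _
  have ha := one_le_blockCentre n
  rw [div_le_iff₀ (by linarith)] at h4
  have h5 : blockCentre n ≤ n := by nlinarith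
  rw [abs_div, abs_of_pos (show 0 < blockScale (blockCentre n) by linarith),
    div_le_iff₀ (by linarith)]
  have h6 : |(i : ℝ) - blockCentre n| ≤ n := abs_le.2 ⟨by linarith, by linarith⟩
  nlinarith

theorem tendsto_inv_scale :
    Tendsto (fun n => 1 / blockScale (blockCentre n)) atTop (nhds 0) :=
  tendsto_const_nhds.div_atTop tendsto_scale_centre

theorem tendsto_perfAvg_standardized : Tendsto (fun n => perfAvg n fun i =>
    ((i : ℝ) - blockCentre n) / blockScale (blockCentre n)) atTop (nhds 0) := by
  have h₁ := tendsto_blockAvg_id tendsto_centre_windowFilter eventually_abs_sub_le_windowFilter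
  have h₂ : Tendsto (fun p : ℕ × ℕ => blockAvg (p.1 - p.2) fun i =>
      1 * (((i : ℝ) - blockCentre p.1) / blockScale (blockCentre p.1)) +
        1 / blockScale (blockCentre p.1)) windowFilter (nhds 0) := by
    simp only [blockAvg_affine]
    simpa using h₁.add (tendsto_inv_scale.comp tendsto_fst_windowFilter)
  refine tendsto_perfAvg
    (F₁ := fun n i => ((i : ℝ) - blockCentre n) / blockScale (blockCentre n))
    (F₂ := fun n i => 1 * (((i : ℝ) - blockCentre n) / blockScale (blockCentre n)) +
        1 / blockScale (blockCentre n)) h₁ h₂ ?_ ?_ ?_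
  · filter_upwards [eventually_abs_standardized_le] with n ⟨h1, h2, h3⟩ i hi
    have := h3 i hi
    nlinarith
  · filter_upwards [eventually_abs_standardized_le] with n ⟨h1, h2, h3⟩ i hi
    have h4 := abs_le.1 (h3 i hi)
    have h5 : 0 < 1 / blockScale (blockCentre n) := one_div_pos.2 (by linarith)
    constructor <;> nlinarith
  · filter_upwards [eventually_abs_standardized_le] with n ⟨h1, _, _⟩ T
    have h5 : 0 < 1 / blockScale (blockCentre n) := one_div_pos.2 (by linarith)
    have e : (((T + 1 : ℕ) : ℝ) - blockCentre n) / blockScale (blockCentre n) =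
      ((T : ℝ) - blockCentre n) / blockScale (blockCentre n) +
        1 / blockScale (blockCentre n) := by push_cast; ring
    rw [e]
    refine ⟨⟨?_, ?_⟩, ?_, ?_⟩ <;> linarith

theorem shifted_sq_bounds {z d : ℝ} (hd : 0 < d) :
    (1 - d) * z ^ 2 + -d ≤ (z + d) ^ 2 ∧ (z + d) ^ 2 ≤ (1 + d) * z ^ 2 + (d + d ^ 2) := by
  constructor <;> nlinarith [mul_nonneg hd.le (sq_nonneg (z + 1)), mul_nonneg hd.le (sq_nonneg (z - 1)), sq_nonneg d]

theorem tendsto_perfAvg_standardized_sq : Tendsto (fun n => perfAvg n fun i =>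
    (((i : ℝ) - blockCentre n) / blockScale (blockCentre n)) ^ 2) atTop (nhds 1) := by
  have h := tendsto_blockAvg_sq tendsto_centre_windowFilter eventually_abs_sub_le_windowFilter
  have hd := tendsto_inv_scale.comp tendsto_fst_windowFilter
  have h₁ : Tendsto (fun p : ℕ × ℕ => blockAvg (p.1 - p.2) fun i =>
      (1 - 1 / blockScale (blockCentre p.1)) *
        (((i : ℝ) - blockCentre p.1) / blockScale (blockCentre p.1)) ^ 2 +
        -(1 / blockScale (blockCentre p.1))) windowFilter (nhds 1) := by
    simp only [blockAvg_affine]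
    simpa using ((hd.const_sub 1).mul h).add hd.neg
  have h₂ : Tendsto (fun p : ℕ × ℕ => blockAvg (p.1 - p.2) fun i =>
      (1 + 1 / blockScale (blockCentre p.1)) *
        (((i : ℝ) - blockCentre p.1) / blockScale (blockCentre p.1)) ^ 2 +
        (1 / blockScale (blockCentre p.1) + (1 / blockScale (blockCentre p.1)) ^ 2))
      windowFilter (nhds 1) := by
    simp only [blockAvg_affine]
    simpa using ((hd.const_add 1).mul h).add (hd.add (hd.pow 2))
  refine tendsto_perfAvg
    (F₁ := fun n i => (1 - 1 / blockScale (blockCentre n)) *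
        (((i : ℝ) - blockCentre n) / blockScale (blockCentre n)) ^ 2 +
        -(1 / blockScale (blockCentre n)))
    (F₂ := fun n i => (1 + 1 / blockScale (blockCentre n)) *
        (((i : ℝ) - blockCentre n) / blockScale (blockCentre n)) ^ 2 +
        (1 / blockScale (blockCentre n) + (1 / blockScale (blockCentre n)) ^ 2)) h₁ h₂ ?_ ?_ ?_
  · filter_upwards [eventually_abs_standardized_le] with n ⟨h1, h2, h3⟩ i hi
    rw [abs_of_nonneg (sq_nonneg _)]
    exact sq_le_sq' (abs_le.1 (h3 i hi)).1 (abs_le.1 (h3 i hi)).2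
  · filter_upwards [eventually_abs_standardized_le] with n ⟨h1, h2, h3⟩ i hi
    have h4 := sq_le_sq' (abs_le.1 (h3 i hi)).1 (abs_le.1 (h3 i hi)).2
    have h5 : 0 < 1 / blockScale (blockCentre n) := one_div_pos.2 (by linarith)
    have h6 := sq_nonneg (((i : ℝ) - blockCentre n) / blockScale (blockCentre n))
    have h7 := mul_nonneg h5.le h6
    constructor
    · linarith
    · have : 0 ≤ (1 / blockScale (blockCentre n)) ^ 2 := sq_nonneg _
      linarith
  · filter_upwards [eventually_abs_standardized_le] with n ⟨h1, _, _⟩ T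
    have h5 : 0 < 1 / blockScale (blockCentre n) := one_div_pos.2 (by linarith)
    have h6 := sq_nonneg (((T : ℝ) - blockCentre n) / blockScale (blockCentre n))
    have h7 := mul_nonneg h5.le h6
    have h8 := sq_nonneg (1 / blockScale (blockCentre n))
    have e : (((T + 1 : ℕ) : ℝ) - blockCentre n) / blockScale (blockCentre n) =
      ((T : ℝ) - blockCentre n) / blockScale (blockCentre n) +
        1 / blockScale (blockCentre n) := by push_cast; ring
    rw [e]
    have h9 := shifted_sq_bounds (z := ((T : ℝ) - blockCentre n) / blockScale (blockCentre n)) h5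
    exact ⟨⟨by linarith, h9.1⟩, by linarith, h9.2⟩

theorem tendsto_perfAvg_indicator {x : ℕ → ℝ} {t : ℝ}
    (hx : Tendsto (fun n => (x n - blockCentre n) / blockScale (blockCentre n)) atTop (nhds t)) :
    Tendsto (fun n => perfAvg n fun i => if (i : ℝ) ≤ x n then 1 else 0) atTop
      (nhds (stdNormalCdf t)) := by
  have hx' : Tendsto (fun n => (x n - 1 - blockCentre n) / blockScale (blockCentre n)) atTop
      (nhds t) := by
    have := hx.sub tendsto_inv_scale
    rw [sub_zero] at this
    refine this.congr fun n => by ring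
  have h₁ := tendsto_blockAvg_indicator tendsto_centre_windowFilter
    eventually_abs_sub_le_windowFilter (x := fun p => x p.1 - 1) (hx'.comp tendsto_fst_windowFilter)
  have h₂ := tendsto_blockAvg_indicator tendsto_centre_windowFilter
    eventually_abs_sub_le_windowFilter (x := fun p => x p.1) (hx.comp tendsto_fst_windowFilter)
  have hsq : ∀ᶠ n : ℕ in atTop, (1 : ℝ) ≤ (n : ℝ) ^ 2 := by
    filter_upwards [eventually_ge_atTop 1] with n hn
    have : (1 : ℝ) ≤ n := by exact_mod_cast hn
    exact one_le_pow₀ this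
  refine tendsto_perfAvg (F₁ := fun n i => if (i : ℝ) ≤ x n - 1 then 1 else 0)
    (F₂ := fun n i => if (i : ℝ) ≤ x n then 1 else 0) h₁ h₂ ?_ ?_ ?_
  · filter_upwards [hsq] with n hn i _
    split_ifs
    · rwa [abs_one]
    · rw [abs_zero]; linarith
  · filter_upwards [hsq] with n hn i _
    constructor <;> split_ifs <;> linarith
  · refine .of_forall fun n T => ?_
    push_cast
    refine ⟨⟨?_, ?_⟩, ?_, ?_⟩ <;> split_ifs <;> linarith

theorem tendsto_hMean_standardized : Tendsto (fun n =>
    (hMean n - blockCentre n) / blockScale (blockCentre n)) atTop (nhds 0) := by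
  refine tendsto_perfAvg_standardized.congr' ?_
  filter_upwards with n
  have h := perfAvg_quadratic n (fun i => (i : ℝ)) (fun _ => 0) (1 / blockScale (blockCentre n)) 0
    (-blockCentre n / blockScale (blockCentre n))
  rw [← hMean_eq] at h
  simp only [zero_mul, add_zero] at h
  rw [show (hMean n - blockCentre n) / blockScale (blockCentre n) = 1 / blockScale (blockCentre n) *
    hMean n + -blockCentre n / blockScale (blockCentre n) by ring, ← h]
  congr 1
  funext i
  ring

theorem tendsto_hVar_div : Tendsto (fun n => hVar n / blockScale (blockCentre n) ^ 2) atTop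
    (nhds 1) := by
  have h := tendsto_perfAvg_standardized_sq.sub (tendsto_hMean_standardized.pow 2)
  norm_num at h
  refine h.congr fun n => ?_
  have h := perfAvg_quadratic n (fun i => (i : ℝ) ^ 2) (fun i => (i : ℝ))
    (1 / blockScale (blockCentre n) ^ 2) (-2 * blockCentre n / blockScale (blockCentre n) ^ 2)
    (blockCentre n ^ 2 / blockScale (blockCentre n) ^ 2)
  rw [← hMean_eq] at h
  have e : (perfAvg n fun i => (((i : ℝ) - blockCentre n) / blockScale (blockCentre n)) ^ 2) =
      _ := (congrArg (perfAvg n) (funext fun i => by ring)).trans h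
  rw [e, hVar_eq]
  ring

theorem tendsto_hCdf (t : ℝ) : Tendsto (fun n => hCdf n t) atTop (nhds (stdNormalCdf t)) := by
  simp only [hCdf_eq]
  refine tendsto_perfAvg_indicator ?_
  have h := tendsto_hMean_standardized.add (tendsto_hVar_div.sqrt.const_mul t)
  rw [Real.sqrt_one, mul_one, zero_add] at h
  refine h.congr fun n => ?_
  have hs : 0 ≤ blockScale (blockCentre n) := Real.sqrt_nonneg _
  rw [Real.sqrt_div' _ (sq_nonneg _), Real.sqrt_sq hs]
  ring

theorem blockScale_div_le {a : ℝ} (ha : 1 ≤ a) : blockScale a / a ≤ 1 / blockScale a := by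
  have hl := Real.log_nonneg ha
  have hp : 0 < a / (Real.log a + 1) := by positivity
  have hs : 0 < blockScale a := Real.sqrt_pos.2 hp
  rw [div_le_div_iff₀ (by linarith) hs, ← sq, blockScale, Real.sq_sqrt hp.le, one_mul]
  exact div_le_self (by linarith) (by linarith)

theorem tendsto_hMean : Tendsto (fun n => hMean n * (2 * Real.log n) / (n : ℝ)) atTop
    (nhds 1) := by
  have h1 : Tendsto (fun n => blockScale (blockCentre n) / blockCentre n) atTop (nhds 0) :=
    squeeze_zero (fun n => div_nonneg (Real.sqrt_nonneg _) (by linarith [one_le_blockCentre n]))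
      (fun n => blockScale_div_le (one_le_blockCentre n)) tendsto_inv_scale
  have h2 := tendsto_blockCentre_mul.mul ((tendsto_hMean_standardized.mul h1).const_add 1)
  norm_num at h2
  refine h2.congr' ?_
  filter_upwards [tendsto_scale_centre.eventually_gt_atTop 0] with n hs
  have ha := one_le_blockCentre n
  have ha0 : blockCentre n ≠ 0 := by linarith
  field_simp
  ring

theorem tendsto_hVar : Tendsto (fun n => hVar n * (2 * (Real.log n) ^ 2) / (n : ℝ)) atTop
    (nhds 1) := by
  have h := tendsto_hVar_div.mul tendsto_blockScale_sq_mul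
  norm_num at h
  refine h.congr' ?_
  filter_upwards [tendsto_scale_centre.eventually_gt_atTop 0] with n hs
  field_simp

end PerfectGraphs

/-- `h(P_n) = min{α(P_n), ω(P_n)}` is asymptotically normal, with mean `∼ n/(2 ln n)` and
variance `∼ n/(2 ln² n)`. -/
theorem hNum_asymptotically_normal :
    (∀ t : ℝ, Tendsto (fun n : ℕ => hCdf n t) atTop (nhds (stdNormalCdf t))) ∧
      Tendsto (fun n : ℕ => hMean n * (2 * Real.log n) / (n : ℝ)) atTop (nhds 1) ∧
      Tendsto (fun n : ℕ => hVar n * (2 * (Real.log n) ^ 2) / (n : ℝ)) atTop (nhds 1) := by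
  exact ⟨PerfectGraphs.tendsto_hCdf, PerfectGraphs.tendsto_hMean, PerfectGraphs.tendsto_hVar⟩
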